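/- Let d≥3, σ=1 (repulsive case), and let f_0∈L^1_+(ℝ^{2d}) satisfy ∫_{ℝ^{2d}} |v|^2 f_0 dx dv + ∫_{ℝ^d} (H∗ρ_0) ρ_0 dx < ∞, where H(x):= (c_d/(d−2)) |x|^{2−d} and ρ_0(x)=∫ f_0(x,v) dv. Then there exists a global renormalized solution f∈C([0,∞);L^1_loc(ℝ^{2d})) of the Vlasov–Poisson system with initial datum f_0 such that: (1) t↦ρ_t and t↦E_t are strongly continuous in L^1_loc(ℝ^d); (2) for every t≥0, ∫_{ℝ^{2d}} |v|^2 f_t dx dv + ∫_{ℝ^d} (H∗ρ_t) ρ_t dx ≤ ∫_{ℝ^{2d}} |v|^2 f_0 dx dv + ∫_{ℝ^d} (H∗ρ_0) ρ_0 dx; and (3) if d∈{3,4}, there exists a Borel map X:[0,∞)×ℝ^{2d}→ℝ^{2d} such that for f_0·Leb^{2d}-a.e. (x,v) the curve X(·,(x,v)) is locally absolutely continuous on [0,∞), starts at (x,v), solves (d/dt)X(t)=b_t(X(t)) a.e., and f_t·Leb^{2d}=X(t,·)_#(f_0·Leb^{2d}) for every t≥0. -/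

import Mathlib

open MeasureTheory Filter Set Metric Topology
open scoped ENNReal NNReal

noncomputable section

/-- `Ed d` is the Euclidean space `ℝ^d`. -/
abbrev Ed (d : ℕ) : Type := EuclideanSpace ℝ (Fin d)

/-- Borel σ-algebra on the one-point compactification. -/
instance (X : Type*) [TopologicalSpace X] : MeasurableSpace (OnePoint X) := borel _

/-- The dimensional constant `c_d` such that `c_d div(x/|x|^d) = δ₀`,
namely the reciprocal of the surface measure of the unit sphere. -/
noncomputable def cdim (d : ℕ) : ℝ :=
  ((d : ℝ) * (volume (ball (0 : Ed d) 1)).toReal)⁻¹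

/-- The singular kernel `x/|x|^d`. -/
noncomputable def kern (d : ℕ) (x : Ed d) : Ed d := (‖x‖ ^ d)⁻¹ • x

/-- The physical density `ρ_t(x) = ∫ f_t(x,v) dv`. -/
noncomputable def vpRho (d : ℕ) (f : ℝ → (Ed d × Ed d) → ℝ) (t : ℝ) (x : Ed d) : ℝ :=
  ∫ v : Ed d, f t (x, v)

/-- The force field `E_t(x) = σ c_d ∫ ρ_t(y) (x-y)/|x-y|^d dy`. -/
noncomputable def vpE (d : ℕ) (σ : ℝ) (f : ℝ → (Ed d × Ed d) → ℝ) (t : ℝ) (x : Ed d) : Ed d :=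
  (σ * cdim d) • ∫ y : Ed d, vpRho d f t y • kern d (x - y)

/-- The phase-space vector field `b_t(x,v) = (v, E_t(x))`. -/
noncomputable def vpB (d : ℕ) (σ : ℝ) (f : ℝ → (Ed d × Ed d) → ℝ) (t : ℝ)
    (z : Ed d × Ed d) : Ed d × Ed d :=
  (z.2, vpE d σ f t z.1)

/-- `f` is a renormalized solution on `(0,∞)` of the Vlasov–Poisson system with initial
datum `f₀`: for every bounded `β ∈ C¹(ℝ)` and every `φ ∈ C¹_c([0,∞) × ℝ^{2d})`,
`∫ φ(0,·) β(f₀) + ∫₀^∞ ∫ (∂_t φ + ∇_{x,v} φ · b_t) β(f_t) = 0`. -/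
def IsRenormalizedVPInf (d : ℕ) (σ : ℝ) (f0 : (Ed d × Ed d) → ℝ)
    (f : ℝ → (Ed d × Ed d) → ℝ) : Prop :=
  ∀ β : ℝ → ℝ, ContDiff ℝ 1 β → (∃ M, ∀ s, |β s| ≤ M) →
  ∀ φ : ℝ × (Ed d × Ed d) → ℝ, ContDiff ℝ 1 φ → HasCompactSupport φ →
    (∫ z : Ed d × Ed d, φ (0, z) * β (f0 z)) +
      (∫ t in Ioi (0:ℝ), ∫ z : Ed d × Ed d,
        fderiv ℝ φ (t, z) (1, vpB d σ f t z) * β (f t z)) = 0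

/-- The kernel `H(x) = (c_d/(d−2)) |x|^{2−d}`, with the convention `H(0) = +∞`
(valued in `[0,∞]`). -/
noncomputable def Hkern (d : ℕ) (x : Ed d) : ℝ≥0∞ :=
  ENNReal.ofReal (cdim d / ((d : ℝ) - 2)) * (ENNReal.ofReal ‖x‖) ^ ((2 : ℝ) - d)

/-- The kinetic energy `∫ |v|² g(x,v) dx dv`, valued in `[0,∞]`. -/
noncomputable def kinEnergy (d : ℕ) (g : (Ed d × Ed d) → ℝ) : ℝ≥0∞ :=
  ∫⁻ z : Ed d × Ed d, ENNReal.ofReal (‖z.2‖ ^ 2 * g z)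

/-- The potential energy `∫ (H∗ρ) ρ dx`, valued in `[0,∞]`. -/
noncomputable def potEnergy (d : ℕ) (ρ : Ed d → ℝ) : ℝ≥0∞ :=
  ∫⁻ x : Ed d, (∫⁻ y : Ed d, Hkern d (x - y) * ENNReal.ofReal (ρ y)) * ENNReal.ofReal (ρ x)

open Function (uncurry)
open Real (log norm_eq_abs norm_of_nonneg)
open ENNReal (ofReal ofReal_add ofReal_le_ofReal ofReal_mul ofReal_ne_top)

namespace VP

variable {d : ℕ}

/-! ### Regularised kernels -/

/-- The regularised norm `√(|x|² + ε²)`. -/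
def sreg (ε : ℝ) (x : Ed d) : ℝ := √(‖x‖ ^ 2 + ε ^ 2)

/-- The regularised force kernel. -/
def rk (d : ℕ) (ε : ℝ) (x : Ed d) : Ed d := (sreg ε x ^ d)⁻¹ • x

/-- The regularised potential. -/
def rH (d : ℕ) (ε : ℝ) (x : Ed d) : ℝ := (sreg ε x ^ (d - 2))⁻¹

lemma sreg_zero (x : Ed d) : sreg 0 x = ‖x‖ := by
  simp [sreg, Real.sqrt_sq]

lemma rk_zero : rk d 0 = kern d := by
  ext1 x; simp [rk, kern, sreg_zero]

lemma sreg_nonneg (ε : ℝ) (x : Ed d) : 0 ≤ sreg ε x := Real.sqrt_nonneg _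

lemma norm_le_sreg (ε : ℝ) (x : Ed d) : ‖x‖ ≤ sreg ε x := by
  apply Real.le_sqrt_of_sq_le; nlinarith [sq_nonneg ε]

lemma le_sreg (ε : ℝ) (x : Ed d) : ε ≤ sreg ε x := by
  apply Real.le_sqrt_of_sq_le; nlinarith [sq_nonneg ‖x‖]

lemma sreg_pos {ε : ℝ} (hε : 0 < ε) (x : Ed d) : 0 < sreg ε x := hε.trans_le (le_sreg ε x)

lemma sreg_sq (ε : ℝ) (x : Ed d) : sreg ε x ^ 2 = ‖x‖ ^ 2 + ε ^ 2 :=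
  Real.sq_sqrt (by positivity)

lemma sreg_le_of_norm_le {ε ε' : ℝ} {x y : Ed d} (h : ‖x‖ ≤ ‖y‖) (hε : 0 ≤ ε) (h' : ε ≤ ε') :
    sreg ε x ≤ sreg ε' y := by
  apply Real.sqrt_le_sqrt; gcongr

lemma sreg_le_add {ε : ℝ} (hε : 0 ≤ ε) (x : Ed d) : sreg ε x ≤ ‖x‖ + ε := by
  apply Real.sqrt_le_iff.2 ⟨by positivity, by nlinarith [norm_nonneg x]⟩

lemma abs_sreg_sub_le (ε : ℝ) (a b : Ed d) : |sreg ε a - sreg ε b| ≤ ‖a - b‖ := by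
  by_cases h0 : sreg ε a + sreg ε b = 0
  · have h1 := sreg_nonneg ε a
    have h2 := sreg_nonneg ε b
    have : sreg ε a = 0 := by linarith
    have h3 : sreg ε b = 0 := by linarith
    simp [this, h3]
  have hp : 0 < sreg ε a + sreg ε b :=
    lt_of_le_of_ne (add_nonneg (sreg_nonneg ε a) (sreg_nonneg ε b)) (Ne.symm h0)
  have h1 := sreg_sq ε a
  have h2 := sreg_sq ε b
  have h3 : |‖a‖ - ‖b‖| ≤ ‖a - b‖ := abs_norm_sub_norm_le a b
  have key : |sreg ε a - sreg ε b| * (sreg ε a + sreg ε b) = |‖a‖ - ‖b‖| * (‖a‖ + ‖b‖) := by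
    have e1 : |sreg ε a - sreg ε b| * (sreg ε a + sreg ε b)
        = |(sreg ε a - sreg ε b) * (sreg ε a + sreg ε b)| := by rw [abs_mul, abs_of_pos hp]
    have e2 : |‖a‖ - ‖b‖| * (‖a‖ + ‖b‖) = |(‖a‖ - ‖b‖) * (‖a‖ + ‖b‖)| := by
      rw [abs_mul, abs_of_nonneg (by positivity : 0 ≤ ‖a‖ + ‖b‖)]
    rw [e1, e2]
    congr 1
    nlinarith
  have h4 : ‖a‖ + ‖b‖ ≤ sreg ε a + sreg ε b := add_le_add (norm_le_sreg ε a) (norm_le_sreg ε b)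
  have h5 : |‖a‖ - ‖b‖| * (‖a‖ + ‖b‖) ≤ ‖a - b‖ * (sreg ε a + sreg ε b) := by gcongr
  rw [← key] at h5
  exact le_of_mul_le_mul_right h5 hp

lemma norm_kern (x : Ed d) : ‖kern d x‖ = (‖x‖ ^ d)⁻¹ * ‖x‖ := by
  rw [kern, norm_smul, norm_inv, norm_pow, norm_norm]

lemma norm_rk (ε : ℝ) (x : Ed d) : ‖rk d ε x‖ = (sreg ε x ^ d)⁻¹ * ‖x‖ := by
  rw [rk, norm_smul, norm_inv, norm_pow, norm_of_nonneg (sreg_nonneg ε x)]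

lemma inv_sreg_pow_le {ε ε' : ℝ} (hε : 0 ≤ ε) (h : ε ≤ ε') {x : Ed d} (hx : x ≠ 0) (k : ℕ) :
    (sreg ε' x ^ k)⁻¹ ≤ (sreg ε x ^ k)⁻¹ := by
  have h0 : 0 < sreg ε x := (norm_pos_iff.2 hx).trans_le (norm_le_sreg ε x)
  have := sreg_le_of_norm_le (le_refl ‖x‖) hε h
  gcongr

lemma norm_rk_le_norm_rk {ε ε' : ℝ} (hε : 0 ≤ ε) (h : ε ≤ ε') (x : Ed d) :
    ‖rk d ε' x‖ ≤ ‖rk d ε x‖ := by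
  rcases eq_or_ne x 0 with rfl | hx
  · simp [norm_rk]
  rw [norm_rk, norm_rk]
  gcongr ?_ * _
  exact inv_sreg_pow_le hε h hx d

lemma norm_rk_le_kern {ε : ℝ} (hε : 0 ≤ ε) (x : Ed d) : ‖rk d ε x‖ ≤ ‖kern d x‖ := by
  rw [← rk_zero]; exact norm_rk_le_norm_rk le_rfl hε x

lemma norm_rk_sub_rk_le {ε ε' : ℝ} (hε : 0 ≤ ε) (h : ε ≤ ε') (x : Ed d) :
    ‖rk d ε x - rk d ε' x‖ ≤ ‖kern d x - rk d ε' x‖ := by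
  rcases eq_or_ne x 0 with rfl | hx
  · simp [rk, kern]
  rw [← rk_zero]
  simp only [rk, ← sub_smul, norm_smul]
  have h1 := inv_sreg_pow_le hε h hx d
  have h2 := inv_sreg_pow_le le_rfl hε hx d
  gcongr ?_ * _
  rw [norm_of_nonneg (by linarith), norm_of_nonneg (by linarith)]
  linarith

/-- `s⁻ᵈ - t⁻ᵈ ≤ d (t - s) s⁻ᵈ⁻¹`. -/
lemma inv_pow_sub_inv_pow_le {s t : ℝ} (hs : 0 < s) (hst : s ≤ t) (k : ℕ) :
    (s ^ k)⁻¹ - (t ^ k)⁻¹ ≤ k * (t - s) * (s ^ (k + 1))⁻¹ := by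
  have ht : 0 < t := hs.trans_le hst
  have h1 : 1 + (k : ℝ) * (s / t - 1) ≤ (s / t) ^ k := by
    have := one_add_mul_le_pow (a := s / t - 1) (by have : 0 < s / t := by positivity
                                                    linarith) k
    simpa using this
  have h2 : (t ^ k)⁻¹ = (s / t) ^ k * (s ^ k)⁻¹ := by
    rw [div_pow]; field_simp
  rw [h2]
  have h3 : (k : ℝ) * (t - s) * (s ^ (k + 1))⁻¹ = k * ((t - s) / s) * (s ^ k)⁻¹ := by
    rw [pow_succ]; field_simp
  rw [h3]
  have h4 : (1 : ℝ) - s / t ≤ (t - s) / s := by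
    rw [← sub_nonneg]
    have : (t - s) / s - (1 - s / t) = (t - s) ^ 2 / (s * t) := by field_simp
    rw [this]; positivity
  have h5 : (1 : ℝ) - (s / t) ^ k ≤ k * ((t - s) / s) := by
    have : (k : ℝ) * (1 - s / t) ≤ k * ((t - s) / s) := by gcongr
    nlinarith
  have h6 : 0 ≤ (s ^ k)⁻¹ := by positivity
  nlinarith

lemma norm_rk_sub_le_aux {ε : ℝ} {a b : Ed d} (hab : ‖a‖ ≤ ‖b‖) (hε : 0 ≤ ε)
    (h0 : 0 < sreg ε a) :
    ‖rk d ε a - rk d ε b‖ ≤ (d + 1) * ‖a - b‖ * (sreg ε a ^ d)⁻¹ := by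
  have hs : sreg ε a ≤ sreg ε b := sreg_le_of_norm_le hab hε le_rfl
  have e : rk d ε a - rk d ε b
      = ((sreg ε a ^ d)⁻¹ - (sreg ε b ^ d)⁻¹) • a + (sreg ε b ^ d)⁻¹ • (a - b) := by
    simp only [rk, sub_smul, smul_sub]; abel
  have h1 := inv_pow_sub_inv_pow_le h0 hs d
  have h2 : (sreg ε b ^ d)⁻¹ ≤ (sreg ε a ^ d)⁻¹ := by gcongr
  have h3 : sreg ε b - sreg ε a ≤ ‖a - b‖ := by
    rw [norm_sub_rev]; exact (le_abs_self _).trans (abs_sreg_sub_le ε b a)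
  have h4 : ‖a‖ ≤ sreg ε a := norm_le_sreg ε a
  rw [e]
  refine (norm_add_le _ _).trans ?_
  rw [norm_smul, norm_smul, norm_of_nonneg (by linarith),
    norm_of_nonneg (inv_nonneg.2 (pow_nonneg (sreg_nonneg ε b) d))]
  have h5 : ((sreg ε a ^ d)⁻¹ - (sreg ε b ^ d)⁻¹) * ‖a‖
      ≤ (d * ‖a - b‖ * (sreg ε a ^ (d + 1))⁻¹) * sreg ε a := by
    have h6 : 0 ≤ (sreg ε a ^ d)⁻¹ - (sreg ε b ^ d)⁻¹ := by linarith
    refine mul_le_mul (h1.trans ?_) h4 (norm_nonneg _) (by positivity)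
    gcongr
  have h7 : (d * ‖a - b‖ * (sreg ε a ^ (d + 1))⁻¹) * sreg ε a = d * ‖a - b‖ * (sreg ε a ^ d)⁻¹ := by
    rw [pow_succ]; field_simp
  have h8 : (sreg ε b ^ d)⁻¹ * ‖a - b‖ ≤ (sreg ε a ^ d)⁻¹ * ‖a - b‖ := by gcongr
  linarith

lemma norm_rk_sub_le {ε : ℝ} (hε : 0 < ε) (a b : Ed d) :
    ‖rk d ε a - rk d ε b‖ ≤ (d + 1) * (ε ^ d)⁻¹ * ‖a - b‖ := by
  wlog hab : ‖a‖ ≤ ‖b‖ generalizing a b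
  · rw [norm_sub_rev, norm_sub_rev a]; exact this b a (le_of_not_ge hab)
  refine (norm_rk_sub_le_aux hab hε.le (sreg_pos hε a)).trans ?_
  have : (sreg ε a ^ d)⁻¹ ≤ (ε ^ d)⁻¹ := by
    have := le_sreg ε a
    gcongr
  calc _ ≤ (d + 1) * ‖a - b‖ * (ε ^ d)⁻¹ := by gcongr
    _ = _ := by ring

/-- Modulus of the kernel. -/
def gmod (d : ℕ) (r : ℝ) (u : Ed d) : ℝ := 2 * (d + 1) * (r / (‖u‖ + r)) * ‖kern d u‖

lemma gmod_nonneg {r : ℝ} (hr : 0 ≤ r) (u : Ed d) : 0 ≤ gmod d r u := by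
  unfold gmod; positivity

lemma norm_kern_anti (hd : 1 ≤ d) {a b : Ed d} (ha : a ≠ 0) (hab : ‖a‖ ≤ ‖b‖) :
    ‖kern d b‖ ≤ ‖kern d a‖ := by
  have e : ∀ x : Ed d, x ≠ 0 → ‖kern d x‖ = (‖x‖ ^ (d - 1))⁻¹ := by
    intro x hx
    obtain ⟨k, rfl⟩ : ∃ k, d = k + 1 := ⟨d - 1, by omega⟩
    have : ‖x‖ ≠ 0 := norm_ne_zero_iff.2 hx
    rw [norm_kern, pow_succ, Nat.add_sub_cancel]; field_simp
  have hb : b ≠ 0 := by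
    rintro rfl; simp at hab; exact ha hab
  rw [e a ha, e b hb]
  have : 0 < ‖a‖ := norm_pos_iff.2 ha
  gcongr

lemma norm_rk_sub_le_gmod (hd : 1 ≤ d) {ε : ℝ} (hε : 0 ≤ ε) (a b : Ed d) :
    ‖rk d ε a - rk d ε b‖ ≤ gmod d ‖a - b‖ a + gmod d ‖a - b‖ b := by
  wlog hab : ‖a‖ ≤ ‖b‖ generalizing a b
  · rw [norm_sub_rev, norm_sub_rev a, add_comm]; exact this b a (le_of_not_ge hab)
  have hd1 : (1 : ℝ) ≤ d := by exact_mod_cast hd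
  rcases eq_or_ne a 0 with rfl | ha
  · have e : gmod d ‖(0 : Ed d) - b‖ b = (d + 1) * ‖kern d b‖ := by
      rcases eq_or_ne b 0 with rfl | hb
      · simp [gmod, kern]
      · have : ‖b‖ ≠ 0 := norm_ne_zero_iff.2 hb
        rw [gmod, zero_sub, norm_neg]; field_simp; ring
    have h1 : rk d ε (0 : Ed d) = 0 := by simp [rk]
    rw [h1, e, zero_sub, norm_neg]
    have := norm_rk_le_kern hε b
    have h2 := gmod_nonneg (norm_nonneg ((0 : Ed d) - b)) (0 : Ed d)
    nlinarith [norm_nonneg (kern d b)]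
  have ha' : 0 < ‖a‖ := norm_pos_iff.2 ha
  have hb0 := gmod_nonneg (norm_nonneg (a - b)) b
  suffices h : ‖rk d ε a - rk d ε b‖ ≤ gmod d ‖a - b‖ a by linarith
  set r := ‖a - b‖ with hr
  have hr0 : 0 ≤ r := norm_nonneg _
  rw [gmod]
  rcases le_or_gt r ‖a‖ with h | h
  · have h1 := norm_rk_sub_le_aux hab hε (ha'.trans_le (norm_le_sreg ε a))
    have h2 : (sreg ε a ^ d)⁻¹ ≤ (‖a‖ ^ d)⁻¹ := by
      have := norm_le_sreg ε a
      gcongr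
    calc _ ≤ (d + 1) * r * (sreg ε a ^ d)⁻¹ := h1
      _ ≤ (d + 1) * r * (‖a‖ ^ d)⁻¹ := by gcongr
      _ = 2 * (d + 1) * (r / (‖a‖ + ‖a‖)) * ‖kern d a‖ := by
        rw [norm_kern]; field_simp; ring
      _ ≤ _ := by gcongr
  · have h1 : ‖rk d ε a - rk d ε b‖ ≤ 2 * ‖kern d a‖ := by
      refine (norm_sub_le _ _).trans ?_
      have := norm_rk_le_kern hε a
      have h2 := norm_rk_le_kern hε b
      have := norm_kern_anti hd ha hab
      linarith
    have h2 : (1 : ℝ) / 2 ≤ r / (‖a‖ + r) := by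
      rw [div_le_div_iff₀ (by norm_num) (by linarith)]; linarith
    calc _ ≤ 2 * ‖kern d a‖ := h1
      _ ≤ 2 * (d + 1) * (1 / 2) * ‖kern d a‖ := by
        gcongr; linarith
      _ ≤ _ := by gcongr

/-- `|K - K_ε|(u) ≤ |K|(u) √(dε/|u|)`. -/
lemma norm_kern_sub_rk_le {ε : ℝ} (hε : 0 ≤ ε) (u : Ed d) :
    ‖kern d u - rk d ε u‖ ≤ √(d * ε / ‖u‖) * ‖kern d u‖ := by
  rcases eq_or_ne u 0 with rfl | hu
  · simp [rk, kern]
  have hu' : 0 < ‖u‖ := norm_pos_iff.2 hu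
  have e : ‖kern d u - rk d ε u‖ = ((‖u‖ ^ d)⁻¹ - (sreg ε u ^ d)⁻¹) * ‖u‖ := by
    have h2 := inv_sreg_pow_le le_rfl hε hu d
    rw [sreg_zero] at h2
    rw [kern, rk, ← sub_smul, norm_smul, norm_of_nonneg (by linarith)]
  have h1 : ‖kern d u - rk d ε u‖ ≤ 1 * ‖kern d u‖ := by
    rw [e, norm_kern, one_mul]
    have : 0 ≤ (sreg ε u ^ d)⁻¹ := inv_nonneg.2 (pow_nonneg (sreg_nonneg _ _) _)
    gcongr; linarith
  have h2 : ‖kern d u - rk d ε u‖ ≤ (d * ε / ‖u‖) * ‖kern d u‖ := by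
    rw [e, norm_kern]
    have := inv_pow_sub_inv_pow_le hu' (norm_le_sreg ε u) d
    have h3 := sreg_le_add hε u
    calc _ ≤ (d * (sreg ε u - ‖u‖) * (‖u‖ ^ (d + 1))⁻¹) * ‖u‖ := by gcongr
      _ ≤ (d * ε * (‖u‖ ^ (d + 1))⁻¹) * ‖u‖ := by
        have : sreg ε u - ‖u‖ ≤ ε := by linarith
        gcongr
      _ = _ := by rw [pow_succ]; field_simp
  rcases le_total 1 (d * ε / ‖u‖) with h | h
  · refine h1.trans ?_
    gcongr
    exact Real.one_le_sqrt.2 h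
  · refine h2.trans ?_
    gcongr
    apply Real.le_sqrt_of_sq_le
    have : 0 ≤ d * ε / ‖u‖ := by positivity
    nlinarith

lemma continuous_sreg (ε : ℝ) : Continuous (sreg (d := d) ε) := by
  unfold sreg; fun_prop

lemma measurable_kern : Measurable (kern d) := by
  unfold kern; fun_prop

lemma continuous_rH {ε : ℝ} (hε : 0 < ε) : Continuous (rH d ε) := by
  unfold rH
  exact ((continuous_sreg ε).pow _).inv₀ (fun x => (pow_pos (sreg_pos hε x) _).ne')

lemma norm_rk_le_const (hd : 1 ≤ d) {ε : ℝ} (hε : 0 < ε) (x : Ed d) :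
    ‖rk d ε x‖ ≤ (ε ^ (d - 1))⁻¹ := by
  obtain ⟨k, rfl⟩ : ∃ k, d = k + 1 := ⟨d - 1, by omega⟩
  rw [norm_rk, Nat.add_sub_cancel]
  have h1 := norm_le_sreg ε x
  have h2 := le_sreg ε x
  have h3 := sreg_pos hε x
  calc _ ≤ (sreg ε x ^ (k + 1))⁻¹ * sreg ε x := by gcongr
    _ = (sreg ε x ^ k)⁻¹ := by rw [pow_succ]; field_simp
    _ ≤ _ := by gcongr

lemma rk_neg (ε : ℝ) (x : Ed d) : rk d ε (-x) = -rk d ε x := by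
  simp [rk, sreg]

lemma rH_nonneg (ε : ℝ) (x : Ed d) : 0 ≤ rH d ε x :=
  inv_nonneg.2 (pow_nonneg (sreg_nonneg _ _) _)

lemma rH_le {ε : ℝ} (hε : 0 < ε) (x : Ed d) : rH d ε x ≤ (ε ^ (d - 2))⁻¹ := by
  have := le_sreg ε x
  unfold rH; gcongr

lemma rH_mono {ε ε' : ℝ} (hε : 0 < ε) (h : ε ≤ ε') (x : Ed d) : rH d ε' x ≤ rH d ε x := by
  have := sreg_le_of_norm_le (le_refl ‖x‖) hε.le h
  have := sreg_pos hε x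
  unfold rH; gcongr

lemma hasDerivAt_rH (hd : 2 ≤ d) {ε : ℝ} (hε : 0 < ε) (a b : Ed d) (t : ℝ) :
    HasDerivAt (fun t : ℝ => rH d ε (a + t • b))
      (-(((d : ℝ) - 2) * inner ℝ (rk d ε (a + t • b)) b)) t := by
  obtain ⟨k, rfl⟩ : ∃ k, d = k + 2 := ⟨d - 2, by omega⟩
  have h1 : HasDerivAt (fun t : ℝ => a + t • b) b t := by
    simpa using ((hasDerivAt_id t).smul_const b).const_add a
  have h2 := (h1.norm_sq.add_const (ε ^ 2)).sqrt (by positivity)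
  have hp := sreg_pos hε (a + t • b)
  have h3 := (h2.pow k).inv (pow_ne_zero _ hp.ne')
  refine h3.congr_deriv ?_
  change -((k : ℝ) * sreg ε (a + t • b) ^ (k - 1) *
    (2 * inner ℝ (a + t • b) b / (2 * sreg ε (a + t • b)))) / (sreg ε (a + t • b) ^ k) ^ 2 = _
  rw [rk, inner_smul_left]
  simp only [map_inv₀, map_pow, RCLike.conj_to_real]
  push_cast
  rcases k with _ | k
  · simp
  simp only [Nat.add_sub_cancel]
  field_simp
  push_cast
  ring

lemma rH_add_le (hd : 2 ≤ d) {ε : ℝ} (hε : 0 < ε) (a b : Ed d) :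
    rH d ε (a + b) ≤ rH d ε a - ((d : ℝ) - 2) * inner ℝ (rk d ε a) b
      + ((d : ℝ) - 2) * ((d + 1) * (ε ^ d)⁻¹) * ‖b‖ ^ 2 := by
  have hd2 : (0 : ℝ) ≤ (d : ℝ) - 2 := by
    have : (2 : ℝ) ≤ d := by exact_mod_cast hd
    linarith
  set L : ℝ := (d + 1) * (ε ^ d)⁻¹
  have hL : 0 ≤ L := by positivity
  let f : ℝ → ℝ := fun t => rH d ε (a + t • b) + t * (((d : ℝ) - 2) * inner ℝ (rk d ε a) b)
    - t * (((d : ℝ) - 2) * L * ‖b‖ ^ 2)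
  have hf : ∀ t, HasDerivAt f (-(((d : ℝ) - 2) * inner ℝ (rk d ε (a + t • b)) b)
      + ((d : ℝ) - 2) * inner ℝ (rk d ε a) b - ((d : ℝ) - 2) * L * ‖b‖ ^ 2) t := by
    intro t
    have := ((hasDerivAt_rH hd hε a b t).add
      ((hasDerivAt_id t).mul_const (((d : ℝ) - 2) * inner ℝ (rk d ε a) b))).sub
      ((hasDerivAt_id t).mul_const (((d : ℝ) - 2) * L * ‖b‖ ^ 2))
    refine this.congr_deriv ?_
    ring
  have hanti : AntitoneOn f (Icc 0 1) := by
    apply antitoneOn_of_deriv_nonpos (convex_Icc 0 1)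
    · exact fun t _ => (hf t).continuousAt.continuousWithinAt
    · exact fun t _ => (hf t).differentiableAt.differentiableWithinAt
    · intro t ht
      rw [interior_Icc] at ht
      rw [(hf t).deriv]
      have h1 : inner ℝ (rk d ε a - rk d ε (a + t • b)) b ≤ L * ‖b‖ ^ 2 := by
        refine (real_inner_le_norm _ _).trans ?_
        have h2 := norm_rk_sub_le hε a (a + t • b)
        have h3 : ‖a - (a + t • b)‖ ≤ ‖b‖ := by
          rw [sub_add_cancel_left, norm_neg, norm_smul, norm_of_nonneg ht.1.le]
          nlinarith [norm_nonneg b, ht.2]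
        calc _ ≤ (L * ‖a - (a + t • b)‖) * ‖b‖ := by gcongr
          _ ≤ (L * ‖b‖) * ‖b‖ := by gcongr
          _ = _ := by ring
      rw [inner_sub_left] at h1
      nlinarith
  have := hanti (left_mem_Icc.2 zero_le_one) (right_mem_Icc.2 zero_le_one) zero_le_one
  simp only [f, one_smul, zero_smul, add_zero, one_mul, zero_mul, sub_zero] at this
  linarith

end VP

namespace VP

variable {d : ℕ}

/-! ### Radial integrals -/

/-- The surface measure of the unit sphere. -/
def sph (d : ℕ) : ℝ≥0∞ := (volume : Measure (Ed d)).toSphere univ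

lemma sph_ne_top (d : ℕ) : sph d ≠ ⊤ := measure_ne_top _ _

lemma lintegral_fun_norm (hd : 1 ≤ d) (F : ℝ → ℝ≥0∞) (hF : Measurable F) :
    ∫⁻ u : Ed d, F ‖u‖ = sph d * ∫⁻ r in Ioi (0 : ℝ), ofReal (r ^ (d - 1)) * F r := by
  have : Nontrivial (Ed d) := by
    have : Nonempty (Fin d) := ⟨⟨0, hd⟩⟩
    infer_instance
  have hdim : Module.finrank ℝ (Ed d) = d := by simp
  calc
    ∫⁻ u : Ed d, F ‖u‖ = ∫⁻ x : ({(0 : Ed d)}ᶜ : Set (Ed d)), F ‖x.1‖ ∂(volume.comap Subtype.val) := by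
      rw [lintegral_subtype_comap (measurableSet_singleton _).compl fun x => F ‖x‖,
        restrict_compl_singleton]
    _ = ∫⁻ x : sphere (0 : Ed d) 1 × Ioi (0 : ℝ), F x.2
          ∂(volume : Measure (Ed d)).toSphere.prod (.volumeIoiPow (Module.finrank ℝ (Ed d) - 1)) :=
      by simpa only [homeomorphUnitSphereProd_apply_snd_coe] using
        ((volume : Measure (Ed d)).measurePreserving_homeomorphUnitSphereProd.lintegral_comp_emb
          (Homeomorph.measurableEmbedding _)
          (fun x : sphere (0 : Ed d) 1 × Ioi (0 : ℝ) => F x.2))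
    _ = sph d * ∫⁻ x : Ioi (0 : ℝ), F x ∂.volumeIoiPow (Module.finrank ℝ (Ed d) - 1) := by
      rw [lintegral_prod _ (by fun_prop)]
      simp [sph, mul_comm]
    _ = _ := by
      rw [hdim, Measure.volumeIoiPow,
        lintegral_withDensity_eq_lintegral_mul _ (by fun_prop) (by fun_prop)]
      congr 1
      exact lintegral_subtype_comap measurableSet_Ioi
        (fun r : ℝ => ofReal (r ^ (d - 1)) * F r)

lemma lintegral_kern_mul (hd : 1 ≤ d) (F : ℝ → ℝ≥0∞) (hF : Measurable F) :
    ∫⁻ u : Ed d, ofReal ‖kern d u‖ * F ‖u‖ = sph d * ∫⁻ r in Ioi (0 : ℝ), F r := by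
  have h := lintegral_fun_norm hd (fun r => ofReal ((r ^ d)⁻¹ * r) * F r) (by fun_prop)
  simp only [norm_kern]
  rw [h]
  congr 1
  refine setLIntegral_congr_fun measurableSet_Ioi fun r (hr : 0 < r) => ?_
  rw [← mul_assoc, ← ofReal_mul (by positivity)]
  obtain ⟨k, rfl⟩ : ∃ k, d = k + 1 := ⟨d - 1, by omega⟩
  have : r ^ (k + 1 - 1) * ((r ^ (k + 1))⁻¹ * r) = 1 := by
    rw [Nat.add_sub_cancel, pow_succ]; field_simp
  rw [this]; simp

lemma norm_kern_le_one (hd : 1 ≤ d) {u : Ed d} (hu : 1 ≤ ‖u‖) : ‖kern d u‖ ≤ 1 := by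
  obtain ⟨k, rfl⟩ : ∃ k, d = k + 1 := ⟨d - 1, by omega⟩
  rw [norm_kern, pow_succ, mul_inv, mul_assoc, inv_mul_cancel₀ (by linarith), mul_one]
  exact inv_le_one_of_one_le₀ (one_le_pow₀ hu)

/-- Local integrals of a singular kernel, uniformly in the centre. -/
lemma setLIntegral_kern_mul_le (hd : 1 ≤ d) (F : ℝ → ℝ≥0∞) (hF : Measurable F) {C : ℝ≥0∞}
    (hC : ∀ r, 1 < r → F r ≤ C) (s : Set (Ed d)) (y : Ed d) :
    ∫⁻ x in s, ofReal ‖kern d (x - y)‖ * F ‖x - y‖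
      ≤ sph d * (∫⁻ r in Ioc (0 : ℝ) 1, F r) + C * volume s := by
  have hk : Measurable (kern d) := measurable_kern
  have h1 : ∀ x : Ed d, ofReal ‖kern d (x - y)‖ * F ‖x - y‖
      ≤ ofReal ‖kern d (x - y)‖ * (Iic (1 : ℝ)).indicator F ‖x - y‖ + C := by
    intro x
    rcases le_or_gt ‖x - y‖ 1 with h | h
    · rw [indicator_of_mem (show ‖x - y‖ ∈ Iic (1 : ℝ) from h)]; exact le_self_add
    · refine le_add_left ?_
      calc _ ≤ ofReal 1 * C := by
            gcongr
            · exact norm_kern_le_one hd h.le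
            · exact hC _ h
        _ = C := by simp
  calc _ ≤ ∫⁻ x in s, (ofReal ‖kern d (x - y)‖ * (Iic (1 : ℝ)).indicator F ‖x - y‖ + C) :=
        lintegral_mono h1
    _ = (∫⁻ x in s, ofReal ‖kern d (x - y)‖ * (Iic (1 : ℝ)).indicator F ‖x - y‖)
        + C * volume s := by
        rw [lintegral_add_right _ measurable_const]; simp
    _ ≤ (∫⁻ x, ofReal ‖kern d (x - y)‖ * (Iic (1 : ℝ)).indicator F ‖x - y‖)
        + C * volume s := by gcongr; exact Measure.restrict_le_self
    _ = _ := by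
        congr 1
        rw [lintegral_sub_right_eq_self
          (fun x => ofReal ‖kern d x‖ * (Iic (1 : ℝ)).indicator F ‖x‖) y,
          lintegral_kern_mul hd _ (hF.indicator measurableSet_Iic)]
        congr 1
        rw [lintegral_indicator measurableSet_Iic, Measure.restrict_restrict measurableSet_Iic,
          inter_comm, Ioi_inter_Iic]

lemma lintegral_Ioc_of_hasDerivAt {g g' : ℝ → ℝ} {a b : ℝ} (hab : a ≤ b)
    (hc : ContinuousOn g (Icc a b)) (hg : ∀ x ∈ Ioo a b, HasDerivAt g (g' x) x)
    (h0 : ∀ x ∈ Ioo a b, 0 ≤ g' x) :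
    ∫⁻ r in Ioc a b, ofReal (g' r) = ofReal (g b - g a) := by
  have hi : IntegrableOn g' (Ioc a b) := intervalIntegral.integrableOn_deriv_of_nonneg hc hg h0
  rw [← intervalIntegral.integral_eq_sub_of_hasDerivAt_of_le hab hc hg
    ((intervalIntegrable_iff_integrableOn_Ioc_of_le hab).2 hi),
    intervalIntegral.integral_of_le hab, ofReal_integral_eq_lintegral_ofReal hi]
  rw [← restrict_Ioo_eq_restrict_Ioc]
  exact (ae_restrict_iff' measurableSet_Ioo).2 (.of_forall fun x hx => h0 x hx)

/-- The kernel is locally integrable, uniformly in the centre. -/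
lemma setLIntegral_kern_le (hd : 1 ≤ d) (s : Set (Ed d)) (y : Ed d) :
    ∫⁻ x in s, ofReal ‖kern d (x - y)‖ ≤ sph d + volume s := by
  have := setLIntegral_kern_mul_le hd (fun _ => 1) measurable_const (C := 1) (fun _ _ => le_rfl) s y
  simpa using this

lemma setLIntegral_kern_sub_rk_le (hd : 1 ≤ d) {ε : ℝ} (hε : 0 ≤ ε) (s : Set (Ed d)) (y : Ed d) :
    ∫⁻ x in s, ofReal ‖kern d (x - y) - rk d ε (x - y)‖
      ≤ ofReal √(d * ε) * (2 * sph d + volume s) := by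
  have h := setLIntegral_kern_mul_le hd (fun r => ofReal (√(d * ε / r))) (by fun_prop)
    (C := ofReal (√(d * ε)))
    (fun r hr => by
      apply ofReal_le_ofReal
      apply Real.sqrt_le_sqrt
      exact div_le_self (by positivity) hr.le) s y
  have e : ∫⁻ r in Ioc (0 : ℝ) 1, ofReal (√(d * ε / r)) = ofReal (2 * √(d * ε)) := by
    have := lintegral_Ioc_of_hasDerivAt (g := fun r => 2 * √(d * ε) * √r)
      (g' := fun r => √(d * ε / r)) zero_le_one (by fun_prop)
      (fun r hr => by
        have hr0 : 0 < r := hr.1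
        refine ((Real.hasDerivAt_sqrt hr0.ne').const_mul _).congr_deriv ?_
        rw [Real.sqrt_div (by positivity)]
        have : 0 < √r := Real.sqrt_pos.2 hr0
        field_simp) (fun r _ => Real.sqrt_nonneg _)
    rw [this]; simp
  rw [e] at h
  calc _ ≤ _ := lintegral_mono fun x => by
        calc _ ≤ ofReal (√(d * ε / ‖x - y‖) * ‖kern d (x - y)‖) :=
              ofReal_le_ofReal (norm_kern_sub_rk_le hε (x - y))
          _ = _ := by rw [mul_comm, ofReal_mul (norm_nonneg _)]
    _ ≤ _ := h
    _ = _ := by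
      rw [ofReal_mul (by norm_num)]
      simp; ring

/-- The kernel modulus integrates to a log-Lipschitz modulus. -/
lemma setLIntegral_gmod_le (hd : 1 ≤ d) {r : ℝ} (hr : 0 < r) (y : Ed d) :
    ∫⁻ x in closedBall y 1, ofReal (gmod d r (x - y))
      ≤ sph d * ofReal (2 * (d + 1) * (r * log (1 + 1 / r))) := by
  have h := lintegral_kern_mul hd
    ((Iic (1 : ℝ)).indicator fun m => ofReal (2 * (d + 1) * (r / (m + r))))
    (Measurable.indicator (by fun_prop) measurableSet_Iic)
  have hk : Measurable (kern d) := measurable_kern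
  rw [← lintegral_sub_right_eq_self _ y, lintegral_indicator measurableSet_Iic,
    Measure.restrict_restrict measurableSet_Iic, inter_comm, Ioi_inter_Iic,
    lintegral_Ioc_of_hasDerivAt (g := fun m => 2 * (d + 1) * (r * log (m + r))) zero_le_one
    (by
      refine ContinuousOn.mul (by fun_prop) (ContinuousOn.mul (by fun_prop) ?_)
      exact ContinuousOn.log (by fun_prop) fun x hx => by have := hx.1; positivity)
    (fun m hm => by
      have hm0 := hm.1
      have := ((hasDerivAt_id m).add_const r).log (by simp only [id]; positivity)
      refine ((this.const_mul r).const_mul _).congr_deriv ?_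
      simp only [id]; ring)
    (fun m hm => by have := hm.1; positivity)] at h
  have e : 2 * ((d : ℝ) + 1) * (r * log (1 + r)) - 2 * (d + 1) * (r * log (0 + r))
      = 2 * (d + 1) * (r * log (1 + 1 / r)) := by
    have : 1 + 1 / r = (1 + r) / r := by field_simp; ring
    rw [this, Real.log_div (by positivity) hr.ne', zero_add]; ring
  rw [e] at h
  rw [← h, ← lintegral_indicator measurableSet_closedBall]
  refine lintegral_mono fun x => ?_
  by_cases hx : x ∈ closedBall y 1
  · have hx' : ‖x - y‖ ∈ Iic (1 : ℝ) := by simpa [dist_eq_norm] using hx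
    rw [indicator_of_mem hx, indicator_of_mem hx', gmod, mul_comm,
      ofReal_mul (norm_nonneg _)]
  · rw [indicator_of_notMem hx]; exact zero_le

lemma gmod_le_of_one_le (hd : 1 ≤ d) {r : ℝ} (hr : 0 ≤ r) {u : Ed d} (hu : 1 ≤ ‖u‖) :
    gmod d r u ≤ 2 * (d + 1) * r := by
  have h1 := norm_kern_le_one hd hu
  have h2 : r / (‖u‖ + r) ≤ r := div_le_self hr (by linarith)
  have h3 : 0 ≤ r / (‖u‖ + r) := by positivity
  calc gmod d r u ≤ 2 * (d + 1) * r * 1 := by unfold gmod; gcongr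
    _ = _ := by ring

end VP

namespace VP

variable {d : ℕ}

/-! ### Fields generated by measures and the splitting scheme -/

/-- Phase space. -/
abbrev PS (d : ℕ) : Type := Ed d × Ed d

lemma cdim_nonneg (d : ℕ) : 0 ≤ cdim d := by unfold cdim; positivity

lemma sub_two_pos (hd : 3 ≤ d) : (0 : ℝ) < (d : ℝ) - 2 := by
  have : (3 : ℝ) ≤ d := by exact_mod_cast hd
  linarith

lemma cdim_div_nonneg (hd : 3 ≤ d) : 0 ≤ cdim d / ((d : ℝ) - 2) :=
  div_nonneg (cdim_nonneg d) (sub_two_pos hd).le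

lemma measurable_rk (ε : ℝ) : Measurable (rk d ε) := by
  have : Measurable (sreg (d := d) ε) := (continuous_sreg ε).measurable
  unfold rk
  fun_prop

/-- The (regularised) field generated by a measure on phase space. -/
def fld (d : ℕ) (ε : ℝ) (ν : Measure (PS d)) (x : Ed d) : Ed d :=
  cdim d • ∫ w : PS d, rk d ε (x - w.1) ∂ν

lemma measurable_fld (ε : ℝ) (ν : Measure (PS d)) [SFinite ν] : Measurable (fld d ε ν) := by
  have : StronglyMeasurable fun x : Ed d => ∫ w : PS d, rk d ε (x - w.1) ∂ν := by
    have h : StronglyMeasurable fun p : Ed d × PS d => rk d ε (p.1 - p.2.1) :=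
      ((measurable_rk ε).comp
        (by fun_prop : Measurable fun p : Ed d × PS d => p.1 - p.2.1)).stronglyMeasurable
    exact h.integral_prod_right'
  exact this.measurable.const_smul (cdim d)

lemma integrable_rk_comp (hd : 1 ≤ d) {ε : ℝ} (hε : 0 < ε) {Ω : Type*} [MeasurableSpace Ω]
    (m : Measure Ω) [IsFiniteMeasure m] {X : Ω → Ed d} (hX : Measurable X) :
    Integrable (fun w => rk d ε (X w)) m :=
  Integrable.of_bound ((measurable_rk ε).comp hX).aestronglyMeasurable _
    (.of_forall fun w => norm_rk_le_const hd hε (X w))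

lemma norm_fld_le (hd : 1 ≤ d) {ε : ℝ} (hε : 0 < ε) (ν : Measure (PS d)) [IsFiniteMeasure ν]
    (x : Ed d) : ‖fld d ε ν x‖ ≤ cdim d * ((ε ^ (d - 1))⁻¹ * ν.real univ) := by
  rw [fld, norm_smul, norm_of_nonneg (cdim_nonneg d)]
  gcongr
  · exact cdim_nonneg d
  · exact norm_integral_le_of_norm_le_const (.of_forall fun w => norm_rk_le_const hd hε _)

lemma norm_fld_sub_le (hd : 1 ≤ d) {ε : ℝ} (hε : 0 < ε) (ν : Measure (PS d)) [IsFiniteMeasure ν]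
    (x y : Ed d) : ‖fld d ε ν x - fld d ε ν y‖
      ≤ cdim d * ((d + 1) * (ε ^ d)⁻¹ * ν.real univ) * ‖x - y‖ := by
  rw [fld, fld, ← smul_sub, norm_smul, norm_of_nonneg (cdim_nonneg d), mul_assoc]
  have := cdim_nonneg d
  gcongr
  rw [← integral_sub (integrable_rk_comp hd hε ν (by fun_prop))
    (integrable_rk_comp hd hε ν (by fun_prop))]
  refine (norm_integral_le_of_norm_le_const (C := (d + 1) * (ε ^ d)⁻¹ * ‖x - y‖)
    (.of_forall fun w => ?_)).trans (le_of_eq (by ring))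
  simpa using norm_rk_sub_le hε (x - w.1) (y - w.1)

/-- The kick `(x,v) ↦ (x, v + τ E(x))`. -/
def kick (τ : ℝ) (E : Ed d → Ed d) (hE : Measurable E) : PS d ≃ᵐ PS d where
  toFun z := (z.1, z.2 + τ • E z.1)
  invFun z := (z.1, z.2 - τ • E z.1)
  left_inv z := by simp
  right_inv z := by simp
  measurable_toFun := by
    change Measurable fun z : PS d => (z.1, z.2 + τ • E z.1)
    fun_prop
  measurable_invFun := by
    change Measurable fun z : PS d => (z.1, z.2 - τ • E z.1)
    fun_prop

/-- The drift `(x,v) ↦ (x + τ v, v)`. -/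
def drift (τ : ℝ) : PS d ≃ᵐ PS d where
  toFun z := (z.1 + τ • z.2, z.2)
  invFun z := (z.1 - τ • z.2, z.2)
  left_inv z := by simp
  right_inv z := by simp
  measurable_toFun := by
    change Measurable fun z : PS d => (z.1 + τ • z.2, z.2)
    fun_prop
  measurable_invFun := by
    change Measurable fun z : PS d => (z.1 - τ • z.2, z.2)
    fun_prop

lemma measurePreserving_kick (τ : ℝ) (E : Ed d → Ed d) (hE : Measurable E) :
    MeasurePreserving (kick τ E hE) volume volume := by
  have := (MeasurePreserving.id (volume : Measure (Ed d))).skew_product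
    (g := fun x v => v + τ • E x) (μb := volume) (μd := volume) (by
      change Measurable fun z : PS d => z.2 + τ • E z.1
      fun_prop) (.of_forall fun x => (measurePreserving_add_right volume (τ • E x)).map_eq)
  exact this

lemma measurePreserving_drift (τ : ℝ) : MeasurePreserving (drift (d := d) τ) volume volume := by
  have := (MeasurePreserving.id (volume : Measure (Ed d))).skew_product
    (g := fun v x => x + τ • v) (μb := volume) (μd := volume) (by
      change Measurable fun z : PS d => z.2 + τ • z.1
      fun_prop) (.of_forall fun v => (measurePreserving_add_right volume (τ • v)).map_eq)
  exact (Measure.measurePreserving_swap.comp this).comp Measure.measurePreserving_swap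

/-- One step of the splitting scheme. -/
def stp (τ : ℝ) (E : Ed d → Ed d) (hE : Measurable E) : PS d ≃ᵐ PS d :=
  (kick τ E hE).trans (drift τ)

lemma stp_apply (τ : ℝ) (E : Ed d → Ed d) (hE : Measurable E) (z : PS d) :
    stp τ E hE z = (z.1 + τ • (z.2 + τ • E z.1), z.2 + τ • E z.1) := rfl

lemma measurePreserving_stp (τ : ℝ) (E : Ed d → Ed d) (hE : Measurable E) :
    MeasurePreserving (stp τ E hE) volume volume :=
  (measurePreserving_drift τ).comp (measurePreserving_kick τ E hE)

/-- The energy of a configuration. -/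
def en (d : ℕ) (ε : ℝ) {Ω : Type*} [MeasurableSpace Ω] (m : Measure Ω) (X V : Ω → Ed d) : ℝ :=
  (∫ a, ‖V a‖ ^ 2 ∂m) +
    cdim d / ((d : ℝ) - 2) * ∫ p : Ω × Ω, rH d ε (X p.1 - X p.2) ∂(m.prod m)

lemma integral_sq_le_en (hd : 3 ≤ d) (ε : ℝ) {Ω : Type*} [MeasurableSpace Ω] {m : Measure Ω}
    (X V : Ω → Ed d) :
    ∫ a, ‖V a‖ ^ 2 ∂m ≤ en d ε m X V :=
  le_add_of_nonneg_right (mul_nonneg (cdim_div_nonneg hd) (integral_nonneg fun _ => rH_nonneg _ _))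

section Energy

variable {Ω : Type*} [MeasurableSpace Ω] {m : Measure Ω} [IsFiniteMeasure m]

lemma integrable_rH {ε : ℝ} (hε : 0 < ε) {X : Ω → Ed d} (hX : Measurable X) :
    Integrable (fun p : Ω × Ω => rH d ε (X p.1 - X p.2)) (m.prod m) := by
  refine Integrable.of_bound (C := (ε ^ (d - 2))⁻¹) ?_ (.of_forall fun p => ?_)
  · exact ((continuous_rH hε).measurable.comp (by fun_prop)).aestronglyMeasurable
  · rw [norm_of_nonneg (rH_nonneg _ _)]; exact rH_le hε _

lemma integrable_sq_add {V W : Ω → Ed d} (hV : Measurable V) (hW : Measurable W)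
    (hV2 : Integrable (fun a => ‖V a‖ ^ 2) m) {C : ℝ} (hC : ∀ a, ‖W a‖ ≤ C) :
    Integrable (fun a => ‖V a + W a‖ ^ 2) m := by
  refine Integrable.mono' ((hV2.const_mul 2).add (integrable_const (2 * C ^ 2)))
    (by fun_prop) (.of_forall fun a => ?_)
  rw [norm_of_nonneg (by positivity)]
  have h3 : ‖W a‖ ^ 2 ≤ C ^ 2 := by gcongr; exact hC a
  simp only [Pi.add_apply]
  nlinarith [parallelogram_law_with_norm ℝ (V a) (W a), sq_nonneg ‖V a - W a‖]

lemma integrable_of_sq {V : Ω → Ed d} (hV : Measurable V) (h : Integrable (fun a => ‖V a‖ ^ 2) m) :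
    Integrable V m :=
  .mono' (h.add (integrable_const 1)) hV.aestronglyMeasurable
    (.of_forall fun a => by simp only [Pi.add_apply]; nlinarith [sq_nonneg (‖V a‖ - 1)])

/-- The growth constant of the energy for the splitting scheme. -/
def growth (d : ℕ) (ε M : ℝ) : ℝ :=
  cdim d * ((d + 1) * (ε ^ d)⁻¹) * (4 * M) *
    (2 + 2 * (cdim d * ((ε ^ (d - 1))⁻¹ * M)) ^ 2 * M)

lemma en_step_le (hd : 3 ≤ d) {ε : ℝ} (hε : 0 < ε) {X V : Ω → Ed d} (hX : Measurable X)
    (hV : Measurable V) (hV2 : Integrable (fun a => ‖V a‖ ^ 2) m) {E : Ed d → Ed d}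
    (hE : ∀ x, E x = cdim d • ∫ b, rk d ε (x - X b) ∂m) (hEm : Measurable E)
    {τ : ℝ} (h0 : 0 ≤ τ) (h1 : τ ≤ 1) :
    en d ε m (fun a => X a + τ • (V a + τ • E (X a))) (fun a => V a + τ • E (X a))
      ≤ en d ε m X V + growth d ε (m.real univ) * τ ^ 2 * (en d ε m X V + 1) := by
  set M := m.real univ with hM
  have hM0 : 0 ≤ M := measureReal_nonneg
  have hc := cdim_nonneg d
  set L : ℝ := (d + 1) * (ε ^ d)⁻¹ with hL
  have hL0 : 0 ≤ L := by positivity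
  set Eb : ℝ := cdim d * ((ε ^ (d - 1))⁻¹ * M) with hEb
  have hEb0 : 0 ≤ Eb := by positivity
  have hd2 := sub_two_pos hd
  have hEbd : ∀ x, ‖E x‖ ≤ Eb := by
    intro x
    rw [hE, norm_smul, norm_of_nonneg hc]
    exact mul_le_mul_of_nonneg_left (norm_integral_le_of_norm_le_const
      (.of_forall fun w => norm_rk_le_const (by omega) hε _)) hc
  set V' : Ω → Ed d := fun a => V a + τ • E (X a) with hV'
  have hV'm : Measurable V' := by fun_prop
  have hW : ∀ a, ‖τ • E (X a)‖ ≤ Eb := fun a => by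
    rw [norm_smul, norm_of_nonneg h0]
    have := hEbd (X a)
    nlinarith [norm_nonneg (E (X a))]
  have hV'2 : Integrable (fun a => ‖V' a‖ ^ 2) m := integrable_sq_add hV (by fun_prop) hV2 hW
  have hV'1 : Integrable V' m := integrable_of_sq hV'm hV'2
  have hVE : Integrable (fun a => inner ℝ (E (X a)) (V' a)) m := by
    refine Integrable.mono' (hV'1.norm.const_mul Eb) (by fun_prop)
      (.of_forall fun a => ?_)
    refine (norm_inner_le_norm _ _).trans ?_
    gcongr; exact hEbd _
  have hkin : ∫ a, ‖V' a‖ ^ 2 ∂m ≤ (∫ a, ‖V a‖ ^ 2 ∂m) + 2 * τ * ∫ a, inner ℝ (E (X a)) (V' a) ∂m := by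
    rw [← integral_const_mul, ← integral_add hV2 (hVE.const_mul _)]
    refine integral_mono hV'2 (hV2.add (hVE.const_mul _)) fun a => ?_
    have e : V a = V' a - τ • E (X a) := by simp [hV']
    simp only [e, norm_sub_sq_real, inner_smul_right, norm_smul, mul_pow]
    rw [real_inner_comm]
    have : 0 ≤ ‖τ‖ ^ 2 * ‖E (X a)‖ ^ 2 := by positivity
    linarith
  have hkin2 : ∫ a, ‖V' a‖ ^ 2 ∂m ≤ 2 * (∫ a, ‖V a‖ ^ 2 ∂m) + 2 * Eb ^ 2 * M := by
    have : ∫ a, ‖V' a‖ ^ 2 ∂m ≤ ∫ a, (2 * ‖V a‖ ^ 2 + 2 * Eb ^ 2) ∂m := by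
      refine integral_mono hV'2 ((hV2.const_mul 2).add (integrable_const _)) fun a => ?_
      have h3 : ‖τ • E (X a)‖ ^ 2 ≤ Eb ^ 2 := by gcongr; exact hW a
      simp only [hV']
      nlinarith [parallelogram_law_with_norm ℝ (V a) (τ • E (X a)), sq_nonneg ‖V a - τ • E (X a)‖]
    rw [integral_add (hV2.const_mul 2) (integrable_const _), integral_const_mul] at this
    simpa [hM, mul_comm] using this
  set K : Ω × Ω → Ed d := fun p => rk d ε (X p.1 - X p.2) with hK
  have hKm : Measurable K := (measurable_rk ε).comp (by fun_prop)
  have hKb : ∀ p, ‖K p‖ ≤ (ε ^ (d - 1))⁻¹ := fun p => norm_rk_le_const (by omega) hε _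
  have hKi : ∀ U : Ω × Ω → Ed d, Measurable U → Integrable U (m.prod m) →
      Integrable (fun p => inner ℝ (K p) (U p)) (m.prod m) := fun U hU hUi => by
    refine (hUi.norm.const_mul ((ε ^ (d - 1))⁻¹)).mono' (by fun_prop)
      (.of_forall fun p => (norm_inner_le_norm _ _).trans ?_)
    gcongr; exact hKb _
  have hKi1 := hKi _ (by fun_prop) (hV'1.comp_fst m)
  have hKi2 := hKi _ (by fun_prop) (hV'1.comp_snd m)
  have hsw : ∫ p, inner ℝ (K p) (V' p.2) ∂(m.prod m) = - ∫ p, inner ℝ (K p) (V' p.1) ∂(m.prod m) := by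
    rw [← integral_prod_swap, ← integral_neg]
    congr 1
    ext p
    simp only [hK, Prod.fst_swap, Prod.snd_swap]
    rw [← neg_sub, rk_neg, inner_neg_left]
  have hfub : cdim d * ∫ p, inner ℝ (K p) (V' p.1) ∂(m.prod m) = ∫ a, inner ℝ (E (X a)) (V' a) ∂m := by
    rw [integral_prod _ hKi1, ← integral_const_mul]
    congr 1
    ext a
    rw [hE, inner_smul_left]
    simp only [RCLike.conj_to_real]
    congr 1
    rw [real_inner_comm, ← integral_inner (integrable_rk_comp (by omega) hε m (by fun_prop))]
    congr 1
    ext b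
    rw [real_inner_comm]
  have hpot : ∫ p : Ω × Ω, rH d ε ((X p.1 + τ • V' p.1) - (X p.2 + τ • V' p.2)) ∂(m.prod m)
      ≤ (∫ p : Ω × Ω, rH d ε (X p.1 - X p.2) ∂(m.prod m))
        - ((d : ℝ) - 2) * τ * (2 * ∫ p, inner ℝ (K p) (V' p.1) ∂(m.prod m))
        + ((d : ℝ) - 2) * L * τ ^ 2 * (4 * M * ∫ a, ‖V' a‖ ^ 2 ∂m) := by
    have hq1 := hV'2.comp_fst m
    have hq2 := hV'2.comp_snd m
    have e1 : (∫ p, inner ℝ (K p) (V' p.1) ∂(m.prod m)) - ∫ p, inner ℝ (K p) (V' p.2) ∂(m.prod m)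
        = 2 * ∫ p, inner ℝ (K p) (V' p.1) ∂(m.prod m) := by rw [hsw]; ring
    have e2 : ∫ p : Ω × Ω, (2 * ‖V' p.1‖ ^ 2 + 2 * ‖V' p.2‖ ^ 2) ∂(m.prod m)
        = 4 * M * ∫ a, ‖V' a‖ ^ 2 ∂m := by
      rw [integral_add (hq1.const_mul 2) (hq2.const_mul 2), integral_const_mul, integral_const_mul,
        integral_fun_fst (f := fun a => ‖V' a‖ ^ 2), integral_fun_snd (f := fun a => ‖V' a‖ ^ 2)]
      simp only [smul_eq_mul, ← hM]; ring
    have i1 : Integrable (fun p : Ω × Ω => ((d : ℝ) - 2) * τ *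
        (inner ℝ (K p) (V' p.1) - inner ℝ (K p) (V' p.2))) (m.prod m) :=
      (hKi1.sub hKi2).const_mul _
    have i2 : Integrable (fun p : Ω × Ω => ((d : ℝ) - 2) * L * τ ^ 2 *
        (2 * ‖V' p.1‖ ^ 2 + 2 * ‖V' p.2‖ ^ 2)) (m.prod m) :=
      ((hq1.const_mul 2).add (hq2.const_mul 2)).const_mul _
    have i3 : Integrable (fun p : Ω × Ω => rH d ε (X p.1 - X p.2) - ((d : ℝ) - 2) * τ *
        (inner ℝ (K p) (V' p.1) - inner ℝ (K p) (V' p.2))) (m.prod m) :=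
      (integrable_rH hε hX).sub i1
    rw [← e1, ← integral_sub hKi1 hKi2, ← e2, ← integral_const_mul, ← integral_const_mul,
      ← integral_sub (integrable_rH hε hX) i1, ← integral_add i3 i2]
    refine integral_mono (integrable_rH (X := fun a => X a + τ • V' a) hε (by fun_prop))
      (i3.add i2) fun p => ?_
    have h := rH_add_le (by omega : 2 ≤ d) hε (X p.1 - X p.2) (τ • (V' p.1 - V' p.2))
    have e3 : X p.1 - X p.2 + τ • (V' p.1 - V' p.2) = (X p.1 + τ • V' p.1) - (X p.2 + τ • V' p.2) := by
      rw [smul_sub]; abel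
    rw [e3, inner_smul_right, inner_sub_right, norm_smul, mul_pow, norm_of_nonneg h0] at h
    have h4 : ‖V' p.1 - V' p.2‖ ^ 2 ≤ 2 * ‖V' p.1‖ ^ 2 + 2 * ‖V' p.2‖ ^ 2 := by
      nlinarith [parallelogram_law_with_norm ℝ (V' p.1) (V' p.2), sq_nonneg ‖V' p.1 + V' p.2‖]
    have h7 : ((d : ℝ) - 2) * L * (τ ^ 2 * ‖V' p.1 - V' p.2‖ ^ 2)
        ≤ ((d : ℝ) - 2) * L * (τ ^ 2 * (2 * ‖V' p.1‖ ^ 2 + 2 * ‖V' p.2‖ ^ 2)) := by gcongr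
    simp only [hK] at h7 ⊢
    linarith
  have hpot2 := mul_le_mul_of_nonneg_left hpot (cdim_div_nonneg hd)
  have e5 : cdim d / ((d : ℝ) - 2) * ((∫ p : Ω × Ω, rH d ε (X p.1 - X p.2) ∂(m.prod m))
        - ((d : ℝ) - 2) * τ * (2 * ∫ p, inner ℝ (K p) (V' p.1) ∂(m.prod m))
        + ((d : ℝ) - 2) * L * τ ^ 2 * (4 * M * ∫ a, ‖V' a‖ ^ 2 ∂m))
      = cdim d / ((d : ℝ) - 2) * (∫ p : Ω × Ω, rH d ε (X p.1 - X p.2) ∂(m.prod m))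
        - 2 * τ * (cdim d * ∫ p, inner ℝ (K p) (V' p.1) ∂(m.prod m))
        + cdim d * L * τ ^ 2 * (4 * M * ∫ a, ‖V' a‖ ^ 2 ∂m) := by
    field_simp
  rw [e5, hfub] at hpot2
  have hk0 : 0 ≤ ∫ a, ‖V a‖ ^ 2 ∂m := integral_nonneg fun a => by positivity
  have h8 : cdim d * L * τ ^ 2 * (4 * M * ∫ a, ‖V' a‖ ^ 2 ∂m)
      ≤ cdim d * L * τ ^ 2 * (4 * M * (2 * (∫ a, ‖V a‖ ^ 2 ∂m) + 2 * Eb ^ 2 * M)) := by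
    gcongr
  have h9 : 2 * (∫ a, ‖V a‖ ^ 2 ∂m) + 2 * Eb ^ 2 * M
      ≤ (2 + 2 * Eb ^ 2 * M) * (en d ε m X V + 1) := by
    have h10 := integral_sq_le_en (m := m) hd ε X V
    have h11 : 0 ≤ 2 * Eb ^ 2 * M := by positivity
    nlinarith
  have h12 : cdim d * L * τ ^ 2 * (4 * M * (2 * (∫ a, ‖V a‖ ^ 2 ∂m) + 2 * Eb ^ 2 * M))
      ≤ cdim d * L * τ ^ 2 * (4 * M * ((2 + 2 * Eb ^ 2 * M) * (en d ε m X V + 1))) := by gcongr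
  have e6 : cdim d * L * τ ^ 2 * (4 * M * ((2 + 2 * Eb ^ 2 * M) * (en d ε m X V + 1)))
      = growth d ε M * τ ^ 2 * (en d ε m X V + 1) := by rw [growth]; ring
  rw [e6] at h12
  change en d ε m (fun a => X a + τ • V' a) V' ≤ _
  rw [en]
  have e7 : en d ε m X V = (∫ a, ‖V a‖ ^ 2 ∂m)
    + cdim d / ((d : ℝ) - 2) * ∫ p : Ω × Ω, rH d ε (X p.1 - X p.2) ∂(m.prod m) := rfl
  linarith

end Energy

end VP

namespace VP

variable {d : ℕ}

/-- The iterates of the splitting scheme with time step `h`. -/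
def iter (ε h : ℝ) (μ : Measure (PS d)) [IsFiniteMeasure μ] : ℕ → PS d ≃ᵐ PS d
  | 0 => MeasurableEquiv.refl _
  | k + 1 => (iter ε h μ k).trans
      (stp h (fld d ε (μ.map (iter ε h μ k))) (measurable_fld ε _))

/-- The flow of the splitting scheme. -/
def sfl (ε h : ℝ) (μ : Measure (PS d)) [IsFiniteMeasure μ] (t : ℝ) : PS d ≃ᵐ PS d :=
  (iter ε h μ ⌊t / h⌋₊).trans
    (stp (t - ⌊t / h⌋₊ * h) (fld d ε (μ.map (iter ε h μ ⌊t / h⌋₊))) (measurable_fld ε _))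

/-- The velocity of the flow of the splitting scheme. -/
def svel (ε h : ℝ) (μ : Measure (PS d)) [IsFiniteMeasure μ] (k : ℕ) (t : ℝ) (z : PS d) : PS d :=
  ((iter ε h μ k z).2 + (2 * (t - k * h)) •
      fld d ε (μ.map (iter ε h μ k)) (iter ε h μ k z).1,
    fld d ε (μ.map (iter ε h μ k)) (iter ε h μ k z).1)

section

variable {ε h : ℝ} {μ : Measure (PS d)} [IsFiniteMeasure μ]

lemma iter_succ_apply (k : ℕ) (z : PS d) : iter ε h μ (k + 1) z =
    stp h (fld d ε (μ.map (iter ε h μ k))) (measurable_fld ε _) (iter ε h μ k z) := rfl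

lemma sfl_apply (t : ℝ) (z : PS d) : sfl ε h μ t z =
    stp (t - ⌊t / h⌋₊ * h) (fld d ε (μ.map (iter ε h μ ⌊t / h⌋₊))) (measurable_fld ε _)
      (iter ε h μ ⌊t / h⌋₊ z) := rfl

lemma sfl_zero (z : PS d) : sfl ε h μ 0 z = z := by
  rw [sfl_apply]
  simp only [zero_div, Nat.floor_zero, Nat.cast_zero, zero_mul, sub_zero, stp_apply, zero_smul,
    add_zero]
  rfl

lemma measurePreserving_iter (k : ℕ) : MeasurePreserving (iter ε h μ k) volume volume := by
  induction k with
  | zero => exact MeasurePreserving.id _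
  | succ k ih => exact (measurePreserving_stp h _ _).comp ih

lemma measurePreserving_sfl (t : ℝ) : MeasurePreserving (sfl ε h μ t) volume volume :=
  (measurePreserving_stp _ _ _).comp (measurePreserving_iter _)

lemma measurable_floor_family {γ : Type*} [MeasurableSpace γ] {F : ℕ → ℝ × PS d → γ}
    (hF : ∀ k, Measurable (F k)) : Measurable fun p : ℝ × PS d => F ⌊p.1 / h⌋₊ p := by
  have h1 : Measurable fun q : ℕ × (ℝ × PS d) => F q.1 q.2 :=
    measurable_from_prod_countable_right hF
  exact h1.comp (by fun_prop : Measurable fun p : ℝ × PS d => (⌊p.1 / h⌋₊, p))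

lemma measurable_svel : Measurable fun p : ℝ × PS d => svel ε h μ ⌊p.1 / h⌋₊ p.1 p.2 := by
  refine measurable_floor_family (h := h)
    (F := fun k p => svel ε h μ k p.1 p.2) fun k => ?_
  have hG : Measurable fun p : ℝ × PS d => iter ε h μ k p.2 :=
    (iter ε h μ k).measurable.comp measurable_snd
  have hF : Measurable fun p : ℝ × PS d =>
      fld d ε (μ.map (iter ε h μ k)) (iter ε h μ k p.2).1 :=
    (measurable_fld ε _).comp hG.fst
  unfold svel
  exact (hG.snd.add ((by fun_prop : Measurable fun p : ℝ × PS d => 2 * (p.1 - k * h)).smul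
    hF)).prodMk hF

lemma measurable_sfl : Measurable fun p : ℝ × PS d => sfl ε h μ p.1 p.2 := by
  have hG : ∀ k : ℕ, Measurable fun p : ℝ × PS d => iter ε h μ k p.2 := fun k =>
    (iter ε h μ k).measurable.comp measurable_snd
  have hF : ∀ k : ℕ, Measurable fun p : ℝ × PS d =>
      fld d ε (μ.map (iter ε h μ k)) (iter ε h μ k p.2).1 := fun k =>
    (measurable_fld ε _).comp (hG k).fst
  have hG' := measurable_floor_family (h := h) hG
  have hF' := measurable_floor_family (h := h) hF
  have hτ : Measurable fun p : ℝ × PS d => p.1 - ⌊p.1 / h⌋₊ * h := by fun_prop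
  have hV := hG'.snd.add (hτ.smul hF')
  simp only [sfl_apply, stp_apply]
  exact (hG'.fst.add (hτ.smul hV)).prodMk hV

lemma hasDerivAt_stp {E : Ed d → Ed d} (hE : Measurable E) (w : PS d) (a t : ℝ) :
    HasDerivAt (fun t => stp (t - a) E hE w) (w.2 + (2 * (t - a)) • E w.1, E w.1) t := by
  have h0 : HasDerivAt (fun t : ℝ => t - a) 1 t := (hasDerivAt_id t).sub_const a
  have h1 : HasDerivAt (fun t : ℝ => w.2 + (t - a) • E w.1) (E w.1) t := by
    simpa using (h0.smul_const (E w.1)).const_add w.2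
  have h2 := (h0.fun_smul h1).const_add w.1
  have h3 := h2.prodMk h1
  simp only [stp_apply]
  convert h3 using 2
  rw [one_smul, mul_smul, two_smul]; abel

lemma floor_of_mem_Ioo (hh : 0 < h) {k : ℕ} {r : ℝ} (h1 : k * h ≤ r) (h2 : r < (k + 1) * h) :
    ⌊r / h⌋₊ = k := by
  rw [Nat.floor_eq_iff (div_nonneg ((by positivity : (0 : ℝ) ≤ k * h).trans h1) hh.le),
    le_div_iff₀ hh, div_lt_iff₀ hh]
  exact ⟨h1, h2⟩

lemma svel_step (hh : 0 < h) (k : ℕ) {t : ℝ} (h1 : k * h ≤ t) (h2 : t ≤ (k + 1) * h) (z : PS d) :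
    IntervalIntegrable (fun r => svel ε h μ ⌊r / h⌋₊ r z) volume (k * h) t ∧
    ∫ r in (k * h)..t, svel ε h μ ⌊r / h⌋₊ r z =
      stp (t - k * h) (fld d ε (μ.map (iter ε h μ k))) (measurable_fld ε _) (iter ε h μ k z)
        - iter ε h μ k z := by
  have hc : Continuous fun r => svel ε h μ k r z := by unfold svel; fun_prop
  have hae : ∀ᵐ r ∂volume, r ∈ uIoc (k * h) t →
      svel ε h μ k r z = svel ε h μ ⌊r / h⌋₊ r z := by
    filter_upwards [Measure.ae_ne volume ((k + 1) * h : ℝ)] with r hr hm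
    rw [uIoc_of_le h1] at hm
    rw [floor_of_mem_Ioo hh hm.1.le (lt_of_le_of_ne (hm.2.trans h2) hr)]
  refine ⟨(hc.intervalIntegrable _ _).congr_ae ?_, ?_⟩
  · exact (ae_restrict_iff' measurableSet_uIoc).2 hae
  · rw [← intervalIntegral.integral_congr_ae hae,
      intervalIntegral.integral_eq_sub_of_hasDerivAt
        (f := fun t => stp (t - k * h) (fld d ε (μ.map (iter ε h μ k))) (measurable_fld ε _)
          (iter ε h μ k z)) (f' := fun r => svel ε h μ k r z) (fun r _ => hasDerivAt_stp _ _ _ _) (hc.intervalIntegrable _ _)]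
    simp [stp_apply]

lemma svel_iter (hh : 0 < h) (k : ℕ) (z : PS d) :
    IntervalIntegrable (fun r => svel ε h μ ⌊r / h⌋₊ r z) volume 0 (k * h) ∧
    ∫ r in (0)..(k * h), svel ε h μ ⌊r / h⌋₊ r z = iter ε h μ k z - z := by
  induction k with
  | zero => simp [iter]
  | succ k ih =>
    have hs := svel_step (ε := ε) (μ := μ) hh k (t := (k + 1) * h) (by nlinarith) le_rfl z
    push_cast
    refine ⟨ih.1.trans hs.1, ?_⟩
    rw [← intervalIntegral.integral_add_adjacent_intervals ih.1 hs.1, ih.2, hs.2, iter_succ_apply]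
    have : ((k : ℝ) + 1) * h - k * h = h := by ring
    rw [this]; abel

lemma sfl_integral (hh : 0 < h) {t : ℝ} (ht : 0 ≤ t) (z : PS d) :
    IntervalIntegrable (fun r => svel ε h μ ⌊r / h⌋₊ r z) volume 0 t ∧
    sfl ε h μ t z = z + ∫ r in (0)..t, svel ε h μ ⌊r / h⌋₊ r z := by
  have h1 : ⌊t / h⌋₊ * h ≤ t := by
    rw [← le_div_iff₀ hh]; exact Nat.floor_le (by positivity)
  have h2 : t ≤ (⌊t / h⌋₊ + 1) * h := by
    rw [← div_le_iff₀ hh]; exact (Nat.lt_floor_add_one _).le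
  have hs := svel_step (ε := ε) (μ := μ) hh _ h1 h2 z
  have hi := svel_iter (ε := ε) (μ := μ) hh ⌊t / h⌋₊ z
  refine ⟨hi.1.trans hs.1, ?_⟩
  rw [← intervalIntegral.integral_add_adjacent_intervals hi.1 hs.1, hi.2, hs.2, sfl_apply]
  abel

lemma fld_map (hd : 1 ≤ d) (hε : 0 < ε) {Z : PS d → PS d} (hZ : Measurable Z) (x : Ed d) :
    fld d ε (μ.map Z) x = cdim d • ∫ b, rk d ε (x - (Z b).1) ∂μ := by
  rw [fld, integral_map hZ.aemeasurable]
  exact (integrable_rk_comp hd hε _ (by fun_prop)).aestronglyMeasurable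

lemma energy_iter (hd : 3 ≤ d) (hε : 0 < ε) (h0 : 0 ≤ h) (h1 : h ≤ 1)
    (hV : Integrable (fun z : PS d => ‖z.2‖ ^ 2) μ) (k : ℕ) :
    Integrable (fun z => ‖(iter ε h μ k z).2‖ ^ 2) μ ∧
    en d ε μ (fun z => (iter ε h μ k z).1) (fun z => (iter ε h μ k z).2) + 1 ≤
      (1 + growth d ε (μ.real univ) * h ^ 2) ^ k * (en d ε μ Prod.fst Prod.snd + 1) := by
  induction k with
  | zero => exact ⟨hV, by simp [iter]⟩
  | succ k ih =>
    have hm := (iter ε h μ k).measurable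
    have hE := fun x => fld_map (μ := μ) (by omega : 1 ≤ d) hε hm x
    constructor
    · simp only [iter_succ_apply, stp_apply]
      refine integrable_sq_add (W := fun z => h • fld d ε (μ.map (iter ε h μ k))
        (iter ε h μ k z).1) hm.snd (((measurable_fld ε _).comp hm.fst).const_smul h) ih.1
        (C := 1 * (cdim d * ((ε ^ (d - 1))⁻¹ * (μ.map (iter ε h μ k)).real univ))) fun a => ?_
      rw [norm_smul, norm_of_nonneg h0]
      exact mul_le_mul h1 (norm_fld_le (by omega) hε _ _) (norm_nonneg _) zero_le_one
    · have := en_step_le hd hε hm.fst hm.snd ih.1 hE (measurable_fld ε _) h0 h1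
      have hg : 0 ≤ growth d ε (μ.real univ) := by
        have := cdim_nonneg d
        have : 0 ≤ μ.real univ := measureReal_nonneg
        unfold growth; positivity
      have e : (1 + growth d ε (μ.real univ) * h ^ 2) ^ (k + 1) * (en d ε μ Prod.fst Prod.snd + 1)
        = (1 + growth d ε (μ.real univ) * h ^ 2) * ((1 + growth d ε (μ.real univ) * h ^ 2) ^ k
          * (en d ε μ Prod.fst Prod.snd + 1)) := by ring
      rw [e]
      refine le_trans ?_ (mul_le_mul_of_nonneg_left ih.2 (by positivity))
      simp only [iter_succ_apply, stp_apply]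
      linarith

lemma energy_sfl (hd : 3 ≤ d) (hε : 0 < ε) (h0 : 0 < h) (h1 : h ≤ 1)
    (hV : Integrable (fun z : PS d => ‖z.2‖ ^ 2) μ) {t : ℝ} (ht : 0 ≤ t) :
    Integrable (fun z => ‖(sfl ε h μ t z).2‖ ^ 2) μ ∧
    en d ε μ (fun z => (sfl ε h μ t z).1) (fun z => (sfl ε h μ t z).2) + 1 ≤
      Real.exp (growth d ε (μ.real univ) * h * (t + 1)) * (en d ε μ Prod.fst Prod.snd + 1) := by
  set k := ⌊t / h⌋₊ with hk
  have ht1 : k * h ≤ t := by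
    rw [← le_div_iff₀ h0]; exact Nat.floor_le (by positivity)
  have ht2 : t ≤ (k + 1) * h := by
    rw [← div_le_iff₀ h0]; exact (Nat.lt_floor_add_one _).le
  have hτ0 : 0 ≤ t - k * h := by linarith
  have hτ1 : t - k * h ≤ h := by linarith
  have hm := (iter ε h μ k).measurable
  have hE := fun x => fld_map (μ := μ) (by omega : 1 ≤ d) hε hm x
  have ih := energy_iter hd hε h0.le h1 hV k
  have hg : 0 ≤ growth d ε (μ.real univ) := by
    have := cdim_nonneg d
    have : 0 ≤ μ.real univ := measureReal_nonneg
    unfold growth; positivity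
  set A := growth d ε (μ.real univ) with hA
  constructor
  · simp only [sfl_apply, stp_apply]
    have hW : Measurable fun z => (t - k * h) • fld d ε (μ.map (iter ε h μ k))
      (iter ε h μ k z).1 := ((measurable_fld ε _).comp hm.fst).const_smul (t - k * h)
    refine integrable_sq_add hm.snd hW ih.1
      (C := 1 * (cdim d * ((ε ^ (d - 1))⁻¹ * (μ.map (iter ε h μ k)).real univ))) fun a => ?_
    rw [norm_smul, norm_of_nonneg hτ0]
    exact mul_le_mul (hτ1.trans h1) (norm_fld_le (by omega) hε _ _) (norm_nonneg _) zero_le_one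
  · have h3 := en_step_le hd hε hm.fst hm.snd ih.1 hE (measurable_fld ε _) hτ0 (hτ1.trans h1)
    have h4 : 0 ≤ en d ε μ (fun z => (iter ε h μ k z).1) (fun z => (iter ε h μ k z).2) + 1 := by
      have := (integral_nonneg fun z => by positivity).trans (integral_sq_le_en (m := μ) hd ε
        (fun z => (iter ε h μ k z).1) fun z => (iter ε h μ k z).2)
      linarith
    have h00 : 0 ≤ en d ε μ Prod.fst Prod.snd + 1 := by
      by_contra hc
      push Not at hc
      have : (1 + A * h ^ 2) ^ k * (en d ε μ Prod.fst Prod.snd + 1) < 0 :=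
        mul_neg_of_pos_of_neg (by positivity) hc
      linarith [ih.2]
    have h5 : (1 + A * h ^ 2) ^ (k + 1) ≤ Real.exp (A * h * (t + 1)) := by
      calc (1 + A * h ^ 2) ^ (k + 1) ≤ Real.exp (A * h ^ 2) ^ (k + 1) := by
            gcongr; linarith [Real.add_one_le_exp (A * h ^ 2)]
        _ = Real.exp (A * h * ((k + 1) * h)) := by
            rw [← Real.exp_nat_mul]; push_cast; ring_nf
        _ ≤ _ := by gcongr; linarith
    calc _ ≤ (1 + A * (t - k * h) ^ 2) *
          (en d ε μ (fun z => (iter ε h μ k z).1) (fun z => (iter ε h μ k z).2) + 1) := by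
          simp only [sfl_apply, stp_apply, ← hk]
          linarith
      _ ≤ (1 + A * h ^ 2) * ((1 + A * h ^ 2) ^ k * (en d ε μ Prod.fst Prod.snd + 1)) := by
          gcongr
          exact ih.2
      _ = (1 + A * h ^ 2) ^ (k + 1) * (en d ε μ Prod.fst Prod.snd + 1) := by ring
      _ ≤ _ := by gcongr

end

/-- An approximate flow for the Vlasov–Poisson system: the velocity `B` is close to the field
generated by the transported measure up to time `T`, and the energy is almost conserved. -/
structure AFlow (d : ℕ) (μ : Measure (PS d)) (e₀ ε η T : ℝ) where
  Z : ℝ → PS d ≃ᵐ PS d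
  B : ℝ → PS d → PS d
  zero : ∀ z, Z 0 z = z
  mp : ∀ t, MeasurePreserving (Z t) volume volume
  measZ : Measurable fun p : ℝ × PS d => Z p.1 p.2
  measB : Measurable (uncurry B)
  intB : ∀ z, ∀ t ≥ 0, IntervalIntegrable (fun r => B r z) volume 0 t
  ftc : ∀ t ≥ 0, ∀ z, Z t z = z + ∫ r in (0 : ℝ)..t, B r z
  close : ∀ t ∈ Icc 0 T, ∀ z, ‖B t z - ((Z t z).2, fld d ε (μ.map (Z t)) (Z t z).1)‖
    ≤ η * (1 + ‖(Z t z).2‖)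
  sq : ∀ t ∈ Icc 0 T, Integrable (fun z => ‖(Z t z).2‖ ^ 2) μ
  en_le : ∀ t ∈ Icc 0 T, en d ε μ (fun z => (Z t z).1) (fun z => (Z t z).2) ≤ e₀ + η

lemma norm_fld_map_sub_le (hd : 1 ≤ d) {ε : ℝ} (hε : 0 < ε) {μ : Measure (PS d)}
    [IsFiniteMeasure μ] {Z W : PS d → PS d} (hZ : Measurable Z) (hW : Measurable W)
    {g : PS d → ℝ} (hg : Integrable g μ) (hZW : ∀ z, ‖(Z z).1 - (W z).1‖ ≤ g z) (x : Ed d) :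
    ‖fld d ε (μ.map Z) x - fld d ε (μ.map W) x‖
      ≤ cdim d * ((d + 1) * (ε ^ d)⁻¹ * ∫ z, g z ∂μ) := by
  rw [fld_map hd hε hZ, fld_map hd hε hW, ← smul_sub, norm_smul,
    norm_of_nonneg (cdim_nonneg d)]
  refine mul_le_mul_of_nonneg_left ?_ (cdim_nonneg d)
  rw [← integral_sub (integrable_rk_comp hd hε μ (by fun_prop))
    (integrable_rk_comp hd hε μ (by fun_prop)), ← integral_const_mul]
  refine norm_integral_le_of_norm_le (hg.const_mul _) (.of_forall fun z => ?_)
  refine (norm_rk_sub_le hε _ _).trans ?_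
  gcongr
  have : x - (Z z).1 - (x - (W z).1) = -((Z z).1 - (W z).1) := by abel
  rw [this, norm_neg]
  exact hZW z

lemma exists_aflow (hd : 3 ≤ d) {ε η T e₀ : ℝ} (hε : 0 < ε) (hη : 0 < η)
    (μ : Measure (PS d)) [IsFiniteMeasure μ] (hV : Integrable (fun z : PS d => ‖z.2‖ ^ 2) μ)
    (he : en d ε μ Prod.fst Prod.snd ≤ e₀) (he₀ : 0 ≤ e₀) : Nonempty (AFlow d μ e₀ ε η T) := by
  set A := growth d ε (μ.real univ) with hA
  set M := μ.real univ with hM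
  have hM0 : 0 ≤ M := measureReal_nonneg
  have hc := cdim_nonneg d
  have hA0 : 0 ≤ A := by rw [hA]; unfold growth; positivity
  set Eb := cdim d * ((ε ^ (d - 1))⁻¹ * M) with hEb
  set L := (d + 1) * (ε ^ d)⁻¹ with hL
  have hL0 : 0 ≤ L := by positivity
  set K := Eb + cdim d * (L * M) + cdim d * (L * (e₀ + η + M)) with hK
  obtain ⟨h, hh, h1, h2, h3⟩ : ∃ h : ℝ, 0 < h ∧ h ≤ 1 ∧
      Real.exp (A * h * (T + 1)) * (e₀ + 1) ≤ e₀ + 1 + η ∧ h * K ≤ η := by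
    have t1 : Tendsto (fun h : ℝ => Real.exp (A * h * (T + 1)) * (e₀ + 1)) (𝓝[>] 0)
        (𝓝 (e₀ + 1)) := by
      have : Continuous fun h : ℝ => Real.exp (A * h * (T + 1)) * (e₀ + 1) := by fun_prop
      simpa using (this.tendsto 0).mono_left nhdsWithin_le_nhds
    have t2 : Tendsto (fun h : ℝ => h * K) (𝓝[>] 0) (𝓝 0) := by
      have : Continuous fun h : ℝ => h * K := by fun_prop
      simpa using (this.tendsto 0).mono_left nhdsWithin_le_nhds
    have t3 : ∀ᶠ h : ℝ in 𝓝[>] 0, h ≤ 1 :=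
      nhdsWithin_le_nhds (Iic_mem_nhds one_pos)
    obtain ⟨h, ⟨ha, hb⟩, hc, hd⟩ := (((eventually_mem_nhdsWithin (s := Ioi (0 : ℝ))).and t3).and
      ((t1.eventually_le_const (by linarith : e₀ + 1 < e₀ + 1 + η)).and
        (t2.eventually_le_const hη))).exists
    exact ⟨h, ha, hb, hc, hd⟩
  have hen : ∀ t ∈ Icc 0 T,
      en d ε μ (fun z => (sfl ε h μ t z).1) (fun z => (sfl ε h μ t z).2) ≤ e₀ + η := by
    intro t ht
    have h4 := (energy_sfl hd hε hh h1 hV ht.1).2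
    have h5 : Real.exp (A * h * (t + 1)) * (en d ε μ Prod.fst Prod.snd + 1)
        ≤ Real.exp (A * h * (T + 1)) * (e₀ + 1) := by
      refine (mul_le_mul_of_nonneg_left (by linarith : en d ε μ Prod.fst Prod.snd + 1 ≤ e₀ + 1)
        (Real.exp_pos _).le).trans ?_
      have := ht.2
      gcongr
    linarith
  refine ⟨{ Z := sfl ε h μ, B := fun t => svel ε h μ ⌊t / h⌋₊ t, zero := sfl_zero,
            mp := measurePreserving_sfl, measZ := measurable_sfl, measB := measurable_svel,
            intB := fun z t ht => (sfl_integral hh ht z).1,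
            ftc := fun t ht z => (sfl_integral hh ht z).2, close := ?_,
            sq := fun t ht => (energy_sfl hd hε hh h1 hV ht.1).1, en_le := hen }⟩
  intro t ht z
  have hVt := (energy_sfl hd hε hh h1 hV ht.1).1
  have hent := hen t ht
  have hZm := (sfl ε h μ t).measurable
  have hVi : Integrable (fun z => ‖(sfl ε h μ t z).2‖) μ :=
    (integrable_of_sq hZm.snd hVt).norm
  have hV1 : ∫ z, ‖(sfl ε h μ t z).2‖ ∂μ ≤ e₀ + η + M := by
    have i1 : ∫ z, ‖(sfl ε h μ t z).2‖ ∂μ ≤ ∫ z, (‖(sfl ε h μ t z).2‖ ^ 2 + 1) ∂μ :=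
      integral_mono hVi (hVt.add (integrable_const 1)) fun a => by
        simp only
        nlinarith [sq_nonneg (‖(sfl ε h μ t a).2‖ - 1)]
    rw [integral_add hVt (integrable_const 1)] at i1
    have i2 : ∫ z, ‖(sfl ε h μ t z).2‖ ^ 2 ∂μ ≤ e₀ + η :=
      (integral_sq_le_en hd ε _ _).trans hent
    simp only [integral_const, smul_eq_mul, mul_one, ← hM] at i1
    linarith
  set k := ⌊t / h⌋₊ with hk
  have ht1 : k * h ≤ t := by
    rw [← le_div_iff₀ hh]; exact Nat.floor_le (div_nonneg ht.1 hh.le)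
  have ht2 : t ≤ (k + 1) * h := by
    rw [← div_le_iff₀ hh]; exact (Nat.lt_floor_add_one _).le
  have hτ0 : 0 ≤ t - k * h := by linarith
  have hτ1 : t - k * h ≤ h := by linarith
  set τ := t - k * h with hτ
  have hGm := (iter ε h μ k).measurable
  have hX : ∀ a, (sfl ε h μ t a).1 = (iter ε h μ k a).1 + τ • (sfl ε h μ t a).2 := fun a => rfl
  have hV' : ∀ a, (sfl ε h μ t a).2 = (iter ε h μ k a).2
      + τ • fld d ε (μ.map (iter ε h μ k)) (iter ε h μ k a).1 := fun a => rfl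
  set E := fld d ε (μ.map (iter ε h μ k)) with hE
  set E' := fld d ε (μ.map (sfl ε h μ t)) with hE'
  have hmass : (μ.map (iter ε h μ k)).real univ = M := by
    rw [measureReal_def, Measure.map_apply hGm MeasurableSet.univ, preimage_univ, hM,
      measureReal_def]
  set V := (sfl ε h μ t z).2 with hVdef
  have hEE : ‖E (iter ε h μ k z).1‖ ≤ Eb := by
    have := norm_fld_le (by omega : 1 ≤ d) hε (μ.map (iter ε h μ k)) (iter ε h μ k z).1
    rwa [hmass] at this
  have b1 : ‖E (iter ε h μ k z).1 - E (sfl ε h μ t z).1‖ ≤ cdim d * (L * M) * (h * ‖V‖) := by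
    have := norm_fld_sub_le (by omega : 1 ≤ d) hε (μ.map (iter ε h μ k)) (iter ε h μ k z).1
      (sfl ε h μ t z).1
    rw [hmass] at this
    refine this.trans ?_
    gcongr
    rw [hX z, ← norm_neg, neg_sub, add_sub_cancel_left, norm_smul, norm_of_nonneg hτ0]
    gcongr
  have b2 : ‖E (sfl ε h μ t z).1 - E' (sfl ε h μ t z).1‖
      ≤ cdim d * (L * (h * (e₀ + η + M))) := by
    have := norm_fld_map_sub_le (by omega : 1 ≤ d) hε hGm hZm (hVi.const_mul h) (fun a => by
      rw [hX a, ← norm_neg, neg_sub, add_sub_cancel_left, norm_smul, norm_of_nonneg hτ0]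
      gcongr) (sfl ε h μ t z).1
    refine this.trans ?_
    rw [integral_const_mul]
    gcongr
  have hKs : h * Eb + h * (cdim d * (L * M)) + h * (cdim d * (L * (e₀ + η + M))) ≤ η := by
    rw [hK] at h3; linarith
  have n1 : 0 ≤ h * Eb := by positivity
  have n2 : 0 ≤ h * (cdim d * (L * M)) := by positivity
  have n3 : 0 ≤ h * (cdim d * (L * (e₀ + η + M))) := by positivity
  have nV := norm_nonneg V
  rw [Prod.norm_def]
  refine max_le ?_ ?_
  · have e : (svel ε h μ k t z - (V, E' (sfl ε h μ t z).1)).1 = τ • E (iter ε h μ k z).1 := by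
      simp only [svel, Prod.fst_sub, ← hE, hVdef, hV' z, ← hτ]
      rw [mul_smul, two_smul]; abel
    rw [e, norm_smul, norm_of_nonneg hτ0]
    have : τ * ‖E (iter ε h μ k z).1‖ ≤ h * Eb := by gcongr
    nlinarith
  · have e : (svel ε h μ k t z - (V, E' (sfl ε h μ t z).1)).2 =
        (E (iter ε h μ k z).1 - E (sfl ε h μ t z).1) +
        (E (sfl ε h μ t z).1 - E' (sfl ε h μ t z).1) := by
      simp only [svel, Prod.snd_sub, ← hE]; abel
    rw [e]
    refine (norm_add_le _ _).trans ((add_le_add b1 b2).trans ?_)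
    have q1 : h * (cdim d * (L * M)) * ‖V‖ ≤ η * ‖V‖ := by gcongr; linarith
    have q2 : h * (cdim d * (L * (e₀ + η + M))) ≤ η := by linarith
    linarith

end VP

namespace VP

/-! ### Setwise limits along an ultrafilter -/

section Setwise

variable {α β : Type} [MeasurableSpace α] [MeasurableSpace β] {m : Measure α}

/-- Setwise convergence of the image measures of `m` under the maps `Z n`. -/
def SetLim (𝒰 : Filter ℕ) (m : Measure α) (Z : ℕ → α → β) (ν : Measure β) : Prop :=
  ∀ A, MeasurableSet A → Tendsto (fun n => m (Z n ⁻¹' A)) 𝒰 (𝓝 (ν A))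

lemma exists_setLim (𝒰 : Ultrafilter ℕ) [IsFiniteMeasure m] {Z : ℕ → α → β}
    (hZ : ∀ n, Measurable (Z n))
    (hc : ∀ s : ℕ → Set β, (∀ i, MeasurableSet (s i)) → Antitone s → ⋂ i, s i = ∅ →
      ∀ θ > 0, ∃ i, ∀ᶠ n in (𝒰 : Filter ℕ), m (Z n ⁻¹' s i) ≤ θ) :
    ∃ ν : Measure β, IsFiniteMeasure ν ∧ SetLim 𝒰 m Z ν := by
  have hex : ∀ A : Set β, ∃ l : ℝ≥0∞, Tendsto (fun n => m (Z n ⁻¹' A)) 𝒰 (𝓝 l) := by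
    intro A
    obtain ⟨l, -, hl⟩ := isCompact_univ.ultrafilter_le_nhds (𝒰.map fun n => m (Z n ⁻¹' A)) (by simp)
    exact ⟨l, hl⟩
  choose l hl using hex
  have hdisj : ∀ A B : Set β, MeasurableSet A → MeasurableSet B → Disjoint A B →
      l (A ∪ B) = l A + l B := by
    intro A B hA hB hAB
    refine tendsto_nhds_unique (hl (A ∪ B)) (((hl A).add (hl B)).congr fun n => ?_)
    rw [preimage_union, measure_union (hAB.preimage _) (hZ n hB)]
  have hempty : l ∅ = 0 := tendsto_nhds_unique (hl ∅) (by simp)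
  have hle : ∀ A, l A ≤ m univ := fun A =>
    le_of_tendsto (hl A) (.of_forall fun n => measure_mono (subset_univ _))
  have hsum : ∀ s : ℕ → Set β, (∀ i, MeasurableSet (s i)) → Pairwise (Function.onFun Disjoint s) →
      l (⋃ i, s i) = ∑' i, l (s i) := by
    intro s hs hd
    have hfin : ∀ N : ℕ, l (⋃ i ∈ Finset.range N, s i) = ∑ i ∈ Finset.range N, l (s i) := by
      intro N
      induction N with
      | zero => simpa using hempty
      | succ N ih =>
        rw [Finset.sum_range_succ, ← ih, Finset.range_add_one, Finset.set_biUnion_insert, union_comm]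
        refine hdisj _ _ (Finset.measurableSet_biUnion _ fun i _ => hs i) (hs N) ?_
        rw [disjoint_iUnion₂_left]
        intro i hi
        exact hd (by simp at hi; omega)
    have htail : Tendsto (fun N => l (⋃ i, s (i + N))) atTop (𝓝 0) := by
      refine ENNReal.tendsto_nhds_zero.2 fun θ hθ => ?_
      obtain ⟨i, hi⟩ := hc (fun N => ⋃ i, s (i + N)) (fun N => MeasurableSet.iUnion fun i => hs _)
        (antitone_nat_of_succ_le fun N => iUnion_subset fun i =>
          (by simpa only [add_assoc, add_comm 1 N] using subset_iUnion (fun i => s (i + N)) (i + 1)))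
        (by
          by_contra hne
          obtain ⟨x, hx⟩ := nonempty_iff_ne_empty.2 hne
          simp only [mem_iInter, mem_iUnion] at hx
          obtain ⟨i0, h0⟩ := hx 0
          obtain ⟨i1, h1⟩ := hx (i0 + 1)
          exact (hd (show i0 + 0 ≠ i1 + (i0 + 1) by omega)).le_bot ⟨h0, h1⟩) θ hθ
      refine eventually_atTop.2 ⟨i, fun N hN => le_of_tendsto (hl _) ?_⟩
      filter_upwards [hi] with n hn
      refine le_trans (measure_mono (preimage_mono ?_)) hn
      refine iUnion_subset fun j => ?_
      have : j + N = (j + (N - i)) + i := by omega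
      rw [this]
      exact subset_iUnion (fun j => s (j + i)) _
    have h1 : ∀ N : ℕ, l (⋃ i, s i) = (∑ i ∈ Finset.range N, l (s i)) + l (⋃ i, s (i + N)) := by
      intro N
      rw [← hfin, ← hdisj _ _ (Finset.measurableSet_biUnion _ fun i _ => hs i)
        (MeasurableSet.iUnion fun i => hs _)]
      · congr 1
        ext x
        simp only [mem_iUnion, mem_union, Finset.mem_range, exists_prop]
        constructor
        · rintro ⟨i, hi⟩
          rcases lt_or_ge i N with h | h
          · exact Or.inl ⟨i, h, hi⟩
          · exact Or.inr ⟨i - N, by rwa [Nat.sub_add_cancel h]⟩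
        · rintro (⟨i, -, hi⟩ | ⟨i, hi⟩)
          · exact ⟨i, hi⟩
          · exact ⟨_, hi⟩
      · rw [disjoint_iUnion₂_left]
        intro i hi
        rw [disjoint_iUnion_right]
        intro j
        exact hd (by simp at hi; omega)
    have h2 : Tendsto (fun N => (∑ i ∈ Finset.range N, l (s i)) + l (⋃ i, s (i + N))) atTop
        (𝓝 ((∑' i, l (s i)) + 0)) := (ENNReal.tendsto_nat_tsum _).add htail
    rw [add_zero] at h2
    exact tendsto_nhds_unique (tendsto_const_nhds.congr h1) h2
  refine ⟨Measure.ofMeasurable (fun A _ => l A) hempty (fun s hs hd => hsum s hs hd), ⟨?_⟩, ?_⟩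
  · rw [Measure.ofMeasurable_apply _ MeasurableSet.univ]
    exact (hle _).trans_lt (measure_lt_top _ _)
  · intro A hA
    rw [Measure.ofMeasurable_apply _ hA]
    exact hl A

lemma SetLim.integral [IsFiniteMeasure m] {𝒰 : Filter ℕ} {Z : ℕ → α → β} {ν : Measure β}
    [IsFiniteMeasure ν] (h : SetLim 𝒰 m Z ν) (hZ : ∀ n, Measurable (Z n)) {χ : β → ℝ}
    (hχ : Measurable χ) {C : ℝ} (hC : ∀ z, |χ z| ≤ C) :
    Tendsto (fun n => ∫ a, χ (Z n a) ∂m) 𝒰 (𝓝 (∫ z, χ z ∂ν)) := by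
  have hstep : ∀ N : ℕ, 0 < N → ∃ g : β → ℝ, Measurable g ∧ (∀ z, |χ z - g z| ≤ 1 / N) ∧
      Tendsto (fun n => ∫ a, g (Z n a) ∂m) 𝒰 (𝓝 (∫ z, g z ∂ν)) := by
    intro N hN
    have hN' : (0 : ℝ) < N := by exact_mod_cast hN
    set K : ℤ := ⌈N * C⌉ + 1 with hK
    set s : ℤ → Set β := fun j => {z | ⌊N * χ z⌋ = j} with hs
    have hsm : ∀ j, MeasurableSet (s j) := fun j =>
      (measurable_const.mul hχ).floor (measurableSet_singleton j)
    set g : β → ℝ := fun z => ∑ j ∈ Finset.Icc (-K) K, (s j).indicator (fun _ => (j : ℝ) / N) z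
      with hg
    have hgv : ∀ z, g z = (⌊N * χ z⌋ : ℝ) / N := by
      intro z
      have hz := abs_le.1 (hC z)
      have h1 : ⌊N * χ z⌋ ∈ Finset.Icc (-K) K := by
        rw [Finset.mem_Icc]
        have h3 := Int.le_ceil (N * C)
        constructor
        · rw [Int.le_floor, hK]; push_cast
          nlinarith
        · have h4 := Int.floor_le (N * χ z)
          have : (⌊N * χ z⌋ : ℝ) ≤ K := by rw [hK]; push_cast; nlinarith
          exact_mod_cast this
      simp only [hg]
      rw [Finset.sum_eq_single_of_mem _ h1]
      · rw [indicator_of_mem]; rfl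
      · intro j _ hj
        rw [indicator_of_notMem]
        exact fun hh => hj hh.symm
    have hItg : ∀ (γ : Type) [MeasurableSpace γ] (m' : Measure γ) [IsFiniteMeasure m'] (W : γ → β),
        Measurable W → ∫ a, g (W a) ∂m' =
          ∑ j ∈ Finset.Icc (-K) K, (m' (W ⁻¹' s j)).toReal * ((j : ℝ) / N) := by
      intro γ _ m' _ W hW
      simp only [hg]
      have e : ∀ (j : ℤ) (a : γ), (s j).indicator (fun _ => (j : ℝ) / N) (W a) =
        (W ⁻¹' s j).indicator (fun _ => (j : ℝ) / N) a := fun j a => rfl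
      rw [integral_finsetSum]
      · refine Finset.sum_congr rfl fun j _ => ?_
        simp only [e]
        rw [integral_indicator_const _ (hW (hsm j)), smul_eq_mul, measureReal_def]
      · intro j _
        simp only [e]
        exact (integrable_const _).indicator (hW (hsm j))
    refine ⟨g, ?_, fun z => ?_, ?_⟩
    · exact Finset.measurable_fun_sum _ fun j _ => measurable_const.indicator (hsm j)
    · rw [hgv, abs_le]
      have h1 := Int.floor_le (N * χ z)
      have h2 := Int.lt_floor_add_one (N * χ z)
      constructor
      · have : (⌊N * χ z⌋ : ℝ) / N ≤ χ z := by rw [div_le_iff₀ hN']; linarith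
        have : 0 ≤ 1 / (N : ℝ) := by positivity
        linarith
      · have : χ z ≤ (⌊N * χ z⌋ + 1 : ℝ) / N := by rw [le_div_iff₀ hN']; linarith
        rw [add_div] at this; linarith
    · have e := hItg β ν id measurable_id
      simp only [id] at e
      rw [e]
      simp only [hItg α m (Z _) (hZ _)]
      refine tendsto_finsetSum _ fun j _ => Tendsto.mul_const _ ?_
      exact (ENNReal.tendsto_toReal (measure_ne_top _ _)).comp (h _ (hsm j))
  rw [Metric.tendsto_nhds]
  intro θ hθ
  obtain ⟨N, hN⟩ := exists_nat_gt ((m.real univ + ν.real univ + 1) / (θ / 2))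
  have hN0 : 0 < N := by
    rcases Nat.eq_zero_or_pos N with h0 | h0
    · subst h0
      have : 0 ≤ (m.real univ + ν.real univ + 1) / (θ / 2) := by positivity
      simp at hN; linarith
    · exact h0
  have hN' : (0 : ℝ) < N := by exact_mod_cast hN0
  obtain ⟨g, hgm, hg, hgl⟩ := hstep N hN0
  have hb : ∀ (γ : Type) [MeasurableSpace γ] (m' : Measure γ) [IsFiniteMeasure m'] (W : γ → β),
      Measurable W → |∫ a, χ (W a) ∂m' - ∫ a, g (W a) ∂m'| ≤ 1 / N * m'.real univ := by
    intro γ _ m' _ W hW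
    have hgb : ∀ z, |g z| ≤ C + 1 / N := fun z => by
      have h1 := abs_le.1 (hg z)
      have h2 := abs_le.1 (hC z)
      rw [abs_le]; constructor <;> linarith
    rw [← integral_sub]
    · rw [← norm_eq_abs]
      exact norm_integral_le_of_norm_le_const (.of_forall fun a => hg _)
    · exact Integrable.of_bound (hχ.comp hW).aestronglyMeasurable C
        (.of_forall fun a => hC _)
    · exact Integrable.of_bound (hgm.comp hW).aestronglyMeasurable _
        (.of_forall fun a => hgb _)
  have h1 : (m.real univ + ν.real univ) * (1 / N) < θ / 2 := by
    rw [div_lt_iff₀ (by positivity)] at hN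
    rw [mul_one_div, div_lt_iff₀ hN']
    linarith
  filter_upwards [Metric.tendsto_nhds.1 hgl (θ / 2) (by positivity)] with n hn
  have h2 := hb α m (Z n) (hZ n)
  have h3 := hb β ν id measurable_id
  rw [Real.dist_eq] at hn ⊢
  simp only [id] at h3
  rw [abs_le] at h2 h3
  rw [abs_lt] at hn ⊢
  constructor <;> linarith

end Setwise

end VP

namespace VP

variable {d : ℕ}

/-! ### Uniform estimates for approximate flows -/

/-- A bound for the displacement of approximate flows. -/
def velBound (μ : Measure (PS d)) (e₀ : ℝ) : ℝ≥0∞ :=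
  2 * (ofReal (e₀ + 1) + μ univ) + μ univ

lemma velBound_ne_top (μ : Measure (PS d)) [IsFiniteMeasure μ] (e₀ : ℝ) : velBound μ e₀ ≠ ⊤ := by
  unfold velBound
  finiteness

namespace AFlow

variable {μ : Measure (PS d)} {e₀ ε η T : ℝ} (F : AFlow d μ e₀ ε η T)

lemma sq_le (hd : 3 ≤ d) (hη1 : η ≤ 1) {t : ℝ} (ht : t ∈ Icc 0 T) :
    ∫ z, ‖(F.Z t z).2‖ ^ 2 ∂μ ≤ e₀ + 1 :=
  ((integral_sq_le_en hd ε _ _).trans (F.en_le t ht)).trans (by linarith)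

lemma lintegral_sq_le (hd : 3 ≤ d) (hη1 : η ≤ 1) {t : ℝ} (ht : t ∈ Icc 0 T) :
    ∫⁻ z, ‖(F.Z t z).2‖ₑ ^ 2 ∂μ ≤ ofReal (e₀ + 1) := by
  refine le_trans (le_of_eq ?_) (ofReal_le_ofReal (F.sq_le hd hη1 ht))
  rw [ofReal_integral_eq_lintegral_ofReal (F.sq t ht) (.of_forall fun z => by positivity)]
  refine lintegral_congr fun z => ?_
  rw [ENNReal.ofReal_pow (norm_nonneg _), ofReal_norm]

lemma lintegral_vel_le (hd : 3 ≤ d) (hη1 : η ≤ 1) {t : ℝ} (ht : t ∈ Icc 0 T) :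
    ∫⁻ z, ‖(F.Z t z).2‖ₑ ∂μ ≤ ofReal (e₀ + 1) + μ univ := by
  calc ∫⁻ z, ‖(F.Z t z).2‖ₑ ∂μ ≤ ∫⁻ z, (‖(F.Z t z).2‖ₑ ^ 2 + 1) ∂μ := by
        refine lintegral_mono fun z => ?_
        rcases le_total (‖(F.Z t z).2‖ₑ) 1 with h | h
        · exact h.trans le_add_self
        · exact (le_self_pow₀ h two_ne_zero).trans le_self_add
    _ = (∫⁻ z, ‖(F.Z t z).2‖ₑ ^ 2 ∂μ) + μ univ := by
        rw [lintegral_add_right _ measurable_const]; simp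
    _ ≤ _ := by gcongr; exact F.lintegral_sq_le hd hη1 ht

lemma norm_B_fst_le (hη1 : η ≤ 1) {t : ℝ} (ht : t ∈ Icc 0 T) (z : PS d) :
    ‖(F.B t z).1‖ ≤ 2 * ‖(F.Z t z).2‖ + 1 := by
  have h := (norm_fst_le _).trans (F.close t ht z)
  have h2 := norm_sub_norm_le (F.B t z).1 (F.Z t z).2
  simp only [Prod.fst_sub] at h
  nlinarith [norm_nonneg (F.Z t z).2]

lemma intervalIntegrable {s t : ℝ} (hs : 0 ≤ s) (ht : 0 ≤ t) (z : PS d) :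
    IntervalIntegrable (fun r => F.B r z) volume s t :=
  (F.intB z s hs).symm.trans (F.intB z t ht)

lemma sub_eq {s t : ℝ} (hs : 0 ≤ s) (ht : 0 ≤ t) (z : PS d) :
    F.Z t z - F.Z s z = ∫ r in s..t, F.B r z := by
  rw [F.ftc t ht, F.ftc s hs, add_sub_add_left_eq_sub,
    intervalIntegral.integral_interval_sub_left (F.intB z t ht) (F.intB z s hs)]

lemma continuousOn (z : PS d) : ContinuousOn (fun t => F.Z t z) (Ici 0) := by
  intro s hs
  have h : ContinuousOn (fun t => ∫ r in (0 : ℝ)..t, F.B r z) (uIcc 0 (s + 1)) :=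
    intervalIntegral.continuousOn_primitive_interval'
      (F.intB z (s + 1) (add_nonneg hs zero_le_one)) (by simp)
  have hs0 : (0 : ℝ) ≤ s := hs
  have h2 : ContinuousOn (fun t => F.Z t z) (Icc 0 (s + 1)) := by
    rw [uIcc_of_le (by linarith)] at h
    refine (continuousOn_const.add h).congr fun t ht => F.ftc t ht.1 z
  refine (h2 s ⟨hs, by linarith⟩).mono_of_mem_nhdsWithin ?_
  refine mem_of_superset (inter_mem_nhdsWithin (Ici 0) (Iio_mem_nhds (by linarith : s < s + 1))) ?_
  rintro x ⟨hx1, hx2⟩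
  exact ⟨hx1, le_of_lt hx2⟩

lemma lintegral_fst_sub_le [SFinite μ] (hd : 3 ≤ d) (hη1 : η ≤ 1) {s t : ℝ} (hs : 0 ≤ s) (hst : s ≤ t)
    (ht : t ≤ T) :
    ∫⁻ z, ‖(F.Z t z).1 - (F.Z s z).1‖ₑ ∂μ ≤ velBound μ e₀ * ofReal (t - s) := by
  have hBm : Measurable fun p : PS d × ℝ => ‖(F.B p.2 p.1).1‖ₑ :=
    (F.measB.comp (by fun_prop : Measurable fun p : PS d × ℝ => (p.2, p.1))).fst.enorm
  have h1 : ∀ z, ‖(F.Z t z).1 - (F.Z s z).1‖ₑ ≤ ∫⁻ r in Ioc s t, ‖(F.B r z).1‖ₑ := by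
    intro z
    have h := F.sub_eq hs (hs.trans hst) z
    rw [intervalIntegral.integral_of_le hst] at h
    have h2 := congrArg Prod.fst h
    rw [fst_integral ((intervalIntegrable_iff_integrableOn_Ioc_of_le hst).1
      (F.intervalIntegrable hs (hs.trans hst) z))] at h2
    rw [← Prod.fst_sub, h2]
    exact enorm_integral_le_lintegral_enorm _
  calc ∫⁻ z, ‖(F.Z t z).1 - (F.Z s z).1‖ₑ ∂μ
      ≤ ∫⁻ z, ∫⁻ r in Ioc s t, ‖(F.B r z).1‖ₑ ∂volume ∂μ := lintegral_mono h1
    _ = ∫⁻ r in Ioc s t, ∫⁻ z, ‖(F.B r z).1‖ₑ ∂μ := lintegral_lintegral_swap hBm.aemeasurable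
    _ ≤ ∫⁻ r in Ioc s t, velBound μ e₀ := by
        refine setLIntegral_mono measurable_const fun r hr => ?_
        have hr' : r ∈ Icc 0 T := ⟨hs.trans hr.1.le, hr.2.trans ht⟩
        calc ∫⁻ z, ‖(F.B r z).1‖ₑ ∂μ ≤ ∫⁻ z, (2 * ‖(F.Z r z).2‖ₑ + 1) ∂μ := by
              refine lintegral_mono fun z => ?_
              rw [← ofReal_norm, ← ofReal_norm]
              refine (ofReal_le_ofReal (F.norm_B_fst_le hη1 hr' z)).trans (le_of_eq ?_)
              rw [ofReal_add (by positivity) zero_le_one,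
                ofReal_mul zero_le_two]
              simp
          _ = 2 * (∫⁻ z, ‖(F.Z r z).2‖ₑ ∂μ) + μ univ := by
              rw [lintegral_add_right _ measurable_const, lintegral_const_mul' _ _ (by simp)]; simp
          _ ≤ _ := by
              unfold velBound
              gcongr
              exact F.lintegral_vel_le hd hη1 hr'
    _ = _ := by rw [setLIntegral_const, Real.volume_Ioc]

lemma lintegral_fst_sub_abs_le [SFinite μ] (hd : 3 ≤ d) (hη1 : η ≤ 1) {s t : ℝ} (hs : s ∈ Icc 0 T)
    (ht : t ∈ Icc 0 T) :
    ∫⁻ z, ‖(F.Z t z).1 - (F.Z s z).1‖ₑ ∂μ ≤ velBound μ e₀ * ofReal |t - s| := by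
  rcases le_total s t with h | h
  · rw [abs_of_nonneg (by linarith)]
    exact F.lintegral_fst_sub_le hd hη1 hs.1 h ht.2
  · rw [abs_of_nonpos (by linarith), neg_sub]
    refine le_trans (le_of_eq (lintegral_congr fun z => ?_))
      (F.lintegral_fst_sub_le hd hη1 ht.1 h hs.2)
    rw [← enorm_neg, neg_sub]

lemma measure_norm_le [SFinite μ] (hd : 3 ≤ d) (hη1 : η ≤ 1) {t T' : ℝ} (ht : t ∈ Icc 0 T) (hT' : t ≤ T')
    {R : ℝ} (hR : 0 < R) :
    μ {z | R ≤ ‖F.Z t z‖} ≤ (ofReal (e₀ + 1) + μ univ) / ofReal R +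
      (velBound μ e₀ * ofReal T' / ofReal (R / 2) + μ {z | R / 2 ≤ ‖z.1‖}) := by
  have hZ := (F.Z t).measurable
  have hsub : {z | R ≤ ‖F.Z t z‖} ⊆ {z | ofReal R ≤ ‖(F.Z t z).2‖ₑ} ∪
      ({z | ofReal (R / 2) ≤ ‖(F.Z t z).1 - (F.Z 0 z).1‖ₑ} ∪ {z | R / 2 ≤ ‖z.1‖}) := by
    intro z hz
    simp only [mem_ofPred_eq, mem_union, ← ofReal_norm] at hz ⊢
    rw [ENNReal.ofReal_le_ofReal_iff (norm_nonneg _), ENNReal.ofReal_le_ofReal_iff (norm_nonneg _),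
      F.zero]
    by_contra hc
    push Not at hc
    rw [Prod.norm_def, le_max_iff] at hz
    rcases hz with hz | hz
    · have := norm_add_le ((F.Z t z).1 - z.1) z.1
      rw [sub_add_cancel] at this
      linarith [hc.2.1, hc.2.2]
    · linarith [hc.1]
  refine (measure_mono hsub).trans ((measure_union_le _ _).trans (add_le_add ?_
    ((measure_union_le _ _).trans (add_le_add ?_ le_rfl))))
  · refine (meas_ge_le_lintegral_div (by fun_prop) (by simpa using hR) (by simp)).trans ?_
    gcongr
    exact F.lintegral_vel_le hd hη1 ht
  · have hZ0 := (F.Z 0).measurable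
    refine (meas_ge_le_lintegral_div (by fun_prop) (by simpa using hR) (by simp)).trans ?_
    gcongr
    refine (F.lintegral_fst_sub_le hd hη1 le_rfl ht.1 ht.2).trans ?_
    gcongr
    linarith

lemma norm_fld_sub_time_le [IsFiniteMeasure μ] (hd : 3 ≤ d) (hη1 : η ≤ 1) {ε' : ℝ} (hε' : 0 < ε') {s t : ℝ}
    (hs : s ∈ Icc 0 T) (ht : t ∈ Icc 0 T) (x : Ed d) :
    ‖fld d ε' (μ.map (F.Z t)) x - fld d ε' (μ.map (F.Z s)) x‖
      ≤ cdim d * ((d + 1) * (ε' ^ d)⁻¹ * ((velBound μ e₀).toReal * |t - s|)) := by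
  have hi := F.lintegral_fst_sub_abs_le hd hη1 hs ht
  have hZt := (F.Z t).measurable
  have hZs := (F.Z s).measurable
  have hfin : velBound μ e₀ * ofReal |t - s| ≠ ⊤ :=
    ENNReal.mul_ne_top (velBound_ne_top μ e₀) ofReal_ne_top
  have hItg : Integrable (fun z => ‖(F.Z t z).1 - (F.Z s z).1‖) μ := by
    refine ⟨by fun_prop, ?_⟩
    rw [hasFiniteIntegral_iff_enorm]
    simpa using hi.trans_lt hfin.lt_top
  refine (norm_fld_map_sub_le (by omega) hε' hZt hZs hItg (fun z => le_rfl) x).trans ?_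
  have hc := cdim_nonneg d
  gcongr
  rw [integral_norm_eq_lintegral_enorm (by fun_prop), ← ENNReal.toReal_ofReal (abs_nonneg (t - s)),
    ← ENNReal.toReal_mul]
  exact ENNReal.toReal_mono hfin hi

end AFlow

end VP

namespace VP

variable {d : ℕ}

/-! ### Limit measures and limit fields -/

/-- Regularization parameters. -/
def eps (n : ℕ) : ℝ := 1 / ((n : ℝ) + 1)

lemma eps_pos (n : ℕ) : 0 < eps n := Nat.one_div_pos_of_nat

lemma eps_le_one (n : ℕ) : eps n ≤ 1 := by
  unfold eps
  rw [div_le_one (by positivity)]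
  linarith [(Nat.cast_nonneg n : (0 : ℝ) ≤ n)]

/-- A sequence of approximate flows whose errors tend to zero. -/
abbrev AFlows (d : ℕ) (μ : Measure (PS d)) (e₀ : ℝ) := ∀ n : ℕ, AFlow d μ e₀ (eps n) (eps n) n

lemma tendsto_eps : Tendsto eps atTop (𝓝 0) := tendsto_one_div_add_atTop_nhds_zero_nat

/-- The ultrafilter along which limits are taken. -/
abbrev UF : Ultrafilter ℕ := hyperfilter ℕ

lemma UF_le : (UF : Filter ℕ) ≤ atTop := Nat.hyperfilter_le_atTop

lemma exists_measure_lt_of_ac {α : Type*} [MeasurableSpace α] {μ ν : Measure α} [SigmaFinite ν]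
    [IsFiniteMeasure μ] (h : μ ≪ ν) {θ : ℝ≥0∞} (hθ : θ ≠ 0) :
    ∃ δ > 0, ∀ A, MeasurableSet A → ν A < δ → μ A < θ := by
  have h1 : ∫⁻ z, μ.rnDeriv ν z ∂ν ≠ ⊤ := (Measure.lintegral_rnDeriv_lt_top μ ν).ne
  obtain ⟨δ, hδ, H⟩ := exists_pos_setLIntegral_lt_of_measure_lt h1 hθ
  refine ⟨δ, hδ, fun A hA hA2 => ?_⟩
  have := H A hA2
  rwa [← withDensity_apply _ hA, Measure.withDensity_rnDeriv_eq μ ν h] at this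

lemma exists_measure_norm_le {E : Type*} [NormedAddCommGroup E] [MeasurableSpace E] [BorelSpace E]
    (μ : Measure E) [IsFiniteMeasure μ] {θ : ℝ≥0∞} (hθ : θ ≠ 0) :
    ∃ R₀ : ℝ, ∀ R ≥ R₀, μ {z | R ≤ ‖z‖} ≤ θ := by
  have h : Tendsto (fun n : ℕ => μ {z : E | (n : ℝ) ≤ ‖z‖}) atTop
      (𝓝 (μ (⋂ n : ℕ, {z : E | (n : ℝ) ≤ ‖z‖}))) := by
    refine tendsto_measure_iInter_atTop (fun n => ?_) ?_ ⟨0, measure_ne_top _ _⟩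
    · exact (measurableSet_le measurable_const measurable_norm).nullMeasurableSet
    · intro i j hij z hz
      have : (i : ℝ) ≤ j := by exact_mod_cast hij
      exact this.trans hz
  have he : (⋂ n : ℕ, {z : E | (n : ℝ) ≤ ‖z‖}) = ∅ := by
    refine eq_empty_of_forall_notMem fun z hz => ?_
    obtain ⟨n, hn⟩ := exists_nat_gt ‖z‖
    exact absurd (mem_iInter.1 hz n) (not_le.2 hn)
  rw [he, measure_empty] at h
  obtain ⟨n, hn⟩ := ((ENNReal.tendsto_nhds_zero.1 h) θ (pos_iff_ne_zero.2 hθ)).exists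
  exact ⟨n, fun R hR => (measure_mono fun z hz => le_trans hR hz).trans hn⟩

section Seq

variable {μ : Measure (PS d)} [IsFiniteMeasure μ] {e₀ : ℝ}

lemma tight_seq (hd : 3 ≤ d) (F : AFlows d μ e₀) (T' : ℝ) {θ : ℝ≥0∞}
    (hθ : θ ≠ 0) :
    ∃ R₀ : ℝ, ∀ R ≥ R₀, ∀ n : ℕ, T' ≤ n → ∀ t ∈ Icc 0 T', μ {z | R ≤ ‖(F n).Z t z‖} ≤ θ := by
  have hθ3 : θ / 3 ≠ 0 := by simp [hθ]
  have hlim : ∀ c : ℝ≥0∞, c ≠ ⊤ → ∀ᶠ R : ℝ in atTop, c / ofReal R ≤ θ / 3 := by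
    intro c hc
    have h : Tendsto (fun R : ℝ => c / ofReal R) atTop (𝓝 (c / ⊤)) :=
      ENNReal.Tendsto.const_div ENNReal.tendsto_ofReal_atTop (Or.inr hc)
    rw [ENNReal.div_top] at h
    exact ENNReal.tendsto_nhds_zero.1 h _ (pos_iff_ne_zero.2 hθ3)
  have h1 := hlim (ofReal (e₀ + 1) + μ univ) (by finiteness)
  have h2 := (tendsto_id.atTop_div_const (two_pos : (0 : ℝ) < 2)).eventually
    (hlim (velBound μ e₀ * ofReal T')
      (ENNReal.mul_ne_top (velBound_ne_top μ e₀) ofReal_ne_top))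
  obtain ⟨R₁, hR₁⟩ := exists_measure_norm_le μ hθ3
  obtain ⟨R₀, hR₀⟩ := eventually_atTop.1 (h1.and (h2.and (eventually_ge_atTop (max 1 (2 * R₁)))))
  refine ⟨R₀, fun R hR n hn t ht => ?_⟩
  obtain ⟨a1, a2, a3⟩ := hR₀ R hR
  have hR0 : 0 < R := lt_of_lt_of_le one_pos ((le_max_left _ _).trans a3)
  have hR2 : R₁ ≤ R / 2 := by linarith [(le_max_right _ _).trans a3]
  refine ((F n).measure_norm_le hd (eps_le_one n) ⟨ht.1, ht.2.trans hn⟩ ht.2 hR0).trans ?_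
  calc _ ≤ θ / 3 + (θ / 3 + θ / 3) := by
        refine add_le_add a1 (add_le_add a2 ((measure_mono ?_).trans (hR₁ (R / 2) hR2)))
        exact fun z (hz : R / 2 ≤ ‖z.1‖) => hz.trans (norm_fst_le z)
    _ = θ := by rw [← add_assoc, ENNReal.add_thirds]

lemma exists_lim (hd : 3 ≤ d) (hμ : μ ≪ volume) (F : AFlows d μ e₀)
    {m : Measure (PS d)} (hm : m ≤ μ) {t : ℝ} (ht : 0 ≤ t) :
    ∃ ν : Measure (PS d), IsFiniteMeasure ν ∧ SetLim UF m (fun n => (F n).Z t) ν := by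
  have : IsFiniteMeasure m := ⟨(hm univ).trans_lt (measure_lt_top _ _)⟩
  refine exists_setLim UF (fun n => ((F n).Z t).measurable) fun s hs hanti hemp θ hθ => ?_
  have hθ2 : θ / 2 ≠ 0 := by simp [hθ.ne']
  obtain ⟨R, hR⟩ := tight_seq hd F t hθ2
  obtain ⟨δ, hδ, H⟩ := exists_measure_lt_of_ac hμ hθ2
  have h1 : Tendsto (fun i => (volume : Measure (PS d)) (s i ∩ ball 0 R)) atTop
      (𝓝 (volume (⋂ i, s i ∩ ball 0 R))) := by
    refine tendsto_measure_iInter_atTop (fun i => ((hs i).inter measurableSet_ball).nullMeasurableSet)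
      (fun i j hij => inter_subset_inter_left _ (hanti hij)) ⟨0, ?_⟩
    exact ((measure_mono inter_subset_right).trans_lt measure_ball_lt_top).ne
  rw [← iInter_inter, hemp, empty_inter, measure_empty] at h1
  obtain ⟨i, hi⟩ := (h1.eventually (gt_mem_nhds hδ)).exists
  refine ⟨i, ?_⟩
  filter_upwards [UF_le (eventually_ge_atTop ⌈t⌉₊)] with n hn
  have hn' : t ≤ n := (Nat.le_ceil t).trans (by exact_mod_cast hn)
  have hsub : (F n).Z t ⁻¹' s i ⊆ (F n).Z t ⁻¹' (s i ∩ ball 0 R) ∪ {z | R ≤ ‖(F n).Z t z‖} := by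
    intro z hz
    by_cases h : R ≤ ‖(F n).Z t z‖
    · exact Or.inr h
    · exact Or.inl ⟨hz, by simpa using h⟩
  calc m ((F n).Z t ⁻¹' s i) ≤ μ ((F n).Z t ⁻¹' s i) := hm _
    _ ≤ μ ((F n).Z t ⁻¹' (s i ∩ ball 0 R)) + μ {z | R ≤ ‖(F n).Z t z‖} :=
        (measure_mono hsub).trans (measure_union_le _ _)
    _ ≤ θ / 2 + θ / 2 := by
        gcongr
        · refine (H _ (((F n).Z t).measurable ((hs i).inter measurableSet_ball)) ?_).le
          rwa [((F n).mp t).measure_preimage ((hs i).inter measurableSet_ball).nullMeasurableSet]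
        · exact hR R le_rfl n hn' t ⟨ht, le_rfl⟩
    _ = θ := ENNReal.add_halves θ

open Classical in
/-- The setwise limit of the transported measures. -/
def nu (F : AFlows d μ e₀) (m : Measure (PS d)) (t : ℝ) :
    Measure (PS d) :=
  if h : ∃ ν : Measure (PS d), IsFiniteMeasure ν ∧ SetLim UF m (fun n => (F n).Z t) ν then h.choose
  else 0

instance (F : AFlows d μ e₀) (m : Measure (PS d)) (t : ℝ) :
    IsFiniteMeasure (nu F m t) := by
  unfold nu
  split_ifs with h
  · exact h.choose_spec.1
  · infer_instance

lemma setLim_nu (hd : 3 ≤ d) (hμ : μ ≪ volume) (F : AFlows d μ e₀)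
    {m : Measure (PS d)} (hm : m ≤ μ) {t : ℝ} (ht : 0 ≤ t) :
    SetLim UF m (fun n => (F n).Z t) (nu F m t) := by
  have h := exists_lim hd hμ F hm ht
  rw [nu, dif_pos h]
  exact h.choose_spec.2

lemma nu_univ (hd : 3 ≤ d) (hμ : μ ≪ volume) (F : AFlows d μ e₀)
    {m : Measure (PS d)} (hm : m ≤ μ) {t : ℝ} (ht : 0 ≤ t) : nu F m t univ = m univ :=
  tendsto_nhds_unique (setLim_nu hd hμ F hm ht univ MeasurableSet.univ) (by simp)

lemma nu_le_smul (hd : 3 ≤ d) (hμ : μ ≪ volume) (F : AFlows d μ e₀)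
    {m : Measure (PS d)} (hm : m ≤ μ) {t : ℝ} (ht : 0 ≤ t)
    {k : ℝ≥0∞} (hk : m ≤ k • volume) : nu F m t ≤ k • volume := by
  refine Measure.le_iff.2 fun A hA => le_of_tendsto (setLim_nu hd hμ F hm ht A hA)
    (.of_forall fun n => (hk _).trans_eq ?_)
  rw [Measure.smul_apply, Measure.smul_apply, ((F n).mp t).measure_preimage hA.nullMeasurableSet]

lemma nu_mono (hd : 3 ≤ d) (hμ : μ ≪ volume) (F : AFlows d μ e₀)
    {m m' : Measure (PS d)} (hm : m ≤ μ) {t : ℝ} (ht : 0 ≤ t) (h : m' ≤ m) : nu F m' t ≤ nu F m t :=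
  Measure.le_iff.2 fun A hA => le_of_tendsto_of_tendsto'
    (setLim_nu hd hμ F (h.trans hm) ht A hA) (setLim_nu hd hμ F hm ht A hA) fun _ => h _

lemma nu_ac (hd : 3 ≤ d) (hμ : μ ≪ volume) (F : AFlows d μ e₀)
    {m : Measure (PS d)} (hm : m ≤ μ) {t : ℝ} (ht : 0 ≤ t) : nu F m t ≪ volume := by
  refine Measure.AbsolutelyContinuous.mk fun A hA hA0 => ?_
  refine tendsto_nhds_unique (setLim_nu hd hμ F hm ht A hA) (tendsto_const_nhds.congr fun n => ?_)
  refine (le_antisymm ((hm _).trans_eq (hμ ?_)) bot_le).symm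
  rwa [((F n).mp t).measure_preimage hA.nullMeasurableSet]

lemma tendsto_integral_nu (hd : 3 ≤ d) (hμ : μ ≪ volume) (F : AFlows d μ e₀)
    {m : Measure (PS d)} (hm : m ≤ μ) {t : ℝ} (ht : 0 ≤ t)
    {G : Type} [NormedAddCommGroup G] [NormedSpace ℝ G] [FiniteDimensional ℝ G]
    [MeasurableSpace G] [BorelSpace G] {χ : PS d → G} (hχ : Measurable χ) {C : ℝ} (hC : ∀ z, ‖χ z‖ ≤ C) :
    Tendsto (fun n => ∫ a, χ ((F n).Z t a) ∂m) UF (𝓝 (∫ z, χ z ∂(nu F m t))) := by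
  have : IsFiniteMeasure m := ⟨(hm univ).trans_lt (measure_lt_top _ _)⟩
  have h := setLim_nu hd hμ F hm ht
  have hItg : ∀ (m' : Measure (PS d)) [IsFiniteMeasure m'] (W : PS d → PS d), Measurable W →
      Integrable (fun a => χ (W a)) m' := fun m' _ W hW =>
    Integrable.of_bound (hχ.comp hW).aestronglyMeasurable C (.of_forall fun a => hC _)
  let b := Module.finBasis ℝ G
  have hrepr : ∀ x : G, x = ∑ i, (b.coord i).toContinuousLinearMap x • b i := fun x => by
    simp [b.sum_repr]
  have key : ∀ (m' : Measure (PS d)) [IsFiniteMeasure m'] (W : PS d → PS d), Measurable W →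
      ∫ a, χ (W a) ∂m' = ∑ i, (∫ a, (b.coord i).toContinuousLinearMap (χ (W a)) ∂m') • b i := by
    intro m' _ W hW
    conv_lhs => rw [hrepr (∫ a, χ (W a) ∂m')]
    refine Finset.sum_congr rfl fun i _ => ?_
    rw [ContinuousLinearMap.integral_comp_comm _ (hItg m' W hW)]
  have e := key (nu F m t) id measurable_id
  simp only [id] at e
  rw [e]
  simp only [key m _ ((F _).Z t).measurable]
  refine tendsto_finsetSum _ fun i _ => Tendsto.smul_const ?_ _
  refine h.integral (fun n => ((F n).Z t).measurable)
    ((b.coord i).toContinuousLinearMap.continuous.measurable.comp hχ)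
    (C := ‖(b.coord i).toContinuousLinearMap‖ * C) fun z => ?_
  exact ((b.coord i).toContinuousLinearMap.le_opNorm _).trans (by gcongr; exact hC z)

end Seq

end VP

namespace VP

variable {d : ℕ}

/-! ### Convergence of the fields -/

lemma ae_integrable_rk (hd : 1 ≤ d) {ε : ℝ} (hε : 0 ≤ ε) (ν : Measure (PS d)) [IsFiniteMeasure ν] :
    ∀ᵐ x : Ed d, Integrable (fun w : PS d => rk d ε (x - w.1)) ν := by
  have hk : Measurable (kern d) := measurable_kern
  have hm : Measurable fun p : Ed d × PS d => ofReal ‖kern d (p.1 - p.2.1)‖ := by fun_prop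
  have h : ∀ N : ℕ, ∀ᵐ x : Ed d, x ∈ ball (0 : Ed d) N →
      ∫⁻ w : PS d, ofReal ‖kern d (x - w.1)‖ ∂ν < ⊤ := by
    intro N
    rw [← ae_restrict_iff' measurableSet_ball]
    refine ae_lt_top hm.lintegral_prod_right' (ne_of_lt ?_)
    rw [lintegral_lintegral_swap hm.aemeasurable]
    calc _ ≤ ∫⁻ _ : PS d, (sph d + volume (ball (0 : Ed d) N)) ∂ν :=
          lintegral_mono fun w => setLIntegral_kern_le hd _ _
      _ < ⊤ := by
          rw [lintegral_const]
          exact ENNReal.mul_lt_top (ENNReal.add_lt_top.2 ⟨(sph_ne_top d).lt_top, measure_ball_lt_top⟩)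
            (measure_lt_top _ _)
  filter_upwards [ae_all_iff.2 h] with x hx
  obtain ⟨N, hN⟩ := exists_nat_gt ‖x‖
  have h2 := hx N (by simpa using hN)
  refine ⟨((measurable_rk ε).comp (by fun_prop)).aestronglyMeasurable, ?_⟩
  refine lt_of_le_of_lt (lintegral_mono fun w => ?_) h2
  rw [← ofReal_norm]
  exact ofReal_le_ofReal (norm_rk_le_kern hε _)

lemma lintegral_fld_sub_le (hd : 1 ≤ d) {ε ε' : ℝ} (hε : 0 ≤ ε) (h : ε ≤ ε') (ν : Measure (PS d))
    [IsFiniteMeasure ν] (s : Set (Ed d)) :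
    ∫⁻ x in s, ‖fld d ε ν x - fld d ε' ν x‖ₑ ≤ ofReal (cdim d) *
      (ofReal √(d * ε') * (2 * sph d + volume s) * ν univ) := by
  have hk : Measurable (kern d) := measurable_kern
  have hr := measurable_rk (d := d) ε'
  have hm : Measurable fun p : Ed d × PS d =>
      ofReal ‖kern d (p.1 - p.2.1) - rk d ε' (p.1 - p.2.1)‖ := by fun_prop
  have hae : ∀ᵐ x : Ed d, ‖fld d ε ν x - fld d ε' ν x‖ₑ ≤ ofReal (cdim d) *
      ∫⁻ w : PS d, ofReal ‖kern d (x - w.1) - rk d ε' (x - w.1)‖ ∂ν := by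
    filter_upwards [ae_integrable_rk hd hε ν, ae_integrable_rk hd (hε.trans h) ν] with x h1 h2
    rw [fld, fld, ← smul_sub, ← integral_sub h1 h2, enorm_smul, ← ofReal_norm (cdim d),
      norm_of_nonneg (cdim_nonneg d)]
    gcongr
    refine (enorm_integral_le_lintegral_enorm _).trans (lintegral_mono fun w => ?_)
    rw [← ofReal_norm]
    exact ofReal_le_ofReal (norm_rk_sub_rk_le hε h _)
  calc _ ≤ ∫⁻ x in s, ofReal (cdim d) *
        ∫⁻ w : PS d, ofReal ‖kern d (x - w.1) - rk d ε' (x - w.1)‖ ∂ν :=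
        lintegral_mono_ae (ae_restrict_of_ae hae)
    _ = ofReal (cdim d) * ∫⁻ w : PS d, (∫⁻ x in s,
        ofReal ‖kern d (x - w.1) - rk d ε' (x - w.1)‖) ∂ν := by
        rw [lintegral_const_mul _ hm.lintegral_prod_right', lintegral_lintegral_swap hm.aemeasurable]
    _ ≤ ofReal (cdim d) *
        ∫⁻ _ : PS d, (ofReal √(d * ε') * (2 * sph d + volume s)) ∂ν := by
        gcongr with w
        exact setLIntegral_kern_sub_rk_le hd (hε.trans h) s w.1
    _ = _ := by rw [lintegral_const]

lemma eventually_norm_sub_le_of_lipschitz {α G : Type*} [PseudoMetricSpace α] [NormedAddCommGroup G]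
    {l : Filter ℕ} [l.NeBot] {K : Set α} (hK : IsCompact K) {g : ℕ → α → G} {g' : α → G} {L : ℝ}
    (hL : ∀ᶠ n in l, ∀ x ∈ K, ∀ y ∈ K, ‖g n x - g n y‖ ≤ L * dist x y)
    (hp : ∀ x ∈ K, Tendsto (fun n => g n x) l (𝓝 (g' x))) {θ : ℝ} (hθ : 0 < θ) :
    ∀ᶠ n in l, ∀ x ∈ K, ‖g n x - g' x‖ ≤ θ := by
  have hL' : ∀ x ∈ K, ∀ y ∈ K, ‖g' x - g' y‖ ≤ L * dist x y := fun x hx y hy =>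
    le_of_tendsto ((hp x hx).sub (hp y hy)).norm (hL.mono fun n hn => hn x hx y hy)
  have hδ : 0 < θ / (3 * (|L| + 1)) := by positivity
  obtain ⟨s, hsK, hs, hcov⟩ := hK.finite_cover_balls hδ
  have hev : ∀ᶠ n in l, ∀ c ∈ s, ‖g n c - g' c‖ < θ / 3 := by
    rw [hs.eventually_all]
    intro c hc
    have := Metric.tendsto_nhds.1 (hp c (hsK hc)) (θ / 3) (by positivity)
    simpa [dist_eq_norm] using this
  filter_upwards [hL, hev] with n h1 h2 x hx
  obtain ⟨c, hc, hxc⟩ := mem_iUnion₂.1 (hcov hx)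
  have hxc' : dist x c < θ / (3 * (|L| + 1)) := hxc
  have hb : L * dist x c ≤ θ / 3 := by
    rw [lt_div_iff₀ (by positivity)] at hxc'
    nlinarith [dist_nonneg (x := x) (y := c), le_abs_self L, abs_nonneg L,
      mul_le_mul_of_nonneg_right (le_abs_self L) (dist_nonneg (x := x) (y := c))]
  have e : g n x - g' x = (g n x - g n c) + (g n c - g' c) + (g' c - g' x) := by abel
  rw [e]
  have h3 := h1 x hx c (hsK hc)
  have h4 := hL' c (hsK hc) x hx
  rw [dist_comm] at h4
  linarith [norm_add₃_le (a := g n x - g n c) (b := g n c - g' c) (c := g' c - g' x), h2 c hc]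

section Seq

variable {μ : Measure (PS d)} [IsFiniteMeasure μ] {e₀ : ℝ}

lemma tendsto_fld (hd : 3 ≤ d) (hμ : μ ≪ volume) (F : AFlows d μ e₀)
    {ε' : ℝ} (hε' : 0 < ε') {t : ℝ} (ht : 0 ≤ t) (x : Ed d) :
    Tendsto (fun n => fld d ε' (μ.map ((F n).Z t)) x) UF (𝓝 (fld d ε' (nu F μ t) x)) := by
  have hr := measurable_rk (d := d) ε'
  simp only [fld_map (by omega : 1 ≤ d) hε' ((F _).Z t).measurable]
  rw [fld]
  exact (tendsto_integral_nu hd hμ F le_rfl ht (χ := fun w : PS d => rk d ε' (x - w.1)) (by fun_prop)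
    (fun w => norm_rk_le_const (by omega) hε' _)).const_smul _

end Seq

/-- The Lipschitz constant in time and space of the regularized fields. -/
def lipC (d : ℕ) (ε' e₀ : ℝ) (μ : Measure (PS d)) : ℝ :=
  cdim d * ((d + 1) * (ε' ^ d)⁻¹ * (velBound μ e₀).toReal) +
    cdim d * ((d + 1) * (ε' ^ d)⁻¹ * μ.real univ)

lemma lipC_nonneg {e₀ : ℝ} {μ : Measure (PS d)} {ε' : ℝ} (hε' : 0 < ε') : 0 ≤ lipC d ε' e₀ μ := by
  have := cdim_nonneg d
  unfold lipC
  positivity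

section Seq

variable {μ : Measure (PS d)} [IsFiniteMeasure μ] {e₀ : ℝ}

lemma norm_fld_sub_le_lipC (hd : 3 ≤ d) (F : AFlows d μ e₀)
    {ε' : ℝ} (hε' : 0 < ε') {T : ℝ} {n : ℕ} (hn : T ≤ n) (p q : ℝ × Ed d) (hp : p.1 ∈ Icc 0 T)
    (hq : q.1 ∈ Icc 0 T) :
    ‖fld d ε' (μ.map ((F n).Z p.1)) p.2 - fld d ε' (μ.map ((F n).Z q.1)) q.2‖
      ≤ lipC d ε' e₀ μ * dist p q := by
  have hZ := ((F n).Z q.1).measurable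
  have h1 := (F n).norm_fld_sub_time_le hd (eps_le_one n) hε' (s := q.1) (t := p.1)
    ⟨hq.1, hq.2.trans hn⟩ ⟨hp.1, hp.2.trans hn⟩ p.2
  have h2 := norm_fld_sub_le (by omega : 1 ≤ d) hε' (μ.map ((F n).Z q.1)) p.2 q.2
  have hmass : (μ.map ((F n).Z q.1)).real univ = μ.real univ := by
    rw [measureReal_def, Measure.map_apply hZ MeasurableSet.univ, preimage_univ, measureReal_def]
  rw [hmass] at h2
  have d1 : |p.1 - q.1| ≤ dist p q := by rw [← Real.dist_eq]; exact le_max_left _ _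
  have d2 : ‖p.2 - q.2‖ ≤ dist p q := by rw [← dist_eq_norm]; exact le_max_right _ _
  have hc := cdim_nonneg d
  refine (norm_sub_le_norm_sub_add_norm_sub _ (fld d ε' (μ.map ((F n).Z q.1)) p.2) _).trans ?_
  rw [lipC, add_mul]
  refine add_le_add (h1.trans ?_) (h2.trans (by gcongr))
  rw [← mul_assoc _ (velBound μ e₀).toReal, ← mul_assoc (cdim d)]
  gcongr

lemma exists_small_reg (C : ℝ≥0∞) (hC : C ≠ ⊤) {θ : ℝ≥0∞} (hθ : θ ≠ 0) :
    ∃ ε' > 0, C * ofReal √(d * ε') ≤ θ := by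
  have h : Tendsto (fun ε' : ℝ => C * ofReal √(d * ε')) (𝓝 0) (𝓝 (C * 0)) := by
    refine ENNReal.Tendsto.const_mul ?_ (Or.inr hC)
    have : Continuous fun ε' : ℝ => ofReal √(d * ε') :=
      ENNReal.continuous_ofReal.comp (by fun_prop)
    simpa using this.tendsto 0
  rw [mul_zero] at h
  have h2 := (h.mono_left (nhdsWithin_le_nhds (s := Ioi 0))).eventually
    (ge_mem_nhds (pos_iff_ne_zero.2 hθ))
  obtain ⟨ε', h3, h4⟩ := (h2.and self_mem_nhdsWithin).exists
  exact ⟨ε', h4, h3⟩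

/-- The bound for the error made by regularizing, uniformly on measures of given mass. -/
lemma exists_reg (hd : 3 ≤ d) (M : ℝ≥0∞) (hM : M ≠ ⊤) (R : ℝ) {θ : ℝ≥0∞} (hθ : θ ≠ 0) :
    ∃ ε' > 0, ∀ ε, 0 ≤ ε → ε ≤ ε' → ∀ ν : Measure (PS d), IsFiniteMeasure ν → ν univ ≤ M →
      ∫⁻ x in ball (0 : Ed d) R, ‖fld d ε ν x - fld d ε' ν x‖ₑ ≤ θ := by
  obtain ⟨ε', h0, h1⟩ := exists_small_reg (d := d)
    (ofReal (cdim d) * ((2 * sph d + volume (ball (0 : Ed d) R)) * M)) (by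
      have := sph_ne_top d
      have := (measure_ball_lt_top (μ := (volume : Measure (Ed d))) (x := 0) (r := R)).ne
      finiteness) hθ
  refine ⟨ε', h0, fun ε hε h ν _ hν => (lintegral_fld_sub_le (by omega) hε h ν _).trans ?_⟩
  calc _ = ofReal (cdim d) * ((2 * sph d + volume (ball (0 : Ed d) R)) * ν univ) *
        ofReal √(d * ε') := by ring
    _ ≤ _ := by gcongr
    _ ≤ θ := h1

lemma lintegral_ball_le_of_norm_le {g : Ed d → Ed d} {c R : ℝ} (h : ∀ x ∈ ball (0 : Ed d) R, ‖g x‖ ≤ c) :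
    ∫⁻ x in ball (0 : Ed d) R, ‖g x‖ₑ ≤ ofReal c * volume (ball (0 : Ed d) R) := by
  rw [← setLIntegral_const]
  refine setLIntegral_mono measurable_const fun x hx => ?_
  rw [← ofReal_norm]
  exact ofReal_le_ofReal (h x hx)

lemma exists_const_mul_volume_le (R : ℝ) {θ : ℝ≥0∞} (hθ : θ ≠ 0) :
    ∃ c > 0, ofReal c * volume (ball (0 : Ed d) R) ≤ θ := by
  have h : Tendsto (fun c : ℝ => ofReal c * volume (ball (0 : Ed d) R)) (𝓝 0)
      (𝓝 (0 * volume (ball (0 : Ed d) R))) := by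
    refine ENNReal.Tendsto.mul_const ?_ (Or.inr measure_ball_lt_top.ne)
    simpa using ENNReal.continuous_ofReal.tendsto 0
  rw [zero_mul] at h
  have h2 := (h.mono_left (nhdsWithin_le_nhds (s := Ioi 0))).eventually
    (ge_mem_nhds (pos_iff_ne_zero.2 hθ))
  obtain ⟨c, h3, h4⟩ := (h2.and self_mem_nhdsWithin).exists
  exact ⟨c, h4, h3⟩

lemma lintegral_enorm_sub_le {α : Type*} [MeasurableSpace α] {m : Measure α} {E : Type*} [NormedAddCommGroup E]
    [SecondCountableTopology E] [MeasurableSpace E] [BorelSpace E] {f g h : α → E} (hf : Measurable f) (hg : Measurable g) :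
    ∫⁻ x, ‖f x - h x‖ₑ ∂m ≤ (∫⁻ x, ‖f x - g x‖ₑ ∂m) + ∫⁻ x, ‖g x - h x‖ₑ ∂m := by
  have hfg : Measurable fun x => ‖f x - g x‖ₑ := (hf.sub hg).enorm
  rw [← lintegral_add_left hfg]
  refine lintegral_mono fun x => ?_
  simpa only [edist_eq_enorm_sub] using edist_triangle (f x) (g x) (h x)

lemma field_conv (hd : 3 ≤ d) (hμ : μ ≪ volume) (F : AFlows d μ e₀)
    (T R : ℝ) {θ : ℝ≥0∞} (hθ : θ ≠ 0) :
    ∀ᶠ n in UF, ∀ t ∈ Icc 0 T, ∫⁻ x in ball (0 : Ed d) R,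
      ‖fld d (eps n) (μ.map ((F n).Z t)) x - fld d 0 (nu F μ t) x‖ₑ ≤ θ := by
  have hθ3 : θ / 3 ≠ 0 := by simp [hθ]
  obtain ⟨ε', h0, hreg⟩ := exists_reg hd (μ univ) (measure_ne_top _ _) R hθ3
  obtain ⟨c, hc, hcv⟩ := exists_const_mul_volume_le (d := d) R hθ3
  have hunif := eventually_norm_sub_le_of_lipschitz (l := UF)
    (K := Icc (0 : ℝ) T ×ˢ closedBall (0 : Ed d) R)
    (isCompact_Icc.prod (isCompact_closedBall _ _))
    (g := fun n p => fld d ε' (μ.map ((F n).Z p.1)) p.2) (g' := fun p => fld d ε' (nu F μ p.1) p.2)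
    (L := lipC d ε' e₀ μ)
    (by
      filter_upwards [UF_le (eventually_ge_atTop ⌈T⌉₊)] with n hn p hp q hq
      exact norm_fld_sub_le_lipC hd F h0 ((Nat.le_ceil T).trans (by exact_mod_cast hn)) p q hp.1 hq.1)
    (fun p hp => tendsto_fld hd hμ F h0 hp.1.1 p.2) hc
  filter_upwards [hunif, UF_le (tendsto_eps.eventually (ge_mem_nhds h0))] with n hn he t ht
  have hm1 := measurable_fld (d := d) (eps n) (μ.map ((F n).Z t))
  have hm2 := measurable_fld (d := d) ε' (μ.map ((F n).Z t))
  have hm3 := measurable_fld (d := d) ε' (nu F μ t)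
  have hm4 := measurable_fld (d := d) 0 (nu F μ t)
  have e1 := hreg (eps n) (eps_pos n).le he (μ.map ((F n).Z t)) inferInstance (by
    rw [Measure.map_apply ((F n).Z t).measurable MeasurableSet.univ, preimage_univ])
  have e2 := (lintegral_ball_le_of_norm_le (R := R) fun x hx => hn (t, x)
    ⟨ht, ball_subset_closedBall hx⟩).trans hcv
  have e3 := hreg 0 le_rfl h0.le (nu F μ t) inferInstance (nu_univ hd hμ F le_rfl ht.1).le
  simp only [← edist_eq_enorm_sub] at e1 e2 e3 ⊢
  simp only [edist_comm (fld d 0 _ _)] at e3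
  simp only [edist_eq_enorm_sub] at e1 e2 e3 ⊢
  calc _ ≤ _ := lintegral_enorm_sub_le hm1 hm2
    _ ≤ _ := add_le_add le_rfl (lintegral_enorm_sub_le hm2 hm3)
    _ ≤ θ / 3 + (θ / 3 + θ / 3) := add_le_add e1 (add_le_add e2 e3)
    _ = θ := by rw [← add_assoc, ENNReal.add_thirds]

lemma field_continuous (hd : 3 ≤ d) (hμ : μ ≪ volume)
    (F : AFlows d μ e₀) (T R : ℝ) {θ : ℝ≥0∞} (hθ : θ ≠ 0) :
    ∃ τ > 0, ∀ s ∈ Icc 0 T, ∀ t ∈ Icc 0 T, |t - s| ≤ τ → ∫⁻ x in ball (0 : Ed d) R,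
      ‖fld d 0 (nu F μ t) x - fld d 0 (nu F μ s) x‖ₑ ≤ θ := by
  have hθ3 : θ / 3 ≠ 0 := by simp [hθ]
  obtain ⟨ε', h0, hreg⟩ := exists_reg hd (μ univ) (measure_ne_top _ _) R hθ3
  obtain ⟨c, hc, hcv⟩ := exists_const_mul_volume_le (d := d) R hθ3
  have hL := lipC_nonneg (d := d) (e₀ := e₀) (μ := μ) h0
  refine ⟨c / (lipC d ε' e₀ μ + 1), by positivity, fun s hs t ht hst => ?_⟩
  have hm1 := measurable_fld (d := d) 0 (nu F μ t)
  have hm2 := measurable_fld (d := d) ε' (nu F μ t)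
  have hm3 := measurable_fld (d := d) ε' (nu F μ s)
  have e1 := hreg 0 le_rfl h0.le (nu F μ t) inferInstance (nu_univ hd hμ F le_rfl ht.1).le
  have e3 := hreg 0 le_rfl h0.le (nu F μ s) inferInstance (nu_univ hd hμ F le_rfl hs.1).le
  have e2 : ∫⁻ x in ball (0 : Ed d) R, ‖fld d ε' (nu F μ t) x - fld d ε' (nu F μ s) x‖ₑ ≤ θ / 3 := by
    refine (lintegral_ball_le_of_norm_le fun x _ => ?_).trans hcv
    refine le_of_tendsto ((tendsto_fld hd hμ F h0 ht.1 x).sub (tendsto_fld hd hμ F h0 hs.1 x)).norm ?_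
    filter_upwards [UF_le (eventually_ge_atTop ⌈T⌉₊)] with n hn
    refine (norm_fld_sub_le_lipC hd F h0 ((Nat.le_ceil T).trans (by exact_mod_cast hn)) (t, x) (s, x)
      ht hs).trans ?_
    rw [Prod.dist_eq, dist_self, max_eq_left dist_nonneg, Real.dist_eq]
    rw [le_div_iff₀ (by positivity)] at hst
    nlinarith [abs_nonneg (t - s)]
  simp only [← edist_eq_enorm_sub] at e1 e2 e3 ⊢
  simp only [edist_comm (fld d 0 (nu F μ s) _)] at e3
  simp only [edist_eq_enorm_sub] at e1 e2 e3 ⊢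
  calc _ ≤ _ := lintegral_enorm_sub_le hm1 hm2
    _ ≤ _ := add_le_add le_rfl (lintegral_enorm_sub_le hm2 hm3)
    _ ≤ θ / 3 + (θ / 3 + θ / 3) := add_le_add e1 (add_le_add e2 e3)
    _ = θ := by rw [← add_assoc, ENNReal.add_thirds]

lemma lintegral_fld_lt_top (hd : 1 ≤ d) (ν : Measure (PS d)) [IsFiniteMeasure ν] (R : ℝ) :
    ∫⁻ x in ball (0 : Ed d) R, ‖fld d 0 ν x‖ₑ < ⊤ := by
  have hm1 := measurable_fld (d := d) 0 ν
  have hm2 := measurable_fld (d := d) 1 ν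
  have h := lintegral_fld_sub_le hd le_rfl zero_le_one ν (ball (0 : Ed d) R)
  have h2 := lintegral_ball_le_of_norm_le (R := R) fun x _ => norm_fld_le hd one_pos ν x
  have h3 := lintegral_enorm_sub_le (m := volume.restrict (ball (0 : Ed d) R)) (h := fun _ => 0) hm1 hm2
  simp only [sub_zero] at h3
  refine (h3.trans (add_le_add h h2)).trans_lt ?_
  have := sph_ne_top d
  have := (measure_ball_lt_top (μ := (volume : Measure (Ed d))) (x := 0) (r := R)).ne
  finiteness

end Seq

end VP

namespace VP

/-! ### The weight of the stability estimate -/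

/-- `logInv s = log (1 + 1/s)`. -/
def logInv (s : ℝ) : ℝ := log (1 + 1 / s)

lemma logInv_pos {s : ℝ} (hs : 0 < s) : 0 < logInv s :=
  Real.log_pos (by have : 0 < 1 / s := by positivity
                   linarith)

lemma one_le_add_mul_logInv {s : ℝ} (hs : 0 < s) : 1 ≤ (1 + s) * logInv s := by
  have h := Real.one_sub_inv_le_log_of_pos (show 0 < 1 + 1 / s by positivity)
  have e : 1 - (1 + 1 / s)⁻¹ = 1 / (1 + s) := by field_simp; ring
  rw [e, div_le_iff₀ (by positivity)] at h
  rw [logInv, mul_comm]; exact h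

lemma mul_logInv_mono {s t : ℝ} (hs : 0 < s) (hst : s ≤ t) : s * logInv s ≤ t * logInv t := by
  have ht : 0 < t := hs.trans_le hst
  have h := one_add_mul_self_le_rpow_one_add (s := 1 / t) (p := t / s)
    (by have : 0 < 1 / t := by positivity
        linarith) (by rw [le_div_iff₀ hs]; linarith)
  have e : t / s * (1 / t) = 1 / s := by field_simp
  rw [e] at h
  have h2 := Real.log_le_log (by positivity) h
  rw [Real.log_rpow (by positivity)] at h2
  unfold logInv
  rw [div_mul_eq_mul_div, le_div_iff₀ hs] at h2
  linarith

lemma add_mul_logInv_anti {s t : ℝ} (hs : 0 < s) (hst : s ≤ t) :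
    (1 + t) * logInv t ≤ (1 + s) * logInv s := by
  have ht : 0 < t := hs.trans_le hst
  have e : ∀ u : ℝ, 0 < u → logInv u = - log (1 + -(1 / (1 + u))) := by
    intro u hu
    rw [logInv, ← Real.log_inv]
    congr 1
    have h1 : 1 + -(1 / (1 + u)) = u / (1 + u) := by field_simp; ring
    rw [h1, inv_div, add_div, div_self hu.ne', add_comm]
  have h := rpow_one_add_le_one_add_mul_self (s := -(1 / (1 + s))) (p := (1 + s) / (1 + t))
    (by have : 1 / (1 + s) ≤ 1 := by rw [div_le_one (by positivity)]; linarith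
        linarith) (by positivity) (by rw [div_le_one (by positivity)]; linarith)
  have e2 : (1 + s) / (1 + t) * -(1 / (1 + s)) = -(1 / (1 + t)) := by field_simp
  rw [e2] at h
  have hp : (0 : ℝ) < 1 + -(1 / (1 + s)) := by
    have : 1 + -(1 / (1 + s)) = s / (1 + s) := by field_simp; ring
    rw [this]; positivity
  have h2 := Real.log_le_log (Real.rpow_pos_of_pos hp _) h
  rw [Real.log_rpow hp] at h2
  rw [e s hs, e t ht]
  rw [div_mul_eq_mul_div, div_le_iff₀ (by positivity)] at h2
  linarith

/-- The Osgood modulus `s (1 + s) log (1 + 1/s)`. -/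
def osg (s : ℝ) : ℝ := s * ((1 + s) * logInv s)

lemma osg_pos {s : ℝ} (hs : 0 < s) : 0 < osg s := by
  have := logInv_pos hs
  unfold osg
  positivity

lemma osg_mono {s t : ℝ} (hs : 0 < s) (hst : s ≤ t) : osg s ≤ osg t := by
  have h := mul_logInv_mono hs hst
  have := logInv_pos hs
  have : osg s = (1 + s) * (s * logInv s) := by unfold osg; ring
  rw [this, show osg t = (1 + t) * (t * logInv t) by unfold osg; ring]
  have : 0 < t := hs.trans_le hst
  gcongr

lemma one_le_osg {s : ℝ} (hs : 1 ≤ s) : 1 ≤ osg s := by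
  have := one_le_add_mul_logInv (show 0 < s by linarith)
  unfold osg
  nlinarith

/-- The weight `1 / ω(r + δ)`. -/
def wt (δ r : ℝ) : ℝ := (osg (r + δ))⁻¹

/-- A primitive of the weight. -/
def psi (δ r : ℝ) : ℝ := log (logInv δ) - log (logInv (r + δ))

section wt

variable {δ r r' : ℝ}

lemma wt_pos (hδ : 0 < δ) (hr : 0 ≤ r) : 0 < wt δ r := inv_pos.2 (osg_pos (by positivity))

lemma wt_anti (hδ : 0 < δ) (hr : 0 ≤ r) (h : r ≤ r') : wt δ r' ≤ wt δ r :=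
  inv_anti₀ (osg_pos (by positivity)) (osg_mono (by positivity) (by linarith))

lemma mul_wt_mono (hδ : 0 < δ) (hr : 0 ≤ r) (h : r ≤ r') : r * wt δ r ≤ r' * wt δ r' := by
  have e : ∀ u : ℝ, 0 ≤ u → u * wt δ u = u / (u + δ) * ((1 + (u + δ)) * logInv (u + δ))⁻¹ := by
    intro u hu
    unfold wt osg
    rw [mul_inv]
    ring
  have hr' := hr.trans h
  rw [e r hr, e r' hr']
  have h1 := logInv_pos (show 0 < r' + δ by positivity)
  have h2 := add_mul_logInv_anti (show 0 < r + δ by positivity) (show r + δ ≤ r' + δ by linarith)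
  have h3 : r / (r + δ) ≤ r' / (r' + δ) := by
    rw [div_le_div_iff₀ (by positivity) (by positivity)]
    nlinarith
  have h4 := logInv_pos (show 0 < r + δ by positivity)
  gcongr

lemma mul_wt_le_one (hδ : 0 < δ) (hr : 0 ≤ r) : r * wt δ r ≤ 1 := by
  have h := one_le_add_mul_logInv (show 0 < r + δ by positivity)
  unfold wt
  rw [← div_eq_mul_inv, div_le_one (osg_pos (by positivity)), osg]
  nlinarith

lemma mul_logInv_mul_wt_le_one (hδ : 0 < δ) (hr : 0 < r) : r * logInv r * wt δ r ≤ 1 := by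
  have h := osg_mono hr (show r ≤ r + δ by linarith)
  have h2 := logInv_pos hr
  unfold wt
  rw [← div_eq_mul_inv, div_le_one (osg_pos (by positivity))]
  refine le_trans ?_ h
  unfold osg
  nlinarith [mul_pos hr h2]

lemma wt_le_one (hδ : 0 < δ) (hr : 1 ≤ r) : wt δ r ≤ 1 :=
  inv_le_one_of_one_le₀ (one_le_osg (by linarith))

lemma psi_zero : psi δ 0 = 0 := by simp [psi]

lemma hasDerivAt_psi (hδ : 0 < δ) (hr : 0 ≤ r) : HasDerivAt (psi δ) (wt δ r) r := by
  have hs : 0 < r + δ := by positivity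
  have hl := logInv_pos hs
  have h0 : HasDerivAt (fun x : ℝ => x + δ) 1 r := (hasDerivAt_id r).add_const δ
  have h1 : HasDerivAt (fun x : ℝ => 1 + 1 / (x + δ)) (-1 / (r + δ) ^ 2) r := by
    simpa [one_div] using (h0.inv hs.ne').const_add 1
  have h2 := (h1.log (by positivity)).log hl.ne'
  refine (h2.const_sub (log (logInv δ))).congr_deriv ?_
  unfold wt osg logInv
  have h3 : (0 : ℝ) < 1 + 1 / (r + δ) := by positivity
  have h4 : log (1 + 1 / (r + δ)) ≠ 0 := hl.ne'
  generalize log (1 + 1 / (r + δ)) = L at h4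
  field_simp
  ring

lemma psi_mono (hδ : 0 < δ) (hr : 0 ≤ r) (h : r ≤ r') : psi δ r ≤ psi δ r' := by
  have h1 := logInv_pos (show 0 < r' + δ by linarith)
  have : logInv (r' + δ) ≤ logInv (r + δ) := by
    unfold logInv
    have : 0 < r + δ := by positivity
    have : r + δ ≤ r' + δ := by linarith
    have : 0 < r' + δ := by linarith
    gcongr
  unfold psi
  gcongr

lemma lintegral_wt (hδ : 0 < δ) : ∫⁻ r in Ioc (0 : ℝ) 1, ofReal (wt δ r) = ofReal (psi δ 1) := by
  rw [lintegral_Ioc_of_hasDerivAt zero_le_one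
    (fun x hx => (hasDerivAt_psi hδ hx.1).continuousAt.continuousWithinAt)
    (fun x hx => hasDerivAt_psi hδ hx.1.le) (fun x hx => (wt_pos hδ hx.1.le).le), psi_zero, sub_zero]

lemma psi_one_le {κ : ℝ} (hκ : 0 < κ) (hδ : 0 < δ) (hδ1 : δ ≤ 1) :
    psi δ 1 ≤ psi δ κ + (log (logInv κ) - log (logInv 2)) := by
  have h1 : logInv (κ + δ) ≤ logInv κ := by
    unfold logInv
    gcongr
    linarith
  have h2 : logInv 2 ≤ logInv (1 + δ) := by
    unfold logInv
    gcongr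
    linarith
  have h3 := Real.log_le_log (logInv_pos (by positivity)) h1
  have h4 := Real.log_le_log (logInv_pos (by positivity)) h2
  unfold psi
  linarith

lemma tendsto_psi {κ : ℝ} (hκ : 0 < κ) : Tendsto (fun δ => psi δ κ) (𝓝[>] 0) atTop := by
  have h1 : Tendsto (fun δ : ℝ => log (logInv δ)) (𝓝[>] 0) atTop := by
    refine Real.tendsto_log_atTop.comp (Real.tendsto_log_atTop.comp ?_)
    refine tendsto_atTop_add_const_left _ 1 ?_
    exact (tendsto_inv_nhdsGT_zero (𝕜 := ℝ)).congr fun x => (one_div x).symm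
  have h2 : ∀ᶠ δ : ℝ in 𝓝[>] 0, log (logInv δ) + -log (logInv κ) ≤ psi δ κ := by
    filter_upwards [self_mem_nhdsWithin] with δ (hδ : 0 < δ)
    have h1 : logInv (κ + δ) ≤ logInv κ := by
      unfold logInv
      gcongr
      linarith
    have h3 := Real.log_le_log (logInv_pos (by positivity)) h1
    unfold psi
    linarith
  exact tendsto_atTop_mono' _ h2 (tendsto_atTop_add_const_right _ _ h1)

end wt

lemma measurable_wt (δ : ℝ) : Measurable (wt δ) := by
  unfold wt osg logInv
  fun_prop

lemma gmod_mono {d : ℕ} {q r : ℝ} (hq : 0 ≤ q) (h : q ≤ r) (u : Ed d) : gmod d q u ≤ gmod d r u := by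
  unfold gmod
  have : q / (‖u‖ + q) ≤ r / (‖u‖ + r) := by
    rcases eq_or_lt_of_le hq with rfl | hq'
    · rw [zero_div]; positivity
    · have := norm_nonneg u
      have hr : 0 < r := hq'.trans_le h
      rw [div_le_div_iff₀ (by positivity) (by positivity)]
      nlinarith
  gcongr

lemma wt_mul_gmod_le {d : ℕ} {δ r : ℝ} (hδ : 0 < δ) (hr : 0 ≤ r) (u : Ed d) :
    wt δ r * gmod d r u ≤ 2 * (d + 1) * (‖kern d u‖ * wt δ ‖u‖) := by
  have hu := norm_nonneg u
  have h : wt δ r * (r / (‖u‖ + r)) ≤ wt δ ‖u‖ := by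
    have w0 := (wt_pos hδ hr).le
    rcases le_total ‖u‖ r with h | h
    · calc wt δ r * (r / (‖u‖ + r)) ≤ wt δ r * 1 := by
            gcongr
            exact div_le_one_of_le₀ (by linarith) (by positivity)
        _ ≤ wt δ ‖u‖ := by rw [mul_one]; exact wt_anti hδ hu h
    · rcases eq_or_lt_of_le hu with h0 | h0
      · have : r = 0 := by linarith
        subst this
        simp [(wt_pos hδ hu).le]
      · have h2 := mul_wt_mono hδ hr h
        rw [mul_div_assoc', div_le_iff₀ (by positivity)]
        nlinarith [wt_pos hδ hu]
  calc wt δ r * gmod d r u = 2 * (d + 1) * (‖kern d u‖ * (wt δ r * (r / (‖u‖ + r)))) := by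
        unfold gmod; ring
    _ ≤ _ := by gcongr

lemma setLIntegral_kern_wt_le {d : ℕ} (hd : 1 ≤ d) {δ : ℝ} (hδ : 0 < δ) (s : Set (Ed d)) (y : Ed d) :
    ∫⁻ x in s, ofReal (‖kern d (x - y)‖ * wt δ ‖x - y‖)
      ≤ sph d * ofReal (psi δ 1) + volume s := by
  have h := setLIntegral_kern_mul_le hd (fun r => ofReal (wt δ r))
    (measurable_wt δ).ennreal_ofReal (C := 1)
    (fun r hr => ENNReal.ofReal_le_one.2 (wt_le_one hδ hr.le)) s y
  rw [lintegral_wt hδ, one_mul] at h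
  simpa only [ofReal_mul (norm_nonneg _)] using h

end VP

namespace VP

lemma measurable_gmod (d : ℕ) : Measurable fun p : ℝ × Ed d => gmod d p.1 p.2 := by
  have := measurable_kern (d := d)
  unfold gmod
  fun_prop

lemma ball_prod (d : ℕ) (R : ℝ) : ball (0 : PS d) R = ball (0 : Ed d) R ×ˢ ball (0 : Ed d) R :=
  (ball_prod_same _ _ _).symm

lemma map_fst_le_of_mp {d : ℕ} {μ : Measure (PS d)} {W : PS d → PS d}
    (hW : MeasurePreserving W volume volume) {U : Set (PS d)} {k : ℝ≥0∞}
    (hk : μ.restrict U ≤ k • volume) (S : ℝ) :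
    (μ.restrict (U ∩ {a | ‖(W a).2‖ ≤ S})).map (fun a => (W a).1)
      ≤ (k * volume (closedBall (0 : Ed d) S)) • volume := by
  have hWm := hW.measurable
  have hA : MeasurableSet {a | ‖(W a).2‖ ≤ S} := measurableSet_le (by fun_prop) measurable_const
  refine Measure.le_iff.2 fun s hs => ?_
  rw [Measure.map_apply (by fun_prop) hs,
    Measure.restrict_apply ((by fun_prop : Measurable fun a => (W a).1) hs)]
  calc μ ((fun a => (W a).1) ⁻¹' s ∩ (U ∩ {a | ‖(W a).2‖ ≤ S}))
      ≤ μ.restrict U (W ⁻¹' (s ×ˢ closedBall 0 S)) := by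
        rw [Measure.restrict_apply (hWm (hs.prod measurableSet_closedBall))]
        refine measure_mono fun a ha => ⟨⟨ha.1, ?_⟩, ha.2.1⟩
        simpa using ha.2.2
    _ ≤ (k • volume) (W ⁻¹' (s ×ˢ closedBall 0 S)) := hk _
    _ = _ := by
        rw [Measure.smul_apply, hW.measure_preimage (hs.prod measurableSet_closedBall).nullMeasurableSet,
          Measure.volume_eq_prod, Measure.prod_prod, Measure.smul_apply, smul_eq_mul, smul_eq_mul]
        ring

lemma lintegral_gmod_le {d : ℕ} (hd : 1 ≤ d) {m : Measure (Ed d)} {K : ℝ≥0∞} (hm : m ≤ K • volume)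
    {r : ℝ} (hr : 0 < r) (x : Ed d) :
    ∫⁻ y, ofReal (gmod d r (x - y)) ∂m
      ≤ K * (sph d * ofReal (2 * (d + 1) * (r * logInv r)))
        + ofReal (2 * (d + 1) * r) * m univ := by
  rw [← lintegral_add_compl _ (measurableSet_closedBall (x := x) (ε := 1))]
  refine add_le_add ?_ ?_
  · calc ∫⁻ y in closedBall x 1, ofReal (gmod d r (x - y)) ∂m
        ≤ ∫⁻ y in closedBall x 1, ofReal (gmod d r (x - y)) ∂(K • volume) :=
          lintegral_mono' (Measure.restrict_mono le_rfl hm) le_rfl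
      _ = K * ∫⁻ y in closedBall x 1, ofReal (gmod d r (y - x)) := by
          rw [Measure.restrict_smul, lintegral_smul_measure, smul_eq_mul]
          congr 1
          refine lintegral_congr fun y => ?_
          rw [← neg_sub y x]
          simp only [gmod, kern, norm_neg, smul_neg]
      _ ≤ _ := by
          gcongr
          exact setLIntegral_gmod_le hd hr x
  · calc ∫⁻ y in (closedBall x 1)ᶜ, ofReal (gmod d r (x - y)) ∂m
        ≤ ∫⁻ _ in (closedBall x 1)ᶜ, ofReal (2 * (d + 1) * r) ∂m := by
          refine setLIntegral_mono measurable_const fun y hy => ofReal_le_ofReal ?_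
          refine gmod_le_of_one_le hd hr.le ?_
          have : 1 < dist y x := by simpa using hy
          rw [← dist_eq_norm, dist_comm]; exact this.le
      _ ≤ _ := by
          rw [setLIntegral_const]
          gcongr
          exact subset_univ _

lemma wt_mul_lintegral_gmod_le {d : ℕ} (hd : 1 ≤ d) {m : Measure (Ed d)} {K : ℝ≥0∞}
    (hm : m ≤ K • volume) {δ r : ℝ} (hδ : 0 < δ) (hr : 0 ≤ r) (x : Ed d) :
    ofReal (wt δ r) * ∫⁻ y, ofReal (gmod d r (x - y)) ∂m
      ≤ ofReal (2 * (d + 1)) * (K * sph d + m univ) := by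
  rcases eq_or_lt_of_le hr with rfl | hr'
  · simp [gmod]
  have hw := (wt_pos hδ hr).le
  have h1 : ofReal (wt δ r) * ofReal (2 * (d + 1) * (r * logInv r))
      ≤ ofReal (2 * (d + 1)) := by
    rw [← ofReal_mul hw]
    refine ofReal_le_ofReal ?_
    have := mul_logInv_mul_wt_le_one hδ hr'
    have h2 : (0 : ℝ) ≤ 2 * (d + 1) := by positivity
    nlinarith
  have h2 : ofReal (wt δ r) * ofReal (2 * (d + 1) * r)
      ≤ ofReal (2 * (d + 1)) := by
    rw [← ofReal_mul hw]
    refine ofReal_le_ofReal ?_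
    have := mul_wt_le_one hδ hr
    have h2 : (0 : ℝ) ≤ 2 * (d + 1) := by positivity
    nlinarith
  calc _ ≤ ofReal (wt δ r) * (K * (sph d * ofReal (2 * (d + 1) * (r * logInv r)))
        + ofReal (2 * (d + 1) * r) * m univ) := by
        gcongr; exact lintegral_gmod_le hd hm hr' x
    _ = (ofReal (wt δ r) * ofReal (2 * (d + 1) * (r * logInv r))) * (K * sph d)
        + (ofReal (wt δ r) * ofReal (2 * (d + 1) * r)) * m univ := by ring
    _ ≤ ofReal (2 * (d + 1)) * (K * sph d) + ofReal (2 * (d + 1)) * m univ := by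
        gcongr
    _ = _ := by ring

/-- Weighted estimate for the oscillation modulus of the kernel, integrated over phase space:
labels in `A` have a bounded spatial density, the other ones are few. -/
lemma lintegral_wt_gmod_le {d : ℕ} (hd : 1 ≤ d) {μ : Measure (PS d)} [IsFiniteMeasure μ]
    {W : PS d → PS d} (hW : Measurable W) {P : PS d → PS d} (hP : MeasurePreserving P volume volume)
    {A : Set (PS d)} (hA : MeasurableSet A) {K : ℝ≥0∞}
    (hK : (μ.restrict A).map (fun a => (W a).1) ≤ K • volume)
    {D : PS d → ℝ} (hD : Measurable D) (hD0 : ∀ z, 0 ≤ D z) {δ : ℝ} (hδ : 0 < δ) (R : ℝ) :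
    ∫⁻ z in P ⁻¹' ball 0 R, ofReal (wt δ (D z)) *
        ∫⁻ b, ofReal (gmod d (D z) ((P z).1 - (W b).1)) ∂μ
      ≤ ofReal (2 * (d + 1)) * (K * sph d + μ univ) * volume (ball (0 : PS d) R)
        + μ Aᶜ * (ofReal (2 * (d + 1)) * (volume (ball (0 : Ed d) R) *
          (sph d * ofReal (psi δ 1) + volume (ball (0 : Ed d) R)))) := by
  have hPm := hP.measurable
  have hwt := measurable_wt δ
  have hker := measurable_kern (d := d)
  have hg : Measurable fun q : PS d × PS d =>
      ofReal (gmod d (D q.1) ((P q.1).1 - (W q.2).1)) :=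
    ((measurable_gmod d).comp (by fun_prop :
      Measurable fun q : PS d × PS d => (D q.1, (P q.1).1 - (W q.2).1))).ennreal_ofReal
  have hgz : ∀ z, Measurable fun b => ofReal (gmod d (D z) ((P z).1 - (W b).1)) :=
    fun z => hg.comp measurable_prodMk_left
  have hPB : MeasurableSet (P ⁻¹' ball (0 : PS d) R) := hPm measurableSet_ball
  have hVB : volume (P ⁻¹' ball (0 : PS d) R) = volume (ball (0 : PS d) R) :=
    hP.measure_preimage measurableSet_ball.nullMeasurableSet
  have hsplit : ∀ z, ofReal (wt δ (D z)) *
        ∫⁻ b, ofReal (gmod d (D z) ((P z).1 - (W b).1)) ∂μ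
      ≤ ofReal (2 * (d + 1)) * (K * sph d + μ univ)
        + ∫⁻ b in Aᶜ, ofReal (2 * (d + 1)) *
          ofReal (‖kern d ((P z).1 - (W b).1)‖ * wt δ ‖(P z).1 - (W b).1‖) ∂μ := by
    intro z
    rw [← lintegral_add_compl _ hA, mul_add]
    refine add_le_add ?_ ?_
    · have h1 := wt_mul_lintegral_gmod_le hd hK hδ (hD0 z) (P z).1
      have hgy : Measurable fun y : Ed d => ofReal (gmod d (D z) ((P z).1 - y)) :=
        ((measurable_gmod d).comp (by fun_prop :
          Measurable fun y : Ed d => (D z, (P z).1 - y))).ennreal_ofReal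
      rw [lintegral_map hgy (by fun_prop)] at h1
      refine h1.trans ?_
      rw [Measure.map_apply (by fun_prop) MeasurableSet.univ, preimage_univ,
        Measure.restrict_apply_univ]
      gcongr
      exact subset_univ _
    · rw [← lintegral_const_mul _ (hgz z)]
      refine lintegral_mono fun b => ?_
      rw [← ofReal_mul (wt_pos hδ (hD0 z)).le, ← ofReal_mul (by positivity)]
      exact ofReal_le_ofReal (wt_mul_gmod_le hδ (hD0 z) _)
  refine (lintegral_mono hsplit).trans ?_
  rw [lintegral_add_left measurable_const, setLIntegral_const, hVB]
  refine add_le_add le_rfl ?_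
  rw [lintegral_lintegral_swap (by fun_prop)]
  rw [mul_comm (μ Aᶜ), ← setLIntegral_const]
  refine lintegral_mono fun b => ?_
  have hf : Measurable fun x : Ed d => ofReal (‖kern d (x - (W b).1)‖ * wt δ ‖x - (W b).1‖) := by
    fun_prop
  rw [lintegral_const_mul _ (by fun_prop)]
  gcongr
  calc ∫⁻ z in P ⁻¹' ball 0 R, ofReal (‖kern d ((P z).1 - (W b).1)‖ * wt δ ‖(P z).1 - (W b).1‖)
      = ∫⁻ z in ball (0 : PS d) R,
          ofReal (‖kern d (z.1 - (W b).1)‖ * wt δ ‖z.1 - (W b).1‖) :=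
        hP.setLIntegral_comp_preimage measurableSet_ball (f := fun z : PS d =>
          ofReal (‖kern d (z.1 - (W b).1)‖ * wt δ ‖z.1 - (W b).1‖)) (by fun_prop)
    _ = (∫⁻ x in ball (0 : Ed d) R, ofReal (‖kern d (x - (W b).1)‖ * wt δ ‖x - (W b).1‖))
          * volume (ball (0 : Ed d) R) := by
        rw [ball_prod, Measure.volume_eq_prod, ← Measure.prod_restrict, lintegral_prod _ (by fun_prop)]
        simp only [lintegral_const, Measure.restrict_apply_univ]
        rw [lintegral_mul_const _ hf]
    _ ≤ _ := by
        rw [mul_comm]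
        gcongr
        exact setLIntegral_kern_wt_le hd hδ _ _

/-- Chain rule inequality for a concave function of the norm along an absolutely continuous curve. -/
lemma chain_curve {E : Type*} [NormedAddCommGroup E] [NormedSpace ℝ E] {ψ w : ℝ → ℝ}
    (hψ : ∀ r, 0 ≤ r → HasDerivAt ψ (w r) r) (hw : AntitoneOn w (Ici 0)) (hw0 : ∀ r, 0 ≤ r → 0 ≤ w r)
    {g b : ℝ → E} {s t : ℝ} (hst : s ≤ t) (hb : IntervalIntegrable b volume s t)
    (hg : ∀ r ∈ Icc s t, g r - g s = ∫ x in s..r, b x) :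
    ofReal (ψ ‖g t‖ - ψ ‖g s‖) ≤ ∫⁻ x in Icc s t, ofReal (w ‖g x‖) * ‖b x‖ₑ := by
  have hmono : MonotoneOn ψ (Ici 0) := monotoneOn_of_hasDerivWithinAt_nonneg (convex_Ici 0)
    (fun r hr => (hψ r hr).continuousAt.continuousWithinAt)
    (fun r hr => (hψ r (interior_subset hr)).hasDerivWithinAt) fun r hr => hw0 r (interior_subset hr)
  have hlip : ∀ r, 0 ≤ r → ∀ u, 0 ≤ u → dist (ψ r) (ψ u) ≤ w 0 * dist r u := fun r hr u hu => by
    have := (convex_Ici (0 : ℝ)).norm_image_sub_le_of_norm_hasDerivWithin_le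
      (fun x hx => (hψ x hx).hasDerivWithinAt) (fun x hx => by
        rw [norm_of_nonneg (hw0 x hx)]
        exact hw (mem_Ici.2 le_rfl) hx hx) hu hr
    simpa [dist_eq_norm] using this
  set P : ℝ → ℝ := fun r => ‖g s‖ + ∫ x in s..r, ‖b x‖ with hP
  have hP0 : ∀ r, s ≤ r → 0 ≤ P r := fun r hr =>
    add_nonneg (norm_nonneg _) (intervalIntegral.integral_nonneg hr fun _ _ => norm_nonneg _)
  have hgP : ∀ r ∈ Icc s t, ‖g r‖ ≤ P r := fun r hr => by
    have h1 := norm_sub_norm_le (g r) (g s)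
    have h2 := intervalIntegral.norm_integral_le_integral_norm (μ := volume) (f := b) hr.1
    rw [← hg r hr] at h2
    simp only [hP]
    linarith
  have hI := hb.norm.absolutelyContinuousOnInterval_intervalIntegral left_mem_uIcc
  have hac : AbsolutelyContinuousOnInterval (fun r => ψ (P r)) s t := by
    refine squeeze_zero' (.of_forall fun E => Finset.sum_nonneg fun i _ => dist_nonneg) ?_
      (hI.const_mul (w 0))
    refine eventually_inf_principal.2 (.of_forall fun E hE => Finset.sum_le_sum fun i hi => ?_)
    have hE' := hE.1 i hi
    rw [uIcc_of_le hst] at hE'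
    refine (hlip _ (hP0 _ hE'.1.1) _ (hP0 _ hE'.2.1)).trans (le_of_eq ?_)
    simp [hP, Real.dist_eq, ← mul_sub, abs_mul, abs_of_nonneg (hw0 0 le_rfl)]
  have hder : ∀ᵐ x, x ∈ Icc s t → deriv (fun r => ψ (P r)) x = w (P x) * ‖b x‖ := by
    filter_upwards [hb.norm.ae_hasDerivAt_integral] with x hx hxI
    rw [uIcc_of_le hst] at hx
    exact ((hψ _ (hP0 x hxI.1)).comp x ((hx hxI s (left_mem_Icc.2 hst)).const_add _)).deriv
  have hItg := (intervalIntegrable_iff_integrableOn_Icc_of_le hst).1 hac.intervalIntegrable_deriv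
  have hderR : ∀ᵐ x ∂volume.restrict (Icc s t), deriv (fun r => ψ (P r)) x = w (P x) * ‖b x‖ ∧
      x ∈ Icc s t := by
    filter_upwards [ae_restrict_of_ae hder, ae_restrict_mem measurableSet_Icc] with x hx hxI
    exact ⟨hx hxI, hxI⟩
  have hPs : P s = ‖g s‖ := by simp [hP]
  calc _ ≤ ofReal (ψ (P t) - ψ (P s)) := by
        rw [hPs]
        have := hmono (norm_nonneg (g t)) (hP0 t hst) (hgP t (right_mem_Icc.2 hst))
        exact ofReal_le_ofReal (by linarith)
    _ = ∫⁻ x in Icc s t, ofReal (deriv (fun r => ψ (P r)) x) := by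
        rw [← hac.integral_deriv_eq_sub, intervalIntegral.integral_of_le hst,
          ← integral_Icc_eq_integral_Ioc, ofReal_integral_eq_lintegral_ofReal hItg]
        filter_upwards [hderR] with x hx
        rw [hx.1]
        exact mul_nonneg (hw0 _ (hP0 x hx.2.1)) (norm_nonneg _)
    _ ≤ _ := by
        refine lintegral_mono_ae ?_
        filter_upwards [hderR] with x hx
        rw [hx.1, ofReal_mul (hw0 _ (hP0 x hx.2.1)), ofReal_norm]
        exact mul_le_mul_left (ofReal_le_ofReal (hw (norm_nonneg _) (hP0 x hx.2.1) (hgP x hx.2))) _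

lemma psi_chain_curve {E : Type*} [NormedAddCommGroup E] [NormedSpace ℝ E]
    {g b : ℝ → E} {s t δ : ℝ} (hst : s ≤ t)
    (hb : IntervalIntegrable b volume s t)
    (hg : ∀ r ∈ Icc s t, ∀ u ∈ Icc s t, g u - g r = ∫ x in r..u, b x) (hg0 : g s = 0 ∨ g t = 0)
    (hδ : 0 < δ) :
    ofReal (psi δ ‖g s‖) + ofReal (psi δ ‖g t‖)
      ≤ ∫⁻ x in Icc s t, ofReal (wt δ ‖g x‖) * ‖b x‖ₑ := by
  have hψ : ∀ r, 0 ≤ r → HasDerivAt (psi δ) (wt δ r) r := fun r hr => hasDerivAt_psi hδ hr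
  have hw : AntitoneOn (wt δ) (Ici 0) := fun r hr u _ h => wt_anti hδ hr h
  have hw0 : ∀ r, 0 ≤ r → 0 ≤ wt δ r := fun r hr => (wt_pos hδ hr).le
  rcases hg0 with h0 | h0
  · have := chain_curve hψ hw hw0 hst hb (hg s (left_mem_Icc.2 hst))
    simpa [h0, psi_zero] using this
  · have := chain_curve hψ hw hw0 (g := fun r => g (-r)) (b := fun r => -b (-r)) (neg_le_neg hst)
      ((IntervalIntegrable.iff_comp_neg (by simp)).1 hb).symm.neg fun r hr => by
        rw [intervalIntegral.integral_neg, intervalIntegral.integral_comp_neg b,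
          ← intervalIntegral.integral_symm, neg_neg]
        exact hg _ (right_mem_Icc.2 hst) _ ⟨by linarith [hr.2], by linarith [hr.1]⟩
    simp only [neg_neg, h0, norm_zero, psi_zero, ENNReal.ofReal_zero, add_zero, sub_zero, enorm_neg] at this ⊢
    refine this.trans (le_of_eq ?_)
    have h := (Measure.measurePreserving_neg (volume : Measure ℝ)).setLIntegral_comp_preimage_emb
      (MeasurableEquiv.neg ℝ).measurableEmbedding (fun x => ofReal (wt δ ‖g x‖) * ‖b x‖ₑ) (Icc s t)
    rw [← h]
    simp

variable {d : ℕ}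

lemma exists_layer {α : Type*} [MeasurableSpace α] {μ ν : Measure α} [SigmaFinite ν]
    [IsFiniteMeasure μ] (h : μ ≪ ν) {θ : ℝ≥0∞} (hθ : θ ≠ 0) :
    ∃ (k : ℝ≥0∞) (U : Set α), k ≠ ⊤ ∧ MeasurableSet U ∧ μ.restrict U ≤ k • ν ∧ μ Uᶜ ≤ θ := by
  have hm := Measure.measurable_rnDeriv μ ν
  have hA : ∀ n : ℕ, MeasurableSet {z | (n : ℝ≥0∞) < μ.rnDeriv ν z} := fun n =>
    measurableSet_lt measurable_const hm
  have hlim : Tendsto (fun n : ℕ => μ {z | (n : ℝ≥0∞) < μ.rnDeriv ν z}) atTop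
      (𝓝 (μ (⋂ n : ℕ, {z | (n : ℝ≥0∞) < μ.rnDeriv ν z}))) := by
    refine tendsto_measure_iInter_atTop (fun n => (hA n).nullMeasurableSet) ?_
      ⟨0, measure_ne_top _ _⟩
    intro i j hij z hz
    have : (i : ℝ≥0∞) ≤ j := by exact_mod_cast hij
    exact this.trans_lt hz
  have h0 : μ (⋂ n : ℕ, {z | (n : ℝ≥0∞) < μ.rnDeriv ν z}) = 0 := by
    have h1 := h (Measure.rnDeriv_lt_top μ ν)
    refine measure_mono_null (fun z hz => ?_) h1
    simp only [mem_iInter, mem_ofPred_eq] at hz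
    simp only [mem_compl_iff, mem_ofPred_eq, not_lt, top_le_iff]
    by_contra hc
    obtain ⟨n, hn⟩ := ENNReal.exists_nat_gt hc
    exact absurd (hz n) (not_lt.2 hn.le)
  rw [h0] at hlim
  obtain ⟨n, hn⟩ := ((ENNReal.tendsto_nhds_zero.1 hlim) θ (pos_iff_ne_zero.2 hθ)).exists
  refine ⟨n, {z | (n : ℝ≥0∞) < μ.rnDeriv ν z}ᶜ, by simp, (hA n).compl, ?_, by rwa [compl_compl]⟩
  refine Measure.le_iff.2 fun s hs => ?_
  rw [Measure.restrict_apply hs]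
  calc μ (s ∩ {z | (n : ℝ≥0∞) < μ.rnDeriv ν z}ᶜ)
      = ∫⁻ z in s ∩ {z | (n : ℝ≥0∞) < μ.rnDeriv ν z}ᶜ, μ.rnDeriv ν z ∂ν := by
        rw [← withDensity_apply _ (hs.inter (hA n).compl), Measure.withDensity_rnDeriv_eq μ ν h]
    _ ≤ ∫⁻ z in s ∩ {z | (n : ℝ≥0∞) < μ.rnDeriv ν z}ᶜ, n ∂ν :=
        setLIntegral_mono measurable_const fun z hz => not_lt.1 hz.2
    _ ≤ _ := by
        rw [setLIntegral_const, Measure.smul_apply, smul_eq_mul]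
        gcongr
        exact inter_subset_left

lemma enorm_fld_map_sub_le_gmod (hd : 1 ≤ d) {ε : ℝ} (hε : 0 < ε) {μ : Measure (PS d)}
    [IsFiniteMeasure μ] {W : PS d → PS d} (hW : Measurable W) {x y : Ed d} {r : ℝ} (h : ‖x - y‖ ≤ r) :
    ‖fld d ε (μ.map W) x - fld d ε (μ.map W) y‖ₑ ≤ ofReal (cdim d) *
      ((∫⁻ b, ofReal (gmod d r (x - (W b).1)) ∂μ)
        + ∫⁻ b, ofReal (gmod d r (y - (W b).1)) ∂μ) := by
  have hr : 0 ≤ r := (norm_nonneg _).trans h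
  rw [fld_map hd hε hW, fld_map hd hε hW, ← smul_sub, enorm_smul, Real.enorm_eq_ofReal (cdim_nonneg d),
    ← integral_sub (integrable_rk_comp hd hε μ (by fun_prop)) (integrable_rk_comp hd hε μ (by fun_prop)),
    ← lintegral_add_left (f := fun b => ofReal (gmod d r (x - (W b).1)))
      ((measurable_gmod d).comp (by fun_prop :
        Measurable fun b => (r, x - (W b).1))).ennreal_ofReal]
  gcongr
  refine (enorm_integral_le_lintegral_enorm _).trans (lintegral_mono fun b => ?_)
  rw [← ofReal_add (gmod_nonneg hr _) (gmod_nonneg hr _), ← ofReal_norm]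
  refine ofReal_le_ofReal ((norm_rk_sub_le_gmod hd hε.le _ _).trans ?_)
  rw [sub_sub_sub_cancel_right]
  exact add_le_add (gmod_mono (norm_nonneg _) h _) (gmod_mono (norm_nonneg _) h _)

section Paths

variable {μ : Measure (PS d)} {e₀ : ℝ}

/-- The path of the `n`-th approximate flow that passes through `z` at time `s`. -/
def pth (F : AFlows d μ e₀) (n : ℕ) (s r : ℝ) (z : PS d) : PS d :=
  (F n).Z r (((F n).Z s).symm z)

/-- The velocity of `pth`. -/
def vel (F : AFlows d μ e₀) (n : ℕ) (s r : ℝ) (z : PS d) : PS d :=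
  (F n).B r (((F n).Z s).symm z)

variable (F : AFlows d μ e₀)

lemma measurable_pth (n : ℕ) (s : ℝ) : Measurable fun p : ℝ × PS d => pth F n s p.1 p.2 :=
  (F n).measZ.comp (measurable_fst.prodMk (((F n).Z s).symm.measurable.comp measurable_snd))

lemma measurable_vel (n : ℕ) (s : ℝ) : Measurable fun p : ℝ × PS d => vel F n s p.1 p.2 :=
  (F n).measB.comp (measurable_fst.prodMk (((F n).Z s).symm.measurable.comp measurable_snd))

lemma pth_self (n : ℕ) (s : ℝ) (z : PS d) : pth F n s s z = z := by simp [pth]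

lemma mp_pth (n : ℕ) (s r : ℝ) : MeasurePreserving (pth F n s r) volume volume :=
  ((F n).mp r).comp ((F n).mp s).symm

lemma pth_sub {n : ℕ} (s : ℝ) {r u : ℝ} (hr : 0 ≤ r) (hu : 0 ≤ u) (z : PS d) :
    pth F n s u z - pth F n s r z = ∫ x in r..u, vel F n s x z :=
  (F n).sub_eq hr hu _

lemma intervalIntegrable_vel {n : ℕ} (s : ℝ) {r u : ℝ} (hr : 0 ≤ r) (hu : 0 ≤ u) (z : PS d) :
    IntervalIntegrable (fun x => vel F n s x z) volume r u :=
  (F n).intervalIntegrable hr hu _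

lemma norm_vel_sub_le {n : ℕ} (s : ℝ) {r : ℝ} (hr : r ∈ Icc (0 : ℝ) n) (z : PS d) :
    ‖vel F n s r z - ((pth F n s r z).2, fld d (eps n) (μ.map ((F n).Z r)) (pth F n s r z).1)‖
      ≤ eps n * (1 + ‖(pth F n s r z).2‖) :=
  (F n).close r hr _

lemma wt_mul_enorm_vel_sub_le [IsFiniteMeasure μ] (hd : 1 ≤ d) {n m : ℕ} {s r R δ : ℝ} (hδ : 0 < δ) {z : PS d}
    (hn : r ∈ Icc (0 : ℝ) n) (hm : r ∈ Icc (0 : ℝ) m)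
    (hp : pth F n s r z ∈ ball 0 R) (hq : pth F m s r z ∈ ball 0 R) :
    ofReal (wt δ ‖pth F n s r z - pth F m s r z‖) * ‖vel F n s r z - vel F m s r z‖ₑ
      ≤ 1 + ofReal (cdim d) *
          (ofReal (wt δ ‖pth F n s r z - pth F m s r z‖) * (∫⁻ b, ofReal
            (gmod d ‖pth F n s r z - pth F m s r z‖ ((pth F n s r z).1 - ((F n).Z r b).1)) ∂μ)
          + ofReal (wt δ ‖pth F n s r z - pth F m s r z‖) * ∫⁻ b, ofReal
            (gmod d ‖pth F n s r z - pth F m s r z‖ ((pth F m s r z).1 - ((F n).Z r b).1)) ∂μ)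
        + ofReal (wt δ 0) * (ofReal ((eps n + eps m) * (1 + R))
          + (‖fld d (eps n) (μ.map ((F n).Z r)) (pth F m s r z).1
              - fld d 0 (nu F μ r) (pth F m s r z).1‖ₑ
            + ‖fld d (eps m) (μ.map ((F m).Z r)) (pth F m s r z).1
              - fld d 0 (nu F μ r) (pth F m s r z).1‖ₑ)) := by
  have hvn := norm_vel_sub_le F s hn z
  have hvm := norm_vel_sub_le F s hm z
  set p := pth F n s r z
  set q := pth F m s r z
  set E := fld d (eps n) (μ.map ((F n).Z r))
  set E' := fld d (eps m) (μ.map ((F m).Z r))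
  set E0 := fld d 0 (nu F μ r)
  set w := ofReal (wt δ ‖p - q‖)
  have hp2 : ‖p.2‖ ≤ R := (norm_snd_le p).trans (by simpa using (mem_ball_zero_iff.1 hp).le)
  have hq2 : ‖q.2‖ ≤ R := (norm_snd_le q).trans (by simpa using (mem_ball_zero_iff.1 hq).le)
  have hw0 : w ≤ ofReal (wt δ 0) :=
    ofReal_le_ofReal (wt_anti hδ le_rfl (norm_nonneg _))
  have hw1 : w * ‖p - q‖ₑ ≤ 1 := by
    rw [← ofReal_norm, ← ofReal_mul (wt_pos hδ (norm_nonneg _)).le, mul_comm]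
    exact ENNReal.ofReal_le_one.2 (mul_wt_le_one hδ (norm_nonneg _))
  have e1 : ‖vel F n s r z - vel F m s r z‖ₑ ≤ ofReal ((eps n + eps m) * (1 + R))
      + (‖p - q‖ₑ + ‖E p.1 - E' q.1‖ₑ) := by
    rw [← ofReal_norm, ← ofReal_norm, ← ofReal_norm,
      ← ofReal_add (norm_nonneg _) (norm_nonneg _),
      ← ofReal_add (by have := eps_pos n; have := eps_pos m; have := (norm_nonneg _).trans hp2; positivity) (by positivity)]
    refine ofReal_le_ofReal ?_
    have h1 : ‖(p.2, E p.1) - (q.2, E' q.1)‖ ≤ ‖p - q‖ + ‖E p.1 - E' q.1‖ := by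
      rw [Prod.norm_def]
      refine max_le ?_ ?_
      · exact (norm_snd_le (p - q)).trans (by linarith [norm_nonneg (E p.1 - E' q.1)])
      · change ‖E p.1 - E' q.1‖ ≤ _
        linarith [norm_nonneg (p - q)]
    have h2 : vel F n s r z - vel F m s r z = (vel F n s r z - (p.2, E p.1))
        - (vel F m s r z - (q.2, E' q.1)) + ((p.2, E p.1) - (q.2, E' q.1)) := by abel
    rw [h2]
    have h3 := norm_add_le ((vel F n s r z - (p.2, E p.1))
        - (vel F m s r z - (q.2, E' q.1))) ((p.2, E p.1) - (q.2, E' q.1))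
    have h4 := norm_sub_le (vel F n s r z - (p.2, E p.1)) (vel F m s r z - (q.2, E' q.1))
    have h5 : eps n * (1 + ‖p.2‖) ≤ eps n * (1 + R) := by have := eps_pos n; gcongr
    have h6 : eps m * (1 + ‖q.2‖) ≤ eps m * (1 + R) := by have := eps_pos m; gcongr
    linarith
  have e2 : ‖E p.1 - E' q.1‖ₑ ≤ ‖E p.1 - E q.1‖ₑ + (‖E q.1 - E0 q.1‖ₑ + ‖E' q.1 - E0 q.1‖ₑ) := by
    have h2 : E p.1 - E' q.1 = (E p.1 - E q.1) + ((E q.1 - E0 q.1) - (E' q.1 - E0 q.1)) := by abel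
    rw [h2]
    exact (enorm_add_le _ _).trans (add_le_add le_rfl enorm_sub_le)
  have e3 := enorm_fld_map_sub_le_gmod hd (eps_pos n) (μ := μ) ((F n).Z r).measurable
    (norm_fst_le (p - q) : ‖p.1 - q.1‖ ≤ ‖p - q‖)
  calc _ ≤ w * (ofReal ((eps n + eps m) * (1 + R))
      + (‖p - q‖ₑ + (‖E p.1 - E q.1‖ₑ + (‖E q.1 - E0 q.1‖ₑ + ‖E' q.1 - E0 q.1‖ₑ)))) := by
        gcongr
        exact e1.trans (add_le_add le_rfl (add_le_add le_rfl e2))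
    _ = w * ‖p - q‖ₑ + w * ‖E p.1 - E q.1‖ₑ + w * (ofReal ((eps n + eps m) * (1 + R))
          + (‖E q.1 - E0 q.1‖ₑ + ‖E' q.1 - E0 q.1‖ₑ)) := by ring
    _ ≤ _ := by
        refine add_le_add (add_le_add hw1 ?_) (by gcongr)
        rw [← mul_add, mul_left_comm]
        gcongr

end Paths

end VP

namespace VP

variable {d : ℕ}

lemma exists_mul_le_one {c : ℝ≥0∞} (hc : c ≠ ⊤) : ∃ Δ : ℝ≥0∞, Δ ≠ 0 ∧ c * Δ ≤ 1 := by
  refine ⟨(c + 1)⁻¹, by simpa using hc, ?_⟩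
  rw [← div_eq_mul_inv]
  exact ENNReal.div_le_of_le_mul (by rw [one_mul]; exact le_self_add)

lemma setLIntegral_fst_comp {P : PS d → PS d} (hP : MeasurePreserving P volume volume)
    {f : Ed d → ℝ≥0∞} (hf : Measurable f) (R : ℝ) :
    ∫⁻ z in P ⁻¹' ball 0 R, f (P z).1
      = (∫⁻ x in ball (0 : Ed d) R, f x) * volume (ball (0 : Ed d) R) := by
  rw [hP.setLIntegral_comp_preimage measurableSet_ball (f := fun z : PS d => f z.1) (by fun_prop),
    ball_prod, Measure.volume_eq_prod, ← Measure.prod_restrict, lintegral_prod _ (by fun_prop)]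
  simp only [lintegral_const, Measure.restrict_apply_univ]
  rw [lintegral_mul_const _ hf]

section Paths

variable {μ : Measure (PS d)} [IsFiniteMeasure μ] {e₀ : ℝ}
  (F : AFlows d μ e₀)

lemma lintegral_wt_vel_le (hd : 1 ≤ d) {n m : ℕ} {s r R δ : ℝ} (hδ : 0 < δ)
    (hn : r ∈ Icc (0 : ℝ) n) (hm : r ∈ Icc (0 : ℝ) m)
    {A : Set (PS d)} (hA : MeasurableSet A) {K Δ : ℝ≥0∞}
    (hK : (μ.restrict A).map (fun a => ((F n).Z r a).1) ≤ K • volume)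
    (hεn : ofReal ((eps n + eps m) * (1 + R)) ≤ Δ)
    (hΔn : ∫⁻ x in ball (0 : Ed d) R,
      ‖fld d (eps n) (μ.map ((F n).Z r)) x - fld d 0 (nu F μ r) x‖ₑ ≤ Δ)
    (hΔm : ∫⁻ x in ball (0 : Ed d) R,
      ‖fld d (eps m) (μ.map ((F m).Z r)) x - fld d 0 (nu F μ r) x‖ₑ ≤ Δ) :
    ∫⁻ z in pth F n s r ⁻¹' ball 0 R ∩ pth F m s r ⁻¹' ball 0 R,
        ofReal (wt δ ‖pth F n s r z - pth F m s r z‖) * ‖vel F n s r z - vel F m s r z‖ₑ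
      ≤ volume (ball (0 : PS d) R) + ofReal (cdim d) *
          (2 * (ofReal (2 * (d + 1)) * (K * sph d + μ univ) * volume (ball (0 : PS d) R)
            + μ Aᶜ * (ofReal (2 * (d + 1)) * (volume (ball (0 : Ed d) R) *
              (sph d * ofReal (psi δ 1) + volume (ball (0 : Ed d) R))))))
        + ofReal (wt δ 0) *
          (volume (ball (0 : PS d) R) + 2 * volume (ball (0 : Ed d) R)) * Δ := by
  have hpm : Measurable (pth F n s r) := (mp_pth F n s r).measurable
  have hqm : Measurable (pth F m s r) := (mp_pth F m s r).measurable
  have hwt := measurable_wt δ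
  set p := pth F n s r with hp
  set q := pth F m s r with hq
  set G := p ⁻¹' ball 0 R ∩ q ⁻¹' ball 0 R with hG
  have hGm : MeasurableSet G := (hpm measurableSet_ball).inter (hqm measurableSet_ball)
  have hvG : volume G ≤ volume (ball (0 : PS d) R) :=
    (measure_mono inter_subset_left).trans
      ((mp_pth F n s r).measure_preimage measurableSet_ball.nullMeasurableSet).le
  have hD : Measurable fun z => ‖p z - q z‖ := by fun_prop
  have hE1 := measurable_fld (d := d) (eps n) (μ.map ((F n).Z r))
  have hE2 := measurable_fld (d := d) (eps m) (μ.map ((F m).Z r))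
  have hE0 := measurable_fld (d := d) 0 (nu F μ r)
  have hgm : ∀ {P : PS d → PS d}, Measurable P → Measurable fun z => ofReal (wt δ ‖p z - q z‖) *
      ∫⁻ b, ofReal (gmod d ‖p z - q z‖ ((P z).1 - ((F n).Z r b).1)) ∂μ := by
    intro P hP
    have hZ := ((F n).Z r).measurable
    have h1 : Measurable fun x : PS d × PS d =>
        ofReal (gmod d ‖p x.1 - q x.1‖ ((P x.1).1 - ((F n).Z r x.2).1)) :=
      ((measurable_gmod d).comp (by fun_prop : Measurable fun x : PS d × PS d =>
        (‖p x.1 - q x.1‖, (P x.1).1 - ((F n).Z r x.2).1))).ennreal_ofReal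
    exact (hwt.comp hD).ennreal_ofReal.mul h1.lintegral_prod_right'
  have hst : ∀ {P : PS d → PS d}, MeasurePreserving P volume volume → G ⊆ P ⁻¹' ball 0 R →
      ∫⁻ z in G, ofReal (wt δ ‖p z - q z‖) *
        ∫⁻ b, ofReal (gmod d ‖p z - q z‖ ((P z).1 - ((F n).Z r b).1)) ∂μ
      ≤ ofReal (2 * (d + 1)) * (K * sph d + μ univ) * volume (ball (0 : PS d) R)
        + μ Aᶜ * (ofReal (2 * (d + 1)) * (volume (ball (0 : Ed d) R) *
          (sph d * ofReal (psi δ 1) + volume (ball (0 : Ed d) R)))) := fun hP hsub =>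
    (lintegral_mono_set hsub).trans
      (lintegral_wt_gmod_le hd ((F n).Z r).measurable hP hA hK hD (fun z => norm_nonneg _) hδ R)
  have hfl : ∀ {f : Ed d → ℝ≥0∞}, Measurable f → (∫⁻ x in ball (0 : Ed d) R, f x ≤ Δ) →
      ∫⁻ z in G, f (q z).1 ≤ Δ * volume (ball (0 : Ed d) R) := fun hf hle =>
    (lintegral_mono_set inter_subset_right).trans
      ((setLIntegral_fst_comp (mp_pth F m s r) hf R).le.trans (by gcongr))
  have m1 := hgm hpm
  have m2 := hgm hqm
  have m3 : Measurable fun z => ‖fld d (eps n) (μ.map ((F n).Z r)) (q z).1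
      - fld d 0 (nu F μ r) (q z).1‖ₑ := by fun_prop
  have m4 : Measurable fun z => ‖fld d (eps m) (μ.map ((F m).Z r)) (q z).1
      - fld d 0 (nu F μ r) (q z).1‖ₑ := by fun_prop
  refine (setLIntegral_mono' hGm fun z hz =>
    wt_mul_enorm_vel_sub_le F hd hδ hn hm hz.1 hz.2).trans ?_
  simp only [← hp, ← hq]
  rw [lintegral_add_left (by fun_prop), lintegral_add_left measurable_const,
    lintegral_const_mul _ (by fun_prop), lintegral_const_mul _ (by fun_prop),
    lintegral_add_left m1, lintegral_add_left measurable_const, lintegral_add_left m3,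
    setLIntegral_const, setLIntegral_const, one_mul]
  refine add_le_add (add_le_add hvG ?_) ?_
  · rw [two_mul]
    gcongr
    · exact hst (mp_pth F n s r) inter_subset_left
    · exact hst (mp_pth F m s r) inter_subset_right
  · rw [mul_assoc]
    gcongr
    calc _ ≤ Δ * volume (ball (0 : PS d) R)
          + (Δ * volume (ball (0 : Ed d) R) + Δ * volume (ball (0 : Ed d) R)) :=
        add_le_add (by gcongr) (add_le_add (hfl (f := fun x => ‖fld d (eps n) (μ.map ((F n).Z r)) x
          - fld d 0 (nu F μ r) x‖ₑ) (by fun_prop) hΔn) (hfl (f := fun x =>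
          ‖fld d (eps m) (μ.map ((F m).Z r)) x - fld d 0 (nu F μ r) x‖ₑ) (by fun_prop) hΔm))
      _ = _ := by ring

lemma exists_stat (hd : 3 ≤ d) (hμ : μ ≪ volume) (T R : ℝ) :
    ∃ C : ℝ≥0∞, C ≠ ⊤ ∧ ∀ ε : ℝ≥0∞, ε ≠ 0 → ε ≠ ⊤ → ∃ K : ℝ≥0∞, K ≠ ⊤ ∧ ∀ δ > 0, ∃ S ∈ UF,
      ∀ n ∈ S, ∀ m ∈ S, ∀ s, ∀ r ∈ Icc 0 T,
      ∫⁻ z in pth F n s r ⁻¹' ball 0 R ∩ pth F m s r ⁻¹' ball 0 R,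
        ofReal (wt δ ‖pth F n s r z - pth F m s r z‖) * ‖vel F n s r z - vel F m s r z‖ₑ
      ≤ K + C * ε * ofReal (psi δ 1) := by
  have hs := sph_ne_top d
  have hb1 : volume (ball (0 : PS d) R) ≠ ⊤ := measure_ball_lt_top.ne
  have hb2 : volume (ball (0 : Ed d) R) ≠ ⊤ := measure_ball_lt_top.ne
  set v := volume (ball (0 : PS d) R)
  set w := volume (ball (0 : Ed d) R)
  set c := ofReal (cdim d)
  have hc : c ≠ ⊤ := ofReal_ne_top
  set e := ofReal (2 * (d + 1))
  have he : e ≠ ⊤ := ofReal_ne_top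
  refine ⟨c * (2 * (e * (w * sph d))), by finiteness, fun ε hε hεt => ?_⟩
  have hε2 : ε / 2 ≠ 0 := by simp [hε]
  obtain ⟨k, U, hk, hU, hkU, hUc⟩ := exists_layer hμ hε2
  obtain ⟨S₀, hS₀⟩ := tight_seq hd F T hε2
  have hcb : volume (closedBall (0 : Ed d) S₀) ≠ ⊤ := measure_closedBall_lt_top.ne
  refine ⟨v + c * (2 * (e * (k * volume (closedBall (0 : Ed d) S₀) * sph d + μ univ) * v
    + ε * (e * (w * w)))) + 1, by finiteness, fun δ hδ => ?_⟩
  obtain ⟨Δ, hΔ, hΔ1⟩ := exists_mul_le_one (c := ofReal (wt δ 0) * (v + 2 * w)) (by finiteness)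
  have hΔ2 : Δ / 2 ≠ 0 := by simp [hΔ]
  have hev : ∀ᶠ n in UF, ofReal (eps n * (1 + |R|)) ≤ Δ / 2 := by
    have h1 : Tendsto (fun n => ofReal (eps n * (1 + |R|))) atTop (𝓝 (ofReal (0 * (1 + |R|)))) :=
      (ENNReal.continuous_ofReal.tendsto _).comp (tendsto_eps.mul_const _)
    rw [zero_mul, ENNReal.ofReal_zero] at h1
    exact UF_le (h1.eventually (ge_mem_nhds (pos_iff_ne_zero.2 hΔ2)))
  refine ⟨_, (field_conv hd hμ F T R hΔ).and (hev.and (UF_le (eventually_ge_atTop ⌈T⌉₊))), ?_⟩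
  rintro n ⟨hn1, hn2, hn3⟩ m ⟨hm1, hm2, hm3⟩ s r hr
  have hnT : r ∈ Icc (0 : ℝ) n := ⟨hr.1, hr.2.trans ((Nat.le_ceil T).trans (by exact_mod_cast hn3))⟩
  have hmT : r ∈ Icc (0 : ℝ) m := ⟨hr.1, hr.2.trans ((Nat.le_ceil T).trans (by exact_mod_cast hm3))⟩
  have hZ := ((F n).Z r).measurable
  have hAm : MeasurableSet (U ∩ {a | ‖((F n).Z r a).2‖ ≤ S₀}) :=
    hU.inter (measurableSet_le (by fun_prop) measurable_const)
  have hAc : μ (U ∩ {a | ‖((F n).Z r a).2‖ ≤ S₀})ᶜ ≤ ε := by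
    rw [compl_inter]
    refine (measure_union_le _ _).trans ?_
    rw [← ENNReal.add_halves ε]
    refine add_le_add hUc ((measure_mono fun a ha => ?_).trans
      (hS₀ S₀ le_rfl n ((Nat.le_ceil T).trans (by exact_mod_cast hn3)) r hr))
    have : S₀ < ‖((F n).Z r a).2‖ := not_le.1 ha
    exact this.le.trans (norm_snd_le _)
  have hεs : ofReal ((eps n + eps m) * (1 + R)) ≤ Δ := by
    rw [← ENNReal.add_halves Δ]
    refine le_trans ?_ (add_le_add hn2 hm2)
    have := eps_pos n
    have := eps_pos m
    rw [← ofReal_add (by positivity) (by positivity), ← add_mul]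
    refine ofReal_le_ofReal ?_
    gcongr
    exact le_abs_self R
  refine (lintegral_wt_vel_le F (by omega) hδ hnT hmT hAm
    (map_fst_le_of_mp ((F n).mp r) hkU S₀) hεs (hn1 r hr) (hm1 r hr)).trans ?_
  calc _ ≤ v + c * (2 * (e * (k * volume (closedBall (0 : Ed d) S₀) * sph d + μ univ) * v
      + ε * (e * (w * (sph d * ofReal (psi δ 1) + w))))) + 1 := by gcongr
    _ = _ := by ring

/-- Stability: two approximate flows issued from the same point stay close as long as they both
remain in a given ball, up to a small set of starting points. -/
lemma stab (hd : 3 ≤ d) (hμ : μ ≪ volume) (T R : ℝ) {κ : ℝ} (hκ : 0 < κ) {θ : ℝ≥0∞} (hθ : θ ≠ 0)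
    (hθt : θ ≠ ⊤) :
    ∃ S ∈ UF, ∀ n ∈ S, ∀ m ∈ S, ∀ s ∈ Icc 0 T, volume {z : PS d | ∃ t ∈ Icc 0 T,
      (∀ r ∈ uIcc s t, pth F n s r z ∈ ball 0 R ∧ pth F m s r z ∈ ball 0 R) ∧
        κ < ‖pth F n s t z - pth F m s t z‖} ≤ θ := by
  obtain ⟨C, hC, H⟩ := exists_stat F hd hμ T R
  set τ := ofReal T
  have hτ : τ ≠ ⊤ := ofReal_ne_top
  have hθ2 : θ / 2 ≠ 0 := by simp [hθ]
  have hθ2t : θ / 2 ≠ ⊤ := (ENNReal.div_lt_top hθt (by simp)).ne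
  obtain ⟨ε, hε, hε1⟩ := exists_mul_le_one (c := τ * C / (θ / 2)) (by finiteness)
  have hε' : τ * C * (min ε 1) ≤ θ / 2 := by
    have h1 : τ * C / (θ / 2) * min ε 1 ≤ 1 := le_trans (by gcongr; exact min_le_left _ _) hε1
    rw [ENNReal.mul_comm_div, ← mul_div_assoc] at h1
    have := (ENNReal.div_le_iff hθ2 hθ2t).1 h1
    rwa [one_mul] at this
  obtain ⟨K, hK, H⟩ := H (min ε 1) (by simp [hε]) (by simp)
  set c := ofReal (log (logInv κ) - log (logInv 2))
  have hc : c ≠ ⊤ := ofReal_ne_top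
  have hlim : Tendsto (fun δ => τ * (K + C * min ε 1 * c) / ofReal (psi δ κ)) (𝓝[>] 0)
      (𝓝 (τ * (K + C * min ε 1 * c) / ⊤)) :=
    ENNReal.Tendsto.const_div (ENNReal.tendsto_ofReal_atTop.comp (tendsto_psi hκ))
      (Or.inr (by have : min ε 1 ≠ ⊤ := by simp
                  finiteness))
  rw [ENNReal.div_top] at hlim
  obtain ⟨δ, ⟨⟨hδa, hδb⟩, hδ1⟩, hδ0⟩ := (((hlim.eventually (ge_mem_nhds (pos_iff_ne_zero.2 hθ2))).and
    ((tendsto_psi hκ).eventually (eventually_gt_atTop 0))).and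
    ((ge_mem_nhds (one_pos : (0 : ℝ) < 1)).filter_mono
      (nhdsWithin_le_nhds (s := Ioi 0)))).and self_mem_nhdsWithin |>.exists
  have hδ0 : 0 < δ := hδ0
  obtain ⟨S, hS, H⟩ := H δ hδ0
  refine ⟨S, hS, fun n hn m hm s hs => ?_⟩
  have mp1 := measurable_pth F n s
  have mp2 := measurable_pth F m s
  have mv1 := measurable_vel F n s
  have mv2 := measurable_vel F m s
  have hwt := measurable_wt δ
  set f : ℝ × PS d → ℝ≥0∞ := fun x => ofReal (wt δ ‖pth F n s x.1 x.2 - pth F m s x.1 x.2‖)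
    * ‖vel F n s x.1 x.2 - vel F m s x.1 x.2‖ₑ with hf
  have hfm : Measurable f := by fun_prop
  set G : Set (ℝ × PS d) := {x | pth F n s x.1 x.2 ∈ ball 0 R ∧ pth F m s x.1 x.2 ∈ ball 0 R} with hG
  have hGm : MeasurableSet G := (mp1 measurableSet_ball).inter (mp2 measurableSet_ball)
  have hgm : Measurable (G.indicator f) := hfm.indicator hGm
  have hsub : {z : PS d | ∃ t ∈ Icc 0 T,
      (∀ r ∈ uIcc s t, pth F n s r z ∈ ball 0 R ∧ pth F m s r z ∈ ball 0 R) ∧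
        κ < ‖pth F n s t z - pth F m s t z‖} ⊆
      {z | ofReal (psi δ κ) ≤ ∫⁻ r in Icc 0 T, G.indicator f (r, z)} := by
    rintro z ⟨t, ht, hst, hκt⟩
    have hU : uIcc s t ⊆ Icc 0 T := ordConnected_Icc.uIcc_subset hs ht
    have hsm : min s t ∈ Icc 0 T := hU ⟨le_rfl, min_le_max⟩
    have htm : max s t ∈ Icc 0 T := hU ⟨min_le_max, le_rfl⟩
    have key := psi_chain_curve (g := fun r => pth F n s r z - pth F m s r z)
      (b := fun r => vel F n s r z - vel F m s r z) (min_le_max (a := s) (b := t))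
      ((intervalIntegrable_vel F s hsm.1 htm.1 z).sub (intervalIntegrable_vel F s hsm.1 htm.1 z))
      (fun r hr u hu => by
        have hr0 := hsm.1.trans hr.1
        have hu0 := hsm.1.trans hu.1
        rw [intervalIntegral.integral_sub (intervalIntegrable_vel F s hr0 hu0 z)
          (intervalIntegrable_vel F s hr0 hu0 z), ← pth_sub F s hr0 hu0, ← pth_sub F s hr0 hu0]
        abel)
      (by
        have h0 : pth F n s s z - pth F m s s z = 0 := by simp [pth_self]
        rcases le_total s t with h | h
        · left; rw [min_eq_left h]; exact h0
        · right; rw [max_eq_left h]; exact h0) hδ0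
    have hpsi : ofReal (psi δ κ) ≤ ofReal (psi δ ‖pth F n s t z - pth F m s t z‖) :=
      ofReal_le_ofReal (psi_mono hδ0 hκ.le hκt.le)
    calc ofReal (psi δ κ)
        ≤ ∫⁻ r in uIcc s t, f (r, z) := by
          refine le_trans ?_ key
          rcases le_total s t with h | h
          · rw [max_eq_right h]; exact hpsi.trans le_add_self
          · rw [min_eq_right h]; exact hpsi.trans le_self_add
      _ = ∫⁻ r in uIcc s t, G.indicator f (r, z) :=
          setLIntegral_congr_fun measurableSet_uIcc fun r hr =>
            (indicator_of_mem (show (r, z) ∈ G from hst r hr) f).symm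
      _ ≤ _ := lintegral_mono_set hU
  have hI : Measurable fun z => ∫⁻ r in Icc 0 T, G.indicator f (r, z) := hgm.lintegral_prod_left'
  refine (measure_mono hsub).trans ((meas_ge_le_lintegral_div hI.aemeasurable
    (by simpa using hδb) ofReal_ne_top).trans ?_)
  have htot : ∫⁻ z, ∫⁻ r in Icc 0 T, G.indicator f (r, z)
      ≤ τ * (K + C * min ε 1 * ofReal (psi δ 1)) := by
    rw [lintegral_lintegral_swap (f := fun z r => G.indicator f (r, z))
      (hgm.comp measurable_swap).aemeasurable]
    calc _ ≤ ∫⁻ r in Icc 0 T, (K + C * min ε 1 * ofReal (psi δ 1)) := by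
          refine setLIntegral_mono measurable_const fun r hr => ?_
          refine le_trans (le_of_eq ?_) (H n hn m hm s r hr)
          rw [← lintegral_indicator (((mp_pth F n s r).measurable measurableSet_ball).inter
            ((mp_pth F m s r).measurable measurableSet_ball))]
          rfl
      _ = _ := by rw [setLIntegral_const, Real.volume_Icc, sub_zero, mul_comm]
  have hψ : ofReal (psi δ 1) ≤ ofReal (psi δ κ) + c :=
    (ofReal_le_ofReal (psi_one_le hκ hδ0 hδ1)).trans ENNReal.ofReal_add_le
  have hp0 : ofReal (psi δ κ) ≠ 0 := by simpa using hδb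
  calc _ ≤ (τ * (K + C * min ε 1 * (ofReal (psi δ κ) + c))) / ofReal (psi δ κ) := by
        gcongr
        exact htot.trans (by gcongr)
    _ = τ * (K + C * min ε 1 * c) / ofReal (psi δ κ)
        + τ * C * min ε 1 * ofReal (psi δ κ) / ofReal (psi δ κ) := by
        rw [← ENNReal.add_div]; congr 1; ring
    _ ≤ θ / 2 + θ / 2 := by
        rw [ENNReal.mul_div_cancel_right hp0 ofReal_ne_top]
        gcongr
    _ = θ := ENNReal.add_halves θ

end Paths

end VP

namespace VP

variable {d : ℕ}

lemma enorm_prod {E E' : Type*} [NormedAddCommGroup E] [NormedAddCommGroup E'] (z : E × E') :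
    ‖z‖ₑ = max ‖z.1‖ₑ ‖z.2‖ₑ := by
  rw [← ofReal_norm, ← ofReal_norm, ← ofReal_norm, Prod.norm_def,
    ENNReal.ofReal_max]

lemma exists_tail {α : Type*} [MeasurableSpace α] {μ : Measure α} {g : α → ℝ≥0∞}
    (hg : Measurable g) (hi : ∫⁻ a, g a ∂μ ≠ ⊤) {θ : ℝ≥0∞} (hθ : θ ≠ 0) :
    ∃ N : ℕ, ∫⁻ a, (g a - N) ∂μ ≤ θ := by
  have h : Tendsto (fun N : ℕ => ∫⁻ a, (g a - N) ∂μ) atTop (𝓝 (∫⁻ _, 0 ∂μ)) := by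
    refine tendsto_lintegral_of_dominated_convergence g (fun N => hg.sub_const _)
      (fun N => .of_forall fun a => tsub_le_self) hi ?_
    filter_upwards [ae_lt_top hg hi] with a ha
    obtain ⟨M, hM⟩ := ENNReal.exists_nat_gt ha.ne
    refine tendsto_const_nhds.congr' ?_
    filter_upwards [eventually_ge_atTop M] with N hN
    exact (tsub_eq_zero_of_le (hM.le.trans (by exact_mod_cast hN))).symm
  rw [lintegral_zero] at h
  exact (h.eventually_le_const hθ.bot_lt).exists

/-- A curve that gets at distance `κ` from its starting point spends a velocity budget while it is
still close to it. -/
lemma le_lintegral_of_exit {E : Type*} [NormedAddCommGroup E] [NormedSpace ℝ E] {p v : ℝ → E}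
    {I : Set ℝ} {u w κ R : ℝ} {N : ℝ≥0∞} (hκ : 0 < κ) (hI : uIcc u w ⊆ I)
    (hp : ContinuousOn p (uIcc u w)) (hsub : ∀ r ∈ uIcc u w, p r - p u = ∫ x in u..r, v x)
    (hu : p u ∈ ball 0 R) (hw : κ ≤ ‖p w - p u‖) (hN : N * ofReal |w - u| ≤ ofReal (κ / 2)) :
    ofReal (κ / 2) ≤
      ∫⁻ r in I, (p ⁻¹' ball 0 (R + κ)).indicator (fun r => ‖v r‖ₑ - N) r := by
  set A : Set ℝ := {r | r ∈ uIcc u w ∧ κ ≤ ‖p r - p u‖} with hA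
  have hcont : ContinuousOn (fun r => ‖p r - p u‖) (uIcc u w) := (hp.sub continuousOn_const).norm
  have hAc : IsCompact A := by
    refine isCompact_uIcc.of_isClosed_subset ?_ fun r hr => hr.1
    exact hcont.preimage_isClosed_of_isClosed isClosed_Icc isClosed_Ici
  obtain ⟨b, hb, hmin⟩ := hAc.exists_isMinOn (f := fun r => |r - u|) ⟨w, right_mem_uIcc, hw⟩
    (by fun_prop)
  have hlt : ∀ x ∈ uIoc u b, x ≠ b → p x ∈ ball 0 (R + κ) := by
    intro x hx hxb
    have hx' := uIoc_subset_uIcc hx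
    have h1 : |x - u| < |b - u| := by
      rcases le_total u b with h | h
      · rw [uIcc_of_le h] at hx'
        rw [abs_of_nonneg (sub_nonneg.2 hx'.1), abs_of_nonneg (sub_nonneg.2 h)]
        have := lt_of_le_of_ne hx'.2 hxb
        linarith
      · rw [uIcc_of_ge h] at hx'
        rw [abs_of_nonpos (sub_nonpos.2 hx'.2), abs_of_nonpos (sub_nonpos.2 h)]
        have := lt_of_le_of_ne hx'.1 (Ne.symm hxb)
        linarith
    have h2 : ‖p x - p u‖ < κ := by
      by_contra! hcon
      have := hmin (show x ∈ A from ⟨uIcc_subset_uIcc_left hb.1 hx', hcon⟩)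
      exact absurd h1 (not_lt.2 this)
    rw [mem_ball_zero_iff] at hu ⊢
    calc ‖p x‖ = ‖p u + (p x - p u)‖ := by rw [add_sub_cancel]
      _ ≤ _ := norm_add_le _ _
      _ < _ := by linarith
  have hlen : |b - u| ≤ |w - u| := hmin (show w ∈ A from ⟨right_mem_uIcc, hw⟩)
  have h1 : ofReal κ ≤ ∫⁻ r in uIoc u b, ‖v r‖ₑ := by
    calc ofReal κ ≤ ‖p b - p u‖ₑ := by
          rw [← ofReal_norm]; exact ofReal_le_ofReal hb.2
      _ = ‖∫ x in uIoc u b, v x‖ₑ := by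
          rw [hsub b hb.1, ← ofReal_norm, ← ofReal_norm, intervalIntegral.norm_integral_eq_norm_integral_uIoc]
      _ ≤ _ := enorm_integral_le_lintegral_enorm _
  have h2 : ∫⁻ r in uIoc u b, ‖v r‖ₑ ≤
      (∫⁻ r in I, (p ⁻¹' ball 0 (R + κ)).indicator (fun r => ‖v r‖ₑ - N) r)
        + ofReal (κ / 2) := by
    calc ∫⁻ r in uIoc u b, ‖v r‖ₑ
        ≤ ∫⁻ r in uIoc u b, ((p ⁻¹' ball 0 (R + κ)).indicator (fun r => ‖v r‖ₑ - N) r + N) := by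
          refine lintegral_mono_ae ?_
          have hne : ∀ᵐ x ∂(volume.restrict (uIoc u b)), x ≠ b :=
            ae_restrict_of_ae (compl_mem_ae_iff.2 (measure_singleton b))
          filter_upwards [hne, ae_restrict_mem measurableSet_uIoc] with x hx hxm
          rw [indicator_of_mem (show x ∈ p ⁻¹' ball 0 (R + κ) from hlt x hxm hx)]
          exact le_tsub_add
      _ = (∫⁻ r in uIoc u b, (p ⁻¹' ball 0 (R + κ)).indicator (fun r => ‖v r‖ₑ - N) r)
          + N * ofReal |b - u| := by
          rw [lintegral_add_right _ measurable_const, setLIntegral_const, Real.volume_uIoc]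
      _ ≤ _ := by
          refine add_le_add (lintegral_mono_set ?_) ((mul_le_mul_right (ofReal_le_ofReal hlen) N).trans hN)
          exact uIoc_subset_uIcc.trans ((uIcc_subset_uIcc_left hb.1).trans hI)
  have h3 : ofReal κ = ofReal (κ / 2) + ofReal (κ / 2) := by
    rw [← ofReal_add (by linarith) (by linarith), add_halves]
  have h4 := h1.trans h2
  rw [h3] at h4
  exact (ENNReal.add_le_add_iff_right ofReal_ne_top).1 h4

section Paths

variable {μ : Measure (PS d)} {e₀ : ℝ} (F : AFlows d μ e₀)

/-- The limit vector field. -/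
def bfl (s : ℝ) (z : PS d) : PS d := (z.2, fld d 0 (nu F μ s) z.1)

lemma measurable_bfl (s : ℝ) : Measurable (bfl F s) := by
  have := measurable_fld (d := d) 0 (nu F μ s)
  unfold bfl
  fun_prop

lemma continuousOn_pth (n : ℕ) (u : ℝ) (z : PS d) : ContinuousOn (fun r => pth F n u r z) (Ici 0) :=
  (F n).continuousOn _

lemma setLIntegral_fst (R : ℝ) {f : Ed d → ℝ≥0∞} (hf : Measurable f) :
    ∫⁻ z in ball (0 : PS d) R, f z.1 = (∫⁻ x in ball (0 : Ed d) R, f x) * volume (ball (0 : Ed d) R) :=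
  setLIntegral_fst_comp (P := id) (MeasurePreserving.id _) hf R

lemma lintegral_bfl_lt_top (hd : 1 ≤ d) (s R : ℝ) :
    ∫⁻ z in ball (0 : PS d) R, ‖bfl F s z‖ₑ < ⊤ := by
  have hm := measurable_fld (d := d) 0 (nu F μ s)
  calc ∫⁻ z in ball (0 : PS d) R, ‖bfl F s z‖ₑ
      ≤ ∫⁻ z in ball (0 : PS d) R, (ofReal R + ‖fld d 0 (nu F μ s) z.1‖ₑ) := by
        refine setLIntegral_mono (by fun_prop) fun z hz => ?_
        rw [enorm_prod]
        refine (max_le_add_of_nonneg zero_le zero_le).trans (add_le_add_left ?_ _)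
        rw [← ofReal_norm]
        rw [ball_prod] at hz
        exact ofReal_le_ofReal (mem_ball_zero_iff.1 hz.2).le
    _ = _ := by
        rw [lintegral_add_left measurable_const, setLIntegral_fst R (f := fun x => ‖fld d 0 (nu F μ s) x‖ₑ) (by fun_prop)]
    _ < ⊤ := by
        rw [setLIntegral_const]
        exact ENNReal.add_lt_top.2 ⟨ENNReal.mul_lt_top ENNReal.ofReal_lt_top measure_ball_lt_top,
          ENNReal.mul_lt_top (lintegral_fld_lt_top hd _ R) measure_ball_lt_top⟩

variable [IsFiniteMeasure μ]

lemma bfl_continuous (hd : 3 ≤ d) (hμ : μ ≪ volume) (T R : ℝ) {θ : ℝ≥0∞} (hθ : θ ≠ 0) :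
    ∃ τ > 0, ∀ s ∈ Icc 0 T, ∀ t ∈ Icc 0 T, |t - s| ≤ τ →
      ∫⁻ z in ball (0 : PS d) R, ‖bfl F t z - bfl F s z‖ₑ ≤ θ := by
  obtain ⟨Δ, hΔ, hΔ1⟩ := exists_mul_le_one (c := volume (ball (0 : Ed d) R) / θ)
    (ENNReal.div_lt_top measure_ball_lt_top.ne hθ).ne
  obtain ⟨τ, hτ, h⟩ := field_continuous hd hμ F T R hΔ
  refine ⟨τ, hτ, fun s hs t ht hst => ?_⟩
  have hm := measurable_fld (d := d) 0 (nu F μ s)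
  have hm' := measurable_fld (d := d) 0 (nu F μ t)
  have e : ∀ z, ‖bfl F t z - bfl F s z‖ₑ = ‖fld d 0 (nu F μ t) z.1 - fld d 0 (nu F μ s) z.1‖ₑ := by
    intro z; simp [bfl, enorm_prod]
  simp only [e]
  rw [setLIntegral_fst R (f := fun x => ‖fld d 0 (nu F μ t) x - fld d 0 (nu F μ s) x‖ₑ) (by fun_prop)]
  calc _ ≤ Δ * volume (ball (0 : Ed d) R) := by gcongr; exact h s hs t ht hst
    _ ≤ θ := by
      rw [mul_comm]
      refine (ENNReal.div_le_iff_le_mul (Or.inl hθ) (Or.inr ?_)).1 ?_ |>.trans_eq (one_mul _)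
      · exact one_ne_zero
      · rwa [ENNReal.mul_div_right_comm]

lemma vel_near (hd : 3 ≤ d) (hμ : μ ≪ volume) (T R : ℝ) {θ : ℝ≥0∞} (hθ : θ ≠ 0) :
    ∃ τ > 0, ∀ᶠ n : ℕ in UF, T ≤ n ∧ ∀ u, ∀ s ∈ Icc 0 T, ∀ r ∈ Icc 0 T, |r - s| ≤ τ →
      ∫⁻ z in pth F n u r ⁻¹' ball 0 R, ‖vel F n u r z - bfl F s (pth F n u r z)‖ₑ ≤ θ := by
  have hθ3 : θ / 3 ≠ 0 := by simpa using hθ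
  set V := volume (ball (0 : Ed d) R) with hV
  set V' := volume (ball (0 : PS d) R) with hV'
  obtain ⟨Δ, hΔ, hΔ1⟩ := exists_mul_le_one (c := V / (θ / 3))
    (ENNReal.div_lt_top measure_ball_lt_top.ne hθ3).ne
  have hΔ2 : Δ * V ≤ θ / 3 := by
    rw [mul_comm]
    refine (ENNReal.div_le_iff_le_mul (Or.inl hθ3) (Or.inr one_ne_zero)).1 ?_ |>.trans_eq (one_mul _)
    rwa [ENNReal.mul_div_right_comm]
  obtain ⟨τ, hτ, hb⟩ := bfl_continuous F hd hμ T R hθ3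
  have he : ∀ᶠ n in UF, ofReal (eps n * (1 + R)) * V' ≤ θ / 3 := by
    refine UF_le ?_
    have h1 : Tendsto (fun n => ofReal (eps n * (1 + R)) * V') atTop (𝓝 0) := by
      have : Tendsto (fun n => eps n * (1 + R)) atTop (𝓝 0) := by
        simpa using tendsto_eps.mul_const (1 + R)
      have := ENNReal.Tendsto.mul_const (b := V') ((ENNReal.continuous_ofReal.tendsto 0).comp this)
        (Or.inr measure_ball_lt_top.ne)
      simpa using this
    exact h1.eventually_le_const hθ3.bot_lt
  refine ⟨τ, hτ, ?_⟩
  filter_upwards [he, field_conv hd hμ F T R hΔ, UF_le (eventually_ge_atTop ⌈T⌉₊)] with n hn hf hT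
  have hTn : T ≤ n := (Nat.le_ceil T).trans (by exact_mod_cast hT)
  refine ⟨hTn, fun u s hs r hr hrs => ?_⟩
  have hpm : Measurable (pth F n u r) := (mp_pth F n u r).measurable
  set p := pth F n u r with hp
  have hE1 := measurable_fld (d := d) (eps n) (μ.map ((F n).Z r))
  have hE0 := measurable_fld (d := d) 0 (nu F μ r)
  have mb := measurable_bfl F s
  have mb' := measurable_bfl F r
  calc ∫⁻ z in p ⁻¹' ball 0 R, ‖vel F n u r z - bfl F s (p z)‖ₑ
      ≤ ∫⁻ z in p ⁻¹' ball 0 R, (ofReal (eps n * (1 + R))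
          + (‖fld d (eps n) (μ.map ((F n).Z r)) (p z).1 - fld d 0 (nu F μ r) (p z).1‖ₑ
          + ‖bfl F r (p z) - bfl F s (p z)‖ₑ)) := by
        refine setLIntegral_mono (by fun_prop) fun z hz => ?_
        have hz' : (p z).2 ∈ ball (0 : Ed d) R := by
          have : p z ∈ ball (0 : PS d) R := hz
          rw [ball_prod] at this; exact this.2
        have h1 := norm_vel_sub_le F u (n := n) ⟨hr.1, hr.2.trans hTn⟩ z
        rw [← hp] at h1
        have h2 : vel F n u r z - bfl F s (p z)
            = (vel F n u r z - ((p z).2, fld d (eps n) (μ.map ((F n).Z r)) (p z).1))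
              + ((0, fld d (eps n) (μ.map ((F n).Z r)) (p z).1 - fld d 0 (nu F μ r) (p z).1)
              + (bfl F r (p z) - bfl F s (p z))) := by
          ext <;> simp [bfl]
        rw [h2]
        refine (enorm_add_le _ _).trans (add_le_add ?_ ((enorm_add_le _ _).trans (add_le_add ?_ le_rfl)))
        · rw [← ofReal_norm]
          refine ofReal_le_ofReal (h1.trans ?_)
          have := (mem_ball_zero_iff.1 hz').le
          have := (eps_pos n).le
          gcongr
        · simp [enorm_prod]
    _ ≤ ofReal (eps n * (1 + R)) * V' + (Δ * V + θ / 3) := by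
        rw [lintegral_add_left measurable_const, lintegral_add_left (by fun_prop), setLIntegral_const,
          (mp_pth F n u r).measure_preimage measurableSet_ball.nullMeasurableSet,
          setLIntegral_fst_comp (mp_pth F n u r) (f := fun x =>
            ‖fld d (eps n) (μ.map ((F n).Z r)) x - fld d 0 (nu F μ r) x‖ₑ) (by fun_prop)]
        refine add_le_add le_rfl (add_le_add ?_ ?_)
        · gcongr; exact hf r hr
        · rw [(mp_pth F n u r).setLIntegral_comp_preimage measurableSet_ball
            (f := fun z => ‖bfl F r z - bfl F s z‖ₑ) (by fun_prop)]
          exact hb s hs r hr hrs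
    _ ≤ θ / 3 + (θ / 3 + θ / 3) := by gcongr
    _ = θ := by rw [← add_assoc]; exact ENNReal.add_thirds θ

/-- Over short time intervals few points move far. -/
lemma disp (hd : 3 ≤ d) (hμ : μ ≪ volume) (T R : ℝ) {κ : ℝ} (hκ : 0 < κ) {θ : ℝ≥0∞} (hθ : θ ≠ 0)
    {s : ℝ} (hs : s ∈ Icc 0 T) :
    ∃ τ > 0, ∀ᶠ n in UF, ∀ t ∈ Icc 0 T, |t - s| ≤ τ → ∀ u ∈ uIcc s t,
      volume {z | z ∈ ball (0 : PS d) R ∧ ∃ r ∈ uIcc s t, κ ≤ ‖pth F n u r z - z‖}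
        ≤ θ * ofReal |t - s| := by
  have hκ2 : 0 < κ / 2 := half_pos hκ
  set c := ofReal (κ / 2) with hc
  have hc0 : c ≠ 0 := by simpa [hc] using hκ
  have hct : c ≠ ⊤ := ofReal_ne_top
  set θ' := c * θ / 2 with hθ'
  have hθ'0 : θ' ≠ 0 := by simp [hθ', hc0, hθ]
  obtain ⟨N, hN⟩ := exists_tail (g := fun z => ‖bfl F s z‖ₑ) (μ := volume.restrict (ball 0 (R + κ)))
    (measurable_bfl F s).enorm (lintegral_bfl_lt_top F (by omega) s _).ne hθ'0
  obtain ⟨τ, hτ, h⟩ := vel_near F hd hμ T (R + κ) hθ'0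
  have hN1 : (0 : ℝ) < N + 1 := by positivity
  refine ⟨min τ (κ / 2 / (N + 1)), lt_min hτ (div_pos hκ2 hN1), ?_⟩
  filter_upwards [h] with n hn t ht hst u hu
  have h0 : ∀ r ∈ uIcc s t, r ∈ Icc (0 : ℝ) T := fun r hr => uIcc_subset_Icc hs ht hr
  have hpm := measurable_pth F n u
  have hvm := measurable_vel F n u
  set p := pth F n u with hp
  set G : Set (ℝ × PS d) := {x | p x.1 x.2 ∈ ball 0 (R + κ)} with hG
  have hGm : MeasurableSet G := hpm measurableSet_ball
  set f : ℝ × PS d → ℝ≥0∞ := G.indicator fun x => ‖vel F n u x.1 x.2‖ₑ - N with hf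
  have hfm : Measurable f := (hvm.enorm.sub_const _).indicator hGm
  have hsub : {z | z ∈ ball (0 : PS d) R ∧ ∃ r ∈ uIcc s t, κ ≤ ‖p r z - z‖}
      ⊆ {z | c ≤ ∫⁻ r in uIcc s t, f (r, z)} := by
    rintro z ⟨hz, w, hw, hκw⟩
    have hUI : uIcc u w ⊆ uIcc s t := uIcc_subset_uIcc hu hw
    have hpu : p u z = z := pth_self F n u z
    refine (le_lintegral_of_exit (p := fun r => p r z) (v := fun r => vel F n u r z) (N := N) hκ hUI
      ((continuousOn_pth F n u z).mono fun r hr => (h0 r (hUI hr)).1)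
      (fun r hr => pth_sub F u (h0 u hu).1 (h0 r (hUI hr)).1 z) (R := R) (by rwa [hpu])
      (by rwa [hpu]) ?_)
    have h1 : |w - u| ≤ |t - s| := abs_sub_le_of_uIcc_subset_uIcc hUI
    have h2 := (le_min_iff.1 hst).2
    rw [le_div_iff₀ hN1] at h2
    rw [show ((N : ℕ) : ℝ≥0∞) = ofReal N by simp, ← ofReal_mul (by positivity)]
    refine ofReal_le_ofReal ?_
    nlinarith [abs_nonneg (t - s), mul_le_mul_of_nonneg_left h1 (Nat.cast_nonneg (α := ℝ) N)]
  have hI : Measurable fun z => ∫⁻ r in uIcc s t, f (r, z) := hfm.lintegral_prod_left'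
  refine (measure_mono hsub).trans ((meas_ge_le_lintegral_div hI.aemeasurable hc0 hct).trans ?_)
  refine ENNReal.div_le_of_le_mul ?_
  rw [lintegral_lintegral_swap (f := fun z r => f (r, z)) (hfm.comp measurable_swap).aemeasurable]
  calc ∫⁻ r in uIcc s t, ∫⁻ z, f (r, z) ≤ ∫⁻ r in uIcc s t, (θ' + θ') := by
        refine setLIntegral_mono measurable_const fun r hr => ?_
        have hpr : Measurable (p r) := (mp_pth F n u r).measurable
        have hvr : Measurable (vel F n u r) := hvm.comp measurable_prodMk_left
        have mb := measurable_bfl F s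
        have e1 : ∀ z, f (r, z) = (p r ⁻¹' ball 0 (R + κ)).indicator (fun z => ‖vel F n u r z‖ₑ - N) z :=
          fun z => rfl
        simp only [e1]
        rw [lintegral_indicator (hpr measurableSet_ball)]
        calc _ ≤ ∫⁻ z in p r ⁻¹' ball 0 (R + κ), (‖vel F n u r z - bfl F s (p r z)‖ₑ
              + (‖bfl F s (p r z)‖ₑ - N)) := by
              refine lintegral_mono fun z => ?_
              refine tsub_le_iff_right.2 ?_
              calc ‖vel F n u r z‖ₑ = ‖(vel F n u r z - bfl F s (p r z)) + bfl F s (p r z)‖ₑ := by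
                    rw [sub_add_cancel]
                _ ≤ _ := enorm_add_le _ _
                _ ≤ _ := by rw [add_assoc]; exact add_le_add le_rfl le_tsub_add
          _ ≤ θ' + θ' := by
              rw [lintegral_add_left (by fun_prop)]
              refine add_le_add (hn.2 u s hs r (h0 r hr) ?_) ?_
              · exact (abs_sub_left_of_mem_uIcc hr).trans (hst.trans (min_le_left _ _))
              · rw [(mp_pth F n u r).setLIntegral_comp_preimage measurableSet_ball
                  (f := fun z => ‖bfl F s z‖ₑ - N) (by fun_prop)]
                exact hN
    _ = _ := by
        rw [setLIntegral_const, hθ', ENNReal.add_halves, Real.volume_interval]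
        ring

end Paths

end VP

namespace VP

variable {d : ℕ}

/-- A cutoff equal to one on the ball of radius `R` and supported in the ball of radius `R + 1`. -/
def cut {E : Type*} [NormedAddCommGroup E] (R : ℝ) (z : E) : ℝ := max 0 (min 1 (R + 1 - ‖z‖))

section Cut

variable {E : Type*} [NormedAddCommGroup E]

lemma continuous_cut (R : ℝ) : Continuous (cut R : E → ℝ) := by unfold cut; fun_prop

lemma cut_nonneg (R : ℝ) (z : E) : 0 ≤ cut R z := le_max_left _ _

lemma cut_le_one (R : ℝ) (z : E) : cut R z ≤ 1 := max_le zero_le_one (min_le_left _ _)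

lemma cut_of_mem {R : ℝ} {z : E} (h : z ∈ ball 0 R) : cut R z = 1 := by
  rw [mem_ball_zero_iff] at h
  rw [cut, min_eq_left (by linarith), max_eq_right zero_le_one]

lemma cut_of_notMem {R : ℝ} {z : E} (h : z ∉ ball 0 (R + 1)) : cut R z = 0 := by
  rw [mem_ball_zero_iff, not_lt] at h
  rw [cut, max_eq_left ((min_le_right _ _).trans (by linarith))]

end Cut

/-- Truncation to the interval `[-1, 1]`. -/
def clamp (r : ℝ) : ℝ := max (-1) (min 1 r)

lemma abs_clamp_le (r : ℝ) : |clamp r| ≤ 1 :=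
  abs_le.2 ⟨le_max_left _ _, max_le (by norm_num) (min_le_left _ _)⟩

lemma abs_le_clamp_mul {w : ℝ} (hw : 0 < w) (g : ℝ) : |g| ≤ clamp (g / w) * g + w := by
  unfold clamp
  rcases le_total w |g| with h | h
  · rcases le_total 0 g with h0 | h0
    · rw [abs_of_nonneg h0] at h ⊢
      have : 1 ≤ g / w := (one_le_div hw).2 h
      rw [min_eq_left this, max_eq_right (by norm_num)]; linarith
    · rw [abs_of_nonpos h0] at h ⊢
      have : g / w ≤ -1 := by rw [div_le_iff₀ hw]; linarith
      rw [min_eq_right (by linarith), max_eq_left this]; linarith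
  · have h1 := abs_le.1 h
    have : |g / w| ≤ 1 := by rw [abs_div, abs_of_pos hw]; exact (div_le_one hw).2 h
    have h2 := abs_le.1 this
    rw [min_eq_right h2.2, max_eq_right h2.1]
    have : 0 ≤ g / w * g := by
      rw [div_mul_eq_mul_div]; exact div_nonneg (mul_self_nonneg g) hw.le
    linarith

lemma exists_mul_le {c ω : ℝ≥0∞} (hc : c ≠ ⊤) (hω : ω ≠ 0) :
    ∃ Δ : ℝ≥0∞, Δ ≠ 0 ∧ Δ ≠ ⊤ ∧ c * Δ ≤ ω := by
  obtain ⟨Δ, hΔ, h⟩ := exists_mul_le_one (c := c / ω) (ENNReal.div_lt_top hc hω).ne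
  have h1 : c * Δ ≤ ω := by
    refine (ENNReal.div_le_iff_le_mul (Or.inl hω) (Or.inr one_ne_zero)).1 ?_ |>.trans_eq (one_mul _)
    rwa [ENNReal.mul_div_right_comm]
  exact ⟨min Δ 1, (lt_min hΔ.bot_lt one_pos).ne', (min_le_right _ _).trans_lt ENNReal.one_lt_top |>.ne,
    (mul_le_mul_right (min_le_left _ _) c).trans h1⟩

lemma exists_ofReal_mul_le {c ω : ℝ≥0∞} (hc : c ≠ ⊤) (hω : ω ≠ 0) :
    ∃ w : ℝ, 0 < w ∧ ofReal w * c ≤ ω := by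
  obtain ⟨Δ, h0, ht, h⟩ := exists_mul_le hc hω
  exact ⟨Δ.toReal, ENNReal.toReal_pos h0 ht, by rwa [ENNReal.ofReal_toReal ht, mul_comm]⟩

lemma exists_comp_sub {G : Type*} [NormedAddCommGroup G] [NormedSpace ℝ G] {h : PS d → G}
    (hh : Integrable h) {ω : ℝ≥0∞} (hω : ω ≠ 0) :
    ∃ κ > 0, ∃ R : ℝ, ∃ θ : ℝ≥0∞, θ ≠ 0 ∧ ∀ p : PS d → PS d, MeasurePreserving p volume volume →
      volume {z | z ∈ ball 0 R ∧ κ ≤ ‖p z - z‖} ≤ θ →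
      volume {z | p z ∈ ball 0 R ∧ κ ≤ ‖p z - z‖} ≤ θ → ∫⁻ z, ‖h (p z) - h z‖ₑ ≤ ω := by
  have hω4 : ω / 4 ≠ 0 := by simpa using hω
  obtain ⟨g, hgs, hgL, hgc, -⟩ := hh.exists_hasCompactSupport_lintegral_sub_le hω4
  obtain ⟨R, hR⟩ := hgs.isCompact.isBounded.subset_ball (0 : PS d)
  have hg0 : ∀ z, z ∉ ball (0 : PS d) R → g z = 0 := fun z hz =>
    image_eq_zero_of_notMem_tsupport fun h => hz (hR h)
  obtain ⟨M, hM⟩ := hgs.exists_bound_of_continuous hgc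
  set V := volume (ball (0 : PS d) R) with hV
  have hω8 : ω / 8 ≠ 0 := by simpa using hω
  obtain ⟨w, hw0, hw⟩ := exists_ofReal_mul_le (c := V) measure_ball_lt_top.ne hω8
  obtain ⟨κ, hκ, hu⟩ := uniformContinuous_iff.1
    (hgs.uniformContinuous_of_continuous hgc) w hw0
  obtain ⟨θ, hθ, -, hMθ⟩ := exists_mul_le (c := ofReal (2 * M)) ofReal_ne_top hω8
  refine ⟨κ, hκ, R, θ, hθ, fun p hp h1 h2 => ?_⟩
  have hpm := hp.measurable
  have hB : MeasurableSet (ball (0 : PS d) R) := measurableSet_ball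
  have hfar : MeasurableSet {z | κ ≤ ‖p z - z‖} := measurableSet_le measurable_const (by fun_prop)
  have key : ∫⁻ z, ‖g (p z) - g z‖ₑ ≤ ω / 2 := by
    calc ∫⁻ z, ‖g (p z) - g z‖ₑ
        ≤ ∫⁻ z, (((ball (0 : PS d) R).indicator (fun _ => ofReal w) z
            + (p ⁻¹' ball (0 : PS d) R).indicator (fun _ => ofReal w) z)
          + ({z | z ∈ ball 0 R ∧ κ ≤ ‖p z - z‖}.indicator (fun _ => ofReal (2 * M)) z
            + {z | p z ∈ ball 0 R ∧ κ ≤ ‖p z - z‖}.indicator (fun _ => ofReal (2 * M)) z)) := by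
          refine lintegral_mono fun z => ?_
          by_cases hf : κ ≤ ‖p z - z‖
          · have hb : ‖g (p z) - g z‖ₑ ≤ ofReal (2 * M) := by
              rw [← ofReal_norm]
              refine ofReal_le_ofReal ((norm_sub_le _ _).trans ?_)
              linarith [hM (p z), hM z]
            by_cases hz : z ∈ ball (0 : PS d) R
            · refine hb.trans (le_trans ?_ le_add_self)
              rw [indicator_of_mem (show z ∈ {z | z ∈ ball 0 R ∧ κ ≤ ‖p z - z‖} from ⟨hz, hf⟩)]
              exact le_self_add
            · by_cases hz' : p z ∈ ball (0 : PS d) R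
              · refine hb.trans (le_trans ?_ le_add_self)
                rw [indicator_of_mem (show z ∈ {z | p z ∈ ball 0 R ∧ κ ≤ ‖p z - z‖} from ⟨hz', hf⟩)]
                exact le_add_self
              · simp [hg0 z hz, hg0 _ hz']
          · have hb : ‖g (p z) - g z‖ₑ ≤ ofReal w := by
              rw [← ofReal_norm, ← dist_eq_norm]
              exact ofReal_le_ofReal (hu (by rw [dist_eq_norm]; exact not_le.1 hf)).le
            by_cases hz : z ∈ ball (0 : PS d) R
            · refine hb.trans (le_trans ?_ le_self_add)
              rw [indicator_of_mem hz]
              exact le_self_add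
            · by_cases hz' : p z ∈ ball (0 : PS d) R
              · refine hb.trans (le_trans ?_ le_self_add)
                rw [indicator_of_mem (show z ∈ p ⁻¹' ball (0 : PS d) R from hz')]
                exact le_add_self
              · simp [hg0 z hz, hg0 _ hz']
      _ ≤ (ω / 8 + ω / 8) + (ω / 8 + ω / 8) := by
          have mA : MeasurableSet {z | z ∈ ball (0 : PS d) R ∧ κ ≤ ‖p z - z‖} := hB.inter hfar
          have mB : MeasurableSet {z | p z ∈ ball (0 : PS d) R ∧ κ ≤ ‖p z - z‖} :=
            (hpm hB).inter hfar
          rw [lintegral_add_left (f := fun z => (ball (0 : PS d) R).indicator (fun _ => ofReal w) z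
              + (p ⁻¹' ball (0 : PS d) R).indicator (fun _ => ofReal w) z)
              ((measurable_const.indicator hB).add (measurable_const.indicator (hpm hB))),
            lintegral_add_left (measurable_const.indicator hB),
            lintegral_add_left (measurable_const.indicator mA),
            lintegral_indicator_const hB, lintegral_indicator_const (hpm hB),
            lintegral_indicator_const mA, lintegral_indicator_const mB,
            hp.measure_preimage hB.nullMeasurableSet]
          exact add_le_add (add_le_add hw hw) (add_le_add ((mul_le_mul_right h1 _).trans hMθ)
            ((mul_le_mul_right h2 _).trans hMθ))
      _ = ω / 2 := by
          rw [← two_mul, ← two_mul, ← mul_assoc, ← mul_div_assoc]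
          rw [ENNReal.div_eq_div_iff (by norm_num) (by norm_num) (by norm_num) (by norm_num)]
          ring
  have hme : AEMeasurable (fun z => ‖h z - g z‖ₑ) :=
    (hh.aestronglyMeasurable.sub hgc.aestronglyMeasurable).enorm
  calc ∫⁻ z, ‖h (p z) - h z‖ₑ
      ≤ ∫⁻ z, (‖h (p z) - g (p z)‖ₑ + (‖g (p z) - g z‖ₑ + ‖h z - g z‖ₑ)) := by
        refine lintegral_mono fun z => ?_
        have e : h (p z) - h z = (h (p z) - g (p z)) + ((g (p z) - g z) + -(h z - g z)) := by abel
        rw [e]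
        refine (enorm_add_le _ _).trans (add_le_add le_rfl ((enorm_add_le _ _).trans ?_))
        rw [enorm_neg]
    _ = (∫⁻ z, ‖h (p z) - g (p z)‖ₑ) + ((∫⁻ z, ‖g (p z) - g z‖ₑ) + ∫⁻ z, ‖h z - g z‖ₑ) := by
        rw [lintegral_add_left' (f := fun z => ‖h (p z) - g (p z)‖ₑ)
          (hme.comp_quasiMeasurePreserving hp.quasiMeasurePreserving),
          lintegral_add_right' _ hme]
    _ ≤ ω / 4 + (ω / 2 + ω / 4) := by
        refine add_le_add ?_ (add_le_add key hgL)
        have : ∫⁻ z, ‖h (p z) - g (p z)‖ₑ = ∫⁻ z, ‖h z - g z‖ₑ := by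
          conv_rhs => rw [← hp.map_eq]
          rw [lintegral_map' (by rw [hp.map_eq]; exact hme) hpm.aemeasurable]
        rw [this]; exact hgL
    _ = ω := by
        rw [add_left_comm, ← two_mul, ← mul_div_assoc]
        rw [show (2 : ℝ≥0∞) * ω / 4 = ω / 2 by
          rw [ENNReal.div_eq_div_iff (by norm_num) (by norm_num) (by norm_num) (by norm_num)]; ring]
        exact ENNReal.add_halves ω

end VP

namespace VP

variable {d : ℕ} {μ : Measure (PS d)} {e₀ : ℝ} (F : AFlows d μ e₀)

/-- The density of the limit of the images of `m` under the approximate flows. -/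
def dens (m : Measure (PS d)) (t : ℝ) (z : PS d) : ℝ := ((nu F m t).rnDeriv volume z).toReal

variable {m : Measure (PS d)}

lemma measurable_dens (t : ℝ) : Measurable (dens F m t) :=
  (Measure.measurable_rnDeriv _ _).ennreal_toReal

lemma dens_nonneg (t : ℝ) (z : PS d) : 0 ≤ dens F m t z := ENNReal.toReal_nonneg

lemma integrable_dens (t : ℝ) : Integrable (dens F m t) := Measure.integrable_toReal_rnDeriv

lemma lintegral_pair_sub_le {n j : ℕ} {u w T R κ ω : ℝ} {D γ : ℝ≥0∞} {Φ : PS d → PS d → ℝ}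
    (hΦ1 : ∀ z y, |Φ z y| ≤ 1) (hΦ0 : ∀ z ∉ ball (0 : PS d) R, ∀ y, Φ z y = 0)
    (hΦc : ∀ z y y', ‖y - y'‖ ≤ κ → |Φ z y - Φ z y'| ≤ ω) (hw : w ∈ Icc 0 T)
    (hn : volume {z | z ∈ ball (0 : PS d) R ∧ ∃ r ∈ uIcc u w, 1 ≤ ‖pth F n u r z - z‖} ≤ D)
    (hj : volume {z | z ∈ ball (0 : PS d) R ∧ ∃ r ∈ uIcc u w, 1 ≤ ‖pth F j u r z - z‖} ≤ D)
    (hst : volume {z : PS d | ∃ t ∈ Icc 0 T, (∀ r ∈ uIcc u t, pth F n u r z ∈ ball 0 (R + 1) ∧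
      pth F j u r z ∈ ball 0 (R + 1)) ∧ κ < ‖pth F n u t z - pth F j u t z‖} ≤ γ) :
    ∫⁻ z, ‖Φ z (pth F n u w z) - Φ z (pth F j u w z)‖ₑ
      ≤ ofReal ω * volume (ball (0 : PS d) R) + 2 * (D + D + γ) := by
  set A := {z | z ∈ ball (0 : PS d) R ∧ ∃ r ∈ uIcc u w, 1 ≤ ‖pth F n u r z - z‖} with hA
  set B := {z | z ∈ ball (0 : PS d) R ∧ ∃ r ∈ uIcc u w, 1 ≤ ‖pth F j u r z - z‖} with hB
  set C := {z : PS d | ∃ t ∈ Icc 0 T, (∀ r ∈ uIcc u t, pth F n u r z ∈ ball 0 (R + 1) ∧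
      pth F j u r z ∈ ball 0 (R + 1)) ∧ κ < ‖pth F n u t z - pth F j u t z‖} with hC
  set M := toMeasurable volume (A ∪ B ∪ C) with hM
  have hMm : MeasurableSet M := measurableSet_toMeasurable _ _
  have hvM : volume M ≤ D + D + γ := by
    rw [hM, measure_toMeasurable]
    exact (measure_union_le _ _).trans (add_le_add ((measure_union_le _ _).trans (add_le_add hn hj)) hst)
  calc ∫⁻ z, ‖Φ z (pth F n u w z) - Φ z (pth F j u w z)‖ₑ
      ≤ ∫⁻ z, ((ball (0 : PS d) R).indicator (fun _ => ofReal ω) z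
          + M.indicator (fun _ => 2) z) := by
        refine lintegral_mono fun z => ?_
        by_cases hz : z ∈ ball (0 : PS d) R
        · by_cases hzM : z ∈ A ∪ B ∪ C
          · rw [indicator_of_mem (subset_toMeasurable volume _ hzM : z ∈ M)]
            refine le_trans ?_ le_add_self
            rw [← ofReal_norm, ← ENNReal.ofReal_ofNat 2]
            refine ofReal_le_ofReal ((norm_sub_le _ _).trans ?_)
            have h1 := hΦ1 z (pth F n u w z)
            have h2 := hΦ1 z (pth F j u w z)
            rw [norm_eq_abs, norm_eq_abs]
            norm_num at *
            linarith
          · rw [indicator_of_mem hz]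
            refine le_trans ?_ le_self_add
            rw [← ofReal_norm]
            refine ofReal_le_ofReal (hΦc _ _ _ ?_)
            by_contra! hcon
            refine hzM (Or.inr ⟨w, hw, fun r hr => ?_, hcon⟩)
            have hstay : ∀ i : ℕ, ¬ (z ∈ ball (0 : PS d) R ∧ ∃ r ∈ uIcc u w, 1 ≤ ‖pth F i u r z - z‖) →
                pth F i u r z ∈ ball (0 : PS d) (R + 1) := by
              intro i hi
              have h1 : ‖pth F i u r z - z‖ < 1 := by
                by_contra! h
                exact hi ⟨hz, r, hr, h⟩
              rw [mem_ball_zero_iff] at hz ⊢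
              calc ‖pth F i u r z‖ = ‖z + (pth F i u r z - z)‖ := by rw [add_sub_cancel]
                _ ≤ _ := norm_add_le _ _
                _ < _ := by linarith
            exact ⟨hstay n fun h => hzM (Or.inl (Or.inl h)), hstay j fun h => hzM (Or.inl (Or.inr h))⟩
        · simp [hΦ0 z hz]
    _ = ofReal ω * volume (ball (0 : PS d) R) + 2 * volume M := by
        rw [lintegral_add_left (measurable_const.indicator measurableSet_ball),
          lintegral_indicator_const measurableSet_ball, lintegral_indicator_const hMm]
    _ ≤ _ := by gcongr

lemma enorm_integral_pair_sub_le {k : ℝ≥0∞} (hk : m ≤ k • volume) [IsFiniteMeasure m] {n j : ℕ} {s t : ℝ}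
    {Ψ : PS d → PS d → ℝ} (hΨm : Measurable (uncurry Ψ)) (hΨ1 : ∀ z y, |Ψ z y| ≤ 1) {X Y : ℝ≥0∞}
    (hX : ∫⁻ z, ‖Ψ z (pth F n s t z) - Ψ z (pth F j s t z)‖ₑ ≤ X)
    (hY : ∫⁻ y, ‖Ψ (pth F n t s y) y - Ψ (pth F j t s y) y‖ₑ ≤ Y) :
    ‖(∫ a, Ψ ((F j).Z s a) (pth F n s t ((F j).Z s a)) ∂m)
      - ∫ a, Ψ (pth F n t s ((F j).Z t a)) ((F j).Z t a) ∂m‖ₑ ≤ k * (X + Y) := by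
  have h1 : Measurable (pth F n s t) := (mp_pth F n s t).measurable
  have h2 : Measurable (pth F n t s) := (mp_pth F n t s).measurable
  have h1' : Measurable (pth F j s t) := (mp_pth F j s t).measurable
  have h2' : Measurable (pth F j t s) := (mp_pth F j t s).measurable
  have hs := ((F j).Z s).measurable
  have ht := ((F j).Z t).measurable
  have hm : ∀ {f g : PS d → PS d}, Measurable f → Measurable g → Measurable fun a => Ψ (f a) (g a) :=
    fun hf hg => hΨm.comp (hf.prodMk hg)
  have hi : ∀ {f g : PS d → PS d}, Measurable f → Measurable g →
      Integrable (fun a => Ψ (f a) (g a)) m := fun hf hg =>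
    Integrable.of_bound (hm hf hg).aestronglyMeasurable 1 (.of_forall fun a => hΨ1 _ _)
  have hle : ∀ {f : PS d → ℝ≥0∞} (r : ℝ), Measurable f →
      ∫⁻ a, f ((F j).Z r a) ∂m ≤ k * ∫⁻ z, f z := by
    intro f r hf
    calc ∫⁻ a, f ((F j).Z r a) ∂m ≤ ∫⁻ a, f ((F j).Z r a) ∂(k • volume) := lintegral_mono' hk le_rfl
      _ = k * ∫⁻ z, f z := by rw [lintegral_smul_measure, ((F j).mp r).lintegral_comp hf, smul_eq_mul]
  have e1 : ∀ a, pth F j s t ((F j).Z s a) = (F j).Z t a := fun a => by simp [pth]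
  have e2 : ∀ a, pth F j t s ((F j).Z t a) = (F j).Z s a := fun a => by simp [pth]
  have i1 : Integrable (fun a => Ψ ((F j).Z s a) (pth F n s t ((F j).Z s a))) m := hi hs (h1.comp hs)
  have i2 : Integrable (fun a => Ψ (pth F n t s ((F j).Z t a)) ((F j).Z t a)) m := hi (h2.comp ht) ht
  rw [← integral_sub i1 i2]
  calc _ ≤ ∫⁻ a, ‖Ψ ((F j).Z s a) (pth F n s t ((F j).Z s a))
        - Ψ (pth F n t s ((F j).Z t a)) ((F j).Z t a)‖ₑ ∂m := enorm_integral_le_lintegral_enorm _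
    _ ≤ ∫⁻ a, (‖Ψ ((F j).Z s a) (pth F n s t ((F j).Z s a)) - Ψ ((F j).Z s a) (pth F j s t ((F j).Z s a))‖ₑ
        + ‖Ψ (pth F n t s ((F j).Z t a)) ((F j).Z t a)
            - Ψ (pth F j t s ((F j).Z t a)) ((F j).Z t a)‖ₑ) ∂m := by
        refine lintegral_mono fun a => ?_
        rw [e1, e2, ← enorm_neg (Ψ (pth F n t s ((F j).Z t a)) ((F j).Z t a) - _)]
        refine le_trans (le_of_eq ?_) (enorm_add_le _ _)
        congr 1; ring
    _ ≤ k * X + k * Y := by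
        have m1 : Measurable fun z => ‖Ψ z (pth F n s t z) - Ψ z (pth F j s t z)‖ₑ :=
          ((hm measurable_id h1).sub (hm measurable_id h1')).enorm
        have m2 : Measurable fun y => ‖Ψ (pth F n t s y) y - Ψ (pth F j t s y) y‖ₑ :=
          ((hm h2 measurable_id).sub (hm h2' measurable_id)).enorm
        rw [lintegral_add_left (f := fun a => ‖Ψ ((F j).Z s a) (pth F n s t ((F j).Z s a))
          - Ψ ((F j).Z s a) (pth F j s t ((F j).Z s a))‖ₑ) (m1.comp hs)]
        exact add_le_add ((hle s m1).trans (by gcongr)) ((hle t m2).trans (by gcongr))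
    _ = _ := (mul_add _ _ _).symm

/-- The test function used to compare densities at two times. -/
def pairTest (R w : ℝ) (g h : PS d → ℝ) (z y : PS d) : ℝ :=
  cut R z * cut R y * clamp ((g z - h y) / w)

section PairTest

variable {R w : ℝ} {g h : PS d → ℝ}

lemma abs_pairTest_le (z y : PS d) : |pairTest R w g h z y| ≤ 1 := by
  rw [pairTest, abs_mul, abs_mul, abs_of_nonneg (cut_nonneg R z), abs_of_nonneg (cut_nonneg R y)]
  have h1 := abs_clamp_le ((g z - h y) / w)
  have h2 := cut_le_one R z
  have h3 := cut_le_one R y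
  have h4 := cut_nonneg R z
  have h5 := cut_nonneg R y
  calc _ ≤ 1 * 1 * (1 : ℝ) := by gcongr
    _ = 1 := by norm_num

lemma continuous_pairTest (hg : Continuous g) (hh : Continuous h) :
    Continuous (uncurry (pairTest R w g h)) := by
  unfold pairTest clamp uncurry
  have := continuous_cut (E := PS d) R
  fun_prop

lemma exists_pairTest_modulus (hg : Continuous g) (hh : Continuous h) {ω : ℝ} (hω : 0 < ω) :
    ∃ κ > 0, (∀ z y y', ‖y - y'‖ ≤ κ → |pairTest R w g h z y - pairTest R w g h z y'| ≤ ω) ∧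
      ∀ z z' y, ‖z - z'‖ ≤ κ → |pairTest R w g h z y - pairTest R w g h z' y| ≤ ω := by
  have hs : HasCompactSupport (uncurry (pairTest R w g h)) := by
    refine HasCompactSupport.intro ((isCompact_closedBall 0 (R + 1)).prod
      (isCompact_closedBall 0 (R + 1))) fun x hx => ?_
    by_cases h1 : x.1 ∈ ball (0 : PS d) (R + 1)
    · have h2 : x.2 ∉ ball (0 : PS d) (R + 1) := fun h2 =>
        hx ⟨ball_subset_closedBall h1, ball_subset_closedBall h2⟩
      simp [uncurry, pairTest, cut_of_notMem h2]
    · simp [uncurry, pairTest, cut_of_notMem h1]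
  obtain ⟨κ, hκ, hu⟩ := uniformContinuous_iff.1
    (hs.uniformContinuous_of_continuous (continuous_pairTest hg hh)) ω hω
  refine ⟨κ / 2, half_pos hκ, fun z y y' hy => ?_, fun z z' y hz => ?_⟩
  · have := @hu (z, y) (z, y') (by rw [Prod.dist_eq, dist_self, dist_eq_norm]; exact max_lt hκ (by linarith))
    exact this.le
  · have := @hu (z, y) (z', y) (by
      rw [Prod.dist_eq, dist_self, dist_eq_norm]; exact max_lt (by show ‖z - z'‖ < κ; linarith) hκ)
    exact this.le

end PairTest

end VP

namespace VP

variable {d : ℕ} {μ : Measure (PS d)} {e₀ : ℝ} (F : AFlows d μ e₀)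

lemma uIcc_mem_uIcc_subset {s t u : ℝ} (hu : u ∈ ({s, t} : Set ℝ)) (w : ℝ) (hw : w ∈ ({s, t} : Set ℝ)) :
    uIcc u w ⊆ uIcc s t := by
  refine uIcc_subset_uIcc ?_ ?_
  · rcases hu with rfl | rfl
    exacts [left_mem_uIcc, right_mem_uIcc]
  · rcases hw with rfl | rfl
    exacts [left_mem_uIcc, right_mem_uIcc]

variable {m : Measure (PS d)} [IsFiniteMeasure μ]

lemma nu_eq (hd : 3 ≤ d) (hμ : μ ≪ volume) (hm : m ≤ μ) {t : ℝ} (ht : 0 ≤ t) :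
    nu F m t = volume.withDensity fun z => ofReal (dens F m t z) := by
  conv_lhs => rw [← Measure.withDensity_rnDeriv_eq _ _ (nu_ac hd hμ F hm ht)]
  refine withDensity_congr_ae ?_
  filter_upwards [Measure.rnDeriv_lt_top (nu F m t) volume] with z hz
  exact (ENNReal.ofReal_toReal hz.ne).symm

lemma integral_nu (hd : 3 ≤ d) (hμ : μ ≪ volume) (hm : m ≤ μ) {t : ℝ} (ht : 0 ≤ t) (χ : PS d → ℝ) :
    ∫ z, χ z ∂(nu F m t) = ∫ z, dens F m t z * χ z :=
  (integral_rnDeriv_smul (nu_ac hd hμ F hm ht)).symm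

lemma lintegral_sub_le_of_clamp {q a b g h : PS d → ℝ} {U : Set (PS d)} {R w : ℝ} (hU : MeasurableSet U)
    (ha : Integrable a) (hb : Integrable b) (hg : Integrable g) (hh : Integrable h) (hqm : Measurable q)
    (hq0 : ∀ z, 0 ≤ q z) (hq1 : ∀ z, q z ≤ 1) (hqR : ∀ z ∉ ball (0 : PS d) R, q z = 0)
    (hqU : ∀ z ∈ U, q z = 1) (hw : 0 < w) :
    ∫⁻ z in U, ‖a z - b z‖ₑ ≤
      ‖∫ z, (a z * (q z * clamp ((g z - h z) / w)) - b z * (q z * clamp ((g z - h z) / w)))‖ₑ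
        + (ofReal w * volume (ball (0 : PS d) R)
          + 2 * ((∫⁻ z, ‖a z - g z‖ₑ) + ∫⁻ z, ‖b z - h z‖ₑ)) := by
  set Ψ : PS d → ℝ := fun z => q z * clamp ((g z - h z) / w) with hΨ
  have hΨm : AEStronglyMeasurable Ψ := by
    have h1 : AEMeasurable fun z => clamp ((g z - h z) / w) := by
      have : Measurable clamp := by unfold clamp; fun_prop
      exact this.comp_aemeasurable ((hg.aemeasurable.sub hh.aemeasurable).div_const w)
    exact (hqm.aemeasurable.mul h1).aestronglyMeasurable
  have hΨ1 : ∀ z, ‖Ψ z‖ ≤ 1 := fun z => by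
    rw [hΨ, norm_eq_abs, abs_mul, abs_of_nonneg (hq0 z)]
    exact mul_le_one₀ (hq1 z) (abs_nonneg _) (abs_clamp_le _)
  have hi1 : Integrable fun z => a z * Ψ z - b z * Ψ z :=
    (ha.mul_bdd (c := 1) hΨm (ae_of_all _ hΨ1)).sub (hb.mul_bdd (c := 1) hΨm (ae_of_all _ hΨ1))
  set G : PS d → ℝ := fun z => (ball (0 : PS d) R).indicator (fun _ => w) z
    + 2 * (‖a z - g z‖ + ‖b z - h z‖) with hG
  have hGi : Integrable G := ((integrable_indicator_iff measurableSet_ball).2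
    (integrableOn_const measure_ball_lt_top.ne)).add
      (((ha.sub hg).norm.add (hb.sub hh).norm).const_mul 2)
  have hpt : ∀ z, q z * ‖a z - b z‖ ≤ (a z * Ψ z - b z * Ψ z) + G z := by
    intro z
    simp only [norm_eq_abs, hG, hΨ]
    set c := clamp ((g z - h z) / w)
    have h1 : |g z - h z| ≤ c * (g z - h z) + w := abs_le_clamp_mul hw _
    have h2 := abs_clamp_le ((g z - h z) / w)
    set e := (a z - g z) - (b z - h z) with he
    have h3 : |e| ≤ |a z - g z| + |b z - h z| := abs_sub _ _
    have h4 : |a z - b z| ≤ |g z - h z| + |e| := by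
      have : a z - b z = (g z - h z) + e := by rw [he]; ring
      rw [this]; exact abs_add_le _ _
    have h5 : c * e ≥ -|e| := by
      have : |c * e| ≤ |e| := by
        rw [abs_mul]; exact mul_le_of_le_one_left (abs_nonneg _) h2
      exact (abs_le.1 this).1
    have h6 : a z * (q z * c) - b z * (q z * c) = q z * (c * (g z - h z) + c * e) := by rw [he]; ring
    have h7 : q z * w ≤ (ball (0 : PS d) R).indicator (fun _ => w) z := by
      by_cases hz : z ∈ ball (0 : PS d) R
      · rw [indicator_of_mem hz]; exact mul_le_of_le_one_left hw.le (hq1 z)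
      · simp [hqR z hz, hz]
    have h8 : q z * (2 * |e|) ≤ 2 * |e| := mul_le_of_le_one_left (by positivity) (hq1 z)
    rw [h6]
    have h9 : q z * |a z - b z| ≤ q z * (c * (g z - h z) + c * e + w + 2 * |e|) :=
      mul_le_mul_of_nonneg_left (by linarith) (hq0 z)
    nlinarith
  have hn : ∀ z, 0 ≤ (a z * Ψ z - b z * Ψ z) + G z := fun z =>
    (mul_nonneg (hq0 z) (norm_nonneg _)).trans (hpt z)
  have m1 : AEMeasurable fun z => ‖a z - g z‖ₑ := (ha.sub hg).aestronglyMeasurable.enorm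
  calc ∫⁻ z in U, ‖a z - b z‖ₑ ≤ ∫⁻ z in U, ofReal ((a z * Ψ z - b z * Ψ z) + G z) := by
        refine setLIntegral_mono' hU fun z hz => ?_
        rw [← ofReal_norm]
        refine ofReal_le_ofReal ((le_of_eq ?_).trans (hpt z))
        rw [hqU z hz, one_mul]
    _ ≤ ∫⁻ z, ofReal ((a z * Ψ z - b z * Ψ z) + G z) := setLIntegral_le_lintegral _ _
    _ = ofReal ((∫ z, (a z * Ψ z - b z * Ψ z)) + ∫ z, G z) := by
        have hsum : Integrable fun z => (a z * Ψ z - b z * Ψ z) + G z := hi1.add hGi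
        rw [← integral_add hi1 hGi, ofReal_integral_eq_lintegral_ofReal hsum (ae_of_all _ hn)]
    _ ≤ ‖∫ z, (a z * Ψ z - b z * Ψ z)‖ₑ + ∫⁻ z, ofReal (G z) := by
        refine ENNReal.ofReal_add_le.trans (add_le_add ?_ ?_)
        · rw [← ofReal_norm]; exact ofReal_le_ofReal (le_abs_self _)
        · rw [ofReal_integral_eq_lintegral_ofReal hGi (.of_forall fun z =>
            add_nonneg (indicator_nonneg (fun _ _ => hw.le) _) (by positivity))]
    _ = _ := by
        congr 1
        have e : ∀ z, ofReal (G z) = (ball (0 : PS d) R).indicator (fun _ => ofReal w) z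
            + 2 * (‖a z - g z‖ₑ + ‖b z - h z‖ₑ) := by
          intro z
          rw [hG, ofReal_add (indicator_nonneg (fun _ _ => hw.le) _) (by positivity),
            ofReal_mul (by norm_num), ofReal_add (norm_nonneg _) (norm_nonneg _),
            ofReal_norm, ofReal_norm, ENNReal.ofReal_ofNat]
          congr 1
          by_cases hz : z ∈ ball (0 : PS d) R <;> simp [hz]
        simp only [e]
        rw [lintegral_add_left (measurable_const.indicator measurableSet_ball),
          lintegral_indicator_const measurableSet_ball, lintegral_const_mul' _ _ (by norm_num),
          lintegral_add_left' m1]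

lemma pair_limit (hd : 3 ≤ d) (hμ : μ ≪ volume) (hm : m ≤ μ) {s t : ℝ} (hs : 0 ≤ s) (ht : 0 ≤ t)
    {Ψ : PS d → PS d → ℝ} (hΨm : Measurable (uncurry Ψ)) (hΨ1 : ∀ z y, |Ψ z y| ≤ 1) {n : ℕ}
    {B : ℝ≥0∞} (hB : ∀ᶠ j : ℕ in UF, ‖(∫ a, Ψ ((F j).Z s a) (pth F n s t ((F j).Z s a)) ∂m)
      - ∫ a, Ψ (pth F n t s ((F j).Z t a)) ((F j).Z t a) ∂m‖ₑ ≤ B) :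
    ‖∫ z, (dens F m s z * Ψ z (pth F n s t z)
      - dens F m t (pth F n s t z) * Ψ z (pth F n s t z))‖ₑ ≤ B := by
  have hPm : Measurable (pth F n s t) := (mp_pth F n s t).measurable
  have hQm : Measurable (pth F n t s) := (mp_pth F n t s).measurable
  have hQP : ∀ z, pth F n t s (pth F n s t z) = z := fun z => by simp [pth]
  have hmA : Measurable fun z => Ψ z (pth F n s t z) := hΨm.comp (measurable_id.prodMk hPm)
  have hmB : Measurable fun y => Ψ (pth F n t s y) y := hΨm.comp (hQm.prodMk measurable_id)
  have h1 := tendsto_integral_nu hd hμ F hm hs hmA (C := 1) fun z => hΨ1 _ _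
  have h2 := tendsto_integral_nu hd hμ F hm ht hmB (C := 1) fun z => hΨ1 _ _
  have hlim := le_of_tendsto ((continuous_enorm.tendsto _).comp (h1.sub h2)) hB
  have hi1 : Integrable fun z => dens F m s z * Ψ z (pth F n s t z) :=
    (integrable_dens F s).mul_bdd (c := 1) hmA.aestronglyMeasurable (.of_forall fun z => hΨ1 _ _)
  have hi2 : Integrable fun y => dens F m t y * Ψ (pth F n t s y) y :=
    (integrable_dens F t).mul_bdd (c := 1) hmB.aestronglyMeasurable (.of_forall fun z => hΨ1 _ _)
  have e : ∀ z, dens F m t (pth F n s t z) * Ψ z (pth F n s t z)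
      = (fun y => dens F m t y * Ψ (pth F n t s y) y) (pth F n s t z) := fun z => by
    simp only [hQP]
  have hi2' : Integrable fun z => dens F m t (pth F n s t z) * Ψ z (pth F n s t z) := by
    simp only [e]
    exact (mp_pth F n s t).integrable_comp_of_integrable hi2
  have e2 : ∫ y, Ψ (pth F n t s y) y ∂(nu F m t)
      = ∫ z, dens F m t (pth F n s t z) * Ψ z (pth F n s t z) := by
    rw [integral_nu F hd hμ hm ht]
    simp only [e]
    have h3 : Measure.map (pth F n s t) volume = volume := (mp_pth F n s t).map_eq
    conv_lhs => rw [← h3]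
    exact integral_map hPm.aemeasurable (by rw [h3]; exact hi2.aestronglyMeasurable)
  rw [e2, integral_nu F hd hμ hm hs, ← integral_sub hi1 hi2'] at hlim
  exact hlim

/-- The limit densities are almost transported, over short times, by the approximate flows. -/
lemma transport (hd : 3 ≤ d) (hμ : μ ≪ volume) (hm : m ≤ μ) {k : ℝ≥0∞} (hkt : k ≠ ⊤)
    (hk : m ≤ k • volume) (T R : ℝ) {s : ℝ} (hs : s ∈ Icc 0 T) {θ : ℝ≥0∞} (hθ : θ ≠ 0) :
    ∃ τ > 0, ∀ t ∈ Icc 0 T, |t - s| ≤ τ → ∀ ω : ℝ≥0∞, ω ≠ 0 → ∀ᶠ n in UF,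
      ∫⁻ z in ball 0 R ∩ pth F n s t ⁻¹' ball 0 R, ‖dens F m s z - dens F m t (pth F n s t z)‖ₑ
        ≤ θ * ofReal |t - s| + ω := by
  have : IsFiniteMeasure m := ⟨(hm univ).trans_lt (measure_lt_top _ _)⟩
  obtain ⟨θ', hθ', -, hθ'1⟩ := exists_mul_le (c := 8 * k) (ENNReal.mul_ne_top (by norm_num) hkt) hθ
  obtain ⟨τ, hτ, hdisp⟩ := disp F hd hμ T (R + 1) one_pos hθ' hs
  refine ⟨τ, hτ, fun t ht hst ω hω => ?_⟩
  have hω4 : ω / 4 ≠ 0 := by simpa using hω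
  set V := volume (ball (0 : PS d) (R + 1)) with hV
  have hVt : V ≠ ⊤ := measure_ball_lt_top.ne
  obtain ⟨γ, hγ, hγt, hγ1⟩ := exists_mul_le (c := 4 * k) (ENNReal.mul_ne_top (by norm_num) hkt) hω4
  obtain ⟨ω₂, hω₂, hω₂1⟩ := exists_ofReal_mul_le (c := 2 * k * V)
    (ENNReal.mul_ne_top (ENNReal.mul_ne_top (by norm_num) hkt) hVt) hω4
  obtain ⟨w, hw, hw1⟩ := exists_ofReal_mul_le hVt hω4
  have hω16 : ω / 16 ≠ 0 := by simpa using hω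
  obtain ⟨g, hgs, hgL, hgc, hgi⟩ :=
    (integrable_dens F (m := m) s).exists_hasCompactSupport_lintegral_sub_le hω16
  obtain ⟨h, hhs, hhL, hhc, hhi⟩ :=
    (integrable_dens F (m := m) t).exists_hasCompactSupport_lintegral_sub_le hω16
  obtain ⟨κ, hκ, hmod1, hmod2⟩ := exists_pairTest_modulus (R := R) (w := w) hgc hhc hω₂
  obtain ⟨S, hS, hstab⟩ := stab F hd hμ T (R + 1 + 1) hκ hγ hγt
  set Ψ := pairTest R w g h with hΨ
  have hΨm : Measurable (uncurry Ψ) := (continuous_pairTest hgc hhc).measurable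
  set D := θ' * ofReal |t - s| with hD
  set X := ofReal ω₂ * V + 2 * (D + D + γ) with hX
  filter_upwards [hdisp, hS] with n hn hnS
  have hfar : ∀ i : ℕ, (∀ t ∈ Icc 0 T, |t - s| ≤ τ → ∀ u ∈ uIcc s t,
      volume {z | z ∈ ball (0 : PS d) (R + 1) ∧ ∃ r ∈ uIcc s t, 1 ≤ ‖pth F i u r z - z‖}
        ≤ θ' * ofReal |t - s|) → ∀ u ∈ ({s, t} : Set ℝ), ∀ v ∈ ({s, t} : Set ℝ),
      volume {z | z ∈ ball (0 : PS d) (R + 1) ∧ ∃ r ∈ uIcc u v, 1 ≤ ‖pth F i u r z - z‖} ≤ D := by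
    intro i hi u hu v hv
    have hsub := uIcc_mem_uIcc_subset hu v hv
    refine le_trans (measure_mono ?_) (hi t ht hst u (hsub left_mem_uIcc))
    rintro z ⟨hz, r, hr, h⟩
    exact ⟨hz, r, hsub hr, h⟩
  set P := pth F n s t with hP
  have hPm : Measurable P := (mp_pth F n s t).measurable
  have hΨ0 : ∀ z ∉ ball (0 : PS d) (R + 1), ∀ y, Ψ z y = 0 := fun z hz y => by
    simp [hΨ, pairTest, cut_of_notMem hz]
  have hΨ0' : ∀ y ∉ ball (0 : PS d) (R + 1), ∀ z, Ψ z y = 0 := fun z hz y => by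
    simp [hΨ, pairTest, cut_of_notMem hz]
  have hpair : ∀ᶠ j in UF, ‖(∫ a, Ψ ((F j).Z s a) (P ((F j).Z s a)) ∂m)
      - ∫ a, Ψ (pth F n t s ((F j).Z t a)) ((F j).Z t a) ∂m‖ₑ ≤ k * (X + X) := by
    filter_upwards [hdisp, hS] with j hj hjS
    refine enorm_integral_pair_sub_le F hk hΨm abs_pairTest_le ?_ ?_
    · exact lintegral_pair_sub_le F (T := T) (κ := κ) abs_pairTest_le hΨ0 hmod1 ht
        (hfar n hn s (by simp) t (by simp)) (hfar j hj s (by simp) t (by simp)) (hstab n hnS j hjS s hs)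
    · exact lintegral_pair_sub_le F (T := T) (κ := κ) (Φ := fun y z => Ψ z y)
        (fun _ _ => abs_pairTest_le _ _) hΨ0' (fun y z z' hz => hmod2 z z' y hz) hs
        (hfar n hn t (by simp) s (by simp)) (hfar j hj t (by simp) s (by simp)) (hstab n hnS j hjS t ht)
  have hlim : ‖∫ z, (dens F m s z * Ψ z (P z) - dens F m t (P z) * Ψ z (P z))‖ₑ ≤ k * (X + X) :=
    pair_limit F hd hμ hm hs.1 ht.1 hΨm abs_pairTest_le hpair
  have hE2 : ∫⁻ z, ‖dens F m t (P z) - h (P z)‖ₑ ≤ ω / 16 := by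
    refine le_trans (le_of_eq ?_) hhL
    exact (mp_pth F n s t).lintegral_comp (f := fun z => ‖dens F m t z - h z‖ₑ)
      ((measurable_dens F t).sub hhc.measurable).enorm
  have hfin := lintegral_sub_le_of_clamp (q := fun z => cut R z * cut R (P z))
    (U := ball 0 R ∩ P ⁻¹' ball 0 R) (R := R + 1) (a := dens F m s)
    (b := fun z => dens F m t (P z)) (g := g) (h := fun z => h (P z)) (w := w)
    (measurableSet_ball.inter (hPm measurableSet_ball))
    (integrable_dens F s) ((mp_pth F n s t).integrable_comp_of_integrable (integrable_dens F t)) hgi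
    ((mp_pth F n s t).integrable_comp_of_integrable hhi)
    (by
      have := continuous_cut (E := PS d) R
      fun_prop)
    (fun z => mul_nonneg (cut_nonneg _ _) (cut_nonneg _ _))
    (fun z => mul_le_one₀ (cut_le_one _ _) (cut_nonneg _ _) (cut_le_one _ _))
    (fun z hz => by simp [cut_of_notMem hz])
    (fun z hz => by simp [cut_of_mem hz.1, cut_of_mem (show P z ∈ ball 0 R from hz.2)]) hw
  refine (hfin.trans (add_le_add hlim (add_le_add hw1 (mul_le_mul_right (add_le_add hgL hE2) 2)))).trans ?_
  have e3 : k * (X + X) = 2 * k * V * ofReal ω₂ + (8 * k * θ' * ofReal |t - s| + 4 * k * γ) := by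
    rw [hX, hD]; ring
  rw [e3]
  calc _ ≤ (ω / 4 + (θ * ofReal |t - s| + ω / 4)) + (ω / 4 + 2 * (ω / 16 + ω / 16)) := by
        gcongr
        rwa [mul_comm]
    _ = θ * ofReal |t - s| + (ω / 4 + ω / 4 + (ω / 4 + 4 * (ω / 16))) := by ring
    _ = θ * ofReal |t - s| + ω := by
        congr 1
        have e4 : 4 * (ω / 16) = ω / 4 := by
          rw [← mul_div_assoc, ENNReal.div_eq_div_iff (by norm_num) (by norm_num) (by norm_num) (by norm_num)]
          ring
        have e5 : ω / 4 + ω / 4 + (ω / 4 + ω / 4) = 4 * (ω / 4) := by ring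
        rw [e4, e5]
        exact ENNReal.mul_div_cancel (by norm_num) (by norm_num)

end VP

namespace VP

variable {d : ℕ} {μ : Measure (PS d)} {e₀ : ℝ} (F : AFlows d μ e₀)

lemma pth_pth (n : ℕ) (u r : ℝ) (z : PS d) : pth F n r u (pth F n u r z) = z := by simp [pth]

lemma volume_pth_swap (n : ℕ) (u r R κ : ℝ) :
    volume {z | pth F n u r z ∈ ball (0 : PS d) R ∧ κ ≤ ‖pth F n u r z - z‖}
      = volume {y | y ∈ ball (0 : PS d) R ∧ κ ≤ ‖pth F n r u y - y‖} := by
  have hm : MeasurableSet {y | y ∈ ball (0 : PS d) R ∧ κ ≤ ‖pth F n r u y - y‖} :=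
    measurableSet_ball.inter
      (measurableSet_le measurable_const (((mp_pth F n r u).measurable.sub measurable_id).norm))
  rw [← (mp_pth F n u r).measure_preimage hm.nullMeasurableSet]
  congr 1
  ext z
  simp only [mem_ofPred_eq, mem_preimage, pth_pth]
  rw [← norm_neg (z - _), neg_sub]

variable {m : Measure (PS d)} [IsFiniteMeasure μ]

lemma comp_near (hd : 3 ≤ d) (hμ : μ ≪ volume) {G : Type*} [NormedAddCommGroup G] [NormedSpace ℝ G]
    {h : PS d → G} (hh : Integrable h) (T : ℝ) {s : ℝ} (hs : s ∈ Icc 0 T) {ω : ℝ≥0∞} (hω : ω ≠ 0) :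
    ∃ τ > 0, ∀ᶠ n : ℕ in UF, ∀ t ∈ Icc 0 T, |t - s| ≤ τ → ∀ u ∈ uIcc s t, ∀ r ∈ uIcc s t,
      ∫⁻ z, ‖h (pth F n u r z) - h z‖ₑ ≤ ω := by
  obtain ⟨κ, hκ, R, θ, hθ, H⟩ := exists_comp_sub hh hω
  obtain ⟨τ, hτ, hdisp⟩ := disp F hd hμ T R hκ hθ hs
  refine ⟨min τ 1, lt_min hτ one_pos, ?_⟩
  filter_upwards [hdisp] with n hn t ht hst u hu r hr
  have hb : ∀ u ∈ uIcc s t, ∀ r ∈ uIcc s t,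
      volume {z | z ∈ ball (0 : PS d) R ∧ κ ≤ ‖pth F n u r z - z‖} ≤ θ := fun u hu r hr => by
    refine le_trans (measure_mono ?_) ((hn t ht (hst.trans (min_le_left _ _)) u hu).trans ?_)
    · rintro z ⟨hz, h⟩
      exact ⟨hz, r, hr, h⟩
    · refine mul_le_of_le_one_right' ?_
      rw [← ENNReal.ofReal_one]
      exact ofReal_le_ofReal (hst.trans (min_le_right _ _))
  refine H _ (mp_pth F n u r) (hb u hu r hr) ?_
  rw [volume_pth_swap]
  exact hb r hr u hu

lemma dens_le (hd : 3 ≤ d) (hμ : μ ≪ volume) (hm : m ≤ μ) {k : ℝ≥0∞} (hkt : k ≠ ⊤)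
    (hk : m ≤ k • volume) {t : ℝ} (ht : 0 ≤ t) : ∀ᵐ z, dens F m t z ≤ k.toReal := by
  have h : (nu F m t).rnDeriv volume ≤ᵐ[volume] fun _ => k := by
    refine ae_le_of_forall_setLIntegral_le_of_sigmaFinite (Measure.measurable_rnDeriv _ _)
      fun A hA _ => ?_
    rw [Measure.setLIntegral_rnDeriv (nu_ac hd hμ F hm ht), setLIntegral_const]
    exact nu_le_smul hd hμ F hm ht hk A
  filter_upwards [h] with z hz
  exact ENNReal.toReal_mono hkt hz

/-- Local strong continuity in time of the limit densities of bounded pieces of the data. -/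
lemma dens_continuous (hd : 3 ≤ d) (hμ : μ ≪ volume) (hm : m ≤ μ) {k : ℝ≥0∞} (hkt : k ≠ ⊤)
    (hk : m ≤ k • volume) (T R : ℝ) {s : ℝ} (hs : s ∈ Icc 0 T) {θ : ℝ≥0∞} (hθ : θ ≠ 0) :
    ∃ τ > 0, ∀ t ∈ Icc 0 T, |t - s| ≤ τ →
      ∫⁻ z in ball 0 R, ‖dens F m t z - dens F m s z‖ₑ ≤ θ := by
  have hθ4 : θ / 4 ≠ 0 := by simpa using hθ
  obtain ⟨τ₁, hτ₁, htr⟩ := transport F hd hμ hm hkt hk T (R + 1) hs hθ4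
  obtain ⟨τ₂, hτ₂, hcn⟩ := comp_near F hd hμ (integrable_dens F (m := m) s) T hs hθ4
  obtain ⟨γ, hγ, -, hγ1⟩ := exists_mul_le (c := k) hkt hθ4
  obtain ⟨τ₃, hτ₃, hdisp⟩ := disp F hd hμ T R one_pos hγ hs
  refine ⟨min (min τ₁ τ₂) (min τ₃ 1), by positivity, fun t ht hst => ?_⟩
  simp only [le_min_iff] at hst
  obtain ⟨⟨h1, h2⟩, h3, h4⟩ := hst
  have h4' : ofReal |t - s| ≤ 1 := by
    rw [← ENNReal.ofReal_one]; exact ofReal_le_ofReal h4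
  obtain ⟨n, hn1, hn2, hn3⟩ := ((htr t ht h1 (θ / 4) hθ4).and (hcn.and hdisp)).exists
  set Q := pth F n t s with hQ
  have hQm : Measurable Q := (mp_pth F n t s).measurable
  have mt := measurable_dens F (m := m) t
  have ms := measurable_dens F (m := m) s
  have hB : ∫⁻ y in ball 0 (R + 1) ∩ Q ⁻¹' ball 0 (R + 1), ‖dens F m s (Q y) - dens F m t y‖ₑ
      ≤ θ / 4 * ofReal |t - s| + θ / 4 := by
    refine le_trans (le_of_eq ?_) hn1
    have := (mp_pth F n t s).setLIntegral_comp_preimage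
      (s := ball 0 (R + 1) ∩ pth F n s t ⁻¹' ball 0 (R + 1))
      (measurableSet_ball.inter ((mp_pth F n s t).measurable measurableSet_ball))
      (f := fun z => ‖dens F m s z - dens F m t (pth F n s t z)‖ₑ)
      (ms.sub (mt.comp (mp_pth F n s t).measurable)).enorm
    rw [← this]
    simp only [pth_pth]
    congr 2
    ext y
    simp [pth_pth, hQ, and_comm]
  have hA : volume {z | z ∈ ball (0 : PS d) R ∧ ∃ r ∈ uIcc s t, 1 ≤ ‖pth F n t r z - z‖} ≤ γ :=
    (hn3 t ht h3 t right_mem_uIcc).trans (mul_le_of_le_one_right' h4')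
  set A := {z | z ∈ ball (0 : PS d) R ∧ ∃ r ∈ uIcc s t, 1 ≤ ‖pth F n t r z - z‖}
  have hbd : ∀ᵐ z, ‖dens F m t z - dens F m s z‖ₑ ≤ k := by
    filter_upwards [dens_le F hd hμ hm hkt hk ht.1, dens_le F hd hμ hm hkt hk hs.1] with z ha hb
    rw [← ofReal_norm, ← ENNReal.ofReal_toReal hkt, norm_eq_abs]
    refine ofReal_le_ofReal (abs_le.2 ⟨?_, ?_⟩)
    · linarith [dens_nonneg F (m := m) t z]
    · linarith [dens_nonneg F (m := m) s z]
  set U := ball (0 : PS d) (R + 1) ∩ Q ⁻¹' ball 0 (R + 1) with hU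
  have hsub : ball (0 : PS d) R ⊆ U ∪ toMeasurable volume A := by
    intro z hz
    by_cases hzA : z ∈ A
    · exact Or.inr (subset_toMeasurable _ _ hzA)
    · have h5 : ‖Q z - z‖ < 1 := by
        by_contra! h
        exact hzA ⟨hz, s, left_mem_uIcc, h⟩
      refine Or.inl ⟨ball_subset_ball (by linarith) hz, ?_⟩
      rw [mem_preimage, mem_ball_zero_iff]
      rw [mem_ball_zero_iff] at hz
      have := norm_add_le (Q z - z) z
      rw [sub_add_cancel] at this
      linarith
  have m1 : Measurable fun z => ‖dens F m s (Q z) - dens F m t z‖ₑ := ((ms.comp hQm).sub mt).enorm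
  calc ∫⁻ z in ball 0 R, ‖dens F m t z - dens F m s z‖ₑ
      ≤ ∫⁻ z in U ∪ toMeasurable volume A, ‖dens F m t z - dens F m s z‖ₑ := lintegral_mono_set hsub
    _ ≤ (∫⁻ z in U, ‖dens F m t z - dens F m s z‖ₑ)
        + ∫⁻ z in toMeasurable volume A, ‖dens F m t z - dens F m s z‖ₑ := lintegral_union_le _ _ _
    _ ≤ (∫⁻ z in U, (‖dens F m s (Q z) - dens F m t z‖ₑ + ‖dens F m s (Q z) - dens F m s z‖ₑ))
        + ∫⁻ z in toMeasurable volume A, k := by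
        refine add_le_add (lintegral_mono fun z => ?_) (lintegral_mono_ae (ae_restrict_of_ae hbd))
        rw [← enorm_neg (dens F m s (Q z) - dens F m t z)]
        refine le_trans (le_of_eq ?_) (enorm_add_le _ _)
        congr 1; ring
    _ ≤ ((θ / 4 * ofReal |t - s| + θ / 4) + θ / 4) + k * γ := by
        rw [lintegral_add_left m1, setLIntegral_const, measure_toMeasurable]
        refine add_le_add (add_le_add hB ?_) (mul_le_mul_right hA k)
        exact (setLIntegral_le_lintegral _ _).trans (hn2 t ht h2 t right_mem_uIcc s left_mem_uIcc)
    _ ≤ ((θ / 4 + θ / 4) + θ / 4) + θ / 4 := by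
        gcongr
        exact mul_le_of_le_one_right' h4'
    _ = 4 * (θ / 4) := by ring
    _ = θ := ENNReal.mul_div_cancel (by norm_num) (by norm_num)

end VP

namespace VP

variable {d : ℕ} {μ : Measure (PS d)} {e₀ : ℝ} (F : AFlows d μ e₀)

lemma integrableOn_bfl (hd : 1 ≤ d) (s R : ℝ) : IntegrableOn (bfl F s) (ball (0 : PS d) R) :=
  ⟨(measurable_bfl F s).aestronglyMeasurable, lintegral_bfl_lt_top F hd s R⟩

variable [IsFiniteMeasure μ]

lemma path_near (hd : 3 ≤ d) (hμ : μ ≪ volume) (T R : ℝ) {s κ : ℝ} (hκ : 0 < κ) (hs : s ∈ Icc 0 T)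
    {θ : ℝ≥0∞} (hθ : θ ≠ 0) :
    ∃ τ > 0, ∀ᶠ n : ℕ in UF, ∀ t ∈ Icc 0 T, |t - s| ≤ τ → ∃ M : Set (PS d), MeasurableSet M ∧
      volume M ≤ θ * ofReal |t - s| ∧
      (∀ z ∈ ball 0 (R + κ) \ M, ‖pth F n s t z - z‖ < κ) ∧
      (∀ z ∉ ball 0 (R + κ) ∪ M, pth F n s t z ∉ ball 0 R) ∧
      ∫⁻ z in ball 0 (R + κ) \ M, ‖pth F n s t z - z - (t - s) • bfl F s z‖ₑ
        ≤ θ * ofReal |t - s| := by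
  have hd1 : 1 ≤ d := by omega
  have hθ2 : θ / 2 ≠ 0 := by simpa using hθ
  set R' := R + κ + κ with hR'
  set h : PS d → PS d := (ball 0 R').indicator (bfl F s) with hh
  have hhi : Integrable h := (integrable_indicator_iff measurableSet_ball).2 (integrableOn_bfl F hd1 s R')
  have hhm : Measurable h := (measurable_bfl F s).indicator measurableSet_ball
  obtain ⟨τ₁, hτ₁, H1⟩ := disp F hd hμ T (R + κ) hκ hθ2 hs
  obtain ⟨τ₂, hτ₂, H2⟩ := vel_near F hd hμ T R' hθ2
  obtain ⟨τ₃, hτ₃, H3⟩ := comp_near F hd hμ hhi T hs hθ2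
  refine ⟨min τ₁ (min τ₂ τ₃), by positivity, ?_⟩
  filter_upwards [H1, H2, H3] with n h1 ⟨hTn, h2⟩ h3 t ht hst
  simp only [le_min_iff] at hst
  have hsT := hs.1.trans hs.2
  have hIcc : uIcc s t ⊆ Icc 0 T := uIcc_subset_Icc hs ht
  set A := {z | z ∈ ball (0 : PS d) (R + κ) ∧ ∃ r ∈ uIcc s t, κ ≤ ‖pth F n s r z - z‖} with hA
  set A' := {y | y ∈ ball (0 : PS d) R ∧ κ ≤ ‖pth F n t s y - y‖} with hA'
  have hAv : volume A ≤ θ / 2 * ofReal |t - s| := h1 t ht hst.1 s left_mem_uIcc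
  have hAv' : volume (pth F n s t ⁻¹' A') ≤ θ / 2 * ofReal |t - s| := by
    have hm : MeasurableSet A' := measurableSet_ball.inter
      (measurableSet_le measurable_const (((mp_pth F n t s).measurable.sub measurable_id).norm))
    rw [(mp_pth F n s t).measure_preimage hm.nullMeasurableSet]
    refine (measure_mono ?_).trans (h1 t ht hst.1 t right_mem_uIcc)
    rintro y ⟨hy, hk⟩
    exact ⟨ball_subset_ball (by linarith) hy, s, left_mem_uIcc, hk⟩
  set M := toMeasurable volume (A ∪ pth F n s t ⁻¹' A') with hM
  have hAM : A ∪ pth F n s t ⁻¹' A' ⊆ M := subset_toMeasurable _ _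
  have hMm : MeasurableSet M := measurableSet_toMeasurable _ _
  have hgood : ∀ z ∈ ball 0 (R + κ) \ M, ∀ r ∈ uIcc s t, ‖pth F n s r z - z‖ < κ := by
    intro z hz r hr
    by_contra! hcon
    exact hz.2 (hAM (Or.inl ⟨hz.1, r, hr, hcon⟩))
  refine ⟨M, hMm, ?_, fun z hz => hgood z hz t right_mem_uIcc, fun z hz hp => ?_, ?_⟩
  · rw [hM, measure_toMeasurable]
    refine (measure_union_le _ _).trans ((add_le_add hAv hAv').trans (le_of_eq ?_))
    rw [← add_mul, ENNReal.add_halves]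
  · refine hz (Or.inr (hAM (Or.inr ⟨hp, ?_⟩)))
    rw [pth_pth]
    by_contra! hcon
    refine hz (Or.inl ?_)
    rw [mem_ball_zero_iff] at hp ⊢
    have := norm_add_le (z - pth F n s t z) (pth F n s t z)
    rw [sub_add_cancel] at this
    linarith
  · set w : ℝ → PS d → ℝ≥0∞ := fun r z =>
      (pth F n s r ⁻¹' ball 0 R').indicator (fun z => ‖vel F n s r z - bfl F s (pth F n s r z)‖ₑ) z
        + ‖h (pth F n s r z) - h z‖ₑ with hw
    have hpm := measurable_pth F n s
    have hvm := measurable_vel F n s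
    have hbm := measurable_bfl F s
    have hwm : Measurable (uncurry w) := by
      have e : uncurry w = fun p : ℝ × PS d =>
          ((fun p : ℝ × PS d => pth F n s p.1 p.2) ⁻¹' ball 0 R').indicator
            (fun p => ‖vel F n s p.1 p.2 - bfl F s (pth F n s p.1 p.2)‖ₑ) p
          + ‖h (pth F n s p.1 p.2) - h p.2‖ₑ := rfl
      rw [e]
      exact ((hvm.sub (hbm.comp hpm)).enorm.indicator (hpm measurableSet_ball)).add
        ((hhm.comp hpm).sub (hhm.comp measurable_snd)).enorm
    have hpt : ∀ z ∈ ball 0 (R + κ) \ M, ‖pth F n s t z - z - (t - s) • bfl F s z‖ₑ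
        ≤ ∫⁻ r in uIoc s t, w r z := by
      intro z hz
      have hi := intervalIntegrable_vel F (n := n) s hs.1 ht.1 z
      have e : pth F n s t z - z - (t - s) • bfl F s z = ∫ r in s..t, (vel F n s r z - bfl F s z) := by
        rw [intervalIntegral.integral_sub hi (by simp), intervalIntegral.integral_const,
          ← pth_sub F s hs.1 ht.1, pth_self]
      rw [e]
      have e' : ‖∫ r in s..t, (vel F n s r z - bfl F s z)‖ₑ
          = ‖∫ r in uIoc s t, (vel F n s r z - bfl F s z)‖ₑ := by
        rw [← ofReal_norm, ← ofReal_norm, intervalIntegral.norm_integral_eq_norm_integral_uIoc]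
      rw [e']
      refine (enorm_integral_le_lintegral_enorm _).trans
        (setLIntegral_mono' measurableSet_uIoc fun r hr => ?_)
      have hr' := uIoc_subset_uIcc hr
      have hb : pth F n s r z ∈ ball (0 : PS d) R' := by
        have h5 := hgood z hz r hr'
        have h6 := hz.1
        rw [mem_ball_zero_iff] at h6 ⊢
        have := norm_add_le (pth F n s r z - z) z
        rw [sub_add_cancel] at this
        linarith
      have hb' : z ∈ ball (0 : PS d) R' := ball_subset_ball (by linarith) hz.1
      simp only [hw]
      rw [indicator_of_mem (show z ∈ pth F n s r ⁻¹' ball 0 R' from hb), hh, indicator_of_mem hb,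
        indicator_of_mem hb']
      refine le_trans (le_of_eq ?_) (enorm_add_le _ _)
      congr 1; abel
    calc ∫⁻ z in ball 0 (R + κ) \ M, ‖pth F n s t z - z - (t - s) • bfl F s z‖ₑ
        ≤ ∫⁻ z in ball 0 (R + κ) \ M, ∫⁻ r in uIoc s t, w r z :=
          setLIntegral_mono' (measurableSet_ball.diff hMm) hpt
      _ ≤ ∫⁻ z, ∫⁻ r in uIoc s t, w r z := setLIntegral_le_lintegral _ _
      _ = ∫⁻ r in uIoc s t, ∫⁻ z, w r z :=
          lintegral_lintegral_swap (f := fun z r => w r z) (hwm.comp measurable_swap).aemeasurable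
      _ ≤ ∫⁻ r in uIoc s t, θ := by
          refine setLIntegral_mono' measurableSet_uIoc fun r hr => ?_
          have hr' := uIoc_subset_uIcc hr
          have hrs : |r - s| ≤ |t - s| := by
            have := abs_sub_left_of_mem_uIcc hr'
            simpa using this
          have m2 : Measurable fun z => ‖h (pth F n s r z) - h z‖ₑ :=
            ((hhm.comp (mp_pth F n s r).measurable).sub hhm).enorm
          simp only [hw]
          rw [lintegral_add_right _ m2, ← ENNReal.add_halves θ,
            lintegral_indicator ((mp_pth F n s r).measurable measurableSet_ball)]
          exact add_le_add (h2 s s hs r (hIcc hr') (hrs.trans hst.2.1))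
            (h3 t ht hst.2.2 s left_mem_uIcc r hr')
      _ = θ * ofReal |t - s| := by
          rw [setLIntegral_const, Real.volume_uIoc]

end VP

namespace VP

variable {d : ℕ}

/-- The space-time directional derivative entering the weak formulation. -/
def dirD (φ : ℝ × PS d → ℝ) (b : PS d → PS d) (s : ℝ) (z : PS d) : ℝ :=
  fderiv ℝ φ (s, z) (1, b z)

structure TestBound (φ : ℝ × PS d → ℝ) (C R : ℝ) : Prop where
  smooth : ContDiff ℝ 1 φ
  compact : HasCompactSupport φ
  C_nonneg : 0 ≤ C
  bound : ∀ x, |φ x| ≤ C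
  bound_fderiv : ∀ x, ‖fderiv ℝ φ x‖ ≤ C
  zero : ∀ t, ∀ z ∉ ball (0 : PS d) R, φ (t, z) = 0
  zero_fderiv : ∀ t, ∀ z ∉ ball (0 : PS d) R, fderiv ℝ φ (t, z) = 0

lemma exists_testBound {φ : ℝ × PS d → ℝ} (h : ContDiff ℝ 1 φ) (hc : HasCompactSupport φ) :
    ∃ C R : ℝ, TestBound φ C R := by
  obtain ⟨C₁, h1⟩ := hc.exists_bound_of_continuous h.continuous
  obtain ⟨C₂, h2⟩ := (hc.fderiv ℝ).exists_bound_of_continuous (h.continuous_fderiv one_ne_zero)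
  have hK : IsCompact (Prod.snd '' tsupport φ) := hc.isCompact.image continuous_snd
  obtain ⟨R, hR⟩ := hK.isBounded.subset_ball (0 : PS d)
  have hn : ∀ t, ∀ z ∉ ball (0 : PS d) R, (t, z) ∉ tsupport φ := fun t z hz hcon =>
    hz (hR ⟨_, hcon, rfl⟩)
  refine ⟨max C₁ C₂, R, h, hc, ?_, fun x => (h1 x).trans (le_max_left _ _),
    fun x => (h2 x).trans (le_max_right _ _), fun t z hz => image_eq_zero_of_notMem_tsupport (hn t z hz),
    fun t z hz => ?_⟩
  · exact (norm_nonneg _).trans ((h1 0).trans (le_max_left _ _))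
  · exact image_eq_zero_of_notMem_tsupport fun hcon => hn t z hz (tsupport_fderiv_subset ℝ hcon)

lemma TestBound.taylor {φ : ℝ × PS d → ℝ} {C R : ℝ} (hφ : TestBound φ C R) {ω : ℝ} (hω : 0 < ω) :
    ∃ κ > 0, ∀ s t : ℝ, ∀ z p : PS d, ∀ b : PS d → PS d, |t - s| < κ → ‖p - z‖ < κ →
      |φ (t, p) - φ (s, z) - (t - s) * dirD φ b s z|
        ≤ ω * (|t - s| * (1 + ‖b z‖)) + (C + ω) * ‖p - z - (t - s) • b z‖ := by
  obtain ⟨κ, hκ, hu⟩ := uniformContinuous_iff.1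
    ((hφ.compact.fderiv ℝ).uniformContinuous_of_continuous (hφ.smooth.continuous_fderiv one_ne_zero)) ω hω
  refine ⟨κ, hκ, fun s t z p b hts hp => ?_⟩
  set L := fderiv ℝ φ (s, z) with hL
  have h1 : ‖φ (t, p) - φ (s, z) - L ((t, p) - (s, z))‖ ≤ ω * ‖(t, p) - (s, z)‖ := by
    refine Convex.norm_image_sub_le_of_norm_fderiv_le' (s := ball (s, z) κ)
      (fun x _ => (hφ.smooth.differentiable one_ne_zero).differentiableAt) (fun x hx => ?_)
      (convex_ball _ _) (mem_ball_self hκ) ?_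
    · rw [← dist_eq_norm]
      exact (hu hx).le
    · rw [mem_ball, Prod.dist_eq]
      exact max_lt (by rwa [Real.dist_eq]) (by rwa [dist_eq_norm])
  have h2 : ‖((t, p) : ℝ × PS d) - (s, z)‖ ≤ |t - s| + ‖p - z‖ :=
    max_le_add_of_nonneg (norm_nonneg _) (norm_nonneg _)
  have h3 : ‖p - z‖ ≤ |t - s| * ‖b z‖ + ‖p - z - (t - s) • b z‖ := by
    have := norm_add_le ((t - s) • b z) (p - z - (t - s) • b z)
    rwa [add_sub_cancel, norm_smul, norm_eq_abs] at this
  have h4 : L ((t, p) - (s, z)) - (t - s) * dirD φ b s z = L (0, p - z - (t - s) • b z) := by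
    rw [dirD, ← hL, ← smul_eq_mul, ← map_smul, ← map_sub]
    congr 1
    ext1 <;> simp
  have h5 : |L (0, p - z - (t - s) • b z)| ≤ C * ‖p - z - (t - s) • b z‖ := by
    refine (L.le_opNorm _).trans (mul_le_mul (hφ.bound_fderiv _) ?_ (norm_nonneg _) hφ.C_nonneg)
    rw [Prod.norm_def]; simp
  have h6 : φ (t, p) - φ (s, z) - (t - s) * dirD φ b s z
      = (φ (t, p) - φ (s, z) - L ((t, p) - (s, z))) + L (0, p - z - (t - s) • b z) := by rw [← h4]; ring
  rw [h6]
  refine (abs_add_le _ _).trans ((add_le_add (h1.trans (mul_le_mul_of_nonneg_left h2 hω.le)) h5).trans ?_)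
  nlinarith

lemma TestBound.abs_dirD_le {φ : ℝ × PS d → ℝ} {C R : ℝ} (hφ : TestBound φ C R) (b : PS d → PS d) (s : ℝ)
    (z : PS d) : |dirD φ b s z| ≤ (ball (0 : PS d) R).indicator (fun z => C * (1 + ‖b z‖)) z := by
  by_cases hz : z ∈ ball (0 : PS d) R
  · rw [indicator_of_mem hz]
    refine ((fderiv ℝ φ (s, z)).le_opNorm _).trans
      (mul_le_mul (hφ.bound_fderiv _) ?_ (norm_nonneg _) hφ.C_nonneg)
    refine (max_le_add_of_nonneg (norm_nonneg _) (norm_nonneg _)).trans ?_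
    simp
  · rw [indicator_of_notMem hz, dirD, hφ.zero_fderiv s z hz]; simp

lemma TestBound.measurable_dirD {φ : ℝ × PS d → ℝ} {C R : ℝ} (hφ : TestBound φ C R) {b : PS d → PS d}
    (hb : Measurable b) (s : ℝ) : Measurable (dirD φ b s) := by
  have h1 : Continuous fun q : PS d × PS d => fderiv ℝ φ (s, q.1) (1, q.2) :=
    ((hφ.smooth.continuous_fderiv one_ne_zero).comp (by fun_prop)).clm_apply (by fun_prop)
  exact h1.measurable.comp (measurable_id.prodMk hb)

/-- The weight `1 + ‖b‖` on a ball. -/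
def wtB (b : PS d → PS d) (R : ℝ) : PS d → ℝ≥0∞ := (ball 0 R).indicator fun z => 1 + ‖b z‖ₑ

lemma measurable_wtB {b : PS d → PS d} (hb : Measurable b) (R : ℝ) : Measurable (wtB b R) :=
  (measurable_const.add hb.enorm).indicator measurableSet_ball

lemma wtB_of_mem {b : PS d → PS d} {R : ℝ} {z : PS d} (hz : z ∈ ball (0 : PS d) R) :
    ofReal (1 + ‖b z‖) = wtB b R z := by
  rw [wtB, indicator_of_mem hz, ofReal_add zero_le_one (norm_nonneg _), ENNReal.ofReal_one, ofReal_norm]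

lemma TestBound.lintegral_le {φ : ℝ × PS d → ℝ} {C R : ℝ} (hφ : TestBound φ C R) {p b : PS d → PS d}
    (hpm : Measurable p) (hbm : Measurable b) {s t ω κ : ℝ} {M : Set (PS d)} (hMm : MeasurableSet M)
    (hω : 0 < ω) (hκ0 : 0 < κ) (hκ1 : κ ≤ 1)
    (htay : ∀ z, ‖p z - z‖ < κ → |φ (t, p z) - φ (s, z) - (t - s) * dirD φ b s z|
        ≤ ω * (|t - s| * (1 + ‖b z‖)) + (C + ω) * ‖p z - z - (t - s) • b z‖)
    (hM1 : ∀ z ∈ ball 0 (R + κ) \ M, ‖p z - z‖ < κ)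
    (hM2 : ∀ z ∉ ball 0 (R + κ) ∪ M, p z ∉ ball 0 R) :
    ∫⁻ z, ‖φ (t, p z) - φ (s, z) - (t - s) * dirD φ b s z‖ₑ ≤
      ofReal ω * ofReal |t - s| * (∫⁻ z, wtB b (R + 1) z)
        + ofReal (C + ω) * (∫⁻ z in ball 0 (R + κ) \ M, ‖p z - z - (t - s) • b z‖ₑ)
        + ofReal (2 * C) * volume M
        + ofReal C * ofReal |t - s| * ∫⁻ z in M, wtB b (R + 1) z := by
  have hwm : Measurable (wtB b (R + 1)) := measurable_wtB hbm _
  have hEm : Measurable fun z => ‖p z - z - (t - s) • b z‖ₑ :=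
    ((hpm.sub measurable_id).sub ((continuous_const_smul (t - s)).measurable.comp hbm)).enorm
  have hGm : MeasurableSet (ball (0 : PS d) (R + κ) \ M) := measurableSet_ball.diff hMm
  have hpt : ∀ z, ‖φ (t, p z) - φ (s, z) - (t - s) * dirD φ b s z‖ₑ
      ≤ ofReal ω * ofReal |t - s| * wtB b (R + 1) z + ofReal (C + ω) * (ball 0 (R + κ) \ M).indicator (fun z => ‖p z - z - (t - s) • b z‖ₑ) z
        + M.indicator (fun _ => ofReal (2 * C)) z + ofReal C * ofReal |t - s| * M.indicator (wtB b (R + 1)) z := by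
    intro z
    by_cases hzM : z ∈ M
    · rw [indicator_of_mem hzM, indicator_of_mem hzM, add_assoc]
      refine le_trans ?_ le_add_self
      refine (enorm_sub_le).trans (add_le_add ?_ ?_)
      · rw [← ofReal_norm]
        refine ofReal_le_ofReal ((norm_sub_le _ _).trans ?_)
        have h1 := hφ.bound (t, p z)
        have h2 := hφ.bound (s, z)
        rw [norm_eq_abs, norm_eq_abs]
        linarith
      · rw [enorm_mul, ← ofReal_norm, ← ofReal_norm, mul_comm, mul_right_comm, norm_eq_abs, norm_eq_abs]
        refine mul_le_mul_left ?_ _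
        refine (ofReal_le_ofReal (hφ.abs_dirD_le b s z)).trans ?_
        by_cases hz : z ∈ ball (0 : PS d) R
        · rw [indicator_of_mem hz, ofReal_mul hφ.C_nonneg,
            wtB_of_mem (ball_subset_ball (show R ≤ R + 1 by linarith) hz)]
        · rw [indicator_of_notMem hz, ENNReal.ofReal_zero]; exact zero_le
    · rw [add_assoc]
      refine le_trans ?_ le_self_add
      by_cases hz : z ∈ ball (0 : PS d) (R + κ)
      · have hzG : z ∈ ball (0 : PS d) (R + κ) \ M := ⟨hz, hzM⟩
        rw [indicator_of_mem hzG, ← wtB_of_mem (ball_subset_ball (show R + κ ≤ R + 1 by linarith) hz), ← ofReal_norm,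
          ← ofReal_norm, mul_assoc, ← ofReal_mul (abs_nonneg _), ← ofReal_mul hω.le,
          ← ofReal_mul (add_nonneg hφ.C_nonneg hω.le), ← ofReal_add (by positivity)
            (mul_nonneg (add_nonneg hφ.C_nonneg hω.le) (norm_nonneg _))]
        refine ofReal_le_ofReal (htay z (hM1 z hzG))
      · have hz' : z ∉ ball (0 : PS d) (R + κ) ∪ M := fun h => h.elim hz hzM
        have hzR : z ∉ ball (0 : PS d) R := fun h => hz (ball_subset_ball (by linarith) h)
        rw [hφ.zero t _ (hM2 z hz'), hφ.zero s z hzR, dirD, hφ.zero_fderiv s z hzR]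
        simp
  calc ∫⁻ z, ‖φ (t, p z) - φ (s, z) - (t - s) * dirD φ b s z‖ₑ
      ≤ ∫⁻ z, (ofReal ω * ofReal |t - s| * wtB b (R + 1) z + ofReal (C + ω) * (ball 0 (R + κ) \ M).indicator (fun z => ‖p z - z - (t - s) • b z‖ₑ) z
        + M.indicator (fun _ => ofReal (2 * C)) z + ofReal C * ofReal |t - s| * M.indicator (wtB b (R + 1)) z) :=
        lintegral_mono hpt
    _ = ofReal ω * ofReal |t - s| * (∫⁻ z, wtB b (R + 1) z) + ofReal (C + ω) * (∫⁻ z in ball 0 (R + κ) \ M, ‖p z - z - (t - s) • b z‖ₑ)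
        + ofReal (2 * C) * volume M + ofReal C * ofReal |t - s| * ∫⁻ z in M, wtB b (R + 1) z := by
        rw [lintegral_add_right _ ((hwm.indicator hMm).const_mul _),
          lintegral_add_right _ (measurable_const.indicator hMm),
          lintegral_add_right _ ((hEm.indicator hGm).const_mul _), lintegral_const_mul _ hwm,
          lintegral_const_mul _ (hEm.indicator hGm), lintegral_const_mul _ (hwm.indicator hMm),
          lintegral_indicator_const hMm, lintegral_indicator hGm, lintegral_indicator hMm]

variable {μ : Measure (PS d)} {e₀ : ℝ} (F : AFlows d μ e₀) [IsFiniteMeasure μ]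

lemma test_near (hd : 3 ≤ d) (hμ : μ ≪ volume) {φ : ℝ × PS d → ℝ} {C R : ℝ} (hφ : TestBound φ C R) (T : ℝ)
    {s : ℝ} (hs : s ∈ Icc 0 T) {θ : ℝ≥0∞} (hθ : θ ≠ 0) :
    ∃ τ > 0, ∀ᶠ n : ℕ in UF, ∀ t ∈ Icc 0 T, |t - s| ≤ τ →
      ∫⁻ z, ‖φ (t, pth F n s t z) - φ (s, z) - (t - s) * dirD φ (bfl F s) s z‖ₑ
        ≤ θ * ofReal |t - s| := by
  have hd1 : 1 ≤ d := by omega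
  have hθ4 : θ / 4 ≠ 0 := by simpa using hθ
  have hbm := measurable_bfl F s
  set w : PS d → ℝ≥0∞ := wtB (bfl F s) (R + 1) with hw
  have hwm : Measurable w := measurable_wtB hbm _
  have hwi : ∫⁻ z, w z ≠ ⊤ := by
    rw [hw, wtB, lintegral_indicator measurableSet_ball, lintegral_add_left measurable_const, setLIntegral_const]
    exact ENNReal.add_ne_top.2 ⟨by simpa using measure_ball_lt_top.ne, (lintegral_bfl_lt_top F hd1 s _).ne⟩
  obtain ⟨ω, hω, hω1⟩ := exists_ofReal_mul_le hwi hθ4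
  obtain ⟨η, hη, -, hη1⟩ := exists_mul_le (c := ofReal C) ofReal_ne_top hθ4
  obtain ⟨δ, hδ, hδ1⟩ := exists_pos_setLIntegral_lt_of_measure_lt hwi hη
  obtain ⟨γ, hγ, -, hγ1⟩ := exists_mul_le (c := ofReal (C + ω) + ofReal (2 * C))
    (ENNReal.add_ne_top.2 ⟨ofReal_ne_top, ofReal_ne_top⟩) hθ4
  obtain ⟨δ', hδ', hδδ⟩ := exists_between hδ
  obtain ⟨κ₀, hκ₀, htay⟩ := hφ.taylor hω
  set κ := min κ₀ 1 with hκ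
  have hκ0 : 0 < κ := lt_min hκ₀ one_pos
  have hκ1 : κ ≤ 1 := min_le_right _ _
  have hθ' : min γ δ' ≠ 0 := (lt_min hγ.bot_lt hδ').ne'
  obtain ⟨τ, hτ, H⟩ := path_near F hd hμ T R hκ0 hs hθ'
  refine ⟨min τ (κ / 2), by positivity, ?_⟩
  filter_upwards [H] with n hn t ht hst
  simp only [le_min_iff] at hst
  obtain ⟨M, hMm, hMv, hM1, hM2, hM3⟩ := hn t ht hst.1
  set a := ofReal |t - s| with ha
  have ha1 : a ≤ 1 := by
    rw [← ENNReal.ofReal_one]; exact ofReal_le_ofReal (by linarith [hst.2])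
  have hMv' : volume M ≤ γ * a := hMv.trans (mul_le_mul_left (min_le_left _ _) _)
  have hMv2 : volume M < δ := by
    refine (hMv.trans (mul_le_of_le_one_right' ha1)).trans_lt ((min_le_right _ _).trans_lt hδδ)
  have hM3' : ∫⁻ z in ball 0 (R + κ) \ M, ‖pth F n s t z - z - (t - s) • bfl F s z‖ₑ ≤ γ * a := hM3.trans (mul_le_mul_left (min_le_left _ _) _)
  have hfin := hφ.lintegral_le (mp_pth F n s t).measurable hbm (t := t) (s := s) hMm hω hκ0 hκ1
    (fun z hz => htay s t z _ (bfl F s) (by linarith [hst.2, min_le_left κ₀ 1])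
      (hz.trans_le (min_le_left _ _))) hM1 hM2
  refine hfin.trans ?_
  calc _ ≤ ofReal ω * a * (∫⁻ z, w z) + ofReal (C + ω) * (γ * a)
        + ofReal (2 * C) * (γ * a) + ofReal C * a * η := by
        refine add_le_add (add_le_add (add_le_add le_rfl ?_) ?_) ?_
        · exact mul_le_mul_right hM3' _
        · exact mul_le_mul_right hMv' _
        · exact mul_le_mul_right (hδ1 M hMv2).le _
    _ = (ofReal ω * (∫⁻ z, w z) + (ofReal (C + ω) + ofReal (2 * C)) * γ
        + ofReal C * η) * a := by ring
    _ ≤ (θ / 4 + θ / 4 + θ / 4) * a :=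
        mul_le_mul_left (add_le_add (add_le_add hω1 hγ1) hη1) _
    _ ≤ (θ / 4 + θ / 4 + θ / 4 + θ / 4) * a := mul_le_mul_left le_self_add _
    _ = 4 * (θ / 4) * a := by ring
    _ = θ * a := by rw [ENNReal.mul_div_cancel (by norm_num) (by norm_num)]

end VP

namespace VP

variable {d : ℕ} {μ : Measure (PS d)} {e₀ : ℝ} (F : AFlows d μ e₀)
  {m : Measure (PS d)}

/-- The weak quantity `∫ φ(t,·) β(f_t)`. -/
def wk (m : Measure (PS d)) (φ : ℝ × PS d → ℝ) (β : ℝ → ℝ) (t : ℝ) : ℝ :=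
  ∫ z, φ (t, z) * β (dens F m t z)

/-- The time derivative of `wk`. -/
def wg (m : Measure (PS d)) (φ : ℝ × PS d → ℝ) (β : ℝ → ℝ) (s : ℝ) : ℝ :=
  ∫ z, dirD φ (bfl F s) s z * β (dens F m s z)

lemma exists_lipschitz_Icc {β : ℝ → ℝ} (hβ : ContDiff ℝ 1 β) (k : ℝ) :
    ∃ L : ℝ, 0 ≤ L ∧ ∀ a ∈ Icc 0 k, ∀ b ∈ Icc 0 k, |β a - β b| ≤ L * |a - b| := by
  obtain ⟨L, hL⟩ := (isCompact_Icc (a := (0 : ℝ)) (b := k)).exists_bound_of_continuousOn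
    (hβ.continuous_deriv_one).continuousOn
  refine ⟨max L 0, le_max_right _ _, fun a ha b hb => ?_⟩
  exact (convex_Icc (0 : ℝ) k).norm_image_sub_le_of_norm_deriv_le
    (fun x _ => (hβ.differentiable one_ne_zero).differentiableAt)
    (fun x hx => (hL x hx).trans (le_max_left _ _)) hb ha

variable {φ : ℝ × PS d → ℝ} {C R : ℝ} {β : ℝ → ℝ} {Mβ : ℝ}

lemma TestBound.integrable_mul (hφ : TestBound φ C R) (hβ : Continuous β) (hM : ∀ x, |β x| ≤ Mβ)
    {g : PS d → ℝ} (hg : Measurable g) (t : ℝ) : Integrable fun z => φ (t, z) * β (g z) := by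
  have h1 : Integrable fun z => φ (t, z) := by
    have hc : Continuous fun z => φ (t, z) := hφ.smooth.continuous.comp (by fun_prop)
    refine hc.integrable_of_hasCompactSupport
      (HasCompactSupport.intro (isCompact_closedBall (0 : PS d) R) fun z hz => ?_)
    exact hφ.zero t z fun h => hz (ball_subset_closedBall h)
  exact h1.mul_bdd (c := Mβ) (hβ.measurable.comp hg).aestronglyMeasurable (.of_forall fun z => hM _)

lemma integrable_indicator_wt (hd : 1 ≤ d) [IsFiniteMeasure μ] (s C R : ℝ) :
    Integrable ((ball (0 : PS d) R).indicator fun z => C * (1 + ‖bfl F s z‖)) := by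
  refine (integrable_indicator_iff measurableSet_ball).2 (Integrable.const_mul ?_ _)
  exact (integrableOn_const measure_ball_lt_top.ne).add (integrableOn_bfl F hd s R).norm

lemma TestBound.integrable_dirD_mul (hφ : TestBound φ C R) (hd : 1 ≤ d) [IsFiniteMeasure μ]
    (hβ : Continuous β) (hM : ∀ x, |β x| ≤ Mβ) {g : PS d → ℝ} (hg : Measurable g) (s : ℝ) :
    Integrable fun z => dirD φ (bfl F s) s z * β (g z) := by
  have h1 : Integrable (dirD φ (bfl F s) s) :=
    (integrable_indicator_wt F hd s C R).mono' (hφ.measurable_dirD (measurable_bfl F s) s).aestronglyMeasurable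
      (.of_forall fun z => hφ.abs_dirD_le _ _ _)
  exact h1.mul_bdd (c := Mβ) (hβ.measurable.comp hg).aestronglyMeasurable (.of_forall fun z => hM _)

lemma lintegral_beta_le {P : PS d → PS d} {g h : PS d → ℝ} (hφ : TestBound φ C R) {L : ℝ} (hL : 0 ≤ L)
    (hM : ∀ x, |β x| ≤ Mβ) (t : ℝ) {U M : Set (PS d)} (hUm : MeasurableSet U) (hMm : MeasurableSet M)
    (hlip : ∀ᵐ z, |β (h (P z)) - β (g z)| ≤ L * |g z - h (P z)|)
    (hUM : ∀ z, z ∉ U → z ∉ M → P z ∉ ball (0 : PS d) R) :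
    ∫⁻ z, ‖φ (t, P z) * (β (h (P z)) - β (g z))‖ₑ
      ≤ ofReal (C * L) * (∫⁻ z in U, ‖g z - h (P z)‖ₑ) + ofReal (C * (2 * Mβ)) * volume M := by
  have hC0 := hφ.C_nonneg
  have hpt : ∀ᵐ z, ‖φ (t, P z) * (β (h (P z)) - β (g z))‖ₑ
      ≤ U.indicator (fun z => ofReal (C * L) * ‖g z - h (P z)‖ₑ) z
        + M.indicator (fun _ => ofReal (C * (2 * Mβ))) z := by
    filter_upwards [hlip] with z hz
    have hφb := hφ.bound (t, P z)
    by_cases hzU : z ∈ U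
    · refine le_trans ?_ le_self_add
      rw [indicator_of_mem hzU, ← ofReal_norm, ← ofReal_norm, ← ofReal_mul (mul_nonneg hC0 hL),
        norm_mul, norm_eq_abs, norm_eq_abs, norm_eq_abs, mul_assoc]
      exact ofReal_le_ofReal (mul_le_mul hφb hz (abs_nonneg _) hC0)
    · by_cases hzM : z ∈ M
      · refine le_trans ?_ le_add_self
        rw [indicator_of_mem hzM, ← ofReal_norm, norm_mul, norm_eq_abs, norm_eq_abs]
        refine ofReal_le_ofReal (mul_le_mul hφb ?_ (abs_nonneg _) hC0)
        refine (abs_sub _ _).trans ?_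
        linarith [hM (h (P z)), hM (g z)]
      · rw [hφ.zero t _ (hUM z hzU hzM), zero_mul, enorm_zero]
        exact zero_le
  refine (lintegral_mono_ae hpt).trans (le_of_eq ?_)
  rw [lintegral_add_right _ (measurable_const.indicator hMm), lintegral_indicator hUm,
    lintegral_indicator_const hMm, lintegral_const_mul' _ _ ofReal_ne_top]

variable [IsFiniteMeasure μ]

lemma beta_near (hd : 3 ≤ d) (hμ : μ ≪ volume) (hm : m ≤ μ) {k : ℝ≥0∞} (hkt : k ≠ ⊤)
    (hk : m ≤ k • volume) (hφ : TestBound φ C R) (hβ : ContDiff ℝ 1 β) (hM : ∀ x, |β x| ≤ Mβ) (T : ℝ)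
    {s : ℝ} (hs : s ∈ Icc 0 T) {θ : ℝ≥0∞} (hθ : θ ≠ 0) :
    ∃ τ > 0, ∀ t ∈ Icc 0 T, |t - s| ≤ τ → ∀ ω : ℝ≥0∞, ω ≠ 0 → ∀ᶠ n : ℕ in UF,
      ∫⁻ z, ‖φ (t, pth F n s t z) * (β (dens F m t (pth F n s t z)) - β (dens F m s z))‖ₑ
        ≤ θ * ofReal |t - s| + ω := by
  obtain ⟨L, hL, hlip⟩ := exists_lipschitz_Icc hβ k.toReal
  have hθ2 : θ / 2 ≠ 0 := by simpa using hθ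
  obtain ⟨θ₁, hθ₁, -, h1⟩ := exists_mul_le (c := ofReal (C * L)) ofReal_ne_top hθ2
  obtain ⟨θ₂, hθ₂, -, h2⟩ := exists_mul_le (c := ofReal (C * (2 * Mβ))) ofReal_ne_top hθ2
  obtain ⟨τ₁, hτ₁, H1⟩ := transport F hd hμ hm hkt hk T (R + 1) hs hθ₁
  obtain ⟨τ₂, hτ₂, H2⟩ := path_near F hd hμ T R one_pos hs hθ₂
  refine ⟨min τ₁ τ₂, lt_min hτ₁ hτ₂, fun t ht hst ω hω => ?_⟩
  rw [le_min_iff] at hst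
  obtain ⟨ω₁, hω₁, -, h3⟩ := exists_mul_le (c := ofReal (C * L)) ofReal_ne_top hω
  filter_upwards [H1 t ht hst.1 ω₁ hω₁, H2] with n hn1 hn2
  obtain ⟨M, hMm, hMv, -, hM2, -⟩ := hn2 t ht hst.2
  have hpm : Measurable (pth F n s t) := (mp_pth F n s t).measurable
  have hae : ∀ᵐ z, dens F m t (pth F n s t z) ≤ k.toReal :=
    (mp_pth F n s t).quasiMeasurePreserving.ae (dens_le F hd hμ hm hkt hk ht.1)
  calc _ ≤ ofReal (C * L) * (∫⁻ z in ball 0 (R + 1) ∩ pth F n s t ⁻¹' ball 0 (R + 1),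
          ‖dens F m s z - dens F m t (pth F n s t z)‖ₑ) + ofReal (C * (2 * Mβ)) * volume M := by
        refine lintegral_beta_le hφ hL hM t (measurableSet_ball.inter (hpm measurableSet_ball)) hMm ?_ ?_
        · filter_upwards [hae, dens_le F hd hμ hm hkt hk hs.1] with z ha hb
          rw [abs_sub_comm (dens F m s z)]
          exact hlip _ ⟨dens_nonneg F _ _, ha⟩ _ ⟨dens_nonneg F _ _, hb⟩
        · intro z hzU hzM hp
          by_cases hz : z ∈ ball (0 : PS d) (R + 1)
          · have hp1 : pth F n s t z ∈ ball (0 : PS d) (R + 1) := ball_subset_ball (by linarith) hp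
            exact hzU (mem_inter hz (mem_preimage.2 hp1))
          · have hzn : z ∉ ball (0 : PS d) (R + 1) ∪ M := by rw [mem_union]; exact not_or.2 ⟨hz, hzM⟩
            exact hM2 z hzn hp
    _ ≤ ofReal (C * L) * (θ₁ * ofReal |t - s| + ω₁)
        + ofReal (C * (2 * Mβ)) * (θ₂ * ofReal |t - s|) :=
        add_le_add (mul_le_mul_right hn1 _) (mul_le_mul_right hMv _)
    _ = (ofReal (C * L) * θ₁ + ofReal (C * (2 * Mβ)) * θ₂) * ofReal |t - s|
        + ofReal (C * L) * ω₁ := by ring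
    _ ≤ (θ / 2 + θ / 2) * ofReal |t - s| + ω :=
        add_le_add (mul_le_mul_left (add_le_add h1 h2) _) h3
    _ = _ := by rw [ENNReal.add_halves]

lemma wk_sub_le (hd : 3 ≤ d) (hμ : μ ≪ volume) (hm : m ≤ μ) {k : ℝ≥0∞} (hkt : k ≠ ⊤)
    (hk : m ≤ k • volume) (hφ : TestBound φ C R) (hβ : ContDiff ℝ 1 β) (hM : ∀ x, |β x| ≤ Mβ) (T : ℝ)
    {s : ℝ} (hs : s ∈ Icc 0 T) {θ : ℝ≥0∞} (hθ : θ ≠ 0) :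
    ∃ τ > 0, ∀ t ∈ Icc 0 T, |t - s| ≤ τ →
      ‖wk F m φ β t - wk F m φ β s - (t - s) * wg F m φ β s‖ₑ ≤ θ * ofReal |t - s| := by
  have hd1 : 1 ≤ d := by omega
  have hθ2 : θ / 2 ≠ 0 := by simpa using hθ
  obtain ⟨θ₂, hθ₂, -, h2⟩ := exists_mul_le (c := ofReal Mβ) ofReal_ne_top hθ2
  obtain ⟨τ₁, hτ₁, H1⟩ := beta_near F hd hμ hm hkt hk hφ hβ hM T hs hθ2
  obtain ⟨τ₂, hτ₂, H2⟩ := test_near F hd hμ hφ T hs hθ₂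
  refine ⟨min τ₁ τ₂, lt_min hτ₁ hτ₂, fun t ht hst => ?_⟩
  rw [le_min_iff] at hst
  refine _root_.le_of_forall_pos_le_add fun ω hω => ?_
  obtain ⟨n, hn1, hn2⟩ := ((H1 t ht hst.1 ω hω.ne').and H2).exists
  have hn2' := hn2 t ht hst.2
  have hpm : Measurable (pth F n s t) := (mp_pth F n s t).measurable
  have mt := measurable_dens F (m := m) t
  have ms := measurable_dens F (m := m) s
  have hφm : ∀ r, Measurable fun z => φ (r, z) := fun r => (hφ.smooth.continuous.comp (by fun_prop)).measurable
  have hβm := hβ.continuous.measurable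
  have i1 : Integrable fun z => φ (t, z) * β (dens F m t z) := hφ.integrable_mul hβ.continuous hM mt t
  have i1' : Integrable fun z => φ (t, pth F n s t z) * β (dens F m t (pth F n s t z)) :=
    (mp_pth F n s t).integrable_comp_of_integrable i1
  have i2 : Integrable fun z => φ (s, z) * β (dens F m s z) := hφ.integrable_mul hβ.continuous hM ms s
  have i3 : Integrable fun z => (t - s) * (dirD φ (bfl F s) s z * β (dens F m s z)) :=
    (hφ.integrable_dirD_mul F hd1 hβ.continuous hM ms s).const_mul _
  have i12 : Integrable fun z => φ (t, pth F n s t z) * β (dens F m t (pth F n s t z))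
      - φ (s, z) * β (dens F m s z) := i1'.sub i2
  have e1 : wk F m φ β t = ∫ z, φ (t, pth F n s t z) * β (dens F m t (pth F n s t z)) := by
    have h3 : Measure.map (pth F n s t) volume = volume := (mp_pth F n s t).map_eq
    rw [wk]
    conv_lhs => rw [← h3]
    exact integral_map hpm.aemeasurable (by rw [h3]; exact i1.aestronglyMeasurable)
  have m1 : Measurable fun z => ‖φ (t, pth F n s t z) * (β (dens F m t (pth F n s t z)) - β (dens F m s z))‖ₑ :=
    (((hφm t).comp hpm).mul ((hβm.comp (mt.comp hpm)).sub (hβm.comp ms))).enorm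
  rw [e1, wk, wg, ← integral_sub i1' i2, ← integral_const_mul, ← integral_sub i12 i3]
  refine (enorm_integral_le_lintegral_enorm _).trans ?_
  calc _ ≤ ∫⁻ z, (‖φ (t, pth F n s t z) * (β (dens F m t (pth F n s t z)) - β (dens F m s z))‖ₑ
        + ofReal Mβ * ‖φ (t, pth F n s t z) - φ (s, z) - (t - s) * dirD φ (bfl F s) s z‖ₑ) := by
        refine lintegral_mono fun z => ?_
        have e2 : φ (t, pth F n s t z) * β (dens F m t (pth F n s t z)) - φ (s, z) * β (dens F m s z)
            - (t - s) * (dirD φ (bfl F s) s z * β (dens F m s z))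
            = φ (t, pth F n s t z) * (β (dens F m t (pth F n s t z)) - β (dens F m s z))
              + β (dens F m s z) * (φ (t, pth F n s t z) - φ (s, z) - (t - s) * dirD φ (bfl F s) s z) := by ring
        rw [e2]
        refine (enorm_add_le _ _).trans (add_le_add_right ?_ _)
        rw [enorm_mul, ← ofReal_norm (β _)]
        exact mul_le_mul_left (ofReal_le_ofReal (hM _)) _
    _ = (∫⁻ z, ‖φ (t, pth F n s t z) * (β (dens F m t (pth F n s t z)) - β (dens F m s z))‖ₑ)
        + ofReal Mβ * ∫⁻ z, ‖φ (t, pth F n s t z) - φ (s, z) - (t - s) * dirD φ (bfl F s) s z‖ₑ := by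
        rw [lintegral_add_left m1, lintegral_const_mul' _ _ ofReal_ne_top]
    _ ≤ (θ / 2 * ofReal |t - s| + ω) + ofReal Mβ * (θ₂ * ofReal |t - s|) :=
        add_le_add hn1 (mul_le_mul_right hn2' _)
    _ = (θ / 2 + ofReal Mβ * θ₂) * ofReal |t - s| + ω := by ring
    _ ≤ (θ / 2 + θ / 2) * ofReal |t - s| + ω :=
        add_le_add_left (mul_le_mul_left (add_le_add_right h2 _) _) _
    _ = _ := by rw [ENNReal.add_halves]

lemma hasDerivWithinAt_wk (hd : 3 ≤ d) (hμ : μ ≪ volume) (hm : m ≤ μ) {k : ℝ≥0∞} (hkt : k ≠ ⊤)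
    (hk : m ≤ k • volume) (hφ : TestBound φ C R) (hβ : ContDiff ℝ 1 β) (hM : ∀ x, |β x| ≤ Mβ) {T s : ℝ}
    (hs : s ∈ Icc 0 T) : HasDerivWithinAt (wk F m φ β) (wg F m φ β s) (Icc 0 T) s := by
  rw [hasDerivWithinAt_iff_isLittleO, Asymptotics.isLittleO_iff]
  intro c hc
  obtain ⟨τ, hτ, H⟩ := wk_sub_le F hd hμ hm hkt hk hφ hβ hM T hs (θ := ofReal c) (by simpa using hc)
  filter_upwards [self_mem_nhdsWithin, mem_nhdsWithin_of_mem_nhds (closedBall_mem_nhds s hτ)] with t ht hts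
  have h1 := H t ht (by rwa [← Real.dist_eq])
  rw [← ofReal_mul hc.le, ← ofReal_norm,
    ENNReal.ofReal_le_ofReal_iff (mul_nonneg hc.le (abs_nonneg _))] at h1
  rwa [smul_eq_mul, norm_eq_abs (t - s)]

end VP

namespace VP

/-- The part of `μ` carried by the set where its density is at most `j`. -/
def lay {d : ℕ} (μ : Measure (PS d)) (j : ℕ) : Measure (PS d) :=
  μ.restrict {z | μ.rnDeriv volume z ≤ j}

section Layers

variable {d : ℕ} {μ : Measure (PS d)}

lemma measurableSet_lay (j : ℕ) : MeasurableSet {z | μ.rnDeriv volume z ≤ j} :=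
  measurableSet_le (Measure.measurable_rnDeriv _ _) measurable_const

lemma lay_le (j : ℕ) : lay μ j ≤ μ := Measure.restrict_le_self

lemma lay_mono {i j : ℕ} (h : i ≤ j) : lay μ i ≤ lay μ j := by
  refine Measure.restrict_mono_set _ fun z hz => ?_
  have : (i : ℝ≥0∞) ≤ j := by exact_mod_cast h
  exact le_trans hz this

variable [IsFiniteMeasure μ]

lemma lay_le_smul (hμ : μ ≪ volume) (j : ℕ) : lay μ j ≤ (j : ℝ≥0∞) • volume := by
  refine Measure.le_iff.2 fun s hs => ?_
  rw [lay, Measure.restrict_apply hs]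
  calc μ (s ∩ {z | μ.rnDeriv volume z ≤ j})
      = ∫⁻ z in s ∩ {z | μ.rnDeriv volume z ≤ j}, μ.rnDeriv volume z := by
        rw [← withDensity_apply _ (hs.inter (measurableSet_lay j)), Measure.withDensity_rnDeriv_eq μ _ hμ]
    _ ≤ ∫⁻ z in s ∩ {z | μ.rnDeriv volume z ≤ j}, j := setLIntegral_mono measurable_const fun z hz => hz.2
    _ ≤ _ := by
        rw [setLIntegral_const, Measure.smul_apply, smul_eq_mul]
        exact mul_le_mul_right (measure_mono inter_subset_left) _

lemma tendsto_lay (hμ : μ ≪ volume) : Tendsto (fun j => lay μ j univ) atTop (𝓝 (μ univ)) := by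
  have h1 : μ univ = μ (⋃ j : ℕ, {z | μ.rnDeriv volume z ≤ j}) := by
    refine (measure_eq_measure_of_null_sdiff (subset_univ _) (measure_mono_null (fun z hz => ?_)
      (hμ (Measure.rnDeriv_lt_top μ volume)))).symm
    simp only [Set.mem_sdiff, mem_iUnion, mem_ofPred_eq, not_exists, not_le] at hz
    simp only [mem_compl_iff, mem_ofPred_eq, not_lt, top_le_iff]
    by_contra hc
    obtain ⟨n, hn⟩ := ENNReal.exists_nat_gt hc
    exact absurd (hz.2 n) (not_lt.2 hn.le)
  rw [h1]
  simp only [lay, Measure.restrict_apply_univ]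
  refine tendsto_measure_iUnion_atTop fun i j hij z hz => ?_
  have : (i : ℝ≥0∞) ≤ j := by exact_mod_cast hij
  exact le_trans hz this

end Layers

lemma exists_fld_bound {d : ℕ} (hd : 1 ≤ d) {c : ℝ≥0∞} (hc : c ≠ ⊤) (R : ℝ) :
    ∃ K : ℝ≥0∞, K ≠ ⊤ ∧ ∀ ν : Measure (PS d), IsFiniteMeasure ν → ν univ = c →
      ∫⁻ x in ball (0 : Ed d) R, ‖fld d 0 ν x‖ₑ ≤ K := by
  have := sph_ne_top d
  have := (measure_ball_lt_top (μ := (volume : Measure (Ed d))) (x := 0) (r := R)).ne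
  refine ⟨ofReal (cdim d) * (ofReal √(d * 1) * (2 * sph d + volume (ball (0 : Ed d) R)) * c)
    + ofReal (cdim d * ((1 ^ (d - 1))⁻¹ * c.toReal)) * volume (ball (0 : Ed d) R), by finiteness,
    fun ν hν hν1 => ?_⟩
  have h := lintegral_fld_sub_le hd le_rfl zero_le_one ν (ball (0 : Ed d) R)
  have h2 := lintegral_ball_le_of_norm_le (R := R) fun x _ => norm_fld_le hd one_pos ν x
  have h3 := lintegral_enorm_sub_le (m := volume.restrict (ball (0 : Ed d) R)) (h := fun _ => 0)
    (measurable_fld (d := d) 0 ν) (measurable_fld (d := d) 1 ν)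
  simp only [sub_zero] at h3
  rw [Measure.real, hν1] at h2
  rw [hν1] at h
  exact h3.trans (add_le_add h h2)

variable {d : ℕ} {μ : Measure (PS d)} {e₀ : ℝ} (F : AFlows d μ e₀)
  {m : Measure (PS d)} [IsFiniteMeasure μ]

lemma exists_bfl_bound (hd : 3 ≤ d) (hμ : μ ≪ volume) (R : ℝ) :
    ∃ K : ℝ≥0∞, K ≠ ⊤ ∧ ∀ s, 0 ≤ s → ∫⁻ z in ball (0 : PS d) R, ‖bfl F s z‖ₑ ≤ K := by
  obtain ⟨K, hK, h⟩ := exists_fld_bound (d := d) (by omega) (measure_ne_top μ univ) R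
  have := (measure_ball_lt_top (μ := (volume : Measure (Ed d))) (x := 0) (r := R)).ne
  have := (measure_ball_lt_top (μ := (volume : Measure (PS d))) (x := 0) (r := R)).ne
  refine ⟨ofReal R * volume (ball (0 : PS d) R) + K * volume (ball (0 : Ed d) R), by finiteness,
    fun s hs => ?_⟩
  have hm := measurable_fld (d := d) 0 (nu F μ s)
  calc ∫⁻ z in ball (0 : PS d) R, ‖bfl F s z‖ₑ
      ≤ ∫⁻ z in ball (0 : PS d) R, (ofReal R + ‖fld d 0 (nu F μ s) z.1‖ₑ) := by
        refine setLIntegral_mono (by fun_prop) fun z hz => ?_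
        rw [enorm_prod]
        refine (max_le_add_of_nonneg zero_le zero_le).trans (add_le_add_left ?_ _)
        rw [← ofReal_norm]
        rw [ball_prod] at hz
        exact ofReal_le_ofReal (mem_ball_zero_iff.1 hz.2).le
    _ = ofReal R * volume (ball (0 : PS d) R)
        + (∫⁻ x in ball (0 : Ed d) R, ‖fld d 0 (nu F μ s) x‖ₑ) * volume (ball (0 : Ed d) R) := by
        rw [lintegral_add_left measurable_const, setLIntegral_const,
          setLIntegral_fst R (f := fun x => ‖fld d 0 (nu F μ s) x‖ₑ) (by fun_prop)]
    _ ≤ _ := add_le_add_right (mul_le_mul_left (h _ inferInstance (nu_univ hd hμ F le_rfl hs)) _) _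

variable {φ : ℝ × PS d → ℝ} {C R : ℝ} {β : ℝ → ℝ} {Mβ : ℝ}

lemma lintegral_rnDeriv_nu (hd : 3 ≤ d) (hμ : μ ≪ volume) (hm : m ≤ μ) {t : ℝ} (ht : 0 ≤ t) :
    ∫⁻ z, (nu F m t).rnDeriv volume z = m univ := by
  rw [← nu_univ hd hμ F hm ht, Measure.lintegral_rnDeriv (nu_ac hd hμ F hm ht)]

lemma rnDeriv_nu_mono (hd : 3 ≤ d) (hμ : μ ≪ volume) {m' : Measure (PS d)} (hm : m ≤ μ) (h : m' ≤ m) {t : ℝ}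
    (ht : 0 ≤ t) : (nu F m' t).rnDeriv volume ≤ᵐ[volume] (nu F m t).rnDeriv volume := by
  refine ae_le_of_forall_setLIntegral_le_of_sigmaFinite (Measure.measurable_rnDeriv _ _) fun s hs _ => ?_
  rw [Measure.setLIntegral_rnDeriv (nu_ac hd hμ F (h.trans hm) ht),
    Measure.setLIntegral_rnDeriv (nu_ac hd hμ F hm ht)]
  exact nu_mono hd hμ F hm ht h s

lemma tendsto_dens (hd : 3 ≤ d) (hμ : μ ≪ volume) {t : ℝ} (ht : 0 ≤ t) :
    ∀ᵐ z, Tendsto (fun j => dens F (lay μ j) t z) atTop (𝓝 (dens F μ t z)) := by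
  have h := tendsto_of_lintegral_tendsto_of_monotone (μ := volume)
    (f := fun j => (nu F (lay μ j) t).rnDeriv volume) (F := (nu F μ t).rnDeriv volume)
    (Measure.measurable_rnDeriv _ _).aemeasurable ?_ ?_ ?_ ?_
  · filter_upwards [h, Measure.rnDeriv_lt_top (nu F μ t) volume] with z hz hz1
    exact (ENNReal.tendsto_toReal hz1.ne).comp hz
  · simp only [lintegral_rnDeriv_nu F hd hμ (lay_le _) ht, lintegral_rnDeriv_nu F hd hμ le_rfl ht]
    exact tendsto_lay hμ
  · have : ∀ᵐ z, ∀ j : ℕ, (nu F (lay μ j) t).rnDeriv volume z ≤ (nu F (lay μ (j + 1)) t).rnDeriv volume z :=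
      ae_all_iff.2 fun j => rnDeriv_nu_mono F hd hμ (lay_le _) (lay_mono (Nat.le_succ j)) ht
    filter_upwards [this] with z hz
    exact monotone_nat_of_le_succ hz
  · exact ae_all_iff.2 fun j => rnDeriv_nu_mono F hd hμ le_rfl (lay_le j) ht
  · rw [lintegral_rnDeriv_nu F hd hμ le_rfl ht]
    exact measure_ne_top _ _

lemma abs_wg_le (hd : 3 ≤ d) (hμ : μ ≪ volume) (hφ : TestBound φ C R) (hM : ∀ x, |β x| ≤ Mβ) :
    ∃ K : ℝ, ∀ m : Measure (PS d), ∀ s, 0 ≤ s → |wg F m φ β s| ≤ K := by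
  obtain ⟨K, hK, h⟩ := exists_bfl_bound F hd hμ R
  have hM0 : 0 ≤ Mβ := (abs_nonneg _).trans (hM 0)
  have hC0 := hφ.C_nonneg
  have hv := (measure_ball_lt_top (μ := (volume : Measure (PS d))) (x := 0) (r := R)).ne
  set A := ofReal (C * Mβ) * (volume (ball (0 : PS d) R) + K) with hA
  have hAt : A ≠ ⊤ := by finiteness
  refine ⟨A.toReal, fun m s hs => ?_⟩
  rw [← norm_eq_abs, ← toReal_enorm]
  refine ENNReal.toReal_mono hAt ((enorm_integral_le_lintegral_enorm _).trans ?_)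
  calc _ ≤ ∫⁻ z, (ball (0 : PS d) R).indicator (fun z => ofReal (C * Mβ) * (1 + ‖bfl F s z‖ₑ)) z := by
        refine lintegral_mono fun z => ?_
        have h1 := hφ.abs_dirD_le (bfl F s) s z
        by_cases hz : z ∈ ball (0 : PS d) R
        · rw [indicator_of_mem hz] at h1 ⊢
          rw [← ofReal_norm, ← ofReal_norm (bfl F s z), ← ENNReal.ofReal_one,
            ← ofReal_add zero_le_one (norm_nonneg _), ← ofReal_mul (by positivity)]
          refine ofReal_le_ofReal ?_
          rw [norm_mul, norm_eq_abs, norm_eq_abs]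
          calc _ ≤ (C * (1 + ‖bfl F s z‖)) * Mβ := mul_le_mul h1 (hM _) (abs_nonneg _) (by positivity)
            _ = _ := by ring
        · rw [indicator_of_notMem hz] at h1
          have h2 : dirD φ (bfl F s) s z = 0 := abs_nonpos_iff.1 h1
          simp [h2]
    _ = ofReal (C * Mβ) * (volume (ball (0 : PS d) R) + ∫⁻ z in ball (0 : PS d) R, ‖bfl F s z‖ₑ) := by
        rw [lintegral_indicator measurableSet_ball, lintegral_const_mul' _ _ ofReal_ne_top,
          lintegral_add_left measurable_const, setLIntegral_one]
    _ ≤ A := mul_le_mul_right (add_le_add_right (h s hs) _) _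

lemma exists_time_bound (hφ : TestBound φ C R) :
    ∃ T₀ : ℝ, 0 ≤ T₀ ∧ ∀ s, T₀ ≤ s → (∀ z, φ (s, z) = 0) ∧ ∀ z, ∀ b : PS d → PS d, dirD φ b s z = 0 := by
  obtain ⟨T₀, hT⟩ := (hφ.compact.isCompact.image continuous_fst).isBounded.subset_ball (0 : ℝ)
  have hn : ∀ s, max T₀ 0 ≤ s → ∀ z, (s, z) ∉ tsupport φ := fun s hs z hz => by
    have := hT ⟨_, hz, rfl⟩
    rw [mem_ball_zero_iff, norm_eq_abs, abs_lt] at this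
    linarith [le_max_left T₀ 0]
  refine ⟨max T₀ 0, le_max_right _ _, fun s hs => ⟨fun z => image_eq_zero_of_notMem_tsupport (hn s hs z),
    fun z b => ?_⟩⟩
  rw [dirD, image_eq_zero_of_notMem_tsupport fun hcon => hn s hs z (tsupport_fderiv_subset ℝ hcon)]
  rfl

lemma integral_wg_layer (hd : 3 ≤ d) (hμ : μ ≪ volume) (hm : m ≤ μ) {k : ℝ≥0∞} (hkt : k ≠ ⊤)
    (hk : m ≤ k • volume) (hφ : TestBound φ C R) (hβ : ContDiff ℝ 1 β) (hM : ∀ x, |β x| ≤ Mβ) :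
    AEStronglyMeasurable (wg F m φ β) (volume.restrict (Ioi 0)) ∧
      ∫ s in Ioi 0, wg F m φ β s = - wk F m φ β 0 := by
  obtain ⟨K, hK⟩ := abs_wg_le F hd hμ hφ hM
  obtain ⟨T₀, hT₀, hT⟩ := exists_time_bound hφ
  have hder : ∀ s ∈ Ioi (0 : ℝ), HasDerivAt (wk F m φ β) (wg F m φ β s) s := fun s hs =>
    (hasDerivWithinAt_wk F hd hμ hm hkt hk hφ hβ hM (T := s + 1) ⟨le_of_lt hs, by linarith⟩).hasDerivAt
      (Icc_mem_nhds hs (by linarith))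
  have hmeas : AEStronglyMeasurable (wg F m φ β) (volume.restrict (Ioi 0)) := by
    refine (measurable_deriv (wk F m φ β)).aestronglyMeasurable.congr ?_
    filter_upwards [ae_restrict_mem measurableSet_Ioi] with s hs
    exact (hder s hs).deriv
  have hg0 : ∀ s, T₀ ≤ s → wg F m φ β s = 0 := fun s hs => by simp [wg, (hT s hs).2]
  have hItg : IntegrableOn (wg F m φ β) (Ioi 0) := by
    have hb : IntegrableOn ((Iio T₀).indicator fun _ => K) (Ioi (0 : ℝ)) := by
      rw [IntegrableOn, integrable_indicator_iff measurableSet_Iio, IntegrableOn,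
        Measure.restrict_restrict measurableSet_Iio, Iio_inter_Ioi]
      exact integrableOn_const measure_Ioo_lt_top.ne
    refine Integrable.mono' hb hmeas ?_
    filter_upwards [ae_restrict_mem measurableSet_Ioi] with s hs
    by_cases h : s < T₀
    · rw [indicator_of_mem (by exact h)]
      exact hK m s (le_of_lt hs)
    · rw [hg0 s (not_lt.1 h), norm_zero, indicator_of_notMem (by exact h)]
  refine ⟨hmeas, ?_⟩
  rw [← zero_sub]
  refine integral_Ioi_of_hasDerivAt_of_tendsto ?_ hder hItg ?_
  · have := (hasDerivWithinAt_wk F hd hμ hm hkt hk hφ hβ hM (T := 1) (s := 0) (by simp)).continuousWithinAt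
    rw [ContinuousWithinAt] at this ⊢
    rwa [nhdsWithin_Icc_eq_nhdsGE zero_lt_one] at this
  · refine tendsto_const_nhds.congr' ?_
    filter_upwards [eventually_ge_atTop T₀] with s hs
    simp [wk, (hT s hs).1]

lemma tendsto_wg (hd : 3 ≤ d) (hμ : μ ≪ volume) (hφ : TestBound φ C R) (hβ : ContDiff ℝ 1 β)
    (hM : ∀ x, |β x| ≤ Mβ) {s : ℝ} (hs : 0 ≤ s) :
    Tendsto (fun j => wg F (lay μ j) φ β s) atTop (𝓝 (wg F μ φ β s)) := by
  have hi := (integrable_indicator_wt F (by omega : 1 ≤ d) s C R).mul_const Mβ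
  refine tendsto_integral_of_dominated_convergence _ (fun j => (hφ.integrable_dirD_mul F (by omega)
    hβ.continuous hM (measurable_dens F s) s).aestronglyMeasurable) hi (fun j => .of_forall fun z => ?_) ?_
  · rw [norm_mul, norm_eq_abs, norm_eq_abs]
    have := hφ.abs_dirD_le (bfl F s) s z
    exact mul_le_mul this (hM _) (abs_nonneg _) ((abs_nonneg _).trans this)
  · filter_upwards [tendsto_dens F hd hμ hs] with z hz
    exact ((hβ.continuous.tendsto _).comp hz).const_mul _

lemma tendsto_wk (hd : 3 ≤ d) (hμ : μ ≪ volume) (hφ : TestBound φ C R) (hβ : ContDiff ℝ 1 β)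
    (hM : ∀ x, |β x| ≤ Mβ) {s : ℝ} (hs : 0 ≤ s) :
    Tendsto (fun j => wk F (lay μ j) φ β s) atTop (𝓝 (wk F μ φ β s)) := by
  have hi : Integrable ((ball (0 : PS d) R).indicator fun _ => C * Mβ) :=
    (integrable_indicator_iff measurableSet_ball).2 (integrableOn_const measure_ball_lt_top.ne)
  refine tendsto_integral_of_dominated_convergence _ (fun j => (hφ.integrable_mul hβ.continuous hM
    (measurable_dens F s) s).aestronglyMeasurable) hi (fun j => .of_forall fun z => ?_) ?_
  · rw [norm_mul, norm_eq_abs, norm_eq_abs]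
    by_cases hz : z ∈ ball (0 : PS d) R
    · rw [indicator_of_mem hz]
      exact mul_le_mul (hφ.bound _) (hM _) (abs_nonneg _) hφ.C_nonneg
    · rw [indicator_of_notMem hz, hφ.zero s z hz, abs_zero, zero_mul]
  · filter_upwards [tendsto_dens F hd hμ hs] with z hz
    exact ((hβ.continuous.tendsto _).comp hz).const_mul _

lemma integral_wg (hd : 3 ≤ d) (hμ : μ ≪ volume) (hφ : TestBound φ C R) (hβ : ContDiff ℝ 1 β)
    (hM : ∀ x, |β x| ≤ Mβ) : wk F μ φ β 0 + ∫ s in Ioi 0, wg F μ φ β s = 0 := by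
  obtain ⟨K, hK⟩ := abs_wg_le F hd hμ hφ hM
  obtain ⟨T₀, hT₀, hT⟩ := exists_time_bound hφ
  have hl := fun j => integral_wg_layer F hd hμ (lay_le j) (ENNReal.natCast_ne_top j) (lay_le_smul hμ j) hφ hβ hM
  have hb : IntegrableOn ((Iio T₀).indicator fun _ => K) (Ioi (0 : ℝ)) := by
    rw [IntegrableOn, integrable_indicator_iff measurableSet_Iio, IntegrableOn,
      Measure.restrict_restrict measurableSet_Iio, Iio_inter_Ioi]
    exact integrableOn_const measure_Ioo_lt_top.ne
  have h1 : Tendsto (fun j => ∫ s in Ioi 0, wg F (lay μ j) φ β s) atTop (𝓝 (∫ s in Ioi 0, wg F μ φ β s)) := by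
    refine tendsto_integral_of_dominated_convergence _ (fun j => (hl j).1) hb (fun j => ?_) ?_
    · filter_upwards [ae_restrict_mem measurableSet_Ioi] with s hs
      by_cases h : s < T₀
      · rw [indicator_of_mem (by exact h)]
        exact hK _ s (le_of_lt hs)
      · have : wg F (lay μ j) φ β s = 0 := by simp [wg, (hT s (not_lt.1 h)).2]
        rw [this, norm_zero, indicator_of_notMem (by exact h)]
    · filter_upwards [ae_restrict_mem measurableSet_Ioi] with s hs
      exact tendsto_wg F hd hμ hφ hβ hM (le_of_lt hs)
  have h2 := tendsto_nhds_unique (h1.congr fun j => (hl j).2) (tendsto_wk F hd hμ hφ hβ hM le_rfl).neg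
  rw [h2, add_neg_cancel]

end VP

namespace VP

lemma rH_sub_le {d : ℕ} (hd : 3 ≤ d) {ε : ℝ} (hε : 0 < ε) (x y : Ed d) :
    ‖rH d ε x - rH d ε y‖ ≤ ((d : ℝ) - 2) * (ε ^ (d - 1))⁻¹ * ‖x - y‖ := by
  have hd2 := (sub_two_pos hd).le
  have h := norm_image_sub_le_of_norm_deriv_le_segment_01' (f := fun t : ℝ => rH d ε (y + t • (x - y)))
    (C := ((d : ℝ) - 2) * (ε ^ (d - 1))⁻¹ * ‖x - y‖)
    (fun t _ => (hasDerivAt_rH (by omega) hε y (x - y) t).hasDerivWithinAt) (fun t _ => ?_)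
  · simpa using h
  · rw [norm_neg, norm_mul, norm_of_nonneg hd2, mul_assoc]
    exact mul_le_mul_of_nonneg_left ((norm_inner_le_norm _ _).trans
      (mul_le_mul_of_nonneg_right (norm_rk_le_const (by omega) hε _) (norm_nonneg _))) hd2

lemma integral_rH {d : ℕ} {Ω : Type*} [MeasurableSpace Ω] {m : Measure Ω} [IsFiniteMeasure m] {ε : ℝ} (hε : 0 < ε)
    {X : Ω → Ed d} (hX : Measurable X) :
    ∫ p : Ω × Ω, rH d ε (X p.1 - X p.2) ∂(m.prod m) = ∫ a, ∫ b, rH d ε (X a - X b) ∂m ∂m :=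
  integral_prod _ (integrable_rH hε hX)

variable {d : ℕ} {μ : Measure (PS d)} {e₀ : ℝ} [IsFiniteMeasure μ]
  (F : AFlows d μ e₀)

lemma tendsto_pot (hd : 3 ≤ d) (hμ : μ ≪ volume) {ε : ℝ} (hε : 0 < ε) {t : ℝ} (ht : 0 ≤ t) :
    Tendsto (fun n => ∫ p : PS d × PS d, rH d ε (((F n).Z t p.1).1 - ((F n).Z t p.2).1) ∂(μ.prod μ)) UF
      (𝓝 (∫ p : PS d × PS d, rH d ε (p.1.1 - p.2.1) ∂((nu F μ t).prod (nu F μ t)))) := by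
  set ν := nu F μ t with hν
  set A := (ε ^ (d - 2))⁻¹ with hA
  have hA0 : 0 ≤ A := by positivity
  have hHm := (continuous_rH (d := d) hε).measurable
  have hHn : ∀ x : Ed d, ‖rH d ε x‖ ≤ A := fun x => by
    rw [norm_of_nonneg (rH_nonneg _ _)]
    exact rH_le hε x
  have hXm : ∀ n, Measurable fun z => ((F n).Z t z).1 := fun n => ((F n).Z t).measurable.fst
  set g : ℕ → Ed d → ℝ := fun n x => ∫ b, rH d ε (x - ((F n).Z t b).1) ∂μ with hg
  set g' : Ed d → ℝ := fun x => ∫ w, rH d ε (x - w.1) ∂ν with hg'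
  have hi : ∀ n x, Integrable (fun b => rH d ε (x - ((F n).Z t b).1)) μ := fun n x =>
    Integrable.of_bound (hHm.comp (measurable_const.sub (hXm n))).aestronglyMeasurable A
      (.of_forall fun _ => hHn _)
  have hgn : ∀ n x, ‖g n x‖ ≤ A * μ.real univ := fun n x =>
    norm_integral_le_of_norm_le_const (.of_forall fun _ => hHn _)
  have hgn' : ∀ x, ‖g' x‖ ≤ A * ν.real univ := fun x =>
    norm_integral_le_of_norm_le_const (.of_forall fun _ => hHn _)
  have hνμ : ν.real univ = μ.real univ := by rw [Measure.real, hν, nu_univ hd hμ F le_rfl ht, Measure.real]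
  rw [hνμ] at hgn'
  have hg'm : Measurable g' :=
    (StronglyMeasurable.integral_prod_right' (f := fun p : Ed d × PS d => rH d ε (p.1 - p.2.1))
      (hHm.comp (by fun_prop)).stronglyMeasurable).measurable
  have hgm : ∀ n, Measurable (g n) := fun n =>
    (StronglyMeasurable.integral_prod_right' (f := fun p : Ed d × PS d => rH d ε (p.1 - ((F n).Z t p.2).1))
      (hHm.comp (measurable_fst.sub ((hXm n).comp measurable_snd))).stronglyMeasurable).measurable
  have e1 : ∀ n, ∫ p : PS d × PS d, rH d ε (((F n).Z t p.1).1 - ((F n).Z t p.2).1) ∂(μ.prod μ)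
      = ∫ a, g n ((F n).Z t a).1 ∂μ := fun n => integral_rH hε (X := fun z => ((F n).Z t z).1) (hXm n)
  have e2 : ∫ p : PS d × PS d, rH d ε (p.1.1 - p.2.1) ∂(ν.prod ν) = ∫ w, g' w.1 ∂ν :=
    integral_rH hε (X := fun z : PS d => z.1) measurable_fst
  rw [e2]
  simp only [e1]
  have h1 : Tendsto (fun n => ∫ a, g' ((F n).Z t a).1 ∂μ) UF (𝓝 (∫ w, g' w.1 ∂ν)) :=
    tendsto_integral_nu hd hμ F le_rfl ht (χ := fun w => g' w.1) (hg'm.comp measurable_fst) fun z => hgn' _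
  refine h1.congr_dist ?_
  rw [Metric.tendsto_nhds]
  intro ω hω
  simp only [dist_zero_right]
  have hB : 0 ≤ μ.real univ := measureReal_nonneg
  set θ : ℝ := ω / (4 * (μ.real univ + 1)) with hθ
  have hθ0 : 0 < θ := by positivity
  set κ : ℝ := ω / (4 * (2 * (A * μ.real univ) + 1)) with hκ
  have hκ0 : 0 < κ := by positivity
  obtain ⟨R, hR⟩ := tight_seq hd F t (θ := ofReal κ) (by simpa using hκ0)
  have hunif := eventually_norm_sub_le_of_lipschitz (l := UF) (K := closedBall (0 : Ed d) R) (g := g) (g' := g')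
    (L := ((d : ℝ) - 2) * (ε ^ (d - 1))⁻¹ * μ.real univ) (isCompact_closedBall _ _)
    (.of_forall fun n x _ y _ => ?_) (fun x _ => ?_) hθ0
  · filter_upwards [hunif, UF_le (eventually_ge_atTop ⌈t⌉₊)] with n hn hn2
    have hn' : t ≤ n := (Nat.le_ceil t).trans (by exact_mod_cast hn2)
    have hS : MeasurableSet {z | R ≤ ‖(F n).Z t z‖} :=
      measurableSet_le measurable_const ((F n).Z t).measurable.norm
    have hμS : μ.real {z | R ≤ ‖(F n).Z t z‖} ≤ κ :=
      ENNReal.toReal_le_of_le_ofReal hκ0.le (hR R le_rfl n hn' t ⟨ht, le_rfl⟩)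
    have i1 : Integrable (fun a => g' ((F n).Z t a).1) μ :=
      Integrable.of_bound (hg'm.comp (hXm n)).aestronglyMeasurable _ (.of_forall fun _ => hgn' _)
    have i2 : Integrable (fun a => g n ((F n).Z t a).1) μ :=
      Integrable.of_bound ((hgm n).comp (hXm n)).aestronglyMeasurable _ (.of_forall fun _ => hgn n _)
    rw [dist_eq_norm, norm_norm, ← integral_sub i1 i2]
    have i3 : Integrable (fun a => θ + {z | R ≤ ‖(F n).Z t z‖}.indicator
        (fun _ => 2 * (A * μ.real univ)) a) μ :=
      (integrable_const _).add ((integrable_const _).indicator hS)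
    suffices hp : ∀ a, ‖g' ((F n).Z t a).1 - g n ((F n).Z t a).1‖ ≤ θ + {z | R ≤ ‖(F n).Z t z‖}.indicator
        (fun _ => 2 * (A * μ.real univ)) a by
      refine (norm_integral_le_of_norm_le i3 (ae_of_all _ hp)).trans_lt ?_
      rw [integral_add (integrable_const _) ((integrable_const _).indicator hS), integral_const,
        integral_indicator_const _ hS, smul_eq_mul, smul_eq_mul]
      have b1 : μ.real univ * θ ≤ ω / 4 := by
        rw [hθ, mul_div_assoc', div_le_div_iff₀ (by positivity) (by norm_num)]
        nlinarith
      have b2 : μ.real {z | R ≤ ‖(F n).Z t z‖} * (2 * (A * μ.real univ)) ≤ ω / 4 := by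
        refine (mul_le_mul_of_nonneg_right hμS (by positivity)).trans ?_
        rw [hκ, div_mul_eq_mul_div, div_le_div_iff₀ (by positivity) (by norm_num)]
        nlinarith [mul_nonneg hA0 hB]
      linarith
    intro a
    by_cases ha : R ≤ ‖(F n).Z t a‖
    · rw [indicator_of_mem (by exact ha)]
      refine (norm_sub_le _ _).trans ?_
      linarith [hgn n ((F n).Z t a).1, hgn' ((F n).Z t a).1]
    · rw [indicator_of_notMem (by exact ha), add_zero, norm_sub_rev]
      exact hn _ (mem_closedBall_zero_iff.2 ((norm_fst_le _).trans (not_le.1 ha).le))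
  · rw [dist_eq_norm]
    change ‖(∫ b, rH d ε (x - ((F n).Z t b).1) ∂μ) - ∫ b, rH d ε (y - ((F n).Z t b).1) ∂μ‖ ≤ _
    rw [← integral_sub (hi n x) (hi n y)]
    refine (norm_integral_le_of_norm_le_const (C := ((d : ℝ) - 2) * (ε ^ (d - 1))⁻¹ * ‖x - y‖)
      (.of_forall fun b => ?_)).trans (le_of_eq (by ring))
    have := rH_sub_le hd hε (x - ((F n).Z t b).1) (y - ((F n).Z t b).1)
    rwa [sub_sub_sub_cancel_right] at this
  · exact tendsto_integral_nu hd hμ F le_rfl ht (χ := fun w => rH d ε (x - w.1))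
      (hHm.comp (by fun_prop)) fun z => hHn _

end VP

namespace VP

lemma ofReal_rH {d : ℕ} (hd : 3 ≤ d) {ε : ℝ} (hε : 0 < ε) (x : Ed d) :
    ofReal (rH d ε x) = ofReal (sreg ε x) ^ ((2 : ℝ) - d) := by
  have hs := sreg_pos hε x
  rw [ENNReal.ofReal_rpow_of_pos hs, rH, show (2 : ℝ) - d = -((d - 2 : ℕ) : ℝ) by
    rw [Nat.cast_sub (by omega)]; norm_num, Real.rpow_neg hs.le, Real.rpow_natCast]

lemma ofReal_mul_rH_le {d : ℕ} (hd : 3 ≤ d) {ε : ℝ} (hε : 0 < ε) (x : Ed d) :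
    ofReal (cdim d / ((d : ℝ) - 2) * rH d ε x) ≤ Hkern d x := by
  have : (3 : ℝ) ≤ d := by exact_mod_cast hd
  rw [ofReal_mul (cdim_div_nonneg hd), ofReal_rH hd hε, Hkern]
  have hn : (2 : ℝ) - d = -((d : ℝ) - 2) := by ring
  rw [hn, ENNReal.rpow_neg, ENNReal.rpow_neg]
  have h1 : ofReal ‖x‖ ^ ((d : ℝ) - 2) ≤ ofReal (sreg ε x) ^ ((d : ℝ) - 2) :=
    ENNReal.rpow_le_rpow (ofReal_le_ofReal (norm_le_sreg _ _)) (by linarith)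
  gcongr

lemma tendsto_ofReal_mul_rH {d : ℕ} (hd : 3 ≤ d) (x : Ed d) :
    Tendsto (fun k => ofReal (cdim d / ((d : ℝ) - 2) * rH d (eps k) x)) atTop (𝓝 (Hkern d x)) := by
  have h0 : Tendsto (fun k => sreg (eps k) x) atTop (𝓝 ‖x‖) := by
    have hc : Continuous fun ε : ℝ => sreg ε x := by unfold sreg; fun_prop
    have := (hc.tendsto 0).comp tendsto_eps
    simpa [sreg, Function.comp_def, Real.sqrt_sq] using this
  have h1 := ((ENNReal.continuous_rpow_const (y := (2 : ℝ) - d)).tendsto _).comp (ENNReal.tendsto_ofReal h0)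
  have h2 := ENNReal.Tendsto.const_mul (a := ofReal (cdim d / ((d : ℝ) - 2))) h1
    (Or.inr ofReal_ne_top)
  refine h2.congr fun k => ?_
  rw [ofReal_mul (cdim_div_nonneg hd), ofReal_rH hd (eps_pos k)]
  rfl

lemma measurable_Hkern (d : ℕ) : Measurable (Hkern d) :=
  measurable_const.mul ((ENNReal.measurable_ofReal.comp measurable_norm).pow_const _)

lemma monotone_rH {d : ℕ} (hd : 3 ≤ d) (x : Ed d) :
    Monotone fun k => ofReal (cdim d / ((d : ℝ) - 2) * rH d (eps k) x) := fun k l h => by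
  refine ofReal_le_ofReal (mul_le_mul_of_nonneg_left (rH_mono (eps_pos l) ?_ x) (cdim_div_nonneg hd))
  exact one_div_le_one_div_of_le (by positivity) (by have : (k : ℝ) ≤ l := by exact_mod_cast h
                                                     linarith)

lemma kinEnergy_eq {d : ℕ} {g : PS d → ℝ} (hg : Measurable g) :
    kinEnergy d g = ∫⁻ z, ofReal (‖z.2‖ ^ 2) ∂(volume.withDensity fun z => ofReal (g z)) := by
  rw [lintegral_withDensity_eq_lintegral_mul _ hg.ennreal_ofReal (by fun_prop), kinEnergy]
  refine lintegral_congr fun z => ?_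
  rw [Pi.mul_apply, ofReal_mul (sq_nonneg _), mul_comm]

lemma potEnergy_eq {d : ℕ} {g : PS d → ℝ} (hg : Measurable g) (hg0 : ∀ z, 0 ≤ g z) (hgi : Integrable g) :
    potEnergy d (fun x => ∫ v, g (x, v)) = ∫⁻ p : PS d × PS d, Hkern d (p.1.1 - p.2.1)
      ∂((volume.withDensity fun z => ofReal (g z)).prod
        (volume.withDensity fun z => ofReal (g z))) := by
  have hgm := hg.ennreal_ofReal
  have hH := measurable_Hkern d
  have hρ : ∀ᵐ x : Ed d, ofReal (∫ v, g (x, v)) = ∫⁻ v, ofReal (g (x, v)) := by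
    rw [Measure.volume_eq_prod] at hgi
    filter_upwards [hgi.prod_right_ae] with x hx
    exact ofReal_integral_eq_lintegral_ofReal hx (.of_forall fun _ => hg0 _)
  have key : ∀ h : Ed d → ℝ≥0∞, Measurable h →
      ∫⁻ x, h x * ofReal (∫ v, g (x, v)) =
        ∫⁻ z, h z.1 ∂(volume.withDensity fun z : PS d => ofReal (g z)) := fun h hh => by
    rw [lintegral_withDensity_eq_lintegral_mul _ hgm (g := fun z : PS d => h z.1) (hh.comp measurable_fst), Measure.volume_eq_prod,
      lintegral_prod _ (by fun_prop)]
    refine lintegral_congr_ae ?_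
    filter_upwards [hρ] with x hx
    rw [hx, ← lintegral_const_mul _ (by fun_prop)]
    exact lintegral_congr fun v => mul_comm _ _
  have hm : Measurable fun p : PS d × PS d => Hkern d (p.1.1 - p.2.1) := hH.comp (by fun_prop)
  have : SFinite (volume.withDensity fun z : PS d => ofReal (g z)) := inferInstance
  rw [lintegral_prod _ hm.aemeasurable, potEnergy,
    ← key (fun x => ∫⁻ w : PS d, Hkern d (x - w.1) ∂(volume.withDensity fun z => ofReal (g z)))
      (Measurable.lintegral_prod_right' (f := fun p : Ed d × PS d => Hkern d (p.1 - p.2.1)) (hH.comp (by fun_prop)))]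
  refine lintegral_congr fun x => ?_
  rw [key (fun y => Hkern d (x - y)) (hH.comp (by fun_prop))]

lemma en_le_of_energy {d : ℕ} (hd : 3 ≤ d) {μ : Measure (PS d)} [IsFiniteMeasure μ] {e : ℝ≥0∞} (he : e ≠ ⊤)
    (h : ∫⁻ z, ofReal (‖z.2‖ ^ 2) ∂μ + ∫⁻ p : PS d × PS d, Hkern d (p.1.1 - p.2.1) ∂(μ.prod μ) ≤ e)
    {ε : ℝ} (hε : 0 < ε) :
    Integrable (fun z => ‖z.2‖ ^ 2) μ ∧ en d ε μ Prod.fst Prod.snd ≤ e.toReal := by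
  have hk : ∫⁻ z, ofReal (‖z.2‖ ^ 2) ∂μ ≠ ⊤ := ne_top_of_le_ne_top he (le_self_add.trans h)
  refine ⟨⟨by fun_prop, ?_⟩, ?_⟩
  · rw [hasFiniteIntegral_iff_ofReal (.of_forall fun z => by positivity)]
    exact hk.lt_top
  · have hi := integrable_rH (m := μ) hε (X := fun z : PS d => z.1) measurable_fst
    rw [en, ← integral_const_mul]
    have hp : ∫⁻ p : PS d × PS d, ofReal (cdim d / ((d : ℝ) - 2) * rH d ε (p.1.1 - p.2.1)) ∂(μ.prod μ)
        ≤ ∫⁻ p : PS d × PS d, Hkern d (p.1.1 - p.2.1) ∂(μ.prod μ) :=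
      lintegral_mono fun p => ofReal_mul_rH_le hd hε _
    rw [integral_eq_lintegral_of_nonneg_ae (.of_forall fun z => by positivity) (by fun_prop),
      integral_eq_lintegral_of_nonneg_ae
        (.of_forall fun p => mul_nonneg (cdim_div_nonneg hd) (rH_nonneg _ _)) (hi.const_mul _).1,
      ← ENNReal.toReal_add hk (ne_top_of_le_ne_top he (hp.trans (le_add_self.trans h)))]
    exact ENNReal.toReal_mono he ((add_le_add_right hp _).trans h)

lemma truncated_en_le {d : ℕ} (hd : 3 ≤ d) {Ω : Type*} [MeasurableSpace Ω] {m : Measure Ω} [IsFiniteMeasure m]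
    {ε ε' : ℝ} (hε : 0 < ε) (h : ε ≤ ε') {Z : Ω → PS d} (hZ : Measurable Z)
    (hV : Integrable (fun z => ‖(Z z).2‖ ^ 2) m) {k : ℕ} :
    ∫ z, min (‖(Z z).2‖ ^ 2) k ∂m + cdim d / ((d : ℝ) - 2) *
      ∫ p : Ω × Ω, rH d ε' ((Z p.1).1 - (Z p.2).1) ∂(m.prod m) ≤
    en d ε m (fun z => (Z z).1) (fun z => (Z z).2) := by
  have h1 := integrable_rH (m := m) (hε.trans_le h) hZ.fst
  have h2 := integrable_rH (m := m) hε hZ.fst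
  have h3 := mul_le_mul_of_nonneg_left (integral_mono h1 h2 fun p => rH_mono hε h _) (cdim_div_nonneg hd)
  rw [en]
  refine add_le_add (integral_mono ?_ hV fun z => min_le_left _ _) h3
  refine Integrable.of_bound (by fun_prop) (k : ℝ) (.of_forall fun z => ?_)
  rw [norm_of_nonneg (by positivity)]
  exact min_le_right _ _

variable {d : ℕ} {μ : Measure (PS d)} {e₀ : ℝ} [IsFiniteMeasure μ]
  (F : AFlows d μ e₀)

lemma truncated_energy_le (hd : 3 ≤ d) (hμ : μ ≪ volume) {t : ℝ} (ht : 0 ≤ t) (k : ℕ) :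
    ∫ z, min (‖z.2‖ ^ 2) k ∂(nu F μ t) + cdim d / ((d : ℝ) - 2) *
      ∫ p : PS d × PS d, rH d (eps k) (p.1.1 - p.2.1) ∂((nu F μ t).prod (nu F μ t)) ≤ e₀ := by
  have hk0 : ∀ z : PS d, ‖min (‖z.2‖ ^ 2) (k : ℝ)‖ ≤ k := fun z => by
    rw [norm_of_nonneg (by positivity)]
    exact min_le_right _ _
  have h1 := tendsto_integral_nu hd hμ F le_rfl ht (χ := fun z : PS d => min (‖z.2‖ ^ 2) (k : ℝ)) (by fun_prop) hk0
  have h2 := (tendsto_pot F hd hμ (eps_pos k) ht).const_mul (cdim d / ((d : ℝ) - 2))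
  have h3 : Tendsto (fun n => e₀ + eps n) UF (𝓝 (e₀ + 0)) := (tendsto_eps.mono_left UF_le).const_add _
  rw [add_zero] at h3
  refine le_of_tendsto_of_tendsto (h1.add h2) h3 ?_
  filter_upwards [UF_le (eventually_ge_atTop ⌈t⌉₊), UF_le (eventually_ge_atTop k)] with n hn hnk
  have hn' : t ≤ n := (Nat.le_ceil t).trans (by exact_mod_cast hn)
  refine le_trans ?_ ((F n).en_le t ⟨ht, hn'⟩)
  have hkn : eps n ≤ eps k := one_div_le_one_div_of_le (by positivity) (by
    have : (k : ℝ) ≤ n := by exact_mod_cast hnk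
    linarith)
  exact truncated_en_le hd (eps_pos n) hkn ((F n).Z t).measurable ((F n).sq t ⟨ht, hn'⟩)

lemma energy_le (hd : 3 ≤ d) (hμ : μ ≪ volume) {t : ℝ} (ht : 0 ≤ t) :
    ∫⁻ z, ofReal (‖z.2‖ ^ 2) ∂(nu F μ t) + ∫⁻ p : PS d × PS d, Hkern d (p.1.1 - p.2.1)
      ∂((nu F μ t).prod (nu F μ t)) ≤ ofReal e₀ := by
  set ν := nu F μ t
  have hHm : ∀ k, Measurable fun p : PS d × PS d =>
      ofReal (cdim d / ((d : ℝ) - 2) * rH d (eps k) (p.1.1 - p.2.1)) := fun k =>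
    (measurable_const.mul ((continuous_rH (eps_pos k)).measurable.comp (by fun_prop))).ennreal_ofReal
  have h1 : Tendsto (fun k : ℕ => ∫⁻ z, ofReal (min (‖z.2‖ ^ 2) k) ∂ν) atTop
      (𝓝 (∫⁻ z, ofReal (‖z.2‖ ^ 2) ∂ν)) := by
    refine lintegral_tendsto_of_tendsto_of_monotone (fun k => by fun_prop)
      (.of_forall fun z k l h => ofReal_le_ofReal (min_le_min le_rfl (by exact_mod_cast h)))
      (.of_forall fun z => tendsto_const_nhds.congr' ?_)
    filter_upwards [eventually_ge_atTop ⌈‖z.2‖ ^ 2⌉₊] with k hk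
    rw [min_eq_left ((Nat.le_ceil _).trans (by exact_mod_cast hk))]
  have h2 : Tendsto (fun k : ℕ => ∫⁻ p : PS d × PS d, ofReal
      (cdim d / ((d : ℝ) - 2) * rH d (eps k) (p.1.1 - p.2.1)) ∂(ν.prod ν)) atTop
      (𝓝 (∫⁻ p : PS d × PS d, Hkern d (p.1.1 - p.2.1) ∂(ν.prod ν))) :=
    lintegral_tendsto_of_tendsto_of_monotone (fun k => (hHm k).aemeasurable)
      (.of_forall fun p => monotone_rH hd _) (.of_forall fun p => tendsto_ofReal_mul_rH hd _)
  refine le_of_tendsto (h1.add h2) (.of_forall fun k => ?_)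
  have hi := (integrable_rH (m := ν) (eps_pos k) (X := fun z : PS d => z.1) measurable_fst).const_mul
    (cdim d / ((d : ℝ) - 2))
  have hi0 := fun p : PS d × PS d => mul_nonneg (cdim_div_nonneg hd) (rH_nonneg (d := d) (eps k) (p.1.1 - p.2.1))
  have hj : Integrable (fun z : PS d => min (‖z.2‖ ^ 2) (k : ℝ)) ν :=
    Integrable.of_bound (by fun_prop) (k : ℝ) (.of_forall fun z => by
      rw [norm_of_nonneg (by positivity)]
      exact min_le_right _ _)
  rw [← ofReal_integral_eq_lintegral_ofReal hj (.of_forall fun z => by positivity),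
    ← ofReal_integral_eq_lintegral_ofReal hi (ae_of_all _ hi0),
    ← ofReal_add (integral_nonneg fun z => by positivity) (integral_nonneg hi0), integral_const_mul]
  exact ofReal_le_ofReal (truncated_energy_le F hd hμ ht k)

end VP

namespace VP

lemma vpE_eq_fld {d : ℕ} {f : ℝ → PS d → ℝ} {t : ℝ} (hm : Measurable (f t)) (h0 : ∀ z, 0 ≤ f t z)
    (hi : Integrable (f t)) (x : Ed d) :
    vpE d 1 f t x = fld d 0 (volume.withDensity fun z => ofReal (f t z)) x := by
  have e1 : ∫ w : PS d, kern d (x - w.1) ∂(volume.withDensity fun z => ofReal (f t z))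
      = ∫ w : PS d, f t w • kern d (x - w.1) := by
    rw [integral_withDensity_eq_integral_toReal_smul hm.ennreal_ofReal (.of_forall fun _ => ENNReal.ofReal_lt_top)]
    exact integral_congr_ae (.of_forall fun w => by simp only [ENNReal.toReal_ofReal (h0 w)])
  have hF : AEStronglyMeasurable (fun w : PS d => f t w • kern d (x - w.1)) volume :=
    (hm.smul (measurable_kern.comp (by fun_prop))).aestronglyMeasurable
  have e2 : ∀ y, vpRho d f t y • kern d (x - y) = ∫ v, f t (y, v) • kern d (x - y) := fun y => by
    rw [integral_smul_const, vpRho]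
  rw [vpE, fld, one_mul, rk_zero, e1]
  congr 1
  simp only [e2]
  rw [Measure.volume_eq_prod] at hF hi ⊢
  by_cases hFi : Integrable (fun w : PS d => f t w • kern d (x - w.1)) (volume.prod volume)
  · exact (integral_prod _ hFi).symm
  · rw [integral_undef hFi, integral_undef]
    intro h
    refine hFi ((integrable_prod_iff hF).2 ⟨?_, ?_⟩)
    · filter_upwards [hi.prod_right_ae] with y hy
      exact hy.smul_const _
    · refine h.norm.congr (.of_forall fun y => ?_)
      simp only [norm_smul, norm_of_nonneg (h0 _), integral_mul_const, integral_smul_const]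
      rw [norm_of_nonneg (integral_nonneg fun v => h0 _)]

lemma tendsto_setIntegral_norm_sub {α E : Type*} [MeasurableSpace α] [NormedAddCommGroup E] {m : Measure α}
    {S : Set α} {g : ℝ → α → E} (hg : ∀ t, 0 ≤ t → AEStronglyMeasurable (g t) m) {s₀ : ℝ} (hs₀ : 0 ≤ s₀)
    (h : ∀ θ : ℝ≥0∞, θ ≠ 0 → ∃ τ > 0, ∀ t ∈ Icc 0 (s₀ + 1), |t - s₀| ≤ τ → ∫⁻ z in S, ‖g t z - g s₀ z‖ₑ ∂m ≤ θ) :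
    Tendsto (fun s => ∫ z in S, ‖g s z - g s₀ z‖ ∂m) (𝓝[Ici 0] s₀) (𝓝 0) := by
  rw [Metric.tendsto_nhds]
  intro ω hω
  obtain ⟨τ, hτ, hh⟩ := h (ofReal (ω / 2)) (by simpa using hω)
  filter_upwards [self_mem_nhdsWithin, mem_nhdsWithin_of_mem_nhds (closedBall_mem_nhds s₀ (lt_min hτ one_pos))]
    with t ht ht'
  rw [mem_closedBall, Real.dist_eq, le_min_iff] at ht'
  have h1 := hh t ⟨ht, by linarith [(abs_le.1 ht'.2).2]⟩ ht'.1
  rw [integral_norm_eq_lintegral_enorm (f := fun z => g t z - g s₀ z) ((hg t ht).sub (hg s₀ hs₀)).restrict,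
    dist_zero_right,
    norm_of_nonneg ENNReal.toReal_nonneg]
  exact (ENNReal.toReal_le_of_le_ofReal (by positivity) h1).trans_lt (by linarith)

section Limit

variable {d : ℕ} {μ : Measure (PS d)} {e₀ : ℝ} [IsFiniteMeasure μ]
  (F : AFlows d μ e₀)

lemma nu_zero (hd : 3 ≤ d) (hμ : μ ≪ volume) : nu F μ 0 = μ := by
  refine Measure.ext fun s hs => ?_
  have h := tendsto_integral_nu hd hμ F le_rfl le_rfl (χ := s.indicator fun _ => (1 : ℝ))
    (measurable_const.indicator hs) (C := 1) fun z => by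
      by_cases hz : z ∈ s <;> simp [hz]
  simp only [(F _).zero] at h
  have h2 := tendsto_nhds_unique h tendsto_const_nhds
  rw [integral_indicator_const _ hs, integral_indicator_const _ hs, smul_eq_mul, smul_eq_mul, mul_one, mul_one] at h2
  exact (measureReal_eq_measureReal_iff (measure_ne_top _ _) (measure_ne_top _ _)).1 h2

lemma lintegral_dens_sub_lay (hd : 3 ≤ d) (hμ : μ ≪ volume) (j : ℕ) {t : ℝ} (ht : 0 ≤ t) :
    ∫⁻ z, ‖dens F μ t z - dens F (lay μ j) t z‖ₑ = μ univ - lay μ j univ := by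
  have hle := rnDeriv_nu_mono F hd hμ le_rfl (lay_le j) ht
  have e1 := lintegral_rnDeriv_nu F hd hμ (lay_le j) ht
  rw [← lintegral_rnDeriv_nu F hd hμ le_rfl ht, ← e1, ← lintegral_sub (Measure.measurable_rnDeriv _ _)
    (by rw [e1]; exact ((lay_le j univ).trans_lt (measure_lt_top μ _)).ne) hle]
  refine lintegral_congr_ae ?_
  filter_upwards [hle, Measure.rnDeriv_lt_top (nu F μ t) volume] with z hz hz1
  rw [dens, dens, ← ENNReal.toReal_sub_of_le hz hz1.ne, Real.enorm_of_nonneg ENNReal.toReal_nonneg,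
    ENNReal.ofReal_toReal (ENNReal.sub_ne_top hz1.ne)]

lemma dens_continuous' (hd : 3 ≤ d) (hμ : μ ≪ volume) (T R : ℝ) {s : ℝ} (hs : s ∈ Icc 0 T) {θ : ℝ≥0∞}
    (hθ : θ ≠ 0) : ∃ τ > 0, ∀ t ∈ Icc 0 T, |t - s| ≤ τ →
      ∫⁻ z in ball 0 R, ‖dens F μ t z - dens F μ s z‖ₑ ≤ θ := by
  have hθ3 : θ / 3 ≠ 0 := by simp [hθ]
  obtain ⟨j, hj⟩ : ∃ j, μ univ - lay μ j univ ≤ θ / 3 := by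
    have h := ENNReal.Tendsto.sub (tendsto_const_nhds (x := μ univ)) (tendsto_lay hμ)
      (Or.inl (measure_ne_top μ univ))
    rw [tsub_self] at h
    exact (h.eventually (ge_mem_nhds (pos_iff_ne_zero.2 hθ3))).exists
  obtain ⟨τ, hτ, h⟩ := dens_continuous F hd hμ (lay_le j) (ENNReal.natCast_ne_top j) (lay_le_smul hμ j) T R hs hθ3
  refine ⟨τ, hτ, fun t ht hts => ?_⟩
  have hA := measurable_dens F (m := μ) t
  have hB := measurable_dens F (m := μ) s
  have hA' := measurable_dens F (m := lay μ j) t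
  have hB' := measurable_dens F (m := lay μ j) s
  have hl : ∀ r, 0 ≤ r → ∫⁻ z in ball 0 R, ‖dens F μ r z - dens F (lay μ j) r z‖ₑ ≤ θ / 3 := fun r hr =>
    (setLIntegral_le_lintegral _ _).trans ((lintegral_dens_sub_lay F hd hμ j hr).le.trans hj)
  have hl2 : ∫⁻ z in ball 0 R, ‖dens F (lay μ j) s z - dens F μ s z‖ₑ ≤ θ / 3 := by
    refine le_trans (lintegral_mono fun z => ?_) (hl s hs.1)
    rw [enorm_sub_rev]
  calc ∫⁻ z in ball 0 R, ‖dens F μ t z - dens F μ s z‖ₑ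
      ≤ _ := lintegral_enorm_sub_le (g := dens F (lay μ j) t) hA hA'
    _ ≤ _ := add_le_add (hl t ht.1) ((lintegral_enorm_sub_le (g := dens F (lay μ j) s) hA' hB').trans
        (add_le_add (h t ht hts) hl2))
    _ = θ := by rw [← add_assoc, ENNReal.add_thirds]

end Limit

end VP

namespace VP

variable {d : ℕ} {μ : Measure (PS d)} {e₀ : ℝ} [IsFiniteMeasure μ]
  (F : AFlows d μ e₀)

lemma exists_velocity_tail (hd : 3 ≤ d) (hμ : μ ≪ volume) {θ : ℝ≥0∞} (hθ : θ ≠ 0) :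
    ∃ S : ℝ, ∀ t, 0 ≤ t → nu F μ t {z | S ≤ ‖z.2‖} ≤ θ := by
  obtain ⟨n, hn⟩ := ENNReal.exists_nat_mul_gt hθ (ofReal_ne_top (r := e₀))
  refine ⟨n + 1, fun t ht => ?_⟩
  have hE := le_self_add.trans (energy_le F hd hμ ht)
  have h1 := mul_meas_ge_le_lintegral (μ := nu F μ t) (f := fun z : PS d => ofReal (‖z.2‖ ^ 2))
    (by fun_prop) (n + 1 : ℕ)
  have h2 : ((n + 1 : ℕ) : ℝ≥0∞) * nu F μ t {z | (n : ℝ) + 1 ≤ ‖z.2‖} ≤ (n + 1 : ℕ) * θ := by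
    have hsub : {z : PS d | (n : ℝ) + 1 ≤ ‖z.2‖} ⊆
        {z | ((n + 1 : ℕ) : ℝ≥0∞) ≤ ofReal (‖z.2‖ ^ 2)} := fun z hz => by
      have hz' : (n : ℝ) + 1 ≤ ‖z.2‖ := hz
      have hn0 : (0 : ℝ) ≤ n := n.cast_nonneg
      rw [mem_ofPred_eq, ← ENNReal.ofReal_natCast]
      refine ofReal_le_ofReal ?_
      push_cast
      nlinarith
    have hnn : (n : ℝ≥0∞) ≤ (n + 1 : ℕ) := by exact_mod_cast Nat.le_succ n
    exact (mul_le_mul_right (measure_mono hsub) _).trans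
      ((h1.trans hE).trans (hn.le.trans (mul_le_mul_left hnn _)))
  exact (ENNReal.mul_le_mul_iff_right (by simp) (ENNReal.natCast_ne_top _)).1 h2

lemma setLIntegral_dens (hd : 3 ≤ d) (hμ : μ ≪ volume) {t : ℝ} (ht : 0 ≤ t) {s : Set (PS d)}
    (hs : MeasurableSet s) : ∫⁻ z in s, ‖dens F μ t z‖ₑ = nu F μ t s := by
  conv_rhs => rw [nu_eq F hd hμ le_rfl ht, withDensity_apply _ hs]
  simp only [Real.enorm_of_nonneg (dens_nonneg F t _)]

lemma rho_continuous (hd : 3 ≤ d) (hμ : μ ≪ volume) (T R : ℝ) {s : ℝ} (hs : s ∈ Icc 0 T) {θ : ℝ≥0∞}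
    (hθ : θ ≠ 0) : ∃ τ > 0, ∀ t ∈ Icc 0 T, |t - s| ≤ τ →
      ∫⁻ x in ball (0 : Ed d) R, ‖(∫ v, dens F μ t (x, v)) - ∫ v, dens F μ s (x, v)‖ₑ ≤ θ := by
  have hθ3 : θ / 3 ≠ 0 := by simp [hθ]
  obtain ⟨S, hS⟩ := exists_velocity_tail F hd hμ hθ3
  obtain ⟨τ, hτ, h⟩ := dens_continuous' F hd hμ T (max R S) hs hθ3
  refine ⟨τ, hτ, fun t ht hts => ?_⟩
  have hA := measurable_dens F (m := μ) t
  have hB := measurable_dens F (m := μ) s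
  have hiA := integrable_dens F (m := μ) t
  have hiB := integrable_dens F (m := μ) s
  have hV : MeasurableSet {z : PS d | S ≤ ‖z.2‖} := measurableSet_le measurable_const (by fun_prop)
  have e1 : ∫⁻ x in ball (0 : Ed d) R, ‖(∫ v, dens F μ t (x, v)) - ∫ v, dens F μ s (x, v)‖ₑ
      ≤ ∫⁻ x in ball (0 : Ed d) R, ∫⁻ v, ‖dens F μ t (x, v) - dens F μ s (x, v)‖ₑ := by
    refine lintegral_mono_ae (ae_restrict_of_ae ?_)
    rw [Measure.volume_eq_prod] at hiA hiB
    filter_upwards [hiA.prod_right_ae, hiB.prod_right_ae] with x hx1 hx2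
    rw [← integral_sub hx1 hx2]
    exact enorm_integral_le_lintegral_enorm _
  have e2 : ∫⁻ x in ball (0 : Ed d) R, ∫⁻ v, ‖dens F μ t (x, v) - dens F μ s (x, v)‖ₑ
      = ∫⁻ z in ball (0 : Ed d) R ×ˢ univ, ‖dens F μ t z - dens F μ s z‖ₑ := by
    rw [Measure.volume_eq_prod, ← Measure.prod_restrict, Measure.restrict_univ,
      lintegral_prod _ (by fun_prop)]
  have e3 : ball (0 : Ed d) R ×ˢ univ ⊆ ball (0 : PS d) (max R S) ∪ {z : PS d | S ≤ ‖z.2‖} := fun z hz => by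
    have hz1 := mem_ball_zero_iff.1 (mem_prod.1 hz).1
    by_cases hz2 : S ≤ ‖z.2‖
    · exact mem_union_right _ hz2
    · exact mem_union_left _ (mem_ball_zero_iff.2 (max_lt_max hz1 (not_le.1 hz2)))
  have e4 : ∫⁻ z in {z : PS d | S ≤ ‖z.2‖}, ‖dens F μ t z - dens F μ s z‖ₑ ≤ θ / 3 + θ / 3 := by
    refine (lintegral_mono fun z => enorm_sub_le).trans ?_
    rw [lintegral_add_left hA.enorm, setLIntegral_dens F hd hμ ht.1 hV, setLIntegral_dens F hd hμ hs.1 hV]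
    exact add_le_add (hS t ht.1) (hS s hs.1)
  calc _ ≤ _ := e1.trans e2.le
    _ ≤ _ := lintegral_mono_set e3
    _ ≤ _ := lintegral_union_le _ _ _
    _ ≤ θ / 3 + (θ / 3 + θ / 3) := add_le_add (h t ht hts) e4
    _ = θ := by rw [← add_assoc, ENNReal.add_thirds]

end VP

namespace VP

variable {d : ℕ}

lemma lintegral_Ioi_inv_pow_le (k : ℕ) {D : ℝ} (hD : 0 < D) :
    ∫⁻ r in Ioi (0 : ℝ), ofReal ((r + D) ^ (k + 2))⁻¹ ≤ ofReal (D ^ (k + 1))⁻¹ := by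
  have hk : (1 : ℝ) ≤ (k + 1 : ℕ) := by exact_mod_cast Nat.le_add_left 1 k
  have hder : ∀ r ∈ Ici (0 : ℝ), HasDerivAt (fun r : ℝ => -((r + D) ^ (k + 1))⁻¹)
      ((k + 1 : ℕ) * ((r + D) ^ (k + 2))⁻¹) r := fun r hr => by
    have hr0 : 0 < r + D := add_pos_of_nonneg_of_pos hr hD
    have h := ((((hasDerivAt_id r).add_const D).pow (k + 1)).inv (pow_ne_zero _ hr0.ne')).neg
    refine h.congr_deriv ?_
    simp only [id, Nat.add_sub_cancel, Pi.pow_apply]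
    field_simp
    ring
  have hlim : Tendsto (fun r : ℝ => -((r + D) ^ (k + 1))⁻¹) atTop (𝓝 0) := by
    have := ((tendsto_pow_atTop (α := ℝ) (n := k + 1) (by omega)).comp
      (tendsto_atTop_add_const_right atTop D tendsto_id)).inv_tendsto_atTop.neg
    simpa using this
  have hpos : ∀ r ∈ Ioi (0 : ℝ), 0 ≤ (k + 1 : ℕ) * ((r + D) ^ (k + 2))⁻¹ := fun r (hr : 0 < r) => by
    positivity
  have hi := integrableOn_Ioi_deriv_of_nonneg' hder hpos hlim
  have hv := integral_Ioi_of_hasDerivAt_of_nonneg' hder hpos hlim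
  calc _ ≤ ∫⁻ r in Ioi (0 : ℝ), ofReal ((k + 1 : ℕ) * ((r + D) ^ (k + 2))⁻¹) := by
        refine setLIntegral_mono' measurableSet_Ioi fun r (hr : 0 < r) => ofReal_le_ofReal ?_
        exact le_mul_of_one_le_left (by positivity) hk
    _ = _ := by
        rw [← ofReal_integral_eq_lintegral_ofReal hi ((ae_restrict_mem measurableSet_Ioi).mono hpos), hv]
        simp

lemma norm_rk_le_of_norm_le (hd : 3 ≤ d) {ε : ℝ} (hε : 0 < ε) {u w : Ed d} (h : ‖w‖ ≤ ‖u‖) :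
    ‖rk d ε u‖ ≤ 3 ^ (d - 1) * ((‖w‖ + sreg ε (w - u)) ^ (d - 1))⁻¹ := by
  have hs := sreg_pos hε u
  have h1 : sreg ε (w - u) ≤ 2 * sreg ε u := by
    unfold sreg
    rw [← Real.sqrt_sq (by norm_num : (0 : ℝ) ≤ 2), ← Real.sqrt_mul (by norm_num)]
    refine Real.sqrt_le_sqrt ?_
    have := norm_sub_le w u
    nlinarith [norm_nonneg (w - u), sq_nonneg ε]
  have h2 : ‖w‖ + sreg ε (w - u) ≤ 3 * sreg ε u := by linarith [norm_le_sreg ε u]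
  have h3 : 0 < ‖w‖ + sreg ε (w - u) := add_pos_of_nonneg_of_pos (norm_nonneg _) (sreg_pos hε _)
  calc ‖rk d ε u‖ ≤ (sreg ε u ^ (d - 1))⁻¹ := by
        obtain ⟨k, rfl⟩ : ∃ k, d = k + 1 := ⟨d - 1, by omega⟩
        rw [norm_rk, Nat.add_sub_cancel, pow_succ, mul_inv, mul_assoc]
        refine mul_le_of_le_one_right (by positivity) ?_
        rw [inv_mul_le_one₀ hs]
        exact norm_le_sreg ε u
    _ ≤ (((‖w‖ + sreg ε (w - u)) / 3) ^ (d - 1))⁻¹ := by gcongr; linarith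
    _ = _ := by rw [div_pow, inv_div, div_eq_mul_inv]

/-- Composing the regularised kernel with itself yields at most the regularised potential. -/
lemma lintegral_rk_mul_rk_le (hd : 3 ≤ d) {ε : ℝ} (hε : 0 < ε) (a b : Ed d) :
    ∫⁻ x, ofReal (‖rk d ε (x - a)‖ * ‖rk d ε (x - b)‖)
      ≤ 2 * sph d * ofReal (3 ^ (d - 1)) * ofReal (rH d ε (a - b)) := by
  have hk : Measurable (kern d) := measurable_kern
  set D := sreg ε (a - b)
  have hD : 0 < D := sreg_pos hε _
  set G : ℝ → ℝ≥0∞ := fun r => ofReal (3 ^ (d - 1)) * ofReal ((r + D) ^ (d - 1))⁻¹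
  have hG : Measurable G := by fun_prop
  have hrk : ∀ x y z : Ed d, sreg ε (y - z) = D → ‖x - y‖ ≤ ‖x - z‖ →
      ofReal (‖rk d ε (x - y)‖ * ‖rk d ε (x - z)‖)
        ≤ ofReal ‖kern d (x - y)‖ * G ‖x - y‖ := fun x y z hyz h => by
    have h2 := norm_rk_le_of_norm_le hd hε h
    have h3 : x - y - (x - z) = -(y - z) := by abel
    have h4 : sreg ε (-(y - z)) = D := by rw [← hyz]; simp [sreg, norm_sub_rev]
    rw [h3, h4] at h2
    simp only [G]
    rw [← ofReal_mul (by positivity), ← ofReal_mul (norm_nonneg _)]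
    exact ofReal_le_ofReal (mul_le_mul (norm_rk_le_kern hε.le _) h2 (norm_nonneg _) (norm_nonneg _))
  have hba : sreg ε (b - a) = D := by simp [D, sreg, norm_sub_rev]
  have hItg : ∀ y : Ed d, ∫⁻ x, ofReal ‖kern d (x - y)‖ * G ‖x - y‖
      ≤ sph d * (ofReal (3 ^ (d - 1)) * ofReal (rH d ε (a - b))) := fun y => by
    rw [lintegral_sub_right_eq_self (fun x => ofReal ‖kern d x‖ * G ‖x‖) y,
      lintegral_kern_mul (by omega) G hG, lintegral_const_mul _ (by fun_prop)]
    obtain ⟨k, rfl⟩ : ∃ k, d = k + 3 := ⟨d - 3, by omega⟩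
    exact mul_le_mul_right (mul_le_mul_right (lintegral_Ioi_inv_pow_le k hD) _) _
  calc _ ≤ ∫⁻ x, (ofReal ‖kern d (x - a)‖ * G ‖x - a‖
          + ofReal ‖kern d (x - b)‖ * G ‖x - b‖) := lintegral_mono fun x => by
        rcases le_total ‖x - a‖ ‖x - b‖ with h | h
        · exact (hrk x a b rfl h).trans le_self_add
        · rw [mul_comm ‖rk d ε (x - a)‖]
          exact (hrk x b a hba h).trans le_add_self
    _ ≤ _ := by
        rw [lintegral_add_left (by fun_prop)]
        refine (add_le_add (hItg a) (hItg b)).trans (le_of_eq ?_)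
        ring

/-- The regularised field is square integrable, with norm controlled by the potential energy. -/
lemma lintegral_fld_sq_le (hd : 3 ≤ d) {ε : ℝ} (hε : 0 < ε) (ν : Measure (PS d)) [IsFiniteMeasure ν] :
    ∫⁻ x, ofReal (‖fld d ε ν x‖ ^ 2) ≤ ofReal (cdim d ^ 2) *
      (2 * sph d * ofReal (3 ^ (d - 1)) * ∫⁻ p, ofReal (rH d ε (p.1.1 - p.2.1)) ∂(ν.prod ν)) := by
  have hrk := measurable_rk (d := d) ε
  have hH : Measurable (rH d ε) := (continuous_rH hε).measurable
  have h1 : ∀ x, ofReal (‖fld d ε ν x‖ ^ 2) ≤ ofReal (cdim d ^ 2) *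
      ∫⁻ p : PS d × PS d, ofReal (‖rk d ε (x - p.1.1)‖ * ‖rk d ε (x - p.2.1)‖) ∂(ν.prod ν) := fun x => by
    have e1 : ofReal ‖∫ w : PS d, rk d ε (x - w.1) ∂ν‖
        ≤ ∫⁻ w : PS d, ofReal ‖rk d ε (x - w.1)‖ ∂ν := by
      simp only [ofReal_norm]
      exact enorm_integral_le_lintegral_enorm _
    have e2 : ∫⁻ p : PS d × PS d, ofReal (‖rk d ε (x - p.1.1)‖ * ‖rk d ε (x - p.2.1)‖) ∂(ν.prod ν)
        = (∫⁻ w : PS d, ofReal ‖rk d ε (x - w.1)‖ ∂ν) ^ 2 := by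
      simp only [ofReal_mul (norm_nonneg _)]
      rw [sq, lintegral_prod_mul (f := fun w : PS d => ofReal ‖rk d ε (x - w.1)‖)
        (g := fun w : PS d => ofReal ‖rk d ε (x - w.1)‖) (by fun_prop) (by fun_prop)]
    rw [e2, fld, norm_smul, norm_eq_abs, mul_pow, sq_abs, ofReal_mul (sq_nonneg _),
      ENNReal.ofReal_pow (norm_nonneg _)]
    exact mul_le_mul_right (pow_le_pow_left₀ (zero_le) e1 2) _
  calc _ ≤ _ := lintegral_mono h1
    _ = ofReal (cdim d ^ 2) * ∫⁻ p : PS d × PS d, (∫⁻ x : Ed d, ofReal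
        (‖rk d ε (x - p.1.1)‖ * ‖rk d ε (x - p.2.1)‖)) ∂(ν.prod ν) := by
        rw [lintegral_const_mul' _ _ ofReal_ne_top]
        congr 1
        exact lintegral_lintegral_swap (f := fun (x : Ed d) (p : PS d × PS d) =>
          ofReal (‖rk d ε (x - p.1.1)‖ * ‖rk d ε (x - p.2.1)‖)) (Measurable.aemeasurable (by unfold uncurry; fun_prop))
    _ ≤ _ := by
        refine mul_le_mul_right ?_ _
        rw [← lintegral_const_mul _ (by fun_prop)]
        exact lintegral_mono fun p => lintegral_rk_mul_rk_le hd hε _ _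

end VP

namespace VP

/-- Slowly growing concave function used to exclude blow-up of the velocity. -/
def lg (r : ℝ) : ℝ := log (1 + log (1 + r))

def lgw (r : ℝ) : ℝ := ((1 + r) * (1 + log (1 + r)))⁻¹

variable {r : ℝ}

lemma one_le_logL (hr : 0 ≤ r) : 1 ≤ 1 + log (1 + r) := by
  have := Real.log_nonneg (by linarith : 1 ≤ 1 + r)
  linarith

lemma lgw_nonneg (hr : 0 ≤ r) : 0 ≤ lgw r := by
  have := one_le_logL hr
  unfold lgw
  positivity

lemma hasDerivAt_logL (hr : 0 ≤ r) : HasDerivAt (fun r => 1 + log (1 + r)) (1 + r)⁻¹ r := by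
  have h := (((hasDerivAt_id r).const_add 1).log (by simp only [id]; positivity)).const_add 1
  simpa using h

lemma hasDerivAt_lg (hr : 0 ≤ r) : HasDerivAt lg (lgw r) r := by
  have h0 := one_le_logL hr
  refine ((hasDerivAt_logL hr).log (by positivity)).congr_deriv ?_
  rw [lgw, mul_inv, div_eq_mul_inv]

lemma lgw_anti : AntitoneOn lgw (Ici 0) := fun r (hr : 0 ≤ r) u _ h => by
  have h0 := one_le_logL hr
  have h1 : 0 ≤ 1 + u := by linarith
  unfold lgw
  gcongr

lemma tendsto_lg : Tendsto lg atTop atTop :=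
  Real.tendsto_log_atTop.comp (tendsto_atTop_add_const_left _ _ (Real.tendsto_log_atTop.comp
    (tendsto_atTop_add_const_left _ _ tendsto_id)))

variable {d : ℕ}

lemma lintegral_lgw_le (hd : d = 3 ∨ d = 4) :
    ∫⁻ v : Ed d, ofReal ((lgw ‖v‖ / (1 + ‖v‖)) ^ 2) ≤ sph d := by
  have hm : Measurable fun r => ofReal ((lgw r / (1 + r)) ^ 2) := by unfold lgw; fun_prop
  have hder : ∀ r ∈ Ici (0 : ℝ), HasDerivAt (fun r : ℝ => -(1 + log (1 + r))⁻¹)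
      ((1 + r)⁻¹ / (1 + log (1 + r)) ^ 2) r := fun r (hr : 0 ≤ r) => by
    have h0 := one_le_logL hr
    refine ((hasDerivAt_logL hr).inv (by positivity)).neg.congr_deriv ?_
    rw [neg_div, neg_neg]
  have hlim : Tendsto (fun r : ℝ => -(1 + log (1 + r))⁻¹) atTop (𝓝 0) := by
    have := (tendsto_atTop_add_const_left atTop (1 : ℝ) (Real.tendsto_log_atTop.comp
      (tendsto_atTop_add_const_left _ (1 : ℝ) tendsto_id))).inv_tendsto_atTop.neg
    simpa using this
  have hpos : ∀ r ∈ Ioi (0 : ℝ), 0 ≤ (1 + r)⁻¹ / (1 + log (1 + r)) ^ 2 := fun r (hr : 0 < r) => by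
    positivity
  have hi := integrableOn_Ioi_deriv_of_nonneg' hder hpos hlim
  have hv := integral_Ioi_of_hasDerivAt_of_nonneg' hder hpos hlim
  rw [lintegral_fun_norm (by omega) _ hm]
  refine mul_le_of_le_one_right (zero_le) ?_
  calc _ ≤ ∫⁻ r in Ioi (0 : ℝ), ofReal ((1 + r)⁻¹ / (1 + log (1 + r)) ^ 2) := by
        refine setLIntegral_mono' measurableSet_Ioi fun r (hr : 0 < r) => ?_
        have h0 := one_le_logL hr.le
        rw [← ofReal_mul (by positivity)]
        refine ofReal_le_ofReal ?_
        have h1 : r ^ (d - 1) ≤ (1 + r) ^ 3 := by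
          refine (pow_le_pow_left₀ hr.le (by linarith) _).trans (pow_le_pow_right₀ (by linarith) (by omega))
        have h2 : (1 + r) ^ 3 * (lgw r / (1 + r)) ^ 2 = (1 + r)⁻¹ / (1 + log (1 + r)) ^ 2 := by
          unfold lgw
          field_simp
        rw [← h2]
        gcongr
    _ = 1 := by
        rw [← ofReal_integral_eq_lintegral_ofReal hi ((ae_restrict_mem measurableSet_Ioi).mono hpos), hv]
        simp

namespace AFlow

variable {μ : Measure (PS d)} {e₀ ε η T : ℝ} (F : AFlow d μ e₀ ε η T)

lemma lgw_mul_norm_B_le (hη1 : η ≤ 1) {t : ℝ} (ht : t ∈ Icc 0 T) (z : PS d) :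
    lgw ‖(F.Z t z).2‖ * ‖(F.B t z).2‖ ≤ 3 + 2 * ‖(F.Z t z).2‖ ^ 2 +
      ‖fld d ε (μ.map (F.Z t)) (F.Z t z).1‖ ^ 2 * (lgw ‖(F.Z t z).2‖ / (1 + ‖(F.Z t z).2‖)) ^ 2 := by
  have h := (norm_snd_le _).trans (F.close t ht z)
  set n := ‖(F.Z t z).2‖
  set E := fld d ε (μ.map (F.Z t)) (F.Z t z).1
  have hn : 0 ≤ n := norm_nonneg _
  have h2 := norm_sub_norm_le (F.B t z).2 E
  simp only [Prod.snd_sub] at h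
  have hB : ‖(F.B t z).2‖ ≤ ‖E‖ + (1 + n) := by nlinarith
  have hw := lgw_nonneg hn
  have hL := one_le_logL hn
  have hw1 : lgw n * (1 + n) ≤ 1 := by
    rw [lgw, mul_inv, mul_right_comm, inv_mul_cancel₀ (by positivity), one_mul]
    exact inv_le_one_of_one_le₀ hL
  set q := lgw n / (1 + n) with hq
  have hqn : lgw n = (1 + n) * q := by rw [hq]; field_simp
  have h3 : lgw n * ‖(F.B t z).2‖ ≤ lgw n * (‖E‖ + (1 + n)) := by gcongr
  have h4 : lgw n * ‖E‖ ≤ (1 + n) ^ 2 + ‖E‖ ^ 2 * q ^ 2 := by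
    rw [hqn]
    nlinarith [sq_nonneg ((1 + n) - ‖E‖ * q), sq_nonneg ((1 + n) + ‖E‖ * q)]
  nlinarith [sq_nonneg (1 - n)]

lemma lg_sub_le {t : ℝ} (ht : t ∈ Icc 0 T) (z : PS d) :
    ofReal (lg ‖(F.Z t z).2‖ - lg ‖z.2‖)
      ≤ ∫⁻ t in Icc 0 T, ofReal (lgw ‖(F.Z t z).2‖) * ‖(F.B t z).2‖ₑ := by
  have hi : ∀ {s}, 0 ≤ s → IntervalIntegrable (fun r => F.B r z) volume 0 s := fun hs => F.intB z _ hs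
  have h := chain_curve (fun r hr => hasDerivAt_lg hr) lgw_anti (fun r hr => lgw_nonneg hr)
    (g := fun r => (F.Z r z).2) (b := fun r => (F.B r z).2) ht.1
    ⟨(hi ht.1).1.snd, (hi ht.1).2.snd⟩ fun r hr => by
      have h2 : (∫ x in (0 : ℝ)..r, F.B x z).2 = ∫ x in (0 : ℝ)..r, (F.B x z).2 :=
        ((ContinuousLinearMap.snd ℝ (Ed d) (Ed d)).intervalIntegral_comp_comm (hi hr.1)).symm
      rw [F.zero, F.ftc r hr.1, ← h2]
      simp
  simp only [F.zero] at h
  exact h.trans (lintegral_mono_set (Icc_subset_Icc_right ht.2))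

lemma norm_fst_le (hη1 : η ≤ 1) {S t : ℝ} (ht : t ∈ Icc 0 T) {z : PS d}
    (hS : ∀ r ∈ Icc 0 T, ‖(F.Z r z).2‖ ≤ S) : ‖(F.Z t z).1‖ ≤ ‖z.1‖ + T * (2 * S + 1) := by
  have h1 : (F.Z t z).1 - z.1 = (∫ x in (0 : ℝ)..t, F.B x z).1 := by
    rw [F.ftc t ht.1]
    simp
  have h2 : (∫ x in (0 : ℝ)..t, F.B x z).1 = ∫ x in (0 : ℝ)..t, (F.B x z).1 :=
    ((ContinuousLinearMap.fst ℝ (Ed d) (Ed d)).intervalIntegral_comp_comm (F.intB z t ht.1)).symm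
  have h3 : ‖∫ x in (0 : ℝ)..t, (F.B x z).1‖ ≤ (2 * S + 1) * |t - 0| :=
    intervalIntegral.norm_integral_le_of_norm_le_const fun r hr => by
      rw [uIoc_of_le ht.1] at hr
      have hrT : r ∈ Icc 0 T := ⟨hr.1.le, hr.2.trans ht.2⟩
      linarith [F.norm_B_fst_le hη1 hrT z, hS r hrT]
  have h4 := norm_sub_norm_le (F.Z t z).1 z.1
  have hS0 : 0 ≤ S := (norm_nonneg _).trans (hS t ht)
  rw [h1, h2] at h4
  rw [sub_zero, abs_of_nonneg ht.1] at h3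
  nlinarith [ht.2]

/-- Restriction of an approximate flow to a shorter time interval. -/
def mono {T' : ℝ} (h : T' ≤ T) : AFlow d μ e₀ ε η T' where
  __ := F
  close t ht := F.close t ⟨ht.1, ht.2.trans h⟩
  sq t ht := F.sq t ⟨ht.1, ht.2.trans h⟩
  en_le t ht := F.en_le t ⟨ht.1, ht.2.trans h⟩

variable [IsFiniteMeasure μ]

lemma lintegral_fld_sq_le (hd : 3 ≤ d) (hε : 0 < ε) (hη1 : η ≤ 1) {t : ℝ} (ht : t ∈ Icc 0 T) :
    ∫⁻ x, ofReal (‖fld d ε (μ.map (F.Z t)) x‖ ^ 2) ≤ 2 * sph d * ofReal (3 ^ (d - 1)) *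
      ofReal (cdim d * (d - 2) * (e₀ + 1)) := by
  have hZ := (F.Z t).measurable
  have hH : Measurable (rH d ε) := (continuous_rH hε).measurable
  have hd2 := sub_two_pos hd
  have hc := cdim_nonneg d
  have hi := integrable_rH (d := d) hε (m := μ) (X := fun z => (F.Z t z).1) (by fun_prop)
  have h1 : ∫⁻ p : PS d × PS d, ofReal (rH d ε (p.1.1 - p.2.1)) ∂((μ.map (F.Z t)).prod (μ.map (F.Z t)))
      = ofReal (∫ p : PS d × PS d, rH d ε ((F.Z t p.1).1 - (F.Z t p.2).1) ∂(μ.prod μ)) := by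
    rw [Measure.map_prod_map _ _ hZ hZ, lintegral_map (by fun_prop) (by fun_prop),
      ofReal_integral_eq_lintegral_ofReal hi (.of_forall fun _ => rH_nonneg _ _)]
    rfl
  have h2 := F.en_le t ht
  have h3 : 0 ≤ ∫ z, ‖(F.Z t z).2‖ ^ 2 ∂μ := integral_nonneg fun z => by positivity
  refine (VP.lintegral_fld_sq_le hd hε _).trans ?_
  rw [h1, mul_left_comm, ← ofReal_mul (by positivity)]
  refine mul_le_mul_right (ofReal_le_ofReal ?_) _
  set I := ∫ p : PS d × PS d, rH d ε ((F.Z t p.1).1 - (F.Z t p.2).1) ∂(μ.prod μ) with hI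
  have h4 : cdim d / (d - 2) * I ≤ e₀ + 1 := by
    rw [en, ← hI] at h2
    linarith
  calc cdim d ^ 2 * I = cdim d * (d - 2) * (cdim d / (d - 2) * I) := by field_simp
    _ ≤ _ := by gcongr

/-- Bound for the expected logarithmic growth of the velocity along the flow. -/
lemma lintegral_lgw_le (hd : d = 3 ∨ d = 4) (hε : 0 < ε) (hη1 : η ≤ 1) {U : Set (PS d)} {K : ℝ≥0∞}
    (hK : μ.restrict U ≤ K • volume) :
    ∫⁻ z in U, (∫⁻ t in Icc 0 T, ofReal (lgw ‖(F.Z t z).2‖) * ‖(F.B t z).2‖ₑ) ∂μ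
      ≤ (3 * μ univ + 2 * ofReal (e₀ + 1) + K * (2 * sph d * ofReal (3 ^ (d - 1)) *
        ofReal (cdim d * (d - 2) * (e₀ + 1)) * sph d)) * ofReal T := by
  have hd3 : 3 ≤ d := by omega
  have hmZ : Measurable fun p : PS d × ℝ => F.Z p.2 p.1 := F.measZ.comp measurable_swap
  have hmB : Measurable fun p : PS d × ℝ => F.B p.2 p.1 := F.measB.comp measurable_swap
  have hlgw : Measurable lgw := by unfold lgw; fun_prop
  rw [lintegral_lintegral_swap (by unfold uncurry; fun_prop)]
  refine (setLIntegral_mono' measurableSet_Icc fun t ht => ?_).trans_eq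
    ((setLIntegral_const _ _).trans (by rw [Real.volume_Icc, sub_zero]))
  have hZ := (F.Z t).measurable
  have hE := measurable_fld ε (μ.map (F.Z t))
  set q : ℝ → ℝ≥0∞ := fun r => ofReal ((lgw r / (1 + r)) ^ 2)
  have hq : Measurable q := by fun_prop
  have hG : Measurable fun z : PS d => ofReal (‖fld d ε (μ.map (F.Z t)) z.1‖ ^ 2) * q ‖z.2‖ := by
    fun_prop
  have hpt : ∀ z, ofReal (lgw ‖(F.Z t z).2‖) * ‖(F.B t z).2‖ₑ ≤ 3 + 2 * ‖(F.Z t z).2‖ₑ ^ 2 +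
      ofReal (‖fld d ε (μ.map (F.Z t)) (F.Z t z).1‖ ^ 2) * q ‖(F.Z t z).2‖ := fun z => by
    have h := ofReal_le_ofReal (F.lgw_mul_norm_B_le hη1 ht z)
    rwa [ofReal_mul (lgw_nonneg (norm_nonneg _)), ofReal_norm,
      ofReal_add (by positivity) (by positivity), ofReal_add (by positivity) (by positivity),
      ofReal_mul (by positivity), ofReal_mul (by positivity),
      ENNReal.ofReal_pow (norm_nonneg _), ofReal_norm, ENNReal.ofReal_ofNat, ENNReal.ofReal_ofNat] at h
  have e3 : ∫⁻ z in U, ofReal (‖fld d ε (μ.map (F.Z t)) (F.Z t z).1‖ ^ 2) * q ‖(F.Z t z).2‖ ∂μ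
      ≤ K * (2 * sph d * ofReal (3 ^ (d - 1)) *
        ofReal (cdim d * (d - 2) * (e₀ + 1)) * sph d) := by
    refine (lintegral_mono' hK le_rfl).trans ?_
    rw [lintegral_smul_measure, smul_eq_mul, (F.mp t).lintegral_comp hG, Measure.volume_eq_prod,
      lintegral_prod_mul (f := fun x => ofReal (‖fld d ε (μ.map (F.Z t)) x‖ ^ 2))
        (g := fun v : Ed d => q ‖v‖) (by fun_prop) (by fun_prop)]
    exact mul_le_mul_right (mul_le_mul' (F.lintegral_fld_sq_le hd3 hε hη1 ht) (VP.lintegral_lgw_le hd)) _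
  refine (lintegral_mono hpt).trans ?_
  rw [lintegral_add_right (g := fun z => ofReal (‖fld d ε (μ.map (F.Z t)) (F.Z t z).1‖ ^ 2) *
    q ‖(F.Z t z).2‖) _ (hG.comp hZ), lintegral_add_left measurable_const, lintegral_const_mul _ (by fun_prop),
    lintegral_const]
  refine add_le_add (add_le_add ?_ ?_) e3
  · rw [Measure.restrict_apply_univ]
    exact mul_le_mul_right (measure_mono (subset_univ _)) _
  · exact mul_le_mul_right ((lintegral_mono' Measure.restrict_le_self le_rfl).trans
      (F.lintegral_sq_le hd3 hη1 ht)) _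

end AFlow

variable {μ : Measure (PS d)} [IsFiniteMeasure μ] {e₀ : ℝ}
  (F : AFlows d μ e₀)

/-- In dimensions three and four the approximate trajectories stay bounded, uniformly in `n`. -/
lemma no_escape (hd : d = 3 ∨ d = 4) (hμ : μ ≪ volume) (T : ℕ) {θ : ℝ≥0∞} (hθ : θ ≠ 0) :
    ∃ R : ℝ, ∀ n : ℕ, T ≤ n → μ {z | ∃ t ∈ Icc (0 : ℝ) T, R ≤ ‖(F n).Z t z‖} ≤ θ := by
  have hθ3 : θ / 3 ≠ 0 := by simp [hθ]
  obtain ⟨K, U, hK, hU, hKU, hUc⟩ := exists_layer hμ hθ3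
  obtain ⟨R₀, hR₀⟩ := exists_measure_norm_le μ hθ3
  set C := (3 * μ univ + 2 * ofReal (e₀ + 1) + K * (2 * sph d * ofReal (3 ^ (d - 1)) *
        ofReal (cdim d * (d - 2) * (e₀ + 1)) * sph d)) with hC
  have hCt : C * ofReal T ≠ ⊤ := by
    have := sph_ne_top d
    finiteness
  obtain ⟨A, hA⟩ := ENNReal.exists_nat_mul_gt hθ3 hCt
  have hA0 : A ≠ 0 := by
    rintro rfl
    simp at hA
  obtain ⟨S, hSA, hS0⟩ := ((tendsto_lg.eventually_ge_atTop (lg |R₀| + A)).and (eventually_ge_atTop 0)).exists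
  refine ⟨|R₀| + T * (2 * S + 1) + S + 1, fun n hn => ?_⟩
  have hTn : (T : ℝ) ≤ n := by exact_mod_cast hn
  set G := (F n).mono hTn
  have hη1 := eps_le_one n
  set Y : PS d → ℝ≥0∞ := fun z =>
    ∫⁻ t in Icc (0 : ℝ) T, ofReal (lgw ‖(G.Z t z).2‖) * ‖(G.B t z).2‖ₑ
  have hYm : Measurable Y := by
    have hmZ : Measurable fun p : PS d × ℝ => G.Z p.2 p.1 := G.measZ.comp measurable_swap
    have hmB : Measurable fun p : PS d × ℝ => G.B p.2 p.1 := G.measB.comp measurable_swap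
    have hlgw : Measurable lgw := by unfold lgw; fun_prop
    exact Measurable.lintegral_prod_right' (f := fun p : PS d × ℝ =>
      ofReal (lgw ‖(G.Z p.2 p.1).2‖) * ‖(G.B p.2 p.1).2‖ₑ) (by fun_prop)
  have hmonolg : ∀ {a b : ℝ}, 0 ≤ a → a ≤ b → lg a ≤ lg b := fun {a b} ha hab =>
    Real.log_le_log (by linarith [one_le_logL ha])
      (add_le_add_right (Real.log_le_log (by linarith) (by linarith)) _)
  have hY : (μ.restrict U) {z | (A : ℝ≥0∞) ≤ Y z} ≤ θ / 3 := by
    have h1 := (mul_meas_ge_le_lintegral (μ := μ.restrict U) hYm A).trans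
      (G.lintegral_lgw_le hd (eps_pos n) hη1 hKU)
    exact (ENNReal.mul_le_mul_iff_right (Nat.cast_ne_zero.2 hA0) (ENNReal.natCast_ne_top A)).1 (h1.trans hA.le)
  have hsub : {z | ∃ t ∈ Icc (0 : ℝ) T, |R₀| + T * (2 * S + 1) + S + 1 ≤ ‖(F n).Z t z‖} ⊆
      Uᶜ ∪ {z | |R₀| ≤ ‖z‖} ∪ (U ∩ {z | (A : ℝ≥0∞) ≤ Y z}) := fun z ⟨t, ht, hz⟩ => by
    by_cases hzU : z ∈ U; swap
    · exact Or.inl (Or.inl hzU)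
    by_cases hzR : |R₀| ≤ ‖z‖
    · exact Or.inl (Or.inr hzR)
    refine Or.inr ⟨hzU, ?_⟩
    rw [not_le] at hzR
    by_contra! hlt
    rw [mem_ofPred_eq, not_le] at hlt
    have hV : ∀ r ∈ Icc (0 : ℝ) T, ‖(G.Z r z).2‖ ≤ S := fun r hr => by
      by_contra! hSr
      have h1 := (G.lg_sub_le hr z).trans_lt hlt
      rw [ENNReal.ofReal_lt_natCast hA0] at h1
      linarith [hmonolg hS0 hSr.le, hmonolg (norm_nonneg z.2) ((norm_snd_le z).trans hzR.le)]
    have h1 := G.norm_fst_le hη1 ht hV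
    have h2 := hV t ht
    have h3 : ‖(F n).Z t z‖ ≤ ‖(G.Z t z).1‖ + ‖(G.Z t z).2‖ :=
      max_le (le_add_of_nonneg_right (norm_nonneg _)) (le_add_of_nonneg_left (norm_nonneg _))
    linarith [norm_fst_le z]
  refine (measure_mono hsub).trans ((measure_union_le _ _).trans
    ((add_le_add ((measure_union_le _ _).trans (add_le_add hUc (hR₀ _ (le_abs_self _)))) ?_).trans_eq
      (ENNReal.add_thirds θ)))
  rwa [inter_comm, ← Measure.restrict_apply' hU]

end VP

namespace VP

variable {d : ℕ} {μ : Measure (PS d)} {e₀ : ℝ} (F : AFlows d μ e₀)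

lemma pth_zero (n : ℕ) (r : ℝ) (z : PS d) : pth F n 0 r z = (F n).Z r z := by
  rw [pth, (MeasurableEquiv.symm_apply_eq _).2 ((F n).zero z).symm]

lemma vel_zero (n : ℕ) (r : ℝ) (z : PS d) : vel F n 0 r z = (F n).B r z := by
  rw [vel, (MeasurableEquiv.symm_apply_eq _).2 ((F n).zero z).symm]

/-- Convergence of compositions with an integrable function, when the image measures are dominated. -/
lemma tendsto_lintegral_comp_sub {Ω : Type*} [MeasurableSpace Ω] {m : Measure Ω} [IsFiniteMeasure m]
    {W : ℕ → Ω → PS d} {Y : Ω → PS d} (hW : ∀ j, Measurable (W j)) (hY : Measurable Y) {K : ℝ≥0∞}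
    (hK : K ≠ ⊤) (hWK : ∀ j, m.map (W j) ≤ K • volume) (hYK : m.map Y ≤ K • volume)
    (hc : ∀ᵐ z ∂m, Tendsto (fun j => W j z) atTop (𝓝 (Y z))) {g : PS d → PS d} (hgm : Measurable g)
    (hg : Integrable g) : Tendsto (fun j => ∫⁻ z, ‖g (W j z) - g (Y z)‖ₑ ∂m) atTop (𝓝 0) := by
  refine ENNReal.tendsto_nhds_zero.2 fun θ hθ => ?_
  have hθ3 : θ / 3 ≠ 0 := by simpa using hθ.ne'
  obtain ⟨δ, hδ, -, hδ1⟩ := exists_mul_le hK hθ3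
  obtain ⟨h, hh, hgh, hhc, -⟩ := hg.exists_hasCompactSupport_lintegral_sub_le hδ
  obtain ⟨M, hM⟩ := hh.exists_bound_of_continuous hhc
  have hhm := hhc.measurable
  have hkey : ∀ {V : Ω → PS d}, Measurable V → m.map V ≤ K • volume →
      ∫⁻ z, ‖g (V z) - h (V z)‖ₑ ∂m ≤ θ / 3 := fun {V} hV hVK => by
    rw [← lintegral_map (f := fun z => ‖g z - h z‖ₑ) (by fun_prop) hV]
    refine (lintegral_mono' hVK le_rfl).trans ?_
    rw [lintegral_smul_measure]
    exact (mul_le_mul_right hgh _).trans hδ1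
  have hlim : Tendsto (fun j => ∫⁻ z, ‖h (W j z) - h (Y z)‖ₑ ∂m) atTop (𝓝 0) := by
    have := tendsto_lintegral_of_dominated_convergence (μ := m) (F := fun j z => ‖h (W j z) - h (Y z)‖ₑ)
      (f := fun _ => 0) (fun _ => ofReal (M + M)) (fun j => by have := hW j; fun_prop)
      (fun j => .of_forall fun z => by
        exact (ofReal_norm _).symm.trans_le <| ofReal_le_ofReal ((norm_sub_le _ _).trans (add_le_add (hM _) (hM _))))
      (by rw [lintegral_const]; finiteness) (hc.mono fun z hz => by
        have := (((hhc.tendsto _).comp hz).sub_const (h (Y z))).enorm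
        simpa using this)
    simpa using this
  filter_upwards [ENNReal.tendsto_nhds_zero.1 hlim (θ / 3) (pos_iff_ne_zero.2 hθ3)] with j hj
  have hWj := hW j
  calc ∫⁻ z, ‖g (W j z) - g (Y z)‖ₑ ∂m
      ≤ ∫⁻ z, (‖g (W j z) - h (W j z)‖ₑ + ‖h (W j z) - h (Y z)‖ₑ) + ‖g (Y z) - h (Y z)‖ₑ ∂m := by
        refine lintegral_mono fun z => ?_
        have e : g (W j z) - g (Y z) = (g (W j z) - h (W j z)) + (h (W j z) - h (Y z)) - (g (Y z) - h (Y z)) := by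
          abel
        rw [e]
        exact enorm_sub_le.trans (add_le_add_left (enorm_add_le _ _) _)
    _ ≤ θ / 3 + θ / 3 + θ / 3 := by
        rw [lintegral_add_left (by fun_prop), lintegral_add_left (by fun_prop)]
        exact add_le_add (add_le_add (hkey hWj (hWK j)) hj) (hkey hY hYK)
    _ = θ := ENNReal.add_thirds θ

variable [IsFiniteMeasure μ]

lemma stab_measure (hd : d = 3 ∨ d = 4) (hμ : μ ≪ volume) (T : ℕ) {κ : ℝ} (hκ : 0 < κ) {θ : ℝ≥0∞}
    (hθ : θ ≠ 0) : ∃ S ∈ UF, ∀ n ∈ S, ∀ m ∈ S,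
      μ {z | ∃ t ∈ Icc (0 : ℝ) T, κ < ‖(F n).Z t z - (F m).Z t z‖} ≤ θ := by
  have hθ3 : θ / 3 ≠ 0 := by simpa using hθ
  obtain ⟨R, hR⟩ := no_escape F hd hμ T hθ3
  obtain ⟨δ, hδ, hδ'⟩ := exists_measure_lt_of_ac hμ hθ3
  obtain ⟨δ₁, hδ0, hδ1⟩ := exists_between hδ
  obtain ⟨S, hS, H⟩ := stab F (by omega) hμ T R hκ hδ0.ne' hδ1.ne_top
  refine ⟨S ∩ {n | T ≤ n}, inter_mem hS (UF_le (eventually_ge_atTop T)), fun n hn m hm => ?_⟩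
  have hE := H n hn.1 m hm.1 0 ⟨le_rfl, T.cast_nonneg⟩
  simp only [pth_zero] at hE
  set E := {z | ∃ t ∈ Icc (0 : ℝ) T, (∀ r ∈ uIcc 0 t, (F n).Z r z ∈ ball 0 R ∧ (F m).Z r z ∈ ball 0 R) ∧
    κ < ‖(F n).Z t z - (F m).Z t z‖}
  have hE : μ E ≤ θ / 3 := (measure_mono (subset_toMeasurable volume E)).trans
    (hδ' _ (measurableSet_toMeasurable _ _) (by rw [measure_toMeasurable]; exact hE.trans_lt hδ1)).le
  have hsub : {z | ∃ t ∈ Icc (0 : ℝ) T, κ < ‖(F n).Z t z - (F m).Z t z‖} ⊆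
      {z | ∃ t ∈ Icc (0 : ℝ) T, R ≤ ‖(F n).Z t z‖} ∪ {z | ∃ t ∈ Icc (0 : ℝ) T, R ≤ ‖(F m).Z t z‖} ∪ E :=
    fun z ⟨t, ht, hz⟩ => by
      by_contra! hc
      simp only [mem_union, mem_ofPred_eq, not_or, not_exists, not_and, not_le] at hc
      refine hc.2 ⟨t, ht, fun r hr => ?_, hz⟩
      rw [uIcc_of_le ht.1] at hr
      have hrT : r ∈ Icc (0 : ℝ) T := ⟨hr.1, hr.2.trans ht.2⟩
      exact ⟨mem_ball_zero_iff.2 (hc.1.1 r hrT), mem_ball_zero_iff.2 (hc.1.2 r hrT)⟩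
  exact (measure_mono hsub).trans ((measure_union_le _ _).trans ((add_le_add ((measure_union_le _ _).trans
    (add_le_add (hR n hn.2) (hR m hm.2))) hE).trans_eq (ENNReal.add_thirds θ)))

/-- A sequence of indices along which the approximate flows converge rapidly. -/
structure FastSeq where
  N : ℕ → ℕ
  S : ℕ → Set ℕ
  mem_UF : ∀ j, S j ∈ UF
  mem : ∀ j, N j ∈ S j
  succ_mem : ∀ j, N (j + 1) ∈ S j
  stab : ∀ j, ∀ n ∈ S j, ∀ m ∈ S j,
    μ {z | ∃ t ∈ Icc (0 : ℝ) j, (1 / 2 : ℝ) ^ j < ‖(F n).Z t z - (F m).Z t z‖} ≤ 2⁻¹ ^ j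
  near : ∀ j, ∀ n ∈ S j, ∀ s ∈ Icc (0 : ℝ) j,
    ∫⁻ z in (F n).Z s ⁻¹' ball 0 j, ‖(F n).B s z - bfl F s ((F n).Z s z)‖ₑ ≤ 2⁻¹ ^ j

lemma nonempty_fastSeq (hd : d = 3 ∨ d = 4) (hμ : μ ≪ volume) : Nonempty (FastSeq F) := by
  have h1 : ∀ j : ℕ, (2⁻¹ : ℝ≥0∞) ^ j ≠ 0 := fun j => by simp
  choose S hS H using fun j : ℕ => stab_measure F hd hμ j (κ := (1 / 2) ^ j) (by positivity) (h1 j)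
  choose τ hτ H' using fun j : ℕ => vel_near F (by omega) hμ j j (h1 j)
  set S' : ℕ → Set ℕ := fun j => S j ∩ {n | (j : ℝ) ≤ n ∧ ∀ u, ∀ s ∈ Icc (0 : ℝ) j, ∀ r ∈ Icc (0 : ℝ) j,
    |r - s| ≤ τ j → ∫⁻ z in pth F n u r ⁻¹' ball 0 j, ‖vel F n u r z - bfl F s (pth F n u r z)‖ₑ ≤ 2⁻¹ ^ j}
  have hS' : ∀ j, S' j ∈ UF := fun j => inter_mem (hS j) (H' j)
  choose N hN using fun j : ℕ => UF.nonempty_of_mem (inter_mem (hS' j) (hS' (j - 1)))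
  refine ⟨⟨N, S', hS', fun j => (hN j).1, fun j => (hN (j + 1)).2, fun j n hn m hm => H j n hn.1 m hm.1,
    fun j n hn s hs => ?_⟩⟩
  have := hn.2.2 0 s hs s hs (by simpa using (hτ j).le)
  rwa [show pth F n 0 s = (F n).Z s from funext (pth_zero F n s),
    show vel F n 0 s = (F n).B s from funext (vel_zero F n s)] at this

namespace FastSeq

variable {d : ℕ} {μ : Measure (PS d)} {e₀ : ℝ} {F : AFlows d μ e₀} (Q : FastSeq F)

/-- Points at which the sequence of flows is locally uniformly Cauchy. -/
def Good (z : PS d) : Prop := ∀ᶠ j : ℕ in atTop, ∀ t ∈ Icc (0 : ℝ) j,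
  ‖(F (Q.N j)).Z t z - (F (Q.N (j + 1))).Z t z‖ ≤ (1 / 2) ^ j

lemma ae_close {n m : ℕ → ℕ} (hn : ∀ j, n j ∈ Q.S j) (hm : ∀ j, m j ∈ Q.S j) : ∀ᵐ z ∂μ, ∀ᶠ j : ℕ in atTop,
    ∀ t ∈ Icc (0 : ℝ) j, ‖(F (n j)).Z t z - (F (m j)).Z t z‖ ≤ (1 / 2) ^ j := by
  refine (ae_eventually_notMem (μ := μ) (s := fun j => {z | ∃ t ∈ Icc (0 : ℝ) j,
    (1 / 2 : ℝ) ^ j < ‖(F (n j)).Z t z - (F (m j)).Z t z‖}) (ne_top_of_le_ne_top ?_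
    (ENNReal.tsum_le_tsum fun j => Q.stab j _ (hn j) _ (hm j)))).mono fun z hz => ?_
  · rw [ENNReal.tsum_geometric]
    simp
  · filter_upwards [hz] with j hj t ht
    by_contra! hc
    exact hj ⟨t, ht, hc⟩

lemma ae_good : ∀ᵐ z ∂μ, Q.Good z := Q.ae_close Q.mem Q.succ_mem

/-- The limit flow. -/
def flow (t : ℝ) (z : PS d) : PS d := limUnder atTop fun j => (F (Q.N j)).Z t z

lemma measurable_flow : Measurable (uncurry Q.flow) :=
  (StronglyMeasurable.limUnder (l := atTop) (f := fun j (p : ℝ × PS d) => (F (Q.N j)).Z p.1 p.2)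
    fun j => (F (Q.N j)).measZ.stronglyMeasurable).measurable

lemma flow_zero (z : PS d) : Q.flow 0 z = z := by
  simp only [flow, AFlow.zero]
  exact tendsto_const_nhds.limUnder_eq

variable {Q} in
lemma Good.exists_le {z : PS d} (hz : Q.Good z) (T : ℕ) : ∃ J ≥ T, ∀ j ≥ J, ∀ t ∈ Icc (0 : ℝ) T,
    ‖(F (Q.N j)).Z t z - (F (Q.N J)).Z t z‖ ≤ 2 ∧
    Tendsto (fun j => (F (Q.N j)).Z t z) atTop (𝓝 (Q.flow t z)) := by
  obtain ⟨J, hJ⟩ := (hz.and (eventually_ge_atTop T)).exists_forall_of_atTop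
  refine ⟨J, (hJ J le_rfl).2, fun j hj t ht => ?_⟩
  have hJT := (hJ J le_rfl).2
  have hstep : ∀ i, dist ((F (Q.N (i + J))).Z t z) ((F (Q.N (i + 1 + J))).Z t z) ≤ 1 * (1 / 2) ^ i := fun i => by
    have h1 : (T : ℝ) ≤ (i + J : ℕ) := by exact_mod_cast hJT.trans (Nat.le_add_left _ _)
    rw [dist_eq_norm, one_mul, add_right_comm]
    exact ((hJ (i + J) (Nat.le_add_left _ _)).1 t ⟨ht.1, ht.2.trans h1⟩).trans
      (pow_le_pow_of_le_one (by norm_num) (by norm_num) (Nat.le_add_right _ _))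
  have hcau := cauchySeq_of_le_geometric (1 / 2) 1 (by norm_num) hstep
  refine ⟨?_, ?_⟩
  · have := dist_le_range_sum_of_dist_le (f := fun i => (F (Q.N (i + J))).Z t z) (j - J)
      (d := fun i => 1 * (1 / 2) ^ i) fun {i} _ => hstep i
    rw [zero_add, Nat.sub_add_cancel hj, dist_comm, dist_eq_norm] at this
    refine this.trans ?_
    simp only [one_mul]
    exact sum_geometric_two_le _
  · obtain ⟨y, hy⟩ := cauchySeq_tendsto_of_complete hcau
    have := (tendsto_add_atTop_iff_nat (f := fun j => (F (Q.N j)).Z t z) J).1 hy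
    rwa [flow, this.limUnder_eq]

end FastSeq

end VP

namespace VP

/-- Passage to the limit in integral equations along a sequence of vector fields. -/
lemma eq_add_integral_of_liminf {E : Type*} [NormedAddCommGroup E] [NormedSpace ℝ E]
    {W B : ℕ → ℝ → E} {Y b : ℝ → E} {z : E} {T : ℝ} {h : ℕ → ℝ≥0∞}
    (hb : AEStronglyMeasurable b (volume.restrict (Icc 0 T))) (hB : ∀ j, IntegrableOn (B j) (Icc 0 T))
    (hle : ∀ᶠ j in atTop, ∫⁻ r in Icc 0 T, ‖B j r - b r‖ₑ ≤ h j) (hl : liminf h atTop = 0)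
    (hW : ∀ j, ∀ t ∈ Icc 0 T, W j t = z + ∫ r in (0 : ℝ)..t, B j r)
    (hlim : ∀ t ∈ Icc 0 T, Tendsto (fun j => W j t) atTop (𝓝 (Y t))) :
    IntegrableOn b (Icc 0 T) ∧ ∀ t ∈ Icc 0 T, Y t = z + ∫ r in (0 : ℝ)..t, b r := by
  have hbi : IntegrableOn b (Icc 0 T) := by
    obtain ⟨j, hj, hj1⟩ := ((frequently_lt_of_liminf_lt (by isBoundedDefault)
      (hl.trans_lt one_pos)).and_eventually hle).exists
    have h1 : IntegrableOn (fun r => B j r - b r) (Icc 0 T) :=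
      ⟨(hB j).1.sub hb, (hj1.trans_lt hj).trans ENNReal.one_lt_top⟩
    exact ((hB j).sub h1).congr (.of_forall fun r => by simp)
  refine ⟨hbi, fun t ht => ?_⟩
  have hsub : Ioc 0 t ⊆ Icc 0 T := fun r hr => ⟨hr.1.le, hr.2.trans ht.2⟩
  have h1 : Tendsto (fun j => ‖W j t - (z + ∫ r in (0 : ℝ)..t, b r)‖ₑ) atTop
      (𝓝 ‖Y t - (z + ∫ r in (0 : ℝ)..t, b r)‖ₑ) := ((hlim t ht).sub_const _).enorm
  have h2 : ‖Y t - (z + ∫ r in (0 : ℝ)..t, b r)‖ₑ ≤ liminf h atTop := by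
    rw [← h1.liminf_eq]
    refine liminf_le_liminf (hle.mono fun j hj => ?_)
    rw [hW j t ht, add_sub_add_left_eq_sub, intervalIntegral.integral_of_le ht.1,
      intervalIntegral.integral_of_le ht.1, ← integral_sub ((hB j).mono_set hsub) (hbi.mono_set hsub)]
    exact (enorm_integral_le_lintegral_enorm _).trans ((lintegral_mono_set hsub).trans hj)
  rw [hl, nonpos_iff_eq_zero, enorm_eq_zero, sub_eq_zero] at h2
  exact h2

lemma measurable_fld_map {d : ℕ} {μ : Measure (PS d)} [SFinite μ] {Y : ℝ → PS d → PS d}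
    (hY : Measurable (uncurry Y)) :
    Measurable fun p : ℝ × Ed d => fld d 0 (μ.map (Y p.1)) p.2 := by
  have hk := measurable_rk (d := d) 0
  have e : ∀ p : ℝ × Ed d, fld d 0 (μ.map (Y p.1)) p.2
      = cdim d • ∫ w, rk d 0 (p.2 - (Y p.1 w).1) ∂μ := fun p => by
    rw [fld, integral_map hY.of_uncurry_left.aemeasurable]
    exact Measurable.aestronglyMeasurable (by fun_prop)
  have h1 : Measurable fun q : (ℝ × Ed d) × PS d => Y q.1.1 q.2 :=
    hY.comp (measurable_fst.fst.prodMk measurable_snd)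
  have h2 : Measurable fun q : (ℝ × Ed d) × PS d => rk d 0 (q.1.2 - (Y q.1.1 q.2).1) :=
    hk.comp (measurable_fst.snd.sub h1.fst)
  simp only [e]
  exact (continuous_const_smul _).measurable.comp (h2.stronglyMeasurable.integral_prod_right' (ν := μ)).measurable

section Gap

variable {d : ℕ} {W B : ℕ → ℝ → PS d → PS d} {Y b : ℝ → PS d → PS d} {L : ℕ}

/-- Distance of the velocities of two flows, localised to a ball. -/
def gap (L : ℕ) (W B Y b : ℝ → PS d → PS d) (p : ℝ × PS d) : ℝ≥0∞ :=
  {p : ℝ × PS d | W p.1 p.2 ∈ ball 0 (L : ℝ) ∧ Y p.1 p.2 ∈ ball 0 (L : ℝ)}.indicator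
    (fun p => ‖B p.1 p.2 - b p.1 (Y p.1 p.2)‖ₑ) p

lemma measurable_gap {W B : ℝ → PS d → PS d} (hW : Measurable (uncurry W))
    (hB : Measurable (uncurry B)) (hY : Measurable (uncurry Y))
    (hb : Measurable (uncurry b)) : Measurable (gap L W B Y b) :=
  Measurable.indicator (hB.sub (hb.comp (measurable_fst.prodMk hY))).enorm
    ((hW measurableSet_ball).inter (hY measurableSet_ball))

lemma tendsto_gap {m : Measure (PS d)} [IsFiniteMeasure m] (hW : ∀ j, Measurable (uncurry (W j)))
    (hB : ∀ j, Measurable (uncurry (B j))) (hY : Measurable (uncurry Y))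
    (hb : Measurable (uncurry b)) {k K : ℝ≥0∞} (hk : k ≠ ⊤) (hK : K ≠ ⊤)
    (hWk : ∀ j r, m.map (W j r) ≤ k • volume) (hYk : ∀ r, 0 ≤ r → m.map (Y r) ≤ k • volume)
    (hbK : ∀ r, 0 ≤ r → ∫⁻ z in ball 0 (L : ℝ), ‖b r z‖ₑ ≤ K)
    (hc : ∀ r ∈ Icc (0 : ℝ) L, ∀ᵐ z ∂m, Tendsto (fun j => W j r z) atTop (𝓝 (Y r z)))
    (hn : ∀ j ≥ L, ∀ r ∈ Icc (0 : ℝ) L, ∫⁻ z in W j r ⁻¹' ball 0 L, ‖B j r z - b r (W j r z)‖ₑ ∂m ≤ k * 2⁻¹ ^ j) :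
    Tendsto (fun j => ∫⁻ z, ∫⁻ r in Icc (0 : ℝ) L, gap L (W j) (B j) Y b (r, z) ∂volume ∂m) atTop (𝓝 0) := by
  have hWm : ∀ j r, Measurable (W j r) := fun j r => (hW j).of_uncurry_left
  have hYm : ∀ r, Measurable (Y r) := fun r => hY.of_uncurry_left
  have hbm : ∀ r, Measurable (b r) := fun r => hb.of_uncurry_left
  have hGm := fun j => measurable_gap (L := L) (hW j) (hB j) hY hb
  set g : ℝ → PS d → PS d := fun r => (ball (0 : PS d) L).indicator (b r)
  have hgm : ∀ r, Measurable (g r) := fun r => (hbm r).indicator measurableSet_ball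
  have hgK : ∀ r, 0 ≤ r → ∫⁻ z, ‖g r z‖ₑ ≤ K := fun r hr => by
    simp only [g, enorm_indicator_eq_indicator_enorm]
    rw [lintegral_indicator measurableSet_ball]
    exact hbK r hr
  have hcomp : ∀ {r} {V : PS d → PS d}, 0 ≤ r → Measurable V → m.map V ≤ k • volume →
      ∫⁻ z, ‖g r (V z)‖ₑ ∂m ≤ k * K := fun {r V} hr hV h => by
    have := hgm r
    rw [← lintegral_map (f := fun z => ‖g r z‖ₑ) (by fun_prop) hV]
    refine (lintegral_mono' h le_rfl).trans ?_
    rw [lintegral_smul_measure]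
    exact mul_le_mul_right (hgK r hr) _
  have hle : ∀ j ≥ L, ∀ r ∈ Icc (0 : ℝ) L, ∫⁻ z, gap L (W j) (B j) Y b (r, z) ∂m
      ≤ k * 2⁻¹ ^ j + ∫⁻ z, ‖g r (W j r z) - g r (Y r z)‖ₑ ∂m := fun j hj r hr => by
    have hWj := hWm j r
    have hYr := hYm r
    have hg := hgm r
    refine (lintegral_mono fun z => ?_).trans ((lintegral_add_right
      ((W j r ⁻¹' ball 0 L).indicator fun z => ‖B j r z - b r (W j r z)‖ₑ) (by fun_prop)).trans_le
      (add_le_add_left ?_ _))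
    · refine indicator_apply_le' (fun hz => ?_) fun _ => zero_le
      obtain ⟨hz1, hz2⟩ : W j r z ∈ ball 0 (L : ℝ) ∧ Y r z ∈ ball 0 (L : ℝ) := hz
      rw [indicator_of_mem (show z ∈ W j r ⁻¹' ball 0 L from hz1)]
      simp only [g]
      rw [indicator_of_mem hz1, indicator_of_mem hz2]
      exact (congrArg _ (sub_add_sub_cancel _ _ _).symm).trans_le (enorm_add_le _ _)
    · rw [lintegral_indicator (hWj measurableSet_ball)]
      exact hn j hj r hr
  simp only [fun j => lintegral_lintegral_swap (μ := m) (ν := volume.restrict (Icc (0 : ℝ) L))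
    (f := fun z r => gap L (W j) (B j) Y b (r, z)) ((hGm j).comp measurable_swap).aemeasurable]
  have hdct := tendsto_lintegral_filter_of_dominated_convergence (μ := volume.restrict (Icc (0 : ℝ) L))
    (l := atTop) (F := fun j r => ∫⁻ z, gap L (W j) (B j) Y b (r, z) ∂m) (f := fun _ => 0)
    (fun _ => k * 1 + (k * K + k * K)) (.of_forall fun j => (hGm j).lintegral_prod_right') ?_ ?_ ?_
  · simpa using hdct
  · filter_upwards [eventually_ge_atTop L] with j hj
    filter_upwards [ae_restrict_mem measurableSet_Icc] with r hr
    have hWj := hWm j r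
    have hg := hgm r
    refine (hle j hj r hr).trans (add_le_add (mul_le_mul_right (pow_le_one' (by simp) _) _) ?_)
    refine (lintegral_mono fun z => enorm_sub_le).trans ?_
    rw [lintegral_add_left (by fun_prop)]
    exact add_le_add (hcomp hr.1 hWj (hWk j r)) (hcomp hr.1 (hYm r) (hYk r hr.1))
  · rw [lintegral_const]
    finiteness
  · filter_upwards [ae_restrict_mem measurableSet_Icc] with r hr
    have h1 := tendsto_lintegral_comp_sub (m := m) (fun j => hWm j r) (hYm r) hk (fun j => hWk j r)
      (hYk r hr.1) (hc r hr) (hgm r) ⟨(hgm r).aestronglyMeasurable, (hgK r hr.1).trans_lt hK.lt_top⟩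
    have h2 : Tendsto (fun j : ℕ => k * 2⁻¹ ^ j) atTop (𝓝 0) := by
      simpa using ENNReal.Tendsto.const_mul (ENNReal.tendsto_pow_atTop_nhds_zero_of_lt_one (r := 2⁻¹) (by simp))
        (Or.inr hk)
    refine tendsto_of_tendsto_of_tendsto_of_le_of_le' tendsto_const_nhds (by simpa using h2.add h1)
      (.of_forall fun _ => zero_le) ?_
    filter_upwards [eventually_ge_atTop L] with j hj using hle j hj r hr

lemma ode_of_gap {T J : ℕ} {z : PS d} (hY : Measurable (uncurry Y))
    (hb : Measurable (uncurry b)) (hB : ∀ j, IntegrableOn (fun r => B j r z) (Icc 0 (T : ℝ)))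
    (hW : ∀ j, ∀ t ∈ Icc (0 : ℝ) T, W j t z = z + ∫ r in (0 : ℝ)..t, B j r z)
    (hc : ContinuousOn (fun t => W J t z) (Icc 0 T))
    (hJ : ∀ j ≥ J, ∀ t ∈ Icc (0 : ℝ) T, ‖W j t z - W J t z‖ ≤ 2 ∧ Tendsto (fun j => W j t z) atTop (𝓝 (Y t z)))
    (hz : ∀ L : ℕ, liminf (fun j => ∫⁻ r in Icc (0 : ℝ) L, gap L (W j) (B j) Y b (r, z)) atTop = 0) :
    IntegrableOn (fun r => b r (Y r z)) (Icc 0 (T : ℝ)) ∧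
      ∀ t ∈ Icc (0 : ℝ) T, Y t z = z + ∫ r in (0 : ℝ)..t, b r (Y r z) := by
  obtain ⟨M, hM⟩ := isCompact_Icc.exists_bound_of_continuousOn hc
  obtain ⟨L, hL⟩ := exists_nat_gt (max (T : ℝ) (M + 2))
  have hZ : ∀ j ≥ J, ∀ t ∈ Icc (0 : ℝ) T, ‖W j t z‖ ≤ M + 2 := fun j hj t ht => by
    linarith [norm_sub_norm_le (W j t z) (W J t z), hM t ht, (hJ j hj t ht).1]
  have hX : ∀ t ∈ Icc (0 : ℝ) T, ‖Y t z‖ ≤ M + 2 := fun t ht =>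
    le_of_tendsto (hJ J le_rfl t ht).2.norm ((eventually_ge_atTop J).mono fun j hj => hZ j hj t ht)
  have hML := (le_max_right _ _).trans_lt hL
  have hflow : Measurable fun r => (r, Y r z) :=
    measurable_id.prodMk (hY.comp (measurable_id.prodMk measurable_const))
  refine eq_add_integral_of_liminf (hb.comp hflow).aestronglyMeasurable hB ?_ (hz L) hW
    fun t ht => (hJ J le_rfl t ht).2
  filter_upwards [eventually_ge_atTop J] with j hj
  refine (setLIntegral_mono' measurableSet_Icc fun r hr => ?_).trans
    (lintegral_mono_set (Icc_subset_Icc_right ((le_max_left _ _).trans hL.le)))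
  have hmem : (r, z) ∈ {p : ℝ × PS d | W j p.1 p.2 ∈ ball 0 (L : ℝ) ∧ Y p.1 p.2 ∈ ball 0 (L : ℝ)} :=
    ⟨mem_ball_zero_iff.2 ((hZ j hj r hr).trans_lt hML), mem_ball_zero_iff.2 ((hX r hr).trans_lt hML)⟩
  rw [gap, indicator_of_mem hmem]

end Gap

lemma ae_of_ae_lay {d : ℕ} {μ : Measure (PS d)} [IsFiniteMeasure μ] (hμ : μ ≪ volume) {p : PS d → Prop}
    (h : ∀ k, ∀ᵐ z ∂(lay μ k), p z) : ∀ᵐ z ∂μ, p z := by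
  have h1 := fun k => (ae_restrict_iff' (measurableSet_lay k)).1 (h k)
  filter_upwards [ae_all_iff.2 h1, hμ.ae_le (Measure.rnDeriv_lt_top μ volume)] with z hz ht
  obtain ⟨n, hn⟩ := ENNReal.exists_nat_gt ht.ne
  exact hz n hn.le

namespace FastSeq

variable {d : ℕ} {μ : Measure (PS d)} {e₀ : ℝ} {F : AFlows d μ e₀} (Q : FastSeq F)

lemma measurable_flow_apply (t : ℝ) : Measurable (Q.flow t) := Q.measurable_flow.of_uncurry_left

/-- The limit field along the limit flow. -/
def field (p : ℝ × PS d) : PS d := (p.2.2, fld d 0 (μ.map (Q.flow p.1)) p.2.1)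

variable [IsFiniteMeasure μ]

lemma measurable_field : Measurable Q.field := by
  have h1 : Measurable fun p : ℝ × Ed d => fld d 0 (μ.map (Q.flow p.1)) p.2 :=
    measurable_fld_map Q.measurable_flow
  have h2 : Measurable fun p : ℝ × PS d => (p.1, p.2.1) := by fun_prop
  have h3 := h1.comp h2
  exact measurable_snd.snd.prodMk h3

lemma map_flow (hd : 3 ≤ d) (hμ : μ ≪ volume) {m : Measure (PS d)} (hm : m ≤ μ) {t : ℝ} (ht : 0 ≤ t) :
    m.map (Q.flow t) = nu F m t := by
  have : IsFiniteMeasure m := ⟨(hm univ).trans_lt (measure_lt_top _ _)⟩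
  have hX := Q.measurable_flow_apply t
  refine Measure.ext_of_integral_eq_on_compactlySupported fun f => ?_
  have hf : Continuous f := f.continuous
  obtain ⟨M, hM⟩ := f.hasCompactSupport.exists_bound_of_continuous hf
  have hlim := tendsto_integral_nu hd hμ F hm ht hf.measurable hM
  have hnear := fun j : ℕ => hlim (ball_mem_nhds _ (show (0 : ℝ) < (1 / 2) ^ j by positivity))
  choose n hn using fun j : ℕ => UF.nonempty_of_mem (inter_mem (Q.mem_UF j) (hnear j))
  have hae : ∀ᵐ z ∂m, Tendsto (fun j => (F (n j)).Z t z) atTop (𝓝 (Q.flow t z)) := by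
    filter_upwards [ae_mono hm Q.ae_good, ae_mono hm (Q.ae_close (fun j => (hn j).1) Q.mem)] with z hz hz2
    obtain ⟨T, hT⟩ := exists_nat_ge t
    obtain ⟨J, -, hJ⟩ := hz.exists_le T
    have h0 : Tendsto (fun j => (F (n j)).Z t z - (F (Q.N j)).Z t z) atTop (𝓝 0) := by
      refine squeeze_zero_norm' ?_ (tendsto_pow_atTop_nhds_zero_of_lt_one (r := (1 / 2 : ℝ)) (by norm_num)
        (by norm_num))
      filter_upwards [hz2, eventually_ge_atTop T] with j hj hjT
      exact hj t ⟨ht, hT.trans (by exact_mod_cast hjT)⟩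
    simpa using h0.add (hJ J le_rfl t ⟨ht, hT⟩).2
  have h1 : Tendsto (fun j => ∫ z, f ((F (n j)).Z t z) ∂m) atTop (𝓝 (∫ z, f (Q.flow t z) ∂m)) :=
    tendsto_integral_of_dominated_convergence (fun _ => M)
      (fun j => (hf.measurable.comp ((F (n j)).Z t).measurable).aestronglyMeasurable) (integrable_const _)
      (fun j => .of_forall fun z => hM _) (hae.mono fun z hz => (hf.tendsto _).comp hz)
  have h2 : Tendsto (fun j => ∫ z, f ((F (n j)).Z t z) ∂m) atTop (𝓝 (∫ z, f z ∂(nu F m t))) := by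
    refine tendsto_iff_dist_tendsto_zero.2 (squeeze_zero (fun _ => dist_nonneg) (fun j => (hn j).2.le)
      (tendsto_pow_atTop_nhds_zero_of_lt_one (by norm_num) (by norm_num)))
  rw [integral_map hX.aemeasurable hf.aestronglyMeasurable, tendsto_nhds_unique h1 h2]

lemma field_eq (hd : 3 ≤ d) (hμ : μ ≪ volume) {t : ℝ} (ht : 0 ≤ t) (z : PS d) : Q.field (t, z) = bfl F t z := by
  rw [field, Q.map_flow hd hμ le_rfl ht, bfl]

/-- `VP.gap` between the approximate and the limit flow. -/
def vgap (L j : ℕ) : ℝ × PS d → ℝ≥0∞ :=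
  gap L (fun r => (F (Q.N j)).Z r) (F (Q.N j)).B Q.flow (fun r z => Q.field (r, z))

lemma measurable_vgap (L j : ℕ) : Measurable (Q.vgap L j) :=
  measurable_gap (F (Q.N j)).measZ (F (Q.N j)).measB Q.measurable_flow Q.measurable_field

lemma tendsto_vgap (hd : 3 ≤ d) (hμ : μ ≪ volume) (k L : ℕ) :
    Tendsto (fun j => ∫⁻ z, ∫⁻ r in Icc (0 : ℝ) L, Q.vgap L j (r, z) ∂volume ∂(lay μ k)) atTop (𝓝 0) := by
  obtain ⟨K, hK, hKb⟩ := exists_bfl_bound F hd hμ L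
  have hm := lay_le (μ := μ) k
  have : IsFiniteMeasure (lay μ k) := ⟨(hm univ).trans_lt (measure_lt_top _ _)⟩
  have hk := lay_le_smul hμ k
  refine tendsto_gap (fun j => (F (Q.N j)).measZ) (fun j => (F (Q.N j)).measB) Q.measurable_flow
    Q.measurable_field (ENNReal.natCast_ne_top k) hK (fun j r => ?_) (fun r hr => ?_) (fun r hr => ?_)
    (fun r hr => ?_) fun j hj r hr => ?_
  · have := Measure.map_mono hk ((F (Q.N j)).Z r).measurable
    rwa [Measure.map_smul, ((F (Q.N j)).mp r).map_eq] at this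
  · rw [Q.map_flow hd hμ hm hr]
    exact nu_le_smul hd hμ F hm hr hk
  · simpa only [Q.field_eq hd hμ hr] using hKb r hr
  · filter_upwards [ae_mono hm Q.ae_good] with z hz
    obtain ⟨J, -, hJ⟩ := hz.exists_le L
    exact (hJ J le_rfl r hr).2
  · have hLj : (L : ℝ) ≤ j := by exact_mod_cast hj
    have h := Q.near j _ (Q.mem j) r ⟨hr.1, hr.2.trans hLj⟩
    refine (lintegral_mono' (Measure.restrict_mono (preimage_mono (ball_subset_ball hLj)) hk) le_rfl).trans ?_
    rw [Measure.restrict_smul, lintegral_smul_measure]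
    refine mul_le_mul_right ?_ _
    simpa only [Q.field_eq hd hμ hr.1] using h

lemma ae_liminf_vgap (hd : 3 ≤ d) (hμ : μ ≪ volume) : ∀ᵐ z ∂μ, ∀ L : ℕ,
    liminf (fun j => ∫⁻ r in Icc (0 : ℝ) L, Q.vgap L j (r, z)) atTop = 0 := by
  refine ae_of_ae_lay hμ fun k => ae_all_iff.2 fun L => ?_
  have hm : ∀ j, Measurable fun z => ∫⁻ r in Icc (0 : ℝ) L, Q.vgap L j (r, z) := fun j =>
    (Q.measurable_vgap L j).lintegral_prod_left'
  have h := (lintegral_liminf_le (μ := lay μ k) hm).trans_eq (Q.tendsto_vgap hd hμ k L).liminf_eq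
  exact (lintegral_eq_zero_iff (Measurable.liminf hm)).1 (nonpos_iff_eq_zero.1 h)

lemma ae_ode (hd : 3 ≤ d) (hμ : μ ≪ volume) : ∀ᵐ z ∂μ, ∀ T : ℕ,
    IntegrableOn (fun s => Q.field (s, Q.flow s z)) (Icc 0 (T : ℝ)) ∧
      ∀ t ∈ Icc (0 : ℝ) T, Q.flow t z = z + ∫ s in (0 : ℝ)..t, Q.field (s, Q.flow s z) := by
  filter_upwards [Q.ae_liminf_vgap hd hμ, Q.ae_good] with z hz hg T
  obtain ⟨J, -, hJ⟩ := hg.exists_le T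
  have hcont : ContinuousOn (fun t => (F (Q.N J)).Z t z) (Icc 0 T) :=
    ((F (Q.N J)).continuousOn z).mono Icc_subset_Ici_self
  exact ode_of_gap (b := fun r z => Q.field (r, z)) Q.measurable_flow Q.measurable_field
    (fun j => (intervalIntegrable_iff_integrableOn_Icc_of_le T.cast_nonneg).1
      ((F (Q.N j)).intB z T T.cast_nonneg))
    (fun j t ht => (F (Q.N j)).ftc t ht.1 z) hcont hJ hz

end FastSeq

end VP

namespace VP

section Solution

variable {d : ℕ} {μ : Measure (PS d)} {e₀ : ℝ} [IsFiniteMeasure μ]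
  (F : AFlows d μ e₀)

lemma vpE_dens (hd : 3 ≤ d) (hμ : μ ≪ volume) {t : ℝ} (ht : 0 ≤ t) (x : Ed d) :
    vpE d 1 (dens F μ) t x = fld d 0 (nu F μ t) x := by
  rw [vpE_eq_fld (measurable_dens F t) (dens_nonneg F t) (integrable_dens F t), ← nu_eq F hd hμ le_rfl ht]

lemma vpB_dens (hd : 3 ≤ d) (hμ : μ ≪ volume) {t : ℝ} (ht : 0 ≤ t) (z : PS d) :
    vpB d 1 (dens F μ) t z = bfl F t z := by
  rw [vpB, vpE_dens F hd hμ ht, bfl]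

lemma isRenormalized_dens (hd : 3 ≤ d) (hμ : μ ≪ volume) {f0 : PS d → ℝ} (h0 : dens F μ 0 =ᵐ[volume] f0) :
    IsRenormalizedVPInf d 1 f0 (dens F μ) := by
  rintro β hβ ⟨M, hM⟩ φ hφ hc
  obtain ⟨C, R, hT⟩ := exists_testBound hφ hc
  have h1 : ∫ z, φ (0, z) * β (f0 z) = wk F μ φ β 0 :=
    integral_congr_ae (h0.mono fun z hz => by simp only [hz])
  have h2 : ∫ t in Ioi (0 : ℝ), ∫ z, fderiv ℝ φ (t, z) (1, vpB d 1 (dens F μ) t z) * β (dens F μ t z)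
      = ∫ t in Ioi (0 : ℝ), wg F μ φ β t := by
    refine setIntegral_congr_fun measurableSet_Ioi fun t ht => integral_congr_ae (.of_forall fun z => ?_)
    simp only [vpB_dens F hd hμ (le_of_lt ht), dirD]
  rw [h1, h2]
  exact integral_wg F hd hμ hT hβ hM

lemma energy_dens (hd : 3 ≤ d) (hμ : μ ≪ volume) {t : ℝ} (ht : 0 ≤ t) :
    kinEnergy d (dens F μ t) + potEnergy d (vpRho d (dens F μ) t) ≤ ofReal e₀ := by
  have h1 := kinEnergy_eq (measurable_dens F (m := μ) t)
  have h2 := potEnergy_eq (measurable_dens F (m := μ) t) (dens_nonneg F t) (integrable_dens F t)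
  rw [← nu_eq F hd hμ le_rfl ht] at h1 h2
  exact (congrArg₂ _ h1 h2).trans_le (energy_le F hd hμ ht)

lemma tendsto_setIntegral_dens (hd : 3 ≤ d) (hμ : μ ≪ volume) (R : ℝ) {s : ℝ} (hs : 0 ≤ s) :
    Tendsto (fun t => ∫ z in ball (0 : PS d) R, |dens F μ t z - dens F μ s z|) (𝓝[Ici 0] s) (𝓝 0) :=
  tendsto_setIntegral_norm_sub (fun t _ => (measurable_dens F t).aestronglyMeasurable) hs
    fun _ hθ => dens_continuous' F hd hμ (s + 1) R ⟨hs, by linarith⟩ hθ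

lemma tendsto_vpRho_dens (hd : 3 ≤ d) (hμ : μ ≪ volume) (R : ℝ) {s : ℝ} (hs : 0 ≤ s) :
    Tendsto (fun t => ∫ x in ball (0 : Ed d) R, |vpRho d (dens F μ) t x - vpRho d (dens F μ) s x|)
      (𝓝[Ici 0] s) (𝓝 0) :=
  tendsto_setIntegral_norm_sub
    (fun t _ => ((measurable_dens F t).stronglyMeasurable.integral_prod_right' (ν := volume)).aestronglyMeasurable) hs
    fun _ hθ => rho_continuous F hd hμ (s + 1) R ⟨hs, by linarith⟩ hθ

lemma tendsto_vpE_dens (hd : 3 ≤ d) (hμ : μ ≪ volume) (R : ℝ) {s : ℝ} (hs : 0 ≤ s) :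
    Tendsto (fun t => ∫ x in ball (0 : Ed d) R, ‖vpE d 1 (dens F μ) t x - vpE d 1 (dens F μ) s x‖)
      (𝓝[Ici 0] s) (𝓝 0) := by
  have hf := fun {t : ℝ} (ht : 0 ≤ t) => funext (vpE_dens F hd hμ ht)
  refine tendsto_setIntegral_norm_sub (fun t ht => ?_) hs fun θ hθ => ?_
  · rw [hf ht]
    exact (measurable_fld 0 (nu F μ t)).aestronglyMeasurable
  · obtain ⟨τ, hτ, h⟩ := field_continuous hd hμ F (s + 1) R hθ
    refine ⟨τ, hτ, fun t ht hts => ?_⟩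
    rw [hf ht.1, hf hs]
    exact h s ⟨hs, by linarith⟩ t ht hts

lemma exists_flow_dens (hd : d = 3 ∨ d = 4) (hμ : μ ≪ volume) : ∃ X : ℝ → PS d → PS d,
    Measurable (uncurry X) ∧
      (∀ᵐ z ∂μ, (∀ T > (0 : ℝ), IntegrableOn (fun s => vpB d 1 (dens F μ) s (X s z)) (Icc 0 T)) ∧ X 0 z = z ∧
        ∀ t ≥ (0 : ℝ), X t z = z + ∫ s in (0 : ℝ)..t, vpB d 1 (dens F μ) s (X s z)) ∧
      ∀ t ≥ (0 : ℝ), μ.map (X t) = volume.withDensity fun z => ofReal (dens F μ t z) := by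
  have hd3 : 3 ≤ d := by omega
  obtain ⟨Q⟩ := nonempty_fastSeq F hd hμ
  have hb : ∀ {s : ℝ}, 0 ≤ s → ∀ z, Q.field (s, z) = vpB d 1 (dens F μ) s z := fun hs z => by
    rw [Q.field_eq hd3 hμ hs, vpB_dens F hd3 hμ hs]
  refine ⟨Q.flow, Q.measurable_flow, ?_, fun t ht => ?_⟩
  · filter_upwards [Q.ae_ode hd3 hμ] with z hz
    refine ⟨fun T hT => ?_, Q.flow_zero z, fun t ht => ?_⟩
    · obtain ⟨n, hn⟩ := exists_nat_ge T
      exact ((hz n).1.mono_set (Icc_subset_Icc_right hn)).congr_fun (fun s hs => hb hs.1 _) measurableSet_Icc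
    · obtain ⟨n, hn⟩ := exists_nat_ge t
      rw [(hz n).2 t ⟨ht, hn⟩]
      congr 1
      refine intervalIntegral.integral_congr fun s hs => ?_
      rw [uIcc_of_le ht] at hs
      exact hb hs.1 _
  · rw [Q.map_flow hd3 hμ le_rfl ht, nu_eq F hd3 hμ le_rfl ht]

end Solution

end VP

/-- Global existence of Lagrangian/renormalized solutions with finite
energy initial data, repulsive case: let `d ≥ 3`, `σ = 1`, and let `f₀ ∈ L¹_+(ℝ^{2d})`
have finite total energy. Then there is a global renormalized solution
`f ∈ C([0,∞);L¹_loc(ℝ^{2d}))` of the Vlasov–Poisson system with initial datum `f₀`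
such that: (1) `ρ_t` and `E_t` are strongly continuous in `L¹_loc(ℝ^d)`;
(2) the total energy at any time `t ≥ 0` is bounded by the initial one; and
(3) if `d ∈ {3,4}` then `f_t` is transported by a globally defined flow of
`b_t(x,v) = (v,E_t(x))`. -/
theorem vlasovPoisson_finite_energy_global_existence
    (d : ℕ) (hd : 3 ≤ d)
    (f0 : (Ed d × Ed d) → ℝ) (hf0_meas : Measurable f0)
    (hf0_nonneg : ∀ z, 0 ≤ f0 z) (hf0_int : Integrable f0)
    (hf0_energy : kinEnergy d f0 + potEnergy d (fun x => ∫ v : Ed d, f0 (x, v)) ≠ ⊤) :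
    ∃ f : ℝ → (Ed d × Ed d) → ℝ,
      (∀ t, Measurable (f t)) ∧ (∀ t z, 0 ≤ f t z) ∧ (∀ t, Integrable (f t)) ∧
      (f 0 =ᵐ[volume] f0) ∧
      IsRenormalizedVPInf d 1 f0 f ∧
      -- `f ∈ C([0,∞); L¹_loc(ℝ^{2d}))`
      (∀ R > (0:ℝ), ∀ t₀ ∈ Ici (0:ℝ),
        Tendsto (fun s => ∫ z in ball (0 : Ed d × Ed d) R, |f s z - f t₀ z|)
          (nhdsWithin t₀ (Ici 0)) (nhds 0)) ∧
      -- (1) strong `L¹_loc` continuity of `ρ_t` and `E_t`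
      (∀ R > (0:ℝ), ∀ t₀ ∈ Ici (0:ℝ),
        Tendsto (fun s => ∫ x in ball (0 : Ed d) R, |vpRho d f s x - vpRho d f t₀ x|)
          (nhdsWithin t₀ (Ici 0)) (nhds 0)) ∧
      (∀ R > (0:ℝ), ∀ t₀ ∈ Ici (0:ℝ),
        Tendsto (fun s => ∫ x in ball (0 : Ed d) R, ‖vpE d 1 f s x - vpE d 1 f t₀ x‖)
          (nhdsWithin t₀ (Ici 0)) (nhds 0)) ∧
      -- (2) energy bound
      (∀ t ≥ (0:ℝ),
        kinEnergy d (f t) + potEnergy d (vpRho d f t) ≤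
          kinEnergy d f0 + potEnergy d (fun x => ∫ v : Ed d, f0 (x, v))) ∧
      -- (3) global flow in dimensions 3 and 4
      ((d = 3 ∨ d = 4) →
        ∃ X : ℝ → (Ed d × Ed d) → (Ed d × Ed d),
          Measurable (Function.uncurry X) ∧
          (∀ᵐ z ∂(volume.withDensity fun z => ENNReal.ofReal (f0 z)),
            (∀ T > (0:ℝ), IntegrableOn (fun s => vpB d 1 f s (X s z)) (Icc 0 T)) ∧
            X 0 z = z ∧
            ∀ t ≥ (0:ℝ), X t z = z + ∫ s in (0:ℝ)..t, vpB d 1 f s (X s z)) ∧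
          (∀ t ≥ (0:ℝ),
            Measure.map (X t) (volume.withDensity fun z => ENNReal.ofReal (f0 z)) =
              volume.withDensity fun z => ENNReal.ofReal (f t z))) := by
  set μ : Measure (VP.PS d) := volume.withDensity fun z => ENNReal.ofReal (f0 z)
  have hμ : μ ≪ volume := withDensity_absolutelyContinuous _ _
  have : IsFiniteMeasure μ := isFiniteMeasure_withDensity_ofReal hf0_int.2
  have hen := fun n : ℕ => VP.en_le_of_energy hd hf0_energy (congrArg₂ (· + ·) (VP.kinEnergy_eq hf0_meas)
    (VP.potEnergy_eq hf0_meas hf0_nonneg hf0_int)).ge (VP.eps_pos n)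
  have F : ∀ n : ℕ, VP.AFlow d μ _ (VP.eps n) (VP.eps n) n := fun n => (VP.exists_aflow hd (VP.eps_pos n)
    (VP.eps_pos n) μ (hen n).1 (hen n).2 ENNReal.toReal_nonneg).some
  have h0 : VP.dens F μ 0 =ᵐ[volume] f0 := by
    have h := (VP.nu_eq F hd hμ le_rfl le_rfl).symm.trans (VP.nu_zero F hd hμ)
    have hm := VP.measurable_dens F (m := μ) 0
    rw [withDensity_eq_iff hm.ennreal_ofReal.aemeasurable hf0_meas.ennreal_ofReal.aemeasurable
      (VP.integrable_dens F 0).lintegral_lt_top.ne] at h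
    filter_upwards [h] with z hz
    exact (ENNReal.ofReal_eq_ofReal_iff (VP.dens_nonneg F 0 z) (hf0_nonneg z)).1 hz
  exact ⟨VP.dens F μ, VP.measurable_dens F, VP.dens_nonneg F, VP.integrable_dens F, h0,
    VP.isRenormalized_dens F hd hμ h0, fun R _ s hs => VP.tendsto_setIntegral_dens F hd hμ R hs,
    fun R _ s hs => VP.tendsto_vpRho_dens F hd hμ R hs, fun R _ s hs => VP.tendsto_vpE_dens F hd hμ R hs,
    fun t ht => (VP.energy_dens F hd hμ ht).trans_eq (ENNReal.ofReal_toReal hf0_energy),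
    fun h => VP.exists_flow_dens F h hμ⟩

end
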